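/- There exists a subset Υ of the Mandelbrot set M such that (i) every point of the frontier (boundary) of M lies in the closure of Υ, and (ii) for every c ∈ Υ the quadratic polynomial P_c(z) = z² + c is infinitely renormalizable and M is locally connected at c (c has a neighborhood basis, in the subspace topology of M, consisting of connected sets). -/

import Mathlib

open Topology

/-- The quadratic polynomial `P_c(z) = z² + c`. -/
def P (c : ℂ) : ℂ → ℂ := fun z => z ^ 2 + c

/-- The Mandelbrot set: parameters `c` for which the orbit of `0` under `P_c` is bounded. -/
def Mandelbrot : Set ℂ :=
  {c : ℂ | Bornology.IsBounded (Set.range fun n : ℕ => (P c)^[n] 0)}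

/-- `X ⊆ ℂ` is locally connected at `c`: every neighborhood `W` of `c` in `ℂ` contains a
connected set `V ⊆ X` which is a neighborhood of `c` in the subspace topology of `X`. -/
def LocallyConnectedAt (X : Set ℂ) (c : ℂ) : Prop :=
  ∀ W ∈ 𝓝 c, ∃ V : Set ℂ, V ⊆ X ∧ V ⊆ W ∧ IsConnected V ∧ V ∈ 𝓝[X] c

/-- `P_c` is `n`-renormalizable (`n ≥ 2`): there are open, connected, simply connected sets
`U ∋ 0` and `V` with `closure U ⊆ V` such that `P_c^[n] : U → V` is a proper holomorphic
surjection of degree two whose unique critical point in `U` is `0`, with connected filled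
Julia set. -/
def Renormalizable (c : ℂ) (n : ℕ) : Prop :=
  2 ≤ n ∧
  ∃ U V : Set ℂ, IsOpen U ∧ IsOpen V ∧ IsConnected U ∧ IsConnected V ∧
    SimplyConnectedSpace U ∧ SimplyConnectedSpace V ∧
    (0 : ℂ) ∈ U ∧ closure U ⊆ V ∧
    (P c)^[n] '' U = V ∧
    (∀ K : Set ℂ, K ⊆ V → IsCompact K → IsCompact (U ∩ (P c)^[n] ⁻¹' K)) ∧
    deriv ((P c)^[n]) 0 = 0 ∧
    (∀ z ∈ U, deriv ((P c)^[n]) z = 0 → z = 0) ∧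
    (∀ v ∈ V, v ≠ (P c)^[n] 0 → (U ∩ (P c)^[n] ⁻¹' {v}).ncard = 2) ∧
    U ∩ (P c)^[n] ⁻¹' {(P c)^[n] 0} = {0} ∧
    IsConnected {z ∈ U | ∀ k : ℕ, ((P c)^[n])^[k] z ∈ U}

/-- `P_c` is infinitely renormalizable: it is `n`-renormalizable for infinitely many `n ≥ 2`. -/
def InfinitelyRenormalizable (c : ℂ) : Prop :=
  {n : ℕ | Renormalizable c n}.Infinite

namespace QuadDyn
open Set Filter Metric Topology
open Complex (I abs_re_le_norm add_im add_re differentiable_exp div_ofReal_re div_re exp exp_add exp_eq_exp_iff_exists_int exp_nat_mul exp_ne_zero exp_re exp_sub imLm isOpenQuotientMap_pow measurableEquivRealProd mul_I_im mul_I_re mul_im mul_re neg_re norm_I norm_exp norm_of_nonneg norm_real ofReal_exp ofReal_im ofReal_one ofReal_re ofReal_zero one_re reLm re_add_im re_le_norm re_ofReal_mul sub_re)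
open Real (continuous_exp cos dist_eq exp_le_exp exp_log exp_lt_exp exp_pos log log_exp log_le_log log_lt_log log_mul log_nonneg log_pos norm_eq_abs one_le_exp one_lt_exp_iff pi_pos sqrt_lt')
open Function (comp_apply invFunOn invFunOn_eq invFunOn_mem iterate_add_apply iterate_fixed iterate_mul iterate_succ_apply iterate_succ_apply')
open scoped Real
local notation "HolOn" => DifferentiableOn ℂ

/-- A family of functions that is, along the filter `l`, locally eventually holomorphic and
bounded on `U`. -/
def LocBdd {ι : Type*} (l : Filter ι) (F : ι → ℂ → ℂ) (U : Set ℂ) : Prop :=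
  ∀ z ∈ U, ∃ r > 0, ∃ M : ℝ, ∀ᶠ i in l, HolOn (F i) (ball z r) ∧
    ∀ w ∈ ball z r, ‖F i w‖ ≤ M

theorem ball_min_left {x : ℂ} {a b : ℝ} : ball x (min a b) ⊆ ball x a :=
  ball_subset_ball inf_le_left

theorem ball_min_right {x : ℂ} {a b : ℝ} : ball x (min a b) ⊆ ball x b :=
  ball_subset_ball inf_le_right

theorem lipschitz_of_bdd {f : ℂ → ℂ} {z : ℂ} {r M : ℝ} (hr : 0 < r)
    (hd : HolOn f (ball z r)) (hb : ∀ w ∈ ball z r, ‖f w‖ ≤ M) {w w' : ℂ}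
    (hw : w ∈ ball z (r / 2)) (hw' : w' ∈ ball z (r / 2)) :
    ‖f w' - f w‖ ≤ 4 * M / r * ‖w' - w‖ := by
  have hsub : ∀ x ∈ ball z (r / 2), closedBall x (r / 4) ⊆ ball z r := by
    intro x hx y hy
    rw [mem_ball] at *; rw [mem_closedBall] at hy
    linarith [dist_triangle y x z]
  refine Convex.norm_image_sub_le_of_norm_deriv_le (s := ball z (r / 2)) ?_ ?_
    (convex_ball _ _) hw hw'
  · intro x hx
    exact hd.differentiableAt (isOpen_ball.mem_nhds (hsub x hx (mem_closedBall_self (by linarith))))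
  · intro x hx
    have := Complex.norm_deriv_le_of_forall_mem_sphere_norm_le (c := x) (R := r / 4) (C := M)
      (f := f) (by linarith) ?_ ?_
    · calc _ ≤ _ := this
        _ = _ := by field_simp
    · exact (hd.mono (hsub x hx)).diffContOnCl_ball subset_rfl
    · intro y hy
      exact hb y (hsub x hx (sphere_subset_closedBall hy))

section
variable {ι : Type*} {l : Filter ι} {F : ι → ℂ → ℂ} {U : Set ℂ} {f : ℂ → ℂ}

theorem LocBdd.mono {V : Set ℂ} (h : LocBdd l F U) (hV : V ⊆ U) : LocBdd l F V :=
  fun z hz => h z (hV hz)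

theorem LocBdd.mono_filter {l' : Filter ι} (h : LocBdd l F U) (hl : l' ≤ l) : LocBdd l' F U :=
  fun z hz => by
    obtain ⟨r, hr, M, hM⟩ := h z hz
    exact ⟨r, hr, M, hM.filter_mono hl⟩

theorem LocBdd.of_bdd (hU : IsOpen U) (hd : ∀ᶠ i in l, HolOn (F i) U) {M : ℝ}
    (hb : ∀ᶠ i in l, ∀ z ∈ U, ‖F i z‖ ≤ M) : LocBdd l F U := by
  intro z hz
  obtain ⟨r, hr, h⟩ := isOpen_iff.1 hU z hz
  refine ⟨r, hr, M, ?_⟩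
  filter_upwards [hd, hb] with i h1 h2
  exact ⟨h1.mono h, fun w hw => h2 w (h hw)⟩

theorem LocBdd.tendstoLocallyUniformlyOn [l.NeBot] (h : LocBdd l F U)
    (hp : ∀ z ∈ U, Tendsto (F · z) l (𝓝 (f z))) : TendstoLocallyUniformlyOn F f l U := by
  rw [tendstoLocallyUniformlyOn_iff]
  intro ε hε x hx
  obtain ⟨r, hr, M, hM⟩ := h x hx
  have hM0 : 0 ≤ M := by
    obtain ⟨i, hi⟩ := hM.exists
    exact (norm_nonneg _).trans (hi.2 x (mem_ball_self hr))
  set L := 4 * M / r with hL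
  have hL0 : 0 ≤ L := by positivity
  obtain ⟨δ, hδ, hδr, hLδ⟩ : ∃ δ > 0, δ ≤ r / 2 ∧ L * δ < ε / 4 := by
    refine ⟨min (r / 2) (ε / (8 * (L + 1))), by positivity, inf_le_left, ?_⟩
    have h1 : min (r / 2) (ε / (8 * (L + 1))) ≤ ε / (8 * (L + 1)) := inf_le_right
    calc _ ≤ (L + 1) * (ε / (8 * (L + 1))) := by gcongr; linarith
      _ = ε / 8 := by field_simp
      _ < _ := by linarith
  have hlip : ∀ᶠ i in l, ∀ y ∈ ball x δ, ‖F i y - F i x‖ ≤ ε / 4 := by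
    filter_upwards [hM] with i hi y hy
    have := lipschitz_of_bdd hr hi.1 hi.2 (w := x) (w' := y) (mem_ball_self (by linarith))
      (ball_subset_ball hδr hy)
    rw [mem_ball, dist_eq_norm] at hy
    refine this.trans ?_
    have : L * ‖y - x‖ ≤ L * δ := by gcongr
    linarith
  have hflip : ∀ y ∈ ball x δ ∩ U, ‖f y - f x‖ ≤ ε / 4 := by
    intro y hy
    refine le_of_tendsto ((hp y hy.2).sub (hp x hx)).norm ?_
    filter_upwards [hlip] with i hi using hi y hy.1
  refine ⟨ball x δ ∩ U, inter_mem (mem_nhdsWithin_of_mem_nhds (ball_mem_nhds x hδ))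
    self_mem_nhdsWithin, ?_⟩
  filter_upwards [hlip, Metric.tendsto_nhds.1 (hp x hx) (ε / 4) (by linarith)] with i h1 h2 y hy
  have h3 := h1 y hy.1
  have h4 := hflip y hy
  rw [dist_eq_norm] at h2 ⊢
  calc ‖f y - F i y‖ = ‖(f y - f x) - (F i y - F i x) - (F i x - f x)‖ := by ring_nf
    _ ≤ ‖f y - f x‖ + ‖F i y - F i x‖ + ‖F i x - f x‖ :=
      (norm_sub_le _ _).trans (by gcongr; exact norm_sub_le _ _)
    _ < ε := by linarith

theorem LocBdd.differentiableOn [l.NeBot] (hU : IsOpen U) (h : LocBdd l F U)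
    (hp : ∀ z ∈ U, Tendsto (F · z) l (𝓝 (f z))) : HolOn f U := by
  have hu := h.tendstoLocallyUniformlyOn hp
  intro z hz
  obtain ⟨r, hr, M, hM⟩ := h z hz
  obtain ⟨r', hr', h'⟩ := isOpen_iff.1 hU z hz
  have hV : IsOpen (ball z r ∩ ball z r') := isOpen_ball.inter isOpen_ball
  have : HolOn f (ball z r ∩ ball z r') :=
    (hu.mono (inter_subset_right.trans h')).differentiableOn
      (hM.mono fun i hi => hi.1.mono inter_subset_left) hV
  exact (this.differentiableAt (hV.mem_nhds ⟨mem_ball_self hr, mem_ball_self hr'⟩)).differentiableWithinAt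

/-- Montel's theorem along an ultrafilter. -/
theorem LocBdd.exists_limit {𝒰 : Ultrafilter ι} (h : LocBdd (𝒰 : Filter ι) F U) :
    ∃ f : ℂ → ℂ, ∀ z ∈ U, Tendsto (F · z) 𝒰 (𝓝 (f z)) := by
  have : ∀ z, ∃ y, z ∈ U → Tendsto (F · z) 𝒰 (𝓝 y) := by
    intro z
    by_cases hz : z ∈ U
    · obtain ⟨r, hr, M, hM⟩ := h z hz
      have hc : IsCompact (closedBall (0 : ℂ) M) := isCompact_closedBall 0 M
      obtain ⟨y, -, hy⟩ := hc.ultrafilter_le_nhds (𝒰.map (F · z)) (by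
        rw [le_principal_iff, Ultrafilter.mem_coe, Ultrafilter.mem_map]
        filter_upwards [hM] with i hi
        simpa using hi.2 z (mem_ball_self hr))
      exact ⟨y, fun _ => hy⟩
    · exact ⟨0, fun h => absurd h hz⟩
  choose f hf using this
  exact ⟨f, hf⟩

theorem eqOn_of_eventuallyEq_holo {f g : ℂ → ℂ} (hU : IsOpen U) (hc : IsPreconnected U)
    (hf : HolOn f U) (hg : HolOn g U) {z0 : ℂ} (hz : z0 ∈ U)
    (h : ∃ᶠ z in 𝓝[≠] z0, f z = g z) : EqOn f g U :=
  (hf.analyticOnNhd hU).eqOn_of_preconnected_of_frequently_eq (hg.analyticOnNhd hU) hc hz h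

/-- Vitali's theorem. -/
theorem LocBdd.vitali (hU : IsOpen U) (hc : IsPreconnected U) (h : LocBdd l F U)
    (hf : HolOn f U) {z0 : ℂ} (hz₀ : z0 ∈ U)
    (hp : ∃ᶠ z in 𝓝[≠] z0, Tendsto (F · z) l (𝓝 (f z))) :
    ∀ z ∈ U, Tendsto (F · z) l (𝓝 (f z)) := by
  intro z hz
  rw [tendsto_iff_ultrafilter]
  intro 𝒰 h𝒰
  have hb : LocBdd (𝒰 : Filter ι) F U := h.mono_filter h𝒰
  obtain ⟨g, hg⟩ := hb.exists_limit
  have hgd := hb.differentiableOn hU hg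
  have : EqOn f g U := by
    refine eqOn_of_eventuallyEq_holo hU hc hf hgd hz₀ ?_
    have hU' : ∀ᶠ z in 𝓝[≠] z0, z ∈ U := mem_nhdsWithin_of_mem_nhds (hU.mem_nhds hz₀)
    refine (hp.and_eventually hU').mono fun w hw => ?_
    exact tendsto_nhds_unique (hw.1.mono_left h𝒰) (hg w hw.2)
  rw [this hz]; exact hg z hz

/-- Hurwitz's theorem: a zero of a limit that is not locally zero persists. -/
theorem LocBdd.eventually_exists_zero [l.NeBot] (hU : IsOpen U) (h : LocBdd l F U)
    (hp : ∀ z ∈ U, Tendsto (F · z) l (𝓝 (f z))) {z0 : ℂ} (hz₀ : z0 ∈ U) (hf0 : f z0 = 0)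
    (hne : ¬ ∀ᶠ z in 𝓝 z0, f z = 0) {W : Set ℂ} (hW : W ∈ 𝓝 z0) :
    ∀ᶠ i in l, ∃ z ∈ W, F i z = 0 := by
  have hfd := h.differentiableOn hU hp
  have hu := h.tendstoLocallyUniformlyOn hp
  have han : AnalyticAt ℂ f z0 := hfd.analyticAt (hU.mem_nhds hz₀)
  have h1 := han.eventually_eq_zero_or_eventually_ne_zero.resolve_left hne
  obtain ⟨r, hr, M, hM⟩ := h z0 hz₀
  have h2 : ∀ᶠ z in 𝓝 z0, z ∈ W ∩ U ∩ ball z0 r ∧ (z ≠ z0 → f z ≠ 0) := by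
    rw [eventually_nhdsWithin_iff] at h1
    filter_upwards [hW, hU.mem_nhds hz₀, ball_mem_nhds z0 hr, h1] with z a b c d
    exact ⟨⟨⟨a, b⟩, c⟩, d⟩
  obtain ⟨s, hs, hs'⟩ := nhds_basis_closedBall.eventually_iff.1 h2
  have hcs : IsCompact (sphere z0 s) := isCompact_sphere z0 s
  have hsU : sphere z0 s ⊆ U := fun z hz => (hs' (sphere_subset_closedBall hz)).1.1.2
  obtain ⟨x, hx, hxm⟩ := hcs.exists_isMinOn (NormedSpace.sphere_nonempty.2 hs.le)
    ((hfd.continuousOn.mono hsU).norm)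
  have hxp : 0 < ‖f x‖ := by
    rw [norm_pos_iff]
    exact (hs' (sphere_subset_closedBall hx)).2 (ne_of_mem_sphere hx hs.ne')
  set ε := ‖f x‖ with hε
  have hun := (tendstoLocallyUniformlyOn_iff_tendstoUniformlyOn_of_compact hcs).1 (hu.mono hsU)
  rw [tendstoUniformlyOn_iff] at hun
  filter_upwards [hun (ε / 2) (by linarith), hM,
    Metric.tendsto_nhds.1 (hp z0 hz₀) (ε / 2) (by linarith)] with i h3 h4 h5
  by_contra! hcon
  have hd : HolOn (fun z => (F i z)⁻¹) (closedBall z0 s) :=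
    (h4.1.mono fun z hz => (hs' hz).1.2).inv fun z hz => hcon z (hs' hz).1.1.1
  have := Complex.norm_le_of_forall_mem_frontier_norm_le (U := ball z0 s) (C := 2 / ε)
    (f := fun z => (F i z)⁻¹) isBounded_ball (hd.diffContOnCl_ball subset_rfl) ?_
    (subset_closure (mem_ball_self hs))
  · simp only [norm_inv] at this
    rw [hf0, dist_zero_right] at h5
    have h6 : 0 < ‖F i z0‖ := norm_pos_iff.2 (hcon z0 (mem_of_mem_nhds hW))
    rw [inv_le_comm₀ h6 (by positivity), inv_div] at this
    linarith
  · intro z hz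
    rw [frontier_ball z0 hs.ne'] at hz
    have h6 := h3 z hz
    have h7 : ε ≤ ‖f z‖ := hxm hz
    rw [dist_eq_norm] at h6
    have h8 : ε / 2 ≤ ‖F i z‖ := by
      have := norm_sub_norm_le (f z) (F i z)
      linarith
    rw [norm_inv, inv_le_comm₀ (by linarith) (by positivity), inv_div]
    exact h8

theorem LocBdd.zero_or_ne_zero [l.NeBot] (hU : IsOpen U) (hc : IsPreconnected U)
    (h : LocBdd l F U) (hp : ∀ z ∈ U, Tendsto (F · z) l (𝓝 (f z)))
    (hne : ∀ᶠ i in l, ∀ z ∈ U, F i z ≠ 0) : (∀ z ∈ U, f z = 0) ∨ ∀ z ∈ U, f z ≠ 0 := by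
  by_contra! hcon
  obtain ⟨⟨z1, h1, h1'⟩, z2, h2, h2'⟩ := hcon
  have hfd := h.differentiableOn hU hp
  have hn : ¬ ∀ᶠ z in 𝓝 z2, f z = 0 := fun hev => h1'
    ((hfd.analyticOnNhd hU).eqOn_zero_of_preconnected_of_eventuallyEq_zero hc h2 hev h1)
  obtain ⟨i, ⟨z, hz, hz'⟩, hi⟩ := ((h.eventually_exists_zero hU hp h2 h2' hn
    (hU.mem_nhds h2)).and hne).exists
  exact hi z hz hz'

/-- Nonvanishing locally bounded functions tending to `0` at one point tend to `0`. -/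
theorem LocBdd.tendsto_zero_of_ne_zero (hU : IsOpen U) (hc : IsPreconnected U)
    (h : LocBdd l F U) (hne : ∀ᶠ i in l, ∀ z ∈ U, F i z ≠ 0) {z0 : ℂ} (hz₀ : z0 ∈ U)
    (h0 : Tendsto (F · z0) l (𝓝 0)) : ∀ z ∈ U, Tendsto (F · z) l (𝓝 0) := by
  intro z hz
  rw [tendsto_iff_ultrafilter]
  intro 𝒰 h𝒰
  have hb : LocBdd (𝒰 : Filter ι) F U := h.mono_filter h𝒰
  obtain ⟨g, hg⟩ := hb.exists_limit
  have h1 : g z0 = 0 := tendsto_nhds_unique (hg z0 hz₀) (h0.mono_left h𝒰)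
  rcases hb.zero_or_ne_zero hU hc hg (h𝒰 hne) with h2 | h2
  · rw [← h2 z hz]; exact hg z hz
  · exact absurd h1 (h2 z0 hz₀)

theorem LocBdd.sub_const {a : ι → ℂ} {b : ℂ} (h : LocBdd l F U) (ha : Tendsto a l (𝓝 b)) :
    LocBdd l (fun i z => F i z - a i) U := by
  intro z hz
  obtain ⟨r, hr, M, hM⟩ := h z hz
  refine ⟨r, hr, M + (‖b‖ + 1), ?_⟩
  filter_upwards [hM, ha.norm.eventually (gt_mem_nhds (lt_add_one ‖b‖))] with i h1 h2
  exact ⟨h1.1.sub_const _, fun w hw => (norm_sub_le _ _).trans (add_le_add (h1.2 w hw) h2.le)⟩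

/-- Limits of injective holomorphic functions are injective or constant. -/
theorem LocBdd.injOn_of_limit [l.NeBot] (hU : IsOpen U) (hc : IsPreconnected U)
    (h : LocBdd l F U) (hp : ∀ z ∈ U, Tendsto (F · z) l (𝓝 (f z)))
    (hinj : ∀ᶠ i in l, InjOn (F i) U) (hnc : ∃ z ∈ U, ∃ w ∈ U, f z ≠ f w) : InjOn f U := by
  intro z1 h1 z2 h2 h12
  by_contra hne
  have hfd := h.differentiableOn hU hp
  have hb := h.sub_const (hp z1 h1)
  have hW : U ∩ {z1}ᶜ ∈ 𝓝 z2 :=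
    inter_mem (hU.mem_nhds h2) (isOpen_compl_singleton.mem_nhds (Ne.symm hne))
  have hn : ¬ ∀ᶠ z in 𝓝 z2, f z - f z1 = 0 := by
    intro hev
    have := ((hfd.sub_const (f z1)).analyticOnNhd
      hU).eqOn_zero_of_preconnected_of_eventuallyEq_zero hc h2 hev
    obtain ⟨z, hz, w, hw, hzw⟩ := hnc
    have a := this hz
    have b := this hw
    simp only [Pi.zero_apply, sub_eq_zero] at a b
    exact hzw (a.trans b.symm)
  obtain ⟨i, ⟨z, hz, hz'⟩, hi⟩ := ((hb.eventually_exists_zero hU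
    (f := fun z => f z - f z1) (fun z hz => (hp z hz).sub (hp z1 h1)) h2 (by simp [h12])
    hn hW).and hinj).exists
  exact hz.2 (hi hz.1 h1 (sub_eq_zero.1 hz'))
end

section OneVariable
variable {f : ℂ → ℂ} {U : Set ℂ} {a : ℂ}

/-- If `f' (a) = 0` and `f` is not locally constant, `f` is not injective near `a`; moreover
every point near `a` has a companion with the same image. -/
theorem eventually_exists_companion (hf : AnalyticAt ℂ f a) (hnc : ¬ ∀ᶠ z in 𝓝 a, f z = f a)
    (hd : deriv f a = 0) {W : Set ℂ} (hW : W ∈ 𝓝 a) :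
    ∀ᶠ t in 𝓝[≠] a, ∃ z ∈ W, z ≠ t ∧ f z = f t := by
  obtain ⟨r, hr, hrW⟩ : ∃ r > 0, AnalyticOnNhd ℂ f (ball a r) := by
    obtain ⟨r, hr, h⟩ := eventually_nhds_iff_ball.1 hf.eventually_analyticAt
    exact ⟨r, hr, h⟩
  -- boundedness
  obtain ⟨M, s, hs, hsr, hM⟩ : ∃ M s, 0 < s ∧ s ≤ r ∧ ∀ z ∈ ball a s, ‖f z‖ ≤ M := by
    have h1 : ∀ᶠ z in 𝓝 a, ‖f z‖ ≤ ‖f a‖ + 1 :=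
      (hf.continuousAt.norm.eventually (gt_mem_nhds (lt_add_one _))).mono fun _ h => h.le
    obtain ⟨s, hs, h⟩ := eventually_nhds_iff_ball.1 h1
    exact ⟨_, min s r, by positivity, inf_le_right,
      fun z hz => h z (ball_min_left hz)⟩
  have hfd : HolOn f (ball a s) :=
    (hrW.differentiableOn).mono (ball_subset_ball hsr)
  have hdd : ∀ t ∈ ball a s, HolOn (dslope f t) (ball a s) := fun t ht =>
    (Complex.differentiableOn_dslope (isOpen_ball.mem_nhds ht)).2 hfd
  have hM0 : 0 ≤ M := (norm_nonneg _).trans (hM a (mem_ball_self hs))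
  have hbd : ∀ t ∈ ball a (s / 2), ∀ z ∈ ball a (s / 2), ‖dslope f t z‖ ≤ 4 * M / s := by
    intro t ht z hz
    have key : ∀ z ∈ ball a (s / 2), z ≠ t → ‖dslope f t z‖ ≤ 4 * M / s := by
      intro z hz hzt
      rw [dslope_of_ne _ hzt, slope_def_field, norm_div, div_le_iff₀ (norm_pos_iff.2 (sub_ne_zero.2 hzt))]
      exact lipschitz_of_bdd hs hfd hM ht hz
    by_cases hzt : z = t
    · subst hzt
      have hc : ContinuousAt (dslope f z) z :=
        ((hdd z (ball_subset_ball (by linarith) hz)).differentiableAt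
          (isOpen_ball.mem_nhds (ball_subset_ball (by linarith) hz))).continuousAt
      refine le_of_tendsto (hc.norm.tendsto.mono_left (nhdsWithin_le_nhds (s := {z}ᶜ))) ?_
      filter_upwards [mem_nhdsWithin_of_mem_nhds (isOpen_ball.mem_nhds hz),
        self_mem_nhdsWithin] with w hw hw'
      exact key w hw hw'
    · exact key z hz hzt
  have hl : LocBdd (𝓝 a) (fun t => dslope f t) (ball a (s / 2)) := by
    refine LocBdd.of_bdd isOpen_ball (M := 4 * M / s) ?_ ?_
    · filter_upwards [ball_mem_nhds a hs] with t ht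
      exact (hdd t ht).mono (ball_subset_ball (by linarith))
    · filter_upwards [ball_mem_nhds a (half_pos hs)] with t ht using hbd t ht
  have hlim : ∀ z ∈ ball a (s / 2), Tendsto (fun t => dslope f t z) (𝓝 a) (𝓝 (dslope f a z)) := by
    refine hl.vitali isOpen_ball (convex_ball _ _).isPreconnected
      ((hdd a (mem_ball_self hs)).mono (ball_subset_ball (by linarith)))
      (mem_ball_self (half_pos hs)) ?_
    refine Eventually.frequently ?_
    filter_upwards [self_mem_nhdsWithin] with z (hz : z ≠ a)
    have : Tendsto (fun t => (f z - f t) / (z - t)) (𝓝 a) (𝓝 ((f z - f a) / (z - a))) :=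
      (tendsto_const_nhds.sub hf.continuousAt.tendsto).div
        (tendsto_const_nhds.sub tendsto_id) (sub_ne_zero.2 hz)
    rw [dslope_of_ne _ hz, slope_def_field]
    refine this.congr' ?_
    filter_upwards [isOpen_ne.mem_nhds hz.symm] with t ht
    rw [dslope_of_ne _ (Ne.symm ht), slope_def_field]
  have hn0 : ¬ ∀ᶠ z in 𝓝 a, dslope f a z = 0 := by
    intro h
    apply hnc
    filter_upwards [h] with z hz
    have := sub_smul_dslope f a z
    rw [hz, smul_zero] at this
    exact (sub_eq_zero.1 this.symm)
  have h1 := (hl.eventually_exists_zero isOpen_ball hlim (mem_ball_self (half_pos hs))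
    (by rw [dslope_same, hd]) hn0 hW).filter_mono (nhdsWithin_le_nhds (s := {a}ᶜ))
  have hd0 : ∀ᶠ t in 𝓝[≠] a, deriv f t ≠ 0 := by
    refine hf.deriv.eventually_eq_zero_or_eventually_ne_zero.resolve_left fun h => hnc ?_
    obtain ⟨ρ, hρ, h'⟩ := eventually_nhds_iff_ball.1 (h.and hf.eventually_analyticAt)
    filter_upwards [ball_mem_nhds a hρ] with z hz
    exact (convex_ball a ρ).is_const_of_fderivWithin_eq_zero (𝕜 := ℂ)
      (fun w hw => (h' w hw).2.differentiableAt.differentiableWithinAt)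
      (fun w hw => by
        rw [fderivWithin_of_isOpen isOpen_ball hw]
        ext
        simpa using (h' w hw).1) hz (mem_ball_self hρ)
  filter_upwards [h1, hd0] with t ⟨z, hz, hz0⟩ ht
  refine ⟨z, hz, ?_, ?_⟩
  · rintro rfl
    rw [dslope_same] at hz0
    exact ht hz0
  · have := sub_smul_dslope f t z
    rw [hz0, smul_zero] at this
    exact (sub_eq_zero.1 this.symm)

theorem deriv_ne_zero_of_injOn (hU : IsOpen U) (hf : HolOn f U) (hi : InjOn f U)
    (ha : a ∈ U) : deriv f a ≠ 0 := by
  intro hd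
  have hnc : ¬ ∀ᶠ z in 𝓝 a, f z = f a := by
    intro h
    obtain ⟨z, ⟨h1, h2⟩, h3⟩ := (((h.filter_mono (nhdsWithin_le_nhds (s := {a}ᶜ))).and
      (mem_nhdsWithin_of_mem_nhds (hU.mem_nhds ha))).and self_mem_nhdsWithin).exists
    exact h3 (hi h2 ha h1)
  obtain ⟨t, ⟨z, hz, hzt, h⟩, ht⟩ := ((eventually_exists_companion
    (hf.analyticAt (hU.mem_nhds ha)) hnc hd (hU.mem_nhds ha)).and
      (mem_nhdsWithin_of_mem_nhds (hU.mem_nhds ha))).exists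
  exact hzt (hi hz ht h)

theorem hasStrictDerivAt_of_holo (hU : IsOpen U) (hf : HolOn f U) (ha : a ∈ U) :
    HasStrictDerivAt f (deriv f a) a :=
  (hf.analyticAt (hU.mem_nhds ha)).hasStrictDerivAt

/-- A continuous local section of a locally biholomorphic map is holomorphic. -/
theorem differentiableAt_of_comp {p g : ℂ → ℂ} (hp : AnalyticAt ℂ p (g a)) (hp' : deriv p (g a) ≠ 0)
    (hg : ContinuousAt g a) (h : DifferentiableAt ℂ (fun z => p (g z)) a) :
    DifferentiableAt ℂ g a := by
  have hs := hp.hasStrictDerivAt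
  have h1 := (hs.to_localInverse hp').hasDerivAt.differentiableAt
  have h2 : (fun z => hs.localInverse p _ _ hp' (p (g z))) =ᶠ[𝓝 a] g :=
    hg.eventually (hs.eventually_left_inverse hp')
  exact (DifferentiableAt.comp (g := hs.localInverse p _ _ hp') a h1 h).congr_of_eventuallyEq h2.symm

theorem isOpen_image_of_injOn (hU : IsOpen U) (hf : HolOn f U) (hi : InjOn f U) :
    IsOpen (f '' U) := by
  rw [isOpen_iff_mem_nhds]
  rintro _ ⟨a, ha, rfl⟩
  have := (hasStrictDerivAt_of_holo hU hf ha).map_nhds_eq (deriv_ne_zero_of_injOn hU hf hi ha)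
  rw [← this]
  exact image_mem_map (hU.mem_nhds ha)

/-- The inverse of an injective holomorphic function is holomorphic. -/
theorem exists_inverse_of_injOn (hU : IsOpen U) (hf : HolOn f U) (hi : InjOn f U) :
    ∃ g : ℂ → ℂ, HolOn g (f '' U) ∧ (∀ z ∈ U, g (f z) = z) ∧
      (∀ w ∈ f '' U, g w ∈ U ∧ f (g w) = w) := by
  classical
  refine ⟨invFunOn f U, ?_, fun z hz => hi.leftInvOn_invFunOn hz,
    fun w hw => ⟨invFunOn_mem hw, invFunOn_eq hw⟩⟩
  rintro _ ⟨a, ha, rfl⟩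
  have hs := hasStrictDerivAt_of_holo hU hf ha
  have h0 := deriv_ne_zero_of_injOn hU hf hi ha
  have h1 := (hs.to_localInverse h0).hasDerivAt.differentiableAt
  refine (h1.congr_of_eventuallyEq ?_).differentiableWithinAt
  have h2 : ∀ᶠ y in 𝓝 (f a), hs.localInverse f _ _ h0 y ∈ U := by
    have := (hs.to_localInverse h0).hasDerivAt.continuousAt
    have h3 : hs.localInverse f _ _ h0 (f a) = a := (hs.eventually_left_inverse h0).self_of_nhds
    rw [ContinuousAt, h3] at this
    exact this (hU.mem_nhds ha)
  filter_upwards [h2, hs.eventually_right_inverse h0] with y hy hy'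
  have hm : y ∈ f '' U := ⟨_, hy, hy'⟩
  exact hi (invFunOn_mem hm) hy ((invFunOn_eq hm).trans hy'.symm)

theorem isSimplyConnected_of_starConvex {x : ℂ} (hc : StarConvex ℝ x U) (hne : U.Nonempty) :
    SimplyConnectedSpace U := by
  have := hc.contractibleSpace hne
  infer_instance

theorem isSimplyConnected_of_convex (hc : Convex ℝ U) (hne : U.Nonempty) : SimplyConnectedSpace U := by
  have := hc.contractibleSpace hne
  infer_instance

theorem exists_log {x : ℂ} (hU : IsOpen U) (hc : StarConvex ℝ x U) (hf : HolOn f U)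
    (h0 : ∀ z ∈ U, f z ≠ 0) : ∃ g : ℂ → ℂ, HolOn g U ∧ ∀ z ∈ U, exp (g z) = f z := by
  rcases U.eq_empty_or_nonempty with rfl | hne
  · exact ⟨0, differentiableOn_empty, by simp⟩
  obtain ⟨g, hg, h⟩ := Complex.exists_continuousOn_eqOn_exp_comp
    (isSimplyConnected_of_starConvex hc hne) hU
    hf.continuousOn (by rintro ⟨z, hz, h⟩; exact h0 z hz h)
  refine ⟨g, fun z hz => DifferentiableAt.differentiableWithinAt ?_, fun z hz => h hz⟩
  refine differentiableAt_of_comp (p := exp) (analyticAt_cexp) (by simp)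
    (hg.continuousAt (hU.mem_nhds hz)) ?_
  refine (hf.differentiableAt (hU.mem_nhds hz)).congr_of_eventuallyEq ?_
  filter_upwards [hU.mem_nhds hz] with w hw using h hw

theorem exists_sqrt {x : ℂ} (hU : IsOpen U) (hc : StarConvex ℝ x U) (hf : HolOn f U)
    (h0 : ∀ z ∈ U, f z ≠ 0) : ∃ g : ℂ → ℂ, HolOn g U ∧ ∀ z ∈ U, g z ^ 2 = f z := by
  obtain ⟨g, hg, h⟩ := exists_log hU hc hf h0
  refine ⟨fun z => exp (g z / 2), (hg.div_const 2).cexp, fun z hz => ?_⟩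
  rw [← exp_nat_mul, ← h z hz]
  congr 1; push_cast; ring

end OneVariable

open ContinuousLinearMap (toSpanSingleton toSpanSingletonCLE)

/-- Joint holomorphy of a curried function of two variables. -/
def Hol2 (f : ℂ → ℂ → ℂ) (W : Set (ℂ × ℂ)) : Prop :=
  HolOn (fun p : ℂ × ℂ => f p.1 p.2) W

section
variable {f : ℂ → ℂ → ℂ} {W : Set (ℂ × ℂ)}

theorem exists_ball_prod (hW : IsOpen W) {p : ℂ × ℂ} (hp : p ∈ W) :
    ∃ r > 0, ball p.1 r ×ˢ ball p.2 r ⊆ W := by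
  obtain ⟨r, hr, h⟩ := isOpen_iff.1 hW p hp
  exact ⟨r, hr, by rwa [ball_prod_same]⟩

theorem continuousAt_deriv_snd {p : ℂ × ℂ} (hW : W ∈ 𝓝 p) (hc : ContinuousOn (fun p : ℂ × ℂ => f p.1 p.2) W)
    (h2 : ∀ q ∈ W, DifferentiableAt ℂ (f q.1) q.2) :
    ContinuousAt (fun q : ℂ × ℂ => deriv (f q.1) q.2) p := by
  have hpW : p ∈ W := mem_of_mem_nhds hW
  have hcp : ContinuousAt (fun p : ℂ × ℂ => f p.1 p.2) p := hc.continuousAt hW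
  have h1 : ∀ᶠ q in 𝓝 p, q ∈ interior W ∧ ‖f q.1 q.2‖ ≤ ‖f p.1 p.2‖ + 1 := by
    filter_upwards [isOpen_interior.mem_nhds (mem_interior_iff_mem_nhds.2 hW),
      hcp.norm.eventually (gt_mem_nhds (lt_add_one _))] with q a b using ⟨a, b.le⟩
  obtain ⟨r, hr, h⟩ := eventually_nhds_iff_ball.1 h1
  have hm : ∀ c ∈ ball p.1 r, ∀ z ∈ ball p.2 r, (c, z) ∈ ball p r := fun c hc z hz => by
    have : (c, z) ∈ ball p.1 r ×ˢ ball p.2 r := ⟨hc, hz⟩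
    rwa [ball_prod_same] at this
  have hl : LocBdd (𝓝 p.1) f (ball p.2 r) := by
    refine LocBdd.of_bdd isOpen_ball (M := ‖f p.1 p.2‖ + 1) ?_ ?_
    · filter_upwards [ball_mem_nhds p.1 hr] with c hc z hz
      exact (h2 (c, z) (interior_subset (h _ (hm c hc z hz)).1)).differentiableWithinAt
    · filter_upwards [ball_mem_nhds p.1 hr] with c hc z hz
      exact (h _ (hm c hc z hz)).2
  have hp : ∀ z ∈ ball p.2 r, Tendsto (f · z) (𝓝 p.1) (𝓝 (f p.1 z)) := by
    intro z hz
    have h3 : ContinuousAt (fun p : ℂ × ℂ => f p.1 p.2) (p.1, z) :=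
      hc.continuousAt (mem_interior_iff_mem_nhds.1 (h _ (hm _ (mem_ball_self hr) z hz)).1)
    exact h3.tendsto.comp (Continuous.tendsto' (by fun_prop) _ _ rfl : Tendsto (fun c => (c, z)) (𝓝 p.1) (𝓝 (p.1, z)))
  have hu := hl.tendstoLocallyUniformlyOn hp
  have hev : ∀ᶠ c in 𝓝 p.1, HolOn (f c) (ball p.2 r) := by
    filter_upwards [ball_mem_nhds p.1 hr] with c hc z hz
    exact (h2 (c, z) (interior_subset (h _ (hm c hc z hz)).1)).differentiableWithinAt
  have hud := hu.deriv hev isOpen_ball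
  have hcd : ContinuousAt (deriv (f p.1)) p.2 :=
    ((hev.self_of_nhds.deriv isOpen_ball).continuousOn).continuousAt (ball_mem_nhds _ hr)
  rw [tendstoLocallyUniformlyOn_iff] at hud
  rw [ContinuousAt, Metric.tendsto_nhds]
  intro ε hε
  obtain ⟨t, ht, h4⟩ := hud (ε / 2) (half_pos hε) p.2 (mem_ball_self hr)
  have ht' : t ∈ 𝓝 p.2 := by rwa [isOpen_ball.nhdsWithin_eq (mem_ball_self hr)] at ht
  have : (𝓝 p) = 𝓝 p.1 ×ˢ 𝓝 p.2 := by rw [← nhds_prod_eq]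
  rw [this]
  filter_upwards [(h4.prod_mk (inter_mem ht' (hcd.eventually (Metric.ball_mem_nhds _ (half_pos hε)))))] with q hq
  have h5 := hq.1 q.2 hq.2.1
  have h6 : dist (deriv (f p.1) q.2) (deriv (f p.1) p.2) < ε / 2 := hq.2.2
  have := dist_triangle_left (deriv (f q.1) q.2) (deriv (f p.1) p.2) (deriv (f p.1) q.2)
  simp only [Function.comp] at h5
  linarith

theorem hasStrictFDerivAt_of_sep {p : ℂ × ℂ} (hW : W ∈ 𝓝 p) (hc : ContinuousOn (fun p : ℂ × ℂ => f p.1 p.2) W)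
    (h1 : ∀ q ∈ W, DifferentiableAt ℂ (fun c => f c q.2) q.1)
    (h2 : ∀ q ∈ W, DifferentiableAt ℂ (f q.1) q.2) :
    HasStrictFDerivAt (fun p : ℂ × ℂ => f p.1 p.2)
      ((toSpanSingleton ℂ (deriv (fun c => f c p.2) p.1)).coprod
        (toSpanSingleton ℂ (deriv (f p.1) p.2))) p := by
  have c2 := continuousAt_deriv_snd hW hc h2
  have c1 : ContinuousAt (fun q : ℂ × ℂ => deriv (fun c => f c q.2) q.1) p := by
    have hs : Prod.swap ⁻¹' W ∈ 𝓝 p.swap := continuous_swap.tendsto p.swap (by simpa using hW)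
    have := continuousAt_deriv_snd (f := fun z c => f c z) (p := p.swap) hs
      (hc.comp continuous_swap.continuousOn fun q hq => hq) (fun q hq => h1 q.swap hq)
    exact ContinuousAt.comp (f := Prod.swap) (g := fun q : ℂ × ℂ => deriv (fun c => f c q.1) q.2)
      (x := p) this continuous_swap.continuousAt
  have h {x : ℂ} := (toSpanSingletonCLE (𝕜 := ℂ) (E := ℂ)).continuous.continuousAt (x := x)
  exact hasStrictFDerivAt_uncurry_coprod (𝕜 := ℂ) (u := p) (f := f)
    (f₁ := fun c z => toSpanSingleton ℂ (deriv (fun c => f c z) c))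
    (f₂ := fun c z => toSpanSingleton ℂ (deriv (f c) z))
    (by filter_upwards [hW] with q hq using (h1 q hq).hasDerivAt.hasFDerivAt)
    (by filter_upwards [hW] with q hq using (h2 q hq).hasDerivAt.hasFDerivAt)
    (h.comp c1) (h.comp c2)

/-- Osgood's lemma. -/
theorem Hol2.of_sep (hW : IsOpen W) (h1 : ∀ q ∈ W, DifferentiableAt ℂ (fun c => f c q.2) q.1)
    (h2 : ∀ q ∈ W, DifferentiableAt ℂ (f q.1) q.2)
    (hb : ∀ p ∈ W, ∃ M : ℝ, ∀ᶠ q in 𝓝 p, ‖f q.1 q.2‖ ≤ M) : Hol2 f W := by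
  have hc : ContinuousOn (fun p : ℂ × ℂ => f p.1 p.2) W := by
    intro p hp
    refine ContinuousAt.continuousWithinAt ?_
    obtain ⟨M, hM⟩ := hb p hp
    obtain ⟨r, hr, h⟩ := eventually_nhds_iff_ball.1 (hM.and (hW.mem_nhds hp))
    have hm : ∀ c ∈ ball p.1 r, ∀ z ∈ ball p.2 r, (c, z) ∈ ball p r := fun c hc z hz => by
      have : (c, z) ∈ ball p.1 r ×ˢ ball p.2 r := ⟨hc, hz⟩
      rwa [ball_prod_same] at this
    rw [ContinuousAt, tendsto_iff_norm_sub_tendsto_zero]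
    have e1 : Tendsto (fun q : ℂ × ℂ => 4 * M / r * ‖q.2 - p.2‖) (𝓝 p) (𝓝 0) :=
      Continuous.tendsto' (by fun_prop) _ _ (by simp)
    have e2 := tendsto_iff_norm_sub_tendsto_zero.1
      ((h1 p hp).continuousAt.tendsto.comp (continuous_fst.tendsto p))
    refine squeeze_zero' (.of_forall fun _ => norm_nonneg _) ?_ (by simpa using e1.add e2)
    filter_upwards [ball_mem_nhds p (half_pos hr)] with q hq
    rw [← ball_prod_same] at hq
    have hq1 : q.1 ∈ ball p.1 r := ball_subset_ball (by linarith) hq.1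
    have := lipschitz_of_bdd (f := f q.1) (z := p.2) hr (M := M)
      (fun z hz => (h2 (q.1, z) (h _ (hm _ hq1 z hz)).2).differentiableWithinAt)
      (fun z hz => (h _ (hm _ hq1 z hz)).1) (w := p.2) (w' := q.2)
      (mem_ball_self (by linarith)) hq.2
    calc ‖f q.1 q.2 - f p.1 p.2‖ = ‖(f q.1 q.2 - f q.1 p.2) + (f q.1 p.2 - f p.1 p.2)‖ := by ring_nf
      _ ≤ _ := (norm_add_le _ _).trans (by gcongr)
  intro p hp
  exact (hasStrictFDerivAt_of_sep (hW.mem_nhds hp) hc h1 h2).hasFDerivAt.differentiableAt.differentiableWithinAt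

theorem Hol2.sep₁ (hW : IsOpen W) (h : Hol2 f W) {c z : ℂ} (hq : (c, z) ∈ W) :
    DifferentiableAt ℂ (fun c => f c z) c :=
  DifferentiableAt.comp (g := fun p : ℂ × ℂ => f p.1 p.2) (f := fun c => (c, z)) c
    (h.differentiableAt (hW.mem_nhds hq)) (by fun_prop)

theorem Hol2.sep₂ (hW : IsOpen W) (h : Hol2 f W) {c z : ℂ} (hq : (c, z) ∈ W) :
    DifferentiableAt ℂ (f c) z :=
  DifferentiableAt.comp (g := fun p : ℂ × ℂ => f p.1 p.2) (f := fun z => (c, z)) z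
    (h.differentiableAt (hW.mem_nhds hq)) (by fun_prop)

theorem Hol2.comp {E : Type*} [NormedAddCommGroup E] [NormedSpace ℂ E] {s : Set E} {u v : E → ℂ} (h : Hol2 f W)
    (hu : HolOn u s) (hv : HolOn v s) (hs : ∀ x ∈ s, (u x, v x) ∈ W) : HolOn (fun x => f (u x) (v x)) s :=
  DifferentiableOn.comp (g := fun p : ℂ × ℂ => f p.1 p.2) (f := fun x => (u x, v x)) h (hu.prodMk hv) hs

theorem Hol2.continuousAt (hW : IsOpen W) (h : Hol2 f W) {q : ℂ × ℂ} (hq : q ∈ W) :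
    ContinuousAt (fun p : ℂ × ℂ => f p.1 p.2) q :=
  (h.differentiableAt (hW.mem_nhds hq)).continuousAt

theorem Hol2.hasStrictFDerivAt (hW : IsOpen W) (h : Hol2 f W) {p : ℂ × ℂ} (hp : p ∈ W) :
    HasStrictFDerivAt (fun p : ℂ × ℂ => f p.1 p.2)
      ((toSpanSingleton ℂ (deriv (fun c => f c p.2) p.1)).coprod
        (toSpanSingleton ℂ (deriv (f p.1) p.2))) p :=
  hasStrictFDerivAt_of_sep (hW.mem_nhds hp) h.continuousOn (fun _ hq => h.sep₁ hW hq)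
    (fun _ hq => h.sep₂ hW hq)

theorem Hol2.deriv_snd (hW : IsOpen W) (h : Hol2 f W) : Hol2 (fun c => deriv (f c)) W := by
  have hcont : ∀ p ∈ W, ContinuousAt (fun q : ℂ × ℂ => deriv (f q.1) q.2) p := fun p hp =>
    continuousAt_deriv_snd (hW.mem_nhds hp) h.continuousOn (fun _ hq => h.sep₂ hW hq)
  refine Hol2.of_sep hW ?_ ?_ ?_
  · intro q hq
    obtain ⟨r, hr, hrW⟩ := exists_ball_prod hW hq
    have hl : LocBdd (𝓝[≠] (0 : ℂ)) (fun t c => t⁻¹ * (f c (q.2 + t) - f c q.2)) (ball q.1 (r / 2)) := by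
      intro c hc
      have hcW : (c, q.2) ∈ W := hrW ⟨ball_subset_ball (by linarith) hc, mem_ball_self hr⟩
      obtain ⟨K, hK⟩ := (h.hasStrictFDerivAt hW hcW).exists_lipschitzOnWith
      obtain ⟨s, hs, hK⟩ := hK
      obtain ⟨ρ, hρ, hρs⟩ := Metric.mem_nhds_iff.1 (inter_mem hs (hW.mem_nhds hcW))
      refine ⟨ρ, hρ, K, ?_⟩
      filter_upwards [mem_nhdsWithin_of_mem_nhds (ball_mem_nhds (0 : ℂ) hρ), self_mem_nhdsWithin] with t ht (ht0 : t ≠ 0)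
      rw [← ball_prod_same] at hρs
      have m1 : ∀ w ∈ ball c ρ, (w, q.2 + t) ∈ s ∩ W := fun w hw => hρs ⟨hw, by simpa using ht⟩
      have m2 : ∀ w ∈ ball c ρ, (w, q.2) ∈ s ∩ W := fun w hw => hρs ⟨hw, mem_ball_self hρ⟩
      refine ⟨fun w hw => ((DifferentiableAt.sub (f := fun c => f c (q.2 + t)) (g := fun c => f c q.2)
        (h.sep₁ hW (m1 w hw).2) (h.sep₁ hW (m2 w hw).2)).const_mul _).differentiableWithinAt, fun w hw => ?_⟩
      have := hK.norm_sub_le (m1 w hw).1 (m2 w hw).1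
      rw [norm_mul, norm_inv, inv_mul_le_iff₀ (norm_pos_iff.2 ht0)]
      refine this.trans (le_of_eq ?_)
      simp [Prod.norm_def, mul_comm]
    have hp : ∀ c ∈ ball q.1 (r / 2), Tendsto (fun t => t⁻¹ * (f c (q.2 + t) - f c q.2)) (𝓝[≠] (0 : ℂ))
        (𝓝 (deriv (f c) q.2)) := by
      intro c hc
      have hcW : (c, q.2) ∈ W := hrW ⟨ball_subset_ball (by linarith) hc, mem_ball_self hr⟩
      simpa using (h.sep₂ hW hcW).hasDerivAt.tendsto_slope_zero
    exact (hl.differentiableOn isOpen_ball hp).differentiableAt (ball_mem_nhds _ (by linarith))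
  · intro q hq
    obtain ⟨r, hr, hrW⟩ := exists_ball_prod hW hq
    have : HolOn (f q.1) (ball q.2 r) := fun z hz =>
      (h.sep₂ hW (hrW ⟨mem_ball_self hr, hz⟩ : (q.1, z) ∈ W)).differentiableWithinAt
    exact (this.deriv isOpen_ball).differentiableAt (ball_mem_nhds _ hr)
  · intro p hp
    exact ⟨_, ((hcont p hp).norm.eventually (gt_mem_nhds (lt_add_one _))).mono fun _ h => h.le⟩

theorem Hol2.of_limit {ι : Type*} {l : Filter ι} [l.NeBot] {F : ι → ℂ → ℂ → ℂ}
    (hW : IsOpen W) (hp : ∀ p ∈ W, Tendsto (fun i => F i p.1 p.2) l (𝓝 (f p.1 p.2)))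
    (hb : ∀ p ∈ W, ∃ r > 0, ∃ M : ℝ, ∀ᶠ i in l, Hol2 (F i) (ball p.1 r ×ˢ ball p.2 r) ∧
      ∀ q ∈ ball p.1 r ×ˢ ball p.2 r, ‖F i q.1 q.2‖ ≤ M) : Hol2 f W := by
  have key : ∀ p ∈ W, ∃ r > 0, ball p.1 r ×ˢ ball p.2 r ⊆ W ∧ ∃ M : ℝ, ∀ᶠ i in l,
      Hol2 (F i) (ball p.1 r ×ˢ ball p.2 r) ∧
      ∀ q ∈ ball p.1 r ×ˢ ball p.2 r, ‖F i q.1 q.2‖ ≤ M := by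
    intro p hp
    obtain ⟨r, hr, M, h⟩ := hb p hp
    obtain ⟨s, hs, h'⟩ := exists_ball_prod hW hp
    have hsub : ball p.1 (min r s) ×ˢ ball p.2 (min r s) ⊆ ball p.1 r ×ˢ ball p.2 r :=
      Set.prod_mono ball_min_left ball_min_left
    refine ⟨min r s, by positivity, (Set.prod_mono ball_min_right
      ball_min_right).trans h', M, h.mono fun i hi =>
      ⟨hi.1.mono hsub, fun q hq => hi.2 q (hsub hq)⟩⟩
  refine Hol2.of_sep hW ?_ ?_ ?_
  · intro q hq
    obtain ⟨r, hr, hrW, M, hM⟩ := key q hq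
    have hl : LocBdd l (fun i c => F i c q.2) (ball q.1 r) := LocBdd.of_bdd isOpen_ball
      (hM.mono fun i hi c hc => (hi.1.sep₁ (isOpen_ball.prod isOpen_ball)
        (⟨hc, mem_ball_self hr⟩ : (c, q.2) ∈ ball q.1 r ×ˢ ball q.2 r)).differentiableWithinAt)
      (hM.mono fun i hi c hc => hi.2 (c, q.2) ⟨hc, mem_ball_self hr⟩)
    exact (hl.differentiableOn isOpen_ball (fun c hc => hp (c, q.2) (hrW
      ⟨hc, mem_ball_self hr⟩))).differentiableAt (ball_mem_nhds _ hr)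
  · intro q hq
    obtain ⟨r, hr, hrW, M, hM⟩ := key q hq
    have hl : LocBdd l (fun i z => F i q.1 z) (ball q.2 r) := LocBdd.of_bdd isOpen_ball
      (hM.mono fun i hi c hc => (hi.1.sep₂ (isOpen_ball.prod isOpen_ball)
        (⟨mem_ball_self hr, hc⟩ : (q.1, c) ∈ ball q.1 r ×ˢ ball q.2 r)).differentiableWithinAt)
      (hM.mono fun i hi c hc => hi.2 (q.1, c) ⟨mem_ball_self hr, hc⟩)
    exact (hl.differentiableOn isOpen_ball (fun c hc => hp (q.1, c) (hrW
      ⟨mem_ball_self hr, hc⟩))).differentiableAt (ball_mem_nhds _ hr)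
  · intro q hq
    obtain ⟨r, hr, hrW, M, hM⟩ := key q hq
    refine ⟨M, ?_⟩
    filter_upwards [(isOpen_ball.prod isOpen_ball).mem_nhds
      (⟨mem_ball_self hr, mem_ball_self hr⟩ : q ∈ ball q.1 r ×ˢ ball q.2 r)] with p hp'
    exact le_of_tendsto (hp p (hrW hp')).norm (hM.mono fun i hi => hi.2 p hp')

/-- Inverse function theorem with a parameter. -/
theorem Hol2.exists_inverse (hW : IsOpen W) (h : Hol2 f W) {c0 z0 : ℂ} (h0 : (c0, z0) ∈ W)
    (hd : deriv (f c0) z0 ≠ 0) {N : Set ℂ} (hN : N ∈ 𝓝 z0) :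
    ∃ r > 0, ∃ s > 0, ball z0 s ⊆ N ∧ ball c0 r ×ˢ ball z0 s ⊆ W ∧ ∃ κ : ℂ → ℂ → ℂ,
      Hol2 κ (ball c0 r ×ˢ ball (f c0 z0) r) ∧
      (∀ c ∈ ball c0 r, ∀ y ∈ ball (f c0 z0) r, κ c y ∈ ball z0 s ∧ f c (κ c y) = y) ∧
      (∀ c ∈ ball c0 r, InjOn (f c) (ball z0 s)) ∧
      (∀ c ∈ ball c0 r, ∀ z ∈ ball z0 s, deriv (f c) z ≠ 0) := by
  set Φ : ℂ × ℂ → ℂ × ℂ := fun p => (p.1, f p.1 p.2) with hΦ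
  have hder : ∀ p ∈ W, deriv (f p.1) p.2 ≠ 0 → ∃ e : (ℂ × ℂ) ≃L[ℂ] (ℂ × ℂ),
      HasStrictFDerivAt Φ (e : (ℂ × ℂ) →L[ℂ] (ℂ × ℂ)) p := by
    intro p hp hne
    set a := deriv (fun c => f c p.2) p.1
    set b := deriv (f p.1) p.2
    set L := (ContinuousLinearMap.fst ℂ ℂ ℂ).prod ((toSpanSingleton ℂ a).coprod (toSpanSingleton ℂ b))
    have hLv : ∀ x, L x = (x.1, x.1 * a + x.2 * b) := fun _ => rfl
    have hL : Function.Bijective L := by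
      constructor
      · rintro ⟨x1, x2⟩ ⟨y1, y2⟩ hxy
        simp only [hLv, Prod.mk.injEq] at hxy
        obtain ⟨rfl, hxy⟩ := hxy
        rw [mul_right_cancel₀ hne (add_left_cancel hxy)]
      · rintro ⟨y1, y2⟩
        refine ⟨(y1, (y2 - y1 * a) / b), ?_⟩
        simp [hLv, div_mul_cancel₀ _ hne]
    refine ⟨ContinuousLinearEquiv.ofBijective L (LinearMap.ker_eq_bot.2 hL.1)
      (LinearMap.range_eq_top.2 hL.2), ?_⟩
    exact hasStrictFDerivAt_fst.prodMk (h.hasStrictFDerivAt hW hp)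
  obtain ⟨e, he⟩ := hder _ h0 hd
  set E := he.toOpenPartialHomeomorph Φ
  have hEc : ∀ p, E p = Φ p := fun p => rfl
  have hmem : (c0, z0) ∈ E.source := he.mem_toOpenPartialHomeomorph_source
  have hcd := continuousAt_deriv_snd (hW.mem_nhds h0) h.continuousOn (fun _ hq => h.sep₂ hW hq)
  -- a good polydisc
  have hev : ∀ᶠ p in 𝓝 (c0, z0), p ∈ E.source ∩ W ∧ p.2 ∈ N ∧ deriv (f p.1) p.2 ≠ 0 := by
    filter_upwards [E.open_source.mem_nhds hmem, hW.mem_nhds h0,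
      hcd.eventually_ne hd, (continuous_snd.tendsto (c0, z0)) hN] with p h1 h2 h3 h4
    exact ⟨⟨h1, h2⟩, h4, h3⟩
  obtain ⟨s, hs, hsW⟩ := eventually_nhds_iff_ball.1 hev
  rw [← ball_prod_same] at hsW
  have hopen : IsOpen (ball c0 s ×ˢ ball z0 s) := isOpen_ball.prod isOpen_ball
  have hmem' : (c0, z0) ∈ ball c0 s ×ˢ ball z0 s := ⟨mem_ball_self hs, mem_ball_self hs⟩
  have himg : Φ '' (ball c0 s ×ˢ ball z0 s) ∈ 𝓝 (Φ (c0, z0)) :=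
    E.image_mem_nhds hmem (hopen.mem_nhds hmem')
  obtain ⟨r', hr', hr⟩ := Metric.mem_nhds_iff.1 himg
  set r := min r' s
  have hrp : 0 < r := lt_min hr' hs
  have hsol : ∀ c ∈ ball c0 r, ∀ y ∈ ball (f c0 z0) r,
      ∃ z ∈ ball z0 s, f c z = y ∧ E.symm (c, y) = (c, z) := by
    intro c hc y hy
    have : (c, y) ∈ ball (Φ (c0, z0)) r' := by
      rw [← ball_prod_same]
      exact ⟨ball_min_left hc, ball_min_left hy⟩
    obtain ⟨⟨c', z⟩, ⟨h1, h2⟩, h3⟩ := hr this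
    simp only [hΦ, Prod.mk.injEq] at h3
    obtain ⟨rfl, h3⟩ := h3
    refine ⟨z, h2, h3, ?_⟩
    have := E.left_inv (hsW (c', z) ⟨h1, h2⟩).1.1
    rw [hEc] at this
    simpa only [hΦ, h3] using this
  refine ⟨r, hrp, s, hs, fun z hz => (hsW (c0, z) ⟨mem_ball_self hs, hz⟩).2.1,
    fun p hp => (hsW p ⟨ball_min_right hp.1, hp.2⟩).1.2,
    fun c y => (E.symm (c, y)).2, ?_, ?_, ?_, ?_⟩
  · intro p hp
    obtain ⟨z, hz, hfz, hsy⟩ := hsol p.1 hp.1 p.2 hp.2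
    have hq : (p.1, z) ∈ ball c0 s ×ˢ ball z0 s := ⟨ball_min_right hp.1, hz⟩
    obtain ⟨e', he'⟩ := hder (p.1, z) (hsW _ hq).1.2 (hsW _ hq).2.2
    have hp' : p = Φ (p.1, z) := by simp [hΦ, hfz]
    have htgt : p ∈ E.target := hp' ▸ E.map_source (hsW _ hq).1.1
    have := E.hasFDerivAt_symm (f' := e') htgt (by
      have h7 : E.symm p = (p.1, z) := hsy
      rw [h7]; exact he'.hasFDerivAt)
    exact (this.differentiableAt.snd).differentiableWithinAt
  · intro c hc y hy
    obtain ⟨z, hz, hfz, hsy⟩ := hsol c hc y hy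
    simp only [hsy]
    exact ⟨hz, hfz⟩
  · intro c hc z hz w hw hzw
    have hc' := ball_subset_ball (min_le_right r' s) hc
    have := E.injOn (hsW (c, z) ⟨hc', hz⟩).1.1 (hsW (c, w) ⟨hc', hw⟩).1.1 (by
      rw [hEc, hEc]; simp [hΦ, hzw])
    exact (Prod.mk.inj this).2
  · intro c hc z hz
    exact (hsW (c, z) ⟨ball_subset_ball (min_le_right r' s) hc, hz⟩).2.2
end

theorem isPreconnected_iInter_antitone {X : Type*} [TopologicalSpace X] [T2Space X]
    {K : ℕ → Set X} (hanti : Antitone K) (hc : ∀ j, IsCompact (K j))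
    (hp : ∀ j, IsPreconnected (K j)) : IsPreconnected (⋂ j, K j) := by
  intro u v hu hv huv hsu hsv
  by_contra hcon
  rw [not_nonempty_iff_eq_empty] at hcon
  have hcI : IsCompact (⋂ j, K j) := (hc 0).of_isClosed_subset
    (isClosed_iInter fun j => (hc j).isClosed) (iInter_subset _ 0)
  have hA : IsCompact ((⋂ j, K j) \ v) := hcI.diff hv
  have hB : IsCompact ((⋂ j, K j) \ u) := hcI.diff hu
  have hdisj : Disjoint ((⋂ j, K j) \ v) ((⋂ j, K j) \ u) := by
    rw [Set.disjoint_left]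
    rintro x ⟨hx, hxv⟩ ⟨-, hxu⟩
    rcases huv hx with h | h
    · exact hxu h
    · exact hxv h
  obtain ⟨u', v', hu', hv', hAu, hBv, hd⟩ := SeparatedNhds.of_isCompact_isCompact hA hB hdisj
  have hsub : ∀ x ∈ ⋂ j, K j, u' ∪ v' ∈ 𝓝 x := by
    intro x hx
    refine (hu'.union hv').mem_nhds ?_
    by_cases hxv : x ∈ v
    · right
      refine hBv ⟨hx, fun hxu => ?_⟩
      have : x ∈ (⋂ j, K j) ∩ (u ∩ v) := ⟨hx, hxu, hxv⟩
      rw [hcon] at this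
      exact this
    · exact Or.inl (hAu ⟨hx, hxv⟩)
  obtain ⟨j, hj⟩ := exists_subset_nhds_of_isCompact (directed_of_isDirected_le hanti) hc hsub
  obtain ⟨x, hx, hxu⟩ := hsu
  obtain ⟨y, hy, hyv⟩ := hsv
  have hxu' : x ∈ u' := hAu ⟨hx, fun h => by
    have : x ∈ (⋂ j, K j) ∩ (u ∩ v) := ⟨hx, hxu, h⟩
    rw [hcon] at this; exact this⟩
  have hyv' : y ∈ v' := hBv ⟨hy, fun h => by
    have : y ∈ (⋂ j, K j) ∩ (u ∩ v) := ⟨hy, h, hyv⟩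
    rw [hcon] at this; exact this⟩
  obtain ⟨z, -, h1, h2⟩ := hp j u' v' hu' hv' hj ⟨x, mem_iInter.1 hx j, hxu'⟩
    ⟨y, mem_iInter.1 hy j, hyv'⟩
  exact Set.disjoint_left.1 hd h1 h2

/-- The preimage under squaring of a connected compact set containing `0` is connected. -/
theorem isPreconnected_sq_preimage {X : Set ℂ} (hX : IsPreconnected X) (h0 : (0 : ℂ) ∈ X) :
    IsPreconnected ((fun z : ℂ => z ^ 2) ⁻¹' X) := by
  have hcl : IsClosedMap (fun z : ℂ => z ^ 2) := by
    refine IsProperMap.isClosedMap ?_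
    rw [isProperMap_iff_tendsto_cocompact]
    refine ⟨by fun_prop, ?_⟩
    rw [← Metric.cobounded_eq_cocompact, ← comap_norm_atTop, tendsto_comap_iff]
    have : (norm ∘ fun z : ℂ => z ^ 2) = (fun x : ℝ => x ^ 2) ∘ norm := by ext; simp
    rw [this]
    exact (tendsto_pow_atTop two_ne_zero).comp tendsto_comap
  have hop : IsOpenMap (fun z : ℂ => z ^ 2) := (isOpenQuotientMap_pow 2).isOpenMap
  have hsurj : Function.Surjective (fun z : ℂ => z ^ 2) := (isOpenQuotientMap_pow 2).surjective
  rw [isPreconnected_iff_preconnectedSpace] at hX ⊢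
  set φ := X.restrictPreimage (fun z : ℂ => z ^ 2)
  have hφo : IsOpenMap φ := hop.restrictPreimage X
  have hφc : IsClosedMap φ := hcl.restrictPreimage X
  have key : ∀ s : Set ((fun z : ℂ => z ^ 2) ⁻¹' X), IsClopen s → (⟨0, by simpa using h0⟩ ∉ s) → s = ∅ := by
    intro s hs h0s
    rcases preconnectedSpace_iff_clopen.1 hX (φ '' s) ⟨hφc _ hs.1, hφo _ hs.2⟩ with h | h
    · exact image_eq_empty.1 h
    · exfalso
      have : (⟨0, h0⟩ : X) ∈ φ '' s := by rw [h]; trivial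
      obtain ⟨z, hz, hz'⟩ := this
      have h1 : (z : ℂ) ^ 2 = 0 := congrArg Subtype.val hz'
      have h2 : (z : ℂ) = 0 := by simpa using h1
      apply h0s
      convert hz
      exact h2.symm
  rw [preconnectedSpace_iff_clopen]
  intro s hs
  by_cases h : (⟨0, by simpa using h0⟩ : (fun z : ℂ => z ^ 2) ⁻¹' X) ∈ s
  · right
    have := key sᶜ hs.compl (by simpa using h)
    simpa using this
  · exact Or.inl (key s hs h)

/-- The unfolded iterate: `P_c^n(z) = Q n c (z²)`. -/
def Q (n : ℕ) (c w : ℂ) : ℂ := (P c)^[n - 1] (w + c)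

theorem iterate_eq_Q {n : ℕ} (hn : 1 ≤ n) (c z : ℂ) : (P c)^[n] z = Q n c (z ^ 2) := by
  obtain ⟨m, rfl⟩ := Nat.exists_eq_add_of_le' hn
  rfl

theorem hol2_iterate {a : ℂ → ℂ → ℂ} {W : Set (ℂ × ℂ)} (ha : Hol2 a W) (n : ℕ) :
    Hol2 (fun c z => (P c)^[n] (a c z)) W := by
  induction n with
  | zero => exact ha
  | succ n ih =>
    have : (fun p : ℂ × ℂ => (P p.1)^[n + 1] (a p.1 p.2)) =
        fun p => ((P p.1)^[n] (a p.1 p.2)) ^ 2 + p.1 := by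
      ext p; rw [iterate_succ_apply']; rfl
    unfold Hol2
    rw [this]
    exact (DifferentiableOn.pow ih 2).add differentiableOn_fst

theorem hol2_Q (n : ℕ) (W : Set (ℂ × ℂ)) : Hol2 (Q n) W :=
  hol2_iterate (a := fun c w => w + c) (by unfold Hol2; fun_prop) (n - 1)

theorem differentiable_Q (n : ℕ) (c : ℂ) : Differentiable ℂ (Q n c) := fun z =>
  (hol2_Q n univ).sep₂ isOpen_univ (mem_univ (c, z))

theorem differentiable_iterate (n : ℕ) (c : ℂ) : Differentiable ℂ ((P c)^[n]) := fun z =>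
  (hol2_iterate (a := fun _ z => z) (W := univ) (by unfold Hol2; fun_prop) n).sep₂
    isOpen_univ (mem_univ (c, z))

/-- `P_c^n` restricts to a quadratic-like map on the disc of radius `ρ` about `0`. -/
def QLAt (n : ℕ) (ρ : ℝ) (c : ℂ) : Prop :=
  1 ≤ n ∧ 0 < ρ ∧ InjOn (Q n c) (ball 0 (ρ ^ 2)) ∧
    closedBall (0 : ℂ) ρ ⊆ Q n c '' ball 0 (ρ ^ 2)

/-- Boundary points are not mapped into the image of the disc. -/
theorem QLAt.norm_lt_of_mem {n : ℕ} {ρ : ℝ} {c z : ℂ} (h : QLAt n ρ c) (hz : ‖z‖ ≤ ρ)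
    (hV : (P c)^[n] z ∈ Q n c '' ball 0 (ρ ^ 2)) : ‖z‖ < ρ := by
  obtain ⟨hn, hρ, hi, -⟩ := h
  refine lt_of_le_of_ne hz fun hzρ => ?_
  rw [iterate_eq_Q hn] at hV
  obtain ⟨w', hw', hQ⟩ := hV
  set w := z ^ 2
  have hwn : ‖w‖ = ρ ^ 2 := by simp [w, hzρ]
  have hne : w ≠ w' := by
    rintro h
    rw [mem_ball_zero_iff, ← h, hwn] at hw'
    exact lt_irrefl _ hw'
  obtain ⟨N, N', hN, hN', hwN, hwN', hd⟩ := t2_separation hne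
  have himg : IsOpen (Q n c '' (N' ∩ ball 0 (ρ ^ 2))) :=
    isOpen_image_of_injOn (hN'.inter isOpen_ball) (differentiable_Q n c).differentiableOn
      (hi.mono inter_subset_right)
  have h1 : ∀ᶠ x in 𝓝 w, x ∈ N ∧ Q n c x ∈ Q n c '' (N' ∩ ball 0 (ρ ^ 2)) :=
    Filter.Eventually.and (show ∀ᶠ x in 𝓝 w, x ∈ N from hN.mem_nhds hwN) ((differentiable_Q n c).continuous.continuousAt.eventually
      (himg.mem_nhds ⟨w', ⟨hwN', hw'⟩, hQ⟩))
  have h2 : ∃ᶠ x in 𝓝 w, x ∈ ball (0 : ℂ) (ρ ^ 2) := by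
    rw [← mem_closure_iff_frequently, closure_ball _ (by positivity)]
    simp [hwn]
  obtain ⟨x, hx, hxN, y, hy, hxy⟩ := (h2.and_eventually h1).exists
  have := hi hy.2 hx hxy
  rw [this] at hy
  exact Set.disjoint_left.1 hd hxN hy.1

theorem QLAt.renormalizable {n : ℕ} {ρ : ℝ} {c : ℂ} (hn2 : 2 ≤ n) (h : QLAt n ρ c)
    (horb : ∀ k, ((P c)^[n])^[k] 0 ∈ closedBall (0 : ℂ) ρ) : Renormalizable c n := by
  have hbd := fun z => QLAt.norm_lt_of_mem (z := z) h
  obtain ⟨hn, hρ, hi, hV⟩ := h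
  have hQd : HolOn (Q n c) (ball 0 (ρ ^ 2)) := (differentiable_Q n c).differentiableOn
  have hVo := isOpen_image_of_injOn isOpen_ball hQd hi
  obtain ⟨g, hgd, hgl, hgr⟩ := exists_inverse_of_injOn isOpen_ball hQd hi
  have hfQ : ∀ z, (P c)^[n] z = Q n c (z ^ 2) := iterate_eq_Q hn c
  have hsq : ∀ z : ℂ, z ∈ ball (0 : ℂ) ρ ↔ z ^ 2 ∈ ball (0 : ℂ) (ρ ^ 2) := by
    intro z
    simp only [mem_ball_zero_iff, norm_pow]
    exact (pow_lt_pow_iff_left₀ (norm_nonneg _) hρ.le two_ne_zero).symm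
  have hρ2 : 0 < ρ ^ 2 := by positivity
  have hderiv : ∀ z, deriv ((P c)^[n]) z = deriv (Q n c) (z ^ 2) * (2 * z) := by
    intro z
    have h1 : HasDerivAt (fun z : ℂ => z ^ 2) (2 * z) z := by simpa using hasDerivAt_pow 2 z
    have h2 := ((differentiable_Q n c) (z ^ 2)).hasDerivAt.comp z h1
    have : (P c)^[n] = Q n c ∘ fun z => z ^ 2 := funext hfQ
    rw [this]; exact h2.deriv
  have hpre : ∀ K ⊆ Q n c '' ball 0 (ρ ^ 2), ball 0 ρ ∩ (P c)^[n] ⁻¹' K = (fun z => z ^ 2) ⁻¹' (g '' K) := by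
    intro K hK
    ext z
    constructor
    · rintro ⟨h1, h2⟩
      refine ⟨_, h2, ?_⟩
      rw [hfQ]; exact hgl _ ((hsq z).1 h1)
    · rintro ⟨v, hv, hgv⟩
      have := hgr v (hK hv)
      simp only at hgv
      rw [hgv] at this
      refine ⟨(hsq z).2 this.1, ?_⟩
      rw [mem_preimage, hfQ, this.2]; exact hv
  have hcomp : ∀ K : Set ℂ, K ⊆ Q n c '' ball 0 (ρ ^ 2) → IsCompact K →
      IsCompact (ball 0 ρ ∩ (P c)^[n] ⁻¹' K) := by
    intro K hK hKc
    have hc : IsClosed (ball 0 ρ ∩ (P c)^[n] ⁻¹' K) := by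
      rw [hpre K hK]
      exact (hKc.image_of_continuousOn (hgd.continuousOn.mono hK)).isClosed.preimage (by fun_prop)
    exact (isCompact_closedBall (0 : ℂ) ρ).of_isClosed_subset hc
      (inter_subset_left.trans ball_subset_closedBall)
  refine ⟨hn2, ball 0 ρ, Q n c '' ball 0 (ρ ^ 2), isOpen_ball, hVo,
    (convex_ball _ _).isConnected (nonempty_ball.2 hρ), ?_, ?_, ?_, mem_ball_self hρ, ?_, ?_, hcomp, ?_, ?_, ?_, ?_, ?_⟩
  · exact ((convex_ball _ _).isConnected (nonempty_ball.2 hρ2)).image _ hQd.continuousOn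
  · exact isSimplyConnected_of_convex (convex_ball _ _) (nonempty_ball.2 hρ)
  · have hsc := isSimplyConnected_of_convex (convex_ball (0 : ℂ) (ρ ^ 2)) (nonempty_ball.2 hρ2)
    have he : IsOpenEmbedding (fun w : ball (0 : ℂ) (ρ ^ 2) => Q n c w) := by
      refine IsOpenEmbedding.of_continuous_injective_isOpenMap
        ((differentiable_Q n c).continuous.comp continuous_subtype_val) (fun a b hab => Subtype.ext (hi a.2 b.2 hab)) ?_
      intro s hs
      have := isOpen_image_of_injOn (isOpen_ball.isOpenMap_subtype_val s hs) (hQd.mono (by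
        rintro _ ⟨x, -, rfl⟩; exact x.2)) (hi.mono (by rintro _ ⟨x, -, rfl⟩; exact x.2))
      rwa [image_image] at this
    have h2 := he.isEmbedding.toHomeomorph.toHomotopyEquiv.simplyConnectedSpace_iff.1 hsc
    have h3 : range (fun w : ball (0 : ℂ) (ρ ^ 2) => Q n c w) = Q n c '' ball 0 (ρ ^ 2) := by
      rw [image_eq_range]
    rwa [h3] at h2
  · rw [closure_ball _ hρ.ne']; exact hV
  · ext v
    constructor
    · rintro ⟨z, hz, rfl⟩
      exact ⟨z ^ 2, (hsq z).1 hz, (hfQ z).symm⟩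
    · rintro ⟨w, hw, rfl⟩
      obtain ⟨z, rfl⟩ := (isOpenQuotientMap_pow 2).surjective w
      exact ⟨z, (hsq z).2 hw, hfQ z⟩
  · rw [hderiv]; simp
  · intro z hz h0
    rw [hderiv] at h0
    have := deriv_ne_zero_of_injOn isOpen_ball hQd hi ((hsq z).1 hz)
    simpa [this] using h0
  · intro v hv hv0
    have hgv := hgr v hv
    obtain ⟨z, hz⟩ := (isOpenQuotientMap_pow 2).surjective (g v)
    simp only at hz
    have hz0 : z ≠ 0 := by
      rintro rfl
      apply hv0
      rw [hfQ, hz, hgv.2]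
    have : ball 0 ρ ∩ (P c)^[n] ⁻¹' {v} = {z, -z} := by
      rw [hpre {v} (by simpa using hv)]
      ext x
      simp [← hz, sq_eq_sq_iff_eq_or_eq_neg]
    rw [this, ncard_pair]
    intro h
    exact hz0 (self_eq_neg.1 h)
  · have h0 : (P c)^[n] 0 = Q n c 0 := by rw [hfQ]; simp
    have : Q n c 0 ∈ Q n c '' ball 0 (ρ ^ 2) := mem_image_of_mem _ (mem_ball_self hρ2)
    rw [h0, hpre {Q n c 0} (by simpa using this)]
    ext x
    simp [hgl 0 (mem_ball_self hρ2)]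
  -- connectedness of the filled Julia set
  set f := (P c)^[n] with hf
  let K : ℕ → Set ℂ := fun j => Nat.rec (closedBall 0 ρ)
    (fun _ S => ball 0 ρ ∩ f ⁻¹' S) j
  have hK0 : K 0 = closedBall 0 ρ := rfl
  have hKs : ∀ j, K (j + 1) = ball 0 ρ ∩ f ⁻¹' (K j) := fun j => rfl
  have hKsub : ∀ j, K j ⊆ closedBall 0 ρ := by
    intro j
    cases j with
    | zero => exact subset_rfl
    | succ j => rw [hKs]; exact inter_subset_left.trans ball_subset_closedBall
  have hKanti : Antitone K := by
    refine antitone_nat_of_succ_le fun j => ?_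
    induction j with
    | zero => exact hKsub 1
    | succ j ih =>
      rw [hKs (j + 1)]
      conv_rhs => rw [hKs j]
      exact inter_subset_inter_right _ (preimage_mono ih)
  have hmem0 : ∀ j k, f^[k] 0 ∈ K j := by
    intro j
    induction j with
    | zero => exact fun k => horb k
    | succ j ih =>
      intro k
      rw [hKs]
      have h1 : f (f^[k] 0) ∈ K j := by rw [← iterate_succ_apply' f]; exact ih (k + 1)
      refine ⟨?_, h1⟩
      rw [mem_ball_zero_iff]
      exact hbd _ (by simpa using horb k) (hV (hKsub j h1))
  have hKc : ∀ j, IsCompact (K j) ∧ IsPreconnected (K j) := by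
    intro j
    induction j with
    | zero => exact ⟨isCompact_closedBall _ _, (convex_closedBall _ _).isPreconnected⟩
    | succ j ih =>
      have hKV := (hKsub j).trans hV
      refine ⟨by rw [hKs]; exact hcomp _ hKV ih.1, ?_⟩
      rw [hKs, hpre _ hKV]
      refine isPreconnected_sq_preimage (ih.2.image _ (hgd.continuousOn.mono hKV)) ?_
      refine ⟨f 0, hmem0 j 1, ?_⟩
      rw [hfQ]
      simpa using hgl 0 (mem_ball_self hρ2)
  have hKI : {z ∈ ball (0 : ℂ) ρ | ∀ k : ℕ, f^[k] z ∈ ball (0 : ℂ) ρ} = ⋂ j, K j := by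
    ext z
    rw [mem_iInter]
    constructor
    · rintro ⟨-, h2⟩ j
      have : ∀ j k, f^[k] z ∈ K j := by
        intro j
        induction j with
        | zero => exact fun k => ball_subset_closedBall (h2 k)
        | succ j ih =>
          intro k
          refine ⟨h2 k, ?_⟩
          rw [mem_preimage, ← iterate_succ_apply' f]; exact ih (k + 1)
      exact this j 0
    · intro h
      have : ∀ k, ∀ j, f^[k] z ∈ K j := by
        intro k
        induction k with
        | zero => exact h
        | succ k ih =>
          intro j
          rw [iterate_succ_apply']
          exact (ih (j + 1)).2
      exact ⟨(this 0 1).1, fun k => (this k 1).1⟩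
  rw [hKI]
  exact ⟨⟨0, mem_iInter.2 fun j => hmem0 j 0⟩,
    isPreconnected_iInter_antitone hKanti (fun j => (hKc j).1) (fun j => (hKc j).2)⟩

/-- A bound for the error in the functional equation of `log⁺`. -/
noncomputable def gB (c : ℂ) : ℝ := log (2 + 2 * ‖c‖)

theorem gB_nonneg (c : ℂ) : 0 ≤ gB c := log_nonneg (by linarith [norm_nonneg c])

theorem continuous_gB : Continuous gB :=
  Continuous.log (by fun_prop) fun c => by positivity

/-- Approximations of the Green function. -/
noncomputable def gN (N : ℕ) (c z : ℂ) : ℝ := (1 / 2) ^ N * log (max 1 ‖(P c)^[N] z‖)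

theorem gN_nonneg (N : ℕ) (c z : ℂ) : 0 ≤ gN N c z :=
  mul_nonneg (by positivity) (log_nonneg (le_max_left _ _))

theorem log_max_P_le (c z : ℂ) :
    |log (max 1 ‖P c z‖) - 2 * log (max 1 ‖z‖)| ≤ gB c := by
  have hc := norm_nonneg c
  set m := max 1 ‖z‖ with hm
  set m' := max 1 ‖P c z‖ with hm'
  have h1 : 1 ≤ m := le_max_left _ _
  have h1' : 1 ≤ m' := le_max_left _ _
  have hz : ‖z‖ ≤ m := le_max_right _ _
  have e1 : 2 * log m = log (m ^ 2) := by rw [Real.log_pow]; norm_num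
  rw [e1, gB, abs_le]
  constructor
  · have : log (m ^ 2) ≤ log ((2 + 2 * ‖c‖) * m') := by
      apply log_le_log (by positivity)
      rcases le_total ‖z‖ 1 with h | h
      · rw [hm, max_eq_left h]; nlinarith
      · rw [hm, max_eq_right h]
        have h2 : ‖z‖ ^ 2 ≤ ‖P c z‖ + ‖c‖ := by
          rw [← norm_pow]
          have : z ^ 2 = P c z - c := by simp [P]
          rw [this]; exact norm_sub_le _ _
        have h3 : ‖P c z‖ ≤ m' := le_max_right _ _
        nlinarith
    rw [log_mul (by positivity) (by positivity)] at this
    linarith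
  · have : log m' ≤ log ((2 + 2 * ‖c‖) * m ^ 2) := by
      apply log_le_log (by positivity)
      refine max_le (by nlinarith) ?_
      have : ‖P c z‖ ≤ ‖z‖ ^ 2 + ‖c‖ := by
        rw [← norm_pow]; exact norm_add_le _ _
      have h4 : ‖z‖ ^ 2 ≤ m ^ 2 := by gcongr
      nlinarith [one_le_pow₀ h1 (n := 2)]
    rw [log_mul (by positivity) (by positivity)] at this
    linarith

theorem gN_succ_sub (N : ℕ) (c z : ℂ) : |gN (N + 1) c z - gN N c z| ≤ gB c / 2 / 2 ^ N := by
  have h := log_max_P_le c ((P c)^[N] z)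
  rw [gN, gN, iterate_succ_apply']
  have e : (1 / 2 : ℝ) ^ (N + 1) * log (max 1 ‖P c ((P c)^[N] z)‖) -
      (1 / 2) ^ N * log (max 1 ‖(P c)^[N] z‖) = (1 / 2) ^ N / 2 *
      (log (max 1 ‖P c ((P c)^[N] z)‖) - 2 * log (max 1 ‖(P c)^[N] z‖)) := by
    rw [pow_succ]; ring
  rw [e, abs_mul, abs_of_nonneg (by positivity)]
  calc _ ≤ (1 / 2 : ℝ) ^ N / 2 * gB c := by gcongr
    _ = _ := by rw [one_div, inv_pow, div_div, div_eq_mul_inv (gB c), mul_inv]; ring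

theorem exists_green (c z : ℂ) : ∃ g, Tendsto (fun N => gN N c z) atTop (𝓝 g) := by
  refine cauchySeq_tendsto_of_complete (cauchySeq_of_le_geometric_two (C := gB c) fun N => ?_)
  rw [dist_comm, dist_eq]
  exact gN_succ_sub N c z

/-- The Green function of the filled Julia set of `P_c`. -/
noncomputable def G (c z : ℂ) : ℝ := (exists_green c z).choose

theorem tendsto_gN (c z : ℂ) : Tendsto (fun N => gN N c z) atTop (𝓝 (G c z)) :=
  (exists_green c z).choose_spec

theorem abs_gN_sub_G (N : ℕ) (c z : ℂ) : |gN N c z - G c z| ≤ gB c / 2 ^ N := by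
  rw [← dist_eq]
  refine dist_le_of_le_geometric_two_of_tendsto (fun N => ?_) (tendsto_gN c z) N
  rw [dist_comm, dist_eq]
  exact gN_succ_sub N c z

theorem G_nonneg (c z : ℂ) : 0 ≤ G c z :=
  ge_of_tendsto' (tendsto_gN c z) fun N => gN_nonneg N c z

theorem G_P (c z : ℂ) : G c (P c z) = 2 * G c z := by
  refine tendsto_nhds_unique (tendsto_gN c (P c z)) ?_
  refine (((tendsto_add_atTop_iff_nat 1).2 (tendsto_gN c z)).const_mul 2).congr fun N => ?_
  rw [gN, gN, iterate_succ_apply, pow_succ]; ring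

theorem G_iterate (c z : ℂ) (N : ℕ) : G c ((P c)^[N] z) = 2 ^ N * G c z := by
  induction N with
  | zero => simp
  | succ N ih => rw [iterate_succ_apply', G_P, ih, pow_succ]; ring

theorem G_self (c : ℂ) : G c c = 2 * G c 0 := by
  rw [← G_P]; simp [P]

theorem continuous_iterate₂ (N : ℕ) : Continuous fun p : ℂ × ℂ => (P p.1)^[N] p.2 := by
  have := hol2_iterate (a := fun _ z => z) (W := univ) (by unfold Hol2; fun_prop) N
  exact continuousOn_univ.1 this.continuousOn

theorem continuous_gN (N : ℕ) : Continuous fun p : ℂ × ℂ => gN N p.1 p.2 := by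
  refine continuous_const.mul (Continuous.log ?_ fun p => ?_)
  · exact continuous_const.max (continuous_iterate₂ N).norm
  · positivity

theorem continuous_G : Continuous fun p : ℂ × ℂ => G p.1 p.2 := by
  rw [continuous_iff_continuousAt]
  intro p0
  have hU : TendstoUniformlyOn (fun N (p : ℂ × ℂ) => gN N p.1 p.2) (fun p => G p.1 p.2) atTop
      {p | gB p.1 < gB p0.1 + 1} := by
    rw [tendstoUniformlyOn_iff]
    intro ε hε
    have h1 : Tendsto (fun N : ℕ => (gB p0.1 + 1) * (1 / 2) ^ N) atTop (𝓝 ((gB p0.1 + 1) * 0)) :=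
      (tendsto_pow_atTop_nhds_zero_of_lt_one (by norm_num) (by norm_num)).const_mul _
    rw [mul_zero] at h1
    filter_upwards [h1.eventually_lt_const hε] with N hN p hp
    rw [dist_comm, dist_eq]
    calc |gN N p.1 p.2 - G p.1 p.2| ≤ gB p.1 / 2 ^ N := abs_gN_sub_G N _ _
      _ ≤ (gB p0.1 + 1) / 2 ^ N := by gcongr
      _ = (gB p0.1 + 1) * (1 / 2) ^ N := by rw [one_div, inv_pow, div_eq_mul_inv]
      _ < ε := hN
  have hO : IsOpen {p : ℂ × ℂ | gB p.1 < gB p0.1 + 1} :=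
    isOpen_lt (continuous_gB.comp continuous_fst) continuous_const
  refine (hU.continuousOn (Frequently.of_forall fun N => (continuous_gN N).continuousOn)).continuousAt
    (hO.mem_nhds ?_)
  simp

theorem log_le_G (c z : ℂ) : log (max 1 ‖z‖) ≤ G c z + gB c := by
  have := (abs_le.1 (abs_gN_sub_G 0 c z)).2
  simp [gN] at this
  linarith

theorem G_le_log (c z : ℂ) : G c z ≤ log (max 1 ‖z‖) + gB c := by
  have := (abs_le.1 (abs_gN_sub_G 0 c z)).1
  simp [gN] at this
  linarith

theorem norm_le_of_G (c z : ℂ) : ‖z‖ ≤ rexp (G c z + gB c) := by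
  have h := log_le_G c z
  rw [Real.log_le_iff_le_exp (by positivity)] at h
  exact (le_max_right _ _).trans h

theorem exp_gB (c : ℂ) : rexp (gB c) = 2 + 2 * ‖c‖ := exp_log (by positivity)

theorem norm_iterate_le_of_G_eq_zero {c z : ℂ} (h : G c z = 0) (N : ℕ) :
    ‖(P c)^[N] z‖ ≤ 2 + 2 * ‖c‖ := by
  have := norm_le_of_G c ((P c)^[N] z)
  rwa [G_iterate, h, mul_zero, zero_add, exp_gB] at this

theorem G_eq_zero_of_bdd {c z : ℂ} {B : ℝ} (h : ∀ N, ‖(P c)^[N] z‖ ≤ B) : G c z = 0 := by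
  have hb : ∀ N : ℕ, 2 ^ N * G c z ≤ log (max 1 B) + gB c := by
    intro N
    rw [← G_iterate]
    refine (G_le_log _ _).trans ?_
    gcongr
    exact h N
  by_contra hne
  have hpos : 0 < G c z := lt_of_le_of_ne (G_nonneg c z) (Ne.symm hne)
  obtain ⟨N, hN⟩ := pow_unbounded_of_one_lt ((log (max 1 B) + gB c) / G c z) (one_lt_two (α := ℝ))
  rw [div_lt_iff₀ hpos] at hN
  linarith [hb N]

theorem mem_Mandelbrot_iff (c : ℂ) : c ∈ Mandelbrot ↔ G c 0 = 0 := by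
  constructor
  · intro h
    obtain ⟨B, hB⟩ := (show Bornology.IsBounded (Set.range fun n : ℕ => (P c)^[n] 0) from h).exists_norm_le
    exact G_eq_zero_of_bdd fun N => hB _ ⟨N, rfl⟩
  · intro h
    change Bornology.IsBounded (Set.range fun n : ℕ => (P c)^[n] 0)
    refine isBounded_iff_forall_norm_le.2 ⟨2 + 2 * ‖c‖, ?_⟩
    rintro _ ⟨N, rfl⟩
    exact norm_iterate_le_of_G_eq_zero h N

theorem mem_Mandelbrot_of_bdd {c : ℂ} {B : ℝ} (h : ∀ N, ‖(P c)^[N] 0‖ ≤ B) : c ∈ Mandelbrot :=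
  (mem_Mandelbrot_iff c).2 (G_eq_zero_of_bdd h)

theorem continuous_G_zero : Continuous fun c => G c 0 :=
  continuous_G.comp (f := fun c : ℂ => (c, (0 : ℂ))) (by fun_prop)

theorem isClosed_Mandelbrot : IsClosed Mandelbrot := by
  have : Mandelbrot = (fun c => G c 0) ⁻¹' {0} := by ext c; exact mem_Mandelbrot_iff c
  rw [this]
  exact isClosed_singleton.preimage continuous_G_zero

/-- Parameters of large modulus escape at a definite rate. -/
theorem log_le_G_self {c : ℂ} (hc : 4 ≤ ‖c‖) : log (‖c‖ / 2) ≤ G c c := by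
  have hN : ∀ N : ℕ, ‖c‖ ≤ ‖(P c)^[N] c‖ ∧ 2 * (‖c‖ / 2) ^ 2 ^ N ≤ ‖(P c)^[N] c‖ := by
    intro N
    induction N with
    | zero => simp; linarith
    | succ N ih =>
      rw [iterate_succ_apply']
      set x := ‖(P c)^[N] c‖ with hx
      have h1 : x ^ 2 - ‖c‖ ≤ ‖P c ((P c)^[N] c)‖ := by
        rw [hx, ← norm_pow]
        have := norm_sub_le (P c ((P c)^[N] c)) c
        simp only [P, add_sub_cancel_right] at this ⊢
        linarith
      refine ⟨by nlinarith, ?_⟩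
      have h2 : (‖c‖ / 2) ^ 2 ^ (N + 1) = ((‖c‖ / 2) ^ 2 ^ N) ^ 2 := by rw [← pow_mul, pow_succ]
      rw [h2]
      have h3 : 0 ≤ (‖c‖ / 2) ^ 2 ^ N := by positivity
      nlinarith
  refine ge_of_tendsto' (tendsto_gN c c) fun N => ?_
  have h1 : log ((‖c‖ / 2) ^ 2 ^ N) ≤ log (max 1 ‖(P c)^[N] c‖) := by
    apply log_le_log (by positivity)
    refine le_trans ?_ (le_max_right _ _)
    have h3 : 0 ≤ (‖c‖ / 2) ^ 2 ^ N := by positivity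
    linarith [(hN N).2]
  rw [Real.log_pow] at h1
  push_cast at h1
  rw [gN]
  calc log (‖c‖ / 2) = (1 / 2) ^ N * (2 ^ N * log (‖c‖ / 2)) := by
        rw [← mul_assoc, ← mul_pow]; norm_num
    _ ≤ _ := by gcongr

theorem norm_le_of_mem_Mandelbrot {c : ℂ} (h : c ∈ Mandelbrot) : ‖c‖ ≤ 4 := by
  by_contra hc
  push Not at hc
  have h1 := log_le_G_self hc.le
  rw [G_self, (mem_Mandelbrot_iff c).1 h] at h1
  have := log_pos (x := ‖c‖ / 2) (by linarith)
  linarith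

theorem isCompact_Mandelbrot : IsCompact Mandelbrot :=
  (isCompact_closedBall (0 : ℂ) 4).of_isClosed_subset isClosed_Mandelbrot fun c hc => by
    simpa using norm_le_of_mem_Mandelbrot hc

theorem isPreconnected_norm_gt {r : ℝ} (hr : 0 < r) : IsPreconnected {w : ℂ | r < ‖w‖} := by
  have : {w : ℂ | r < ‖w‖} = exp '' {x : ℂ | log r < x.re} := by
    ext w
    constructor
    · intro hw
      have hw : r < ‖w‖ := hw
      have h0 : w ≠ 0 := norm_pos_iff.1 (hr.trans hw)
      refine ⟨Complex.log w, ?_, Complex.exp_log h0⟩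
      rw [mem_ofPred_eq, Complex.log_re]
      exact log_lt_log hr hw
    · rintro ⟨x, hx, rfl⟩
      have hx : log r < x.re := hx
      rw [mem_ofPred_eq, norm_exp]
      exact (Real.log_lt_iff_lt_exp hr).1 hx
  rw [this]
  exact (convex_halfSpace_re_gt _).isPreconnected.image _ Complex.continuous_exp.continuousOn

theorem isPreconnected_annulus {r s : ℝ} (hr : 0 < r) :
    IsPreconnected {w : ℂ | r < ‖w‖ ∧ ‖w‖ < s} := by
  rcases le_or_gt s r with hs | hs
  · have : {w : ℂ | r < ‖w‖ ∧ ‖w‖ < s} = ∅ := by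
      ext w; simp; intro h; linarith
    rw [this]; exact isPreconnected_empty
  have : {w : ℂ | r < ‖w‖ ∧ ‖w‖ < s} =
      exp '' ({x : ℂ | log r < x.re} ∩ {x : ℂ | x.re < log s}) := by
    ext w
    constructor
    · rintro ⟨hw, hw'⟩
      have h0 : w ≠ 0 := norm_pos_iff.1 (hr.trans hw)
      refine ⟨Complex.log w, ⟨?_, ?_⟩, Complex.exp_log h0⟩
      · rw [mem_ofPred_eq, Complex.log_re]
        exact log_lt_log hr hw
      · rw [mem_ofPred_eq, Complex.log_re]
        exact log_lt_log (hr.trans hw) hw'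
    · rintro ⟨x, ⟨hx, hx'⟩, rfl⟩
      have hx : log r < x.re := hx
      have hx' : x.re < log s := hx'
      rw [mem_ofPred_eq, norm_exp]
      exact ⟨(Real.log_lt_iff_lt_exp hr).1 hx, (Real.lt_log_iff_exp_lt (hr.trans hs)).1 hx'⟩
  rw [this]
  exact ((convex_halfSpace_re_gt _).inter (convex_halfSpace_re_lt _)).isPreconnected.image _
    Complex.continuous_exp.continuousOn

theorem isOpen_norm_gt (r : ℝ) : IsOpen {w : ℂ | r < ‖w‖} := isOpen_lt continuous_const continuous_norm

/-- Existence of the inverse branch of `P_c^N` near infinity, lifted by `w ↦ w^(2^N)`. -/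
theorem exists_bott_approx (c : ℂ) (N : ℕ) : ∀ R : ℝ, 0 < R →
    (∀ j, 1 ≤ j → j ≤ N → ‖(P c)^[j] 0‖ ≤ R ^ 2 ^ N) →
    ∃ χ : ℂ → ℂ, HolOn χ (ball 0 R⁻¹) ∧ χ 0 = 1 ∧
      (∀ w, R < ‖w‖ → (P c)^[N] (w * χ w⁻¹) = w ^ 2 ^ N) ∧
      InjOn (fun w => w * χ w⁻¹) {w | R < ‖w‖} ∧
      ∀ z, R ^ 2 ^ N < ‖(P c)^[N] z‖ → ∃ w, R < ‖w‖ ∧ w * χ w⁻¹ = z := by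
  induction N with
  | zero =>
    intro R hR _
    refine ⟨fun _ => 1, differentiableOn_const _, rfl, by simp, fun a _ b _ h => by simpa using h,
      fun z hz => ⟨z, by simpa using hz, by simp⟩⟩
  | succ N ih =>
    intro R hR hF
    have hp : (R ^ 2) ^ 2 ^ N = R ^ 2 ^ (N + 1) := by rw [← pow_mul, pow_succ' 2 N]
    obtain ⟨χ, hχd, hχ0, hχP, hχi, hχs⟩ := ih (R ^ 2) (by positivity) fun j h1 h2 => by
      rw [hp]; exact hF j h1 (by omega)
    have hinv : ∀ v : ℂ, v ≠ 0 → (v⁻¹ ∈ ball (0 : ℂ) (R ^ 2)⁻¹ ↔ R ^ 2 < ‖v‖) := by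
      intro v hv
      rw [mem_ball_zero_iff, norm_inv]
      exact inv_lt_inv₀ (norm_pos_iff.2 hv) (by positivity)
    have hne : ∀ t ∈ ball (0 : ℂ) (R ^ 2)⁻¹, χ t - c * t ≠ 0 := by
      intro t ht h
      rcases eq_or_ne t 0 with rfl | ht0
      · simp [hχ0] at h
      · have hv : R ^ 2 < ‖t⁻¹‖ := (hinv t⁻¹ (inv_ne_zero ht0)).1 (by simpa using ht)
        have h1 := hχP t⁻¹ hv
        rw [inv_inv] at h1
        have h2 : t⁻¹ * χ t = c := by
          rw [sub_eq_zero.1 h]; field_simp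
        rw [h2] at h1
        have h3 := hF (N + 1) (by omega) le_rfl
        rw [iterate_succ_apply] at h3
        have h4 : P c 0 = c := by simp [P]
        rw [h4, h1, norm_pow, ← hp] at h3
        exact absurd h3 (not_le.2 (pow_lt_pow_left₀ hv (by positivity) (by positivity)))
    obtain ⟨s1, hs1d, hs₁⟩ := exists_sqrt isOpen_ball
      ((convex_ball (0 : ℂ) (R ^ 2)⁻¹).starConvex (mem_ball_self (by positivity)))
      (hχd.sub (by fun_prop : HolOn (fun t => c * t) _)) hne
    have h0m : (0 : ℂ) ∈ ball (0 : ℂ) (R ^ 2)⁻¹ := mem_ball_self (by positivity)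
    have hs10 : s1 0 * s1 0 = 1 := by
      simpa [hχ0, sq] using hs₁ 0 h0m
    set s : ℂ → ℂ := fun t => s1 0 * s1 t with hs_def
    have hs : ∀ t ∈ ball (0 : ℂ) (R ^ 2)⁻¹, s t ^ 2 = χ t - c * t := by
      intro t ht
      have h1 : s1 t ^ 2 = χ t - c * t := hs₁ t ht
      linear_combination s1 t ^ 2 * hs10 + h1
    have hsq : ∀ w : ℂ, R < ‖w‖ → R ^ 2 < ‖w ^ 2‖ := fun w hw => by
      rw [norm_pow]; exact pow_lt_pow_left₀ hw hR.le two_ne_zero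
    have hrec : ∀ w : ℂ, R < ‖w‖ → (w * s (w⁻¹ ^ 2)) ^ 2 + c = w ^ 2 * χ (w ^ 2)⁻¹ := by
      intro w hw
      have hw0 : w ≠ 0 := norm_pos_iff.1 (hR.trans hw)
      have := hs (w ^ 2)⁻¹ ((hinv _ (pow_ne_zero 2 hw0)).2 (hsq w hw))
      rw [mul_pow, inv_pow, this]
      field_simp
      ring
    refine ⟨fun ζ => s (ζ ^ 2), ?_, ?_, ?_, ?_, ?_⟩
    · refine (hs1d.const_mul (s1 0)).comp (by fun_prop) fun ζ hζ => ?_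
      rw [mem_ball_zero_iff] at hζ ⊢
      rw [norm_pow, ← inv_pow]
      exact pow_lt_pow_left₀ hζ (norm_nonneg _) two_ne_zero
    · simpa [hs_def] using hs10
    · intro w hw
      rw [iterate_succ_apply]
      have : P c (w * s (w⁻¹ ^ 2)) = w ^ 2 * χ (w ^ 2)⁻¹ := hrec w hw
      rw [this, hχP _ (hsq w hw), ← pow_mul, pow_succ' 2 N]
    · intro w hw w' hw' h
      simp only at h
      have h1 := hrec w hw
      have h2 := hrec w' hw'
      rw [h, h2] at h1
      have h3 := hχi (hsq w' hw') (hsq w hw) h1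
      rcases sq_eq_sq_iff_eq_or_eq_neg.1 h3 with h4 | h4
      · exact h4.symm
      · rw [h4] at h
        have hw0 : w ≠ 0 := norm_pos_iff.1 (hR.trans hw)
        have h5 : w * s (w⁻¹ ^ 2) = 0 := by
          rw [inv_neg, neg_sq, neg_mul] at h
          exact self_eq_neg.1 h
        have hm := (hinv _ (pow_ne_zero 2 hw0)).2 (hsq w hw)
        have h6 := hs _ hm
        rw [← inv_pow, (mul_eq_zero.1 h5).resolve_left hw0] at h6
        exact (hne _ hm (by rw [← inv_pow, ← h6]; simp)).elim
    · intro z hz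
      rw [iterate_succ_apply, ← hp] at hz
      obtain ⟨v, hv, hvz⟩ := hχs _ hz
      obtain ⟨w, rfl⟩ := (isOpenQuotientMap_pow 2).surjective v
      have hw : R < ‖w‖ := by
        simp only [norm_pow] at hv
        exact lt_of_pow_lt_pow_left₀ 2 (norm_nonneg _) hv
      have h1 := hrec w hw
      simp only at hvz
      rw [hvz, P] at h1
      rcases sq_eq_sq_iff_eq_or_eq_neg.1 (add_right_cancel h1) with h | h
      · exact ⟨w, hw, h⟩
      · refine ⟨-w, by simpa using hw, ?_⟩
        simp only
        rw [inv_neg, neg_sq, neg_mul, h, neg_neg]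

theorem exists_ultra_limit {ι : Type*} (𝒰 : Ultrafilter ι) {f : ι → ℂ} {B : ℝ}
    (h : ∀ᶠ i in (𝒰 : Filter ι), ‖f i‖ ≤ B) : ∃ y, ‖y‖ ≤ B ∧ Tendsto f 𝒰 (𝓝 y) := by
  obtain ⟨y, hy, hy'⟩ := (isCompact_closedBall (0 : ℂ) B).ultrafilter_le_nhds (𝒰.map f) (by
    rw [le_principal_iff]
    change ∀ᶠ i in (𝒰 : Filter ι), f i ∈ closedBall (0 : ℂ) B
    filter_upwards [h] with i hi
    simpa using hi)
  exact ⟨y, by simpa using hy, hy'⟩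

/-- Normalized inverse Böttcher coordinates, without the functional equation. -/
structure IsBott' (c : ℂ) (Ψ : ℂ → ℂ) : Prop where
  hol : HolOn Ψ {w | rexp (G c 0) < ‖w‖}
  inj : InjOn Ψ {w | rexp (G c 0) < ‖w‖}
  surj : ∀ z, G c 0 < G c z → ∃ w, rexp (G c 0) < ‖w‖ ∧ Ψ w = z
  green : ∀ w, rexp (G c 0) < ‖w‖ → G c (Ψ w) = log ‖w‖
  norm_sub : ∀ w, 2 * rexp (G c 0 + gB c) < ‖w‖ →
    ‖Ψ w - w‖ ≤ 4 * rexp (2 * gB c) * rexp (G c 0 + gB c)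

theorem IsBott'.eqOn {c : ℂ} {Ψ Ψ2 : ℂ → ℂ} (h : IsBott' c Ψ) {k : ℕ} (hk : k ≠ 0) {R : ℝ}
    (hR : rexp (G c 0) ≤ R) (hd : HolOn Ψ2 {w | R < ‖w‖})
    (hG : ∀ w, R < ‖w‖ → G c (Ψ2 w) = log ‖w ^ k‖)
    (hC : ∀ ε > 0, ∃ R', ∀ w, R' < ‖w‖ → ‖Ψ2 w - w ^ k‖ ≤ ε * ‖w ^ k‖) :
    ∀ w, R < ‖w‖ → Ψ2 w = Ψ (w ^ k) := by
  set U := {w : ℂ | rexp (G c 0) < ‖w‖} with hU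
  set V := {w : ℂ | R < ‖w‖} with hV
  have hR1 : 1 ≤ R := (one_le_exp (G_nonneg c 0)).trans hR
  have hR0 : 0 < R := by linarith
  have hUo : IsOpen U := isOpen_norm_gt _
  have hpow : ∀ w ∈ V, R < ‖w ^ k‖ := by
    intro w hw
    have hw : R < ‖w‖ := hw
    rw [norm_pow]
    exact hw.trans_le (le_self_pow₀ (hR1.trans hw.le) hk)
  obtain ⟨g, hgd, hgl, hgr⟩ := exists_inverse_of_injOn hUo h.hol h.inj
  have hVi : ∀ w ∈ V, Ψ2 w ∈ Ψ '' U := by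
    intro w hw
    obtain ⟨v, hv, hv'⟩ := h.surj (Ψ2 w) (by
      rw [hG w hw]
      exact (Real.lt_log_iff_exp_lt (hR0.trans (hpow w hw))).2 (hR.trans_lt (hpow w hw)))
    exact ⟨v, hv, hv'⟩
  have hnorm : ∀ w ∈ V, ‖g (Ψ2 w)‖ = ‖w ^ k‖ := by
    intro w hw
    obtain ⟨h1, h2⟩ := hgr _ (hVi w hw)
    have h3 := h.green _ h1
    rw [h2, hG w hw] at h3
    exact (Real.log_injOn_pos (mem_Ioi.2 (hR0.trans (hpow w hw)))
      (mem_Ioi.2 ((exp_pos _).trans h1)) h3).symm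
  have hw0 : ∀ w ∈ V, w ^ k ≠ 0 := fun w hw => norm_pos_iff.1 (hR0.trans (hpow w hw))
  set A : ℂ → ℂ := fun w => g (Ψ2 w) / w ^ k with hA
  have hAd : HolOn A V :=
    (hgd.comp hd hVi).div (differentiableOn_id.pow k) hw0
  have hA1 : ∀ w ∈ V, ‖A w‖ = 1 := by
    intro w hw
    rw [hA, norm_div, hnorm w hw, div_self (norm_ne_zero_iff.2 (hw0 w hw))]
  obtain ⟨w0, hw₀⟩ : V.Nonempty := ⟨((R + 1 : ℝ) : ℂ), by
    rw [hV, mem_ofPred_eq, norm_of_nonneg (by positivity)]; linarith⟩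
  have hconst : EqOn A (Function.const ℂ (A w0)) V :=
    Complex.eqOn_of_isPreconnected_of_isMaxOn_norm (isPreconnected_norm_gt hR0) (isOpen_norm_gt _)
      hAd hw₀ fun w hw => by simp [hA1 w hw, hA1 w0 hw₀]
  set β := A w0
  have hgβ : ∀ w ∈ V, g (Ψ2 w) = β * w ^ k := by
    intro w hw
    have h1 : A w = β := hconst hw
    rw [← h1, hA, div_mul_cancel₀ _ (hw0 w hw)]
  have hβ1 : ‖β‖ = 1 := hA1 w0 hw₀
  have hβ : β = 1 := by
    by_contra hne
    have hpos : 0 < ‖β - 1‖ := norm_pos_iff.2 (sub_ne_zero.2 hne)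
    set C₁ := 4 * rexp (2 * gB c) * rexp (G c 0 + gB c)
    obtain ⟨R', hR'⟩ := hC (‖β - 1‖ / 2) (by positivity)
    have key : ∀ t : ℝ, R < t → R' < t → 2 * rexp (G c 0 + gB c) < t →
        ‖β - 1‖ / 2 * t ≤ C₁ := by
      intro t h1 h2 h3
      have ht : 0 < t := hR0.trans h1
      have htk : t ≤ t ^ k := le_self_pow₀ (by linarith) hk
      have hn : ‖(t : ℂ)‖ = t := norm_of_nonneg ht.le
      have hm : (t : ℂ) ∈ V := by rw [hV, mem_ofPred_eq, hn]; exact h1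
      have e1 := hR' t (by rwa [hn])
      have e2 := h.norm_sub (β * (t : ℂ) ^ k) (by
        rw [norm_mul, hβ1, one_mul, norm_pow, hn]; linarith)
      rw [← hgβ _ hm, (hgr _ (hVi _ hm)).2, hgβ _ hm] at e2
      have e3 : ‖β - 1‖ * t ^ k ≤ ‖β - 1‖ / 2 * t ^ k + C₁ := by
        calc ‖β - 1‖ * t ^ k = ‖(β - 1) * (t : ℂ) ^ k‖ := by rw [norm_mul, norm_pow, hn]
          _ = ‖(Ψ2 t - (t : ℂ) ^ k) - (Ψ2 t - β * (t : ℂ) ^ k)‖ := by congr 1; ring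
          _ ≤ _ := (norm_sub_le _ _).trans (add_le_add (by rwa [norm_pow, hn] at e1) e2)
      nlinarith
    have hlim : Tendsto (fun t : ℝ => ‖β - 1‖ / 2 * t) atTop atTop :=
      tendsto_id.const_mul_atTop (by positivity)
    obtain ⟨t, ⟨⟨h1, h2⟩, h3⟩, h4⟩ := ((((eventually_gt_atTop R).and (eventually_gt_atTop R')).and
      (eventually_gt_atTop (2 * rexp (G c 0 + gB c)))).and
      (hlim.eventually_gt_atTop C₁)).exists
    exact absurd (key t h1 h2 h3) (not_le.2 h4)
  intro w hw
  rw [← (hgr _ (hVi w hw)).2, hgβ w hw, hβ, one_mul]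

/-- `Ψ` is the inverse Böttcher coordinate of `P_c` at infinity. -/
structure IsBott (c : ℂ) (Ψ : ℂ → ℂ) : Prop extends IsBott' c Ψ where
  func : ∀ w, rexp (G c 0) < ‖w‖ → Ψ w ^ 2 + c = Ψ (w ^ 2)

/-- Radii for the approximations of the Böttcher coordinate. -/
noncomputable def bR (c : ℂ) (N : ℕ) : ℝ := rexp (G c 0 + gB c / 2 ^ N)

theorem bR_tendsto (c : ℂ) : Tendsto (bR c) atTop (𝓝 (rexp (G c 0))) := by
  have h1 : Tendsto (fun N : ℕ => gB c / 2 ^ N) atTop (𝓝 0) :=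
    tendsto_const_nhds.div_atTop (tendsto_pow_atTop_atTop_of_one_lt one_lt_two)
  have := (continuous_exp.tendsto _).comp (h1.const_add (G c 0))
  rwa [add_zero] at this

theorem one_le_bR (c : ℂ) (N : ℕ) : 1 ≤ bR c N :=
  one_le_exp (add_nonneg (G_nonneg _ _) (div_nonneg (gB_nonneg c) (by positivity)))

theorem bR_le (c : ℂ) (N : ℕ) : bR c N ≤ rexp (G c 0 + gB c) := by
  rw [bR]
  gcongr
  exact div_le_self (gB_nonneg c) (one_le_pow₀ one_le_two)

theorem exists_bott_approx' (c : ℂ) (N : ℕ) :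
    ∃ χ : ℂ → ℂ, HolOn χ (ball 0 (bR c N)⁻¹) ∧ χ 0 = 1 ∧
      (∀ w, bR c N < ‖w‖ → (P c)^[N] (w * χ w⁻¹) = w ^ 2 ^ N) ∧
      InjOn (fun w => w * χ w⁻¹) {w | bR c N < ‖w‖} ∧
      ∀ z, (bR c N) ^ 2 ^ N < ‖(P c)^[N] z‖ → ∃ w, bR c N < ‖w‖ ∧ w * χ w⁻¹ = z := by
  refine exists_bott_approx c N _ (exp_pos _) fun j _ hj => ?_
  refine (norm_le_of_G c _).trans ?_
  rw [bR, ← Real.exp_nat_mul, G_iterate]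
  gcongr
  have h0 := G_nonneg c 0
  have h1 : (2 : ℝ) ^ j ≤ 2 ^ N := pow_le_pow_right₀ one_le_two hj
  have h2 : (2 ^ N : ℝ) * (gB c / 2 ^ N) = gB c := by field_simp
  push_cast
  nlinarith

/-- Chosen approximations of the inverse Böttcher coordinate. -/
noncomputable def bχ (c : ℂ) (N : ℕ) : ℂ → ℂ := (exists_bott_approx' c N).choose

/-- Chosen approximations of the inverse Böttcher coordinate, in the coordinate `w`. -/
noncomputable def bh (c : ℂ) (N : ℕ) (w : ℂ) : ℂ := w * bχ c N w⁻¹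

theorem bχ_spec (c : ℂ) (N : ℕ) : HolOn (bχ c N) (ball 0 (bR c N)⁻¹) ∧
    bχ c N 0 = 1 ∧
    (∀ w, bR c N < ‖w‖ → (P c)^[N] (w * bχ c N w⁻¹) = w ^ 2 ^ N) ∧
    InjOn (fun w => w * bχ c N w⁻¹) {w | bR c N < ‖w‖} ∧
    ∀ z, (bR c N) ^ 2 ^ N < ‖(P c)^[N] z‖ → ∃ w, bR c N < ‖w‖ ∧ w * bχ c N w⁻¹ = z :=
  (exists_bott_approx' c N).choose_spec

theorem gN_bh {c : ℂ} {N : ℕ} {w : ℂ} (hw : bR c N < ‖w‖) : gN N c (bh c N w) = log ‖w‖ := by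
  have h1 : 1 ≤ ‖w‖ := (one_le_bR c N).trans hw.le
  have := (bχ_spec c N).2.2.1 w hw
  rw [gN, bh, this, norm_pow, max_eq_right (one_le_pow₀ h1), Real.log_pow, ← mul_assoc]
  push_cast
  rw [← mul_pow]; norm_num

theorem norm_bh_le {c : ℂ} {N : ℕ} {w : ℂ} (hw : bR c N < ‖w‖) :
    ‖bh c N w‖ ≤ rexp (2 * gB c) * ‖w‖ := by
  have h0 : 0 < ‖w‖ := by linarith [one_le_bR c N]
  have h1 := (abs_le.1 (abs_gN_sub_G N c (bh c N w))).1
  have h2 : gB c / 2 ^ N ≤ gB c := div_le_self (gB_nonneg c) (one_le_pow₀ one_le_two)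
  rw [gN_bh hw] at h1
  refine (norm_le_of_G c _).trans ?_
  calc rexp (G c (bh c N w) + gB c) ≤ rexp (2 * gB c + log ‖w‖) := by
        apply exp_le_exp.2; linarith
    _ = _ := by rw [Real.exp_add, exp_log h0]

theorem norm_bχ_le {c : ℂ} {N : ℕ} {ζ : ℂ} (hζ : ζ ∈ ball (0 : ℂ) (bR c N)⁻¹) :
    ‖bχ c N ζ‖ ≤ rexp (2 * gB c) := by
  rcases eq_or_ne ζ 0 with rfl | h0
  · rw [(bχ_spec c N).2.1, norm_one]
    exact one_le_exp (by linarith [gB_nonneg c])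
  · have hpos : 0 < ‖ζ‖ := norm_pos_iff.2 h0
    have hb : 0 < bR c N := exp_pos _
    have hw : bR c N < ‖ζ⁻¹‖ := by
      rw [mem_ball_zero_iff] at hζ
      rw [norm_inv]
      exact (lt_inv_comm₀ hpos hb).1 hζ
    have := norm_bh_le hw
    rw [bh, inv_inv, norm_mul] at this
    have h3 : 0 < ‖ζ⁻¹‖ := norm_pos_iff.2 (inv_ne_zero h0)
    nlinarith

theorem bh_hol (c : ℂ) (N : ℕ) : HolOn (bh c N) {w | bR c N < ‖w‖} := by
  have hb : 0 < bR c N := exp_pos _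
  have h0 : ∀ w : ℂ, bR c N < ‖w‖ → w ≠ 0 := fun w hw => norm_pos_iff.1 (hb.trans hw)
  refine differentiableOn_id.mul ((bχ_spec c N).1.comp
    (differentiableOn_inv.mono fun w hw => h0 w hw) fun w hw => ?_)
  have hw : bR c N < ‖w‖ := hw
  rw [mem_ball_zero_iff, norm_inv]
  exact inv_strictAnti₀ hb hw

theorem bh_norm_sub {c : ℂ} {N : ℕ} {w : ℂ} (hw : 2 * rexp (G c 0 + gB c) < ‖w‖) :
    ‖bh c N w - w‖ ≤ 4 * rexp (2 * gB c) * rexp (G c 0 + gB c) := by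
  set ρ := rexp (G c 0 + gB c) with hρ
  have hρ0 : 0 < ρ := exp_pos _
  have h0 : 0 < ‖w‖ := by linarith
  have hsub : ball (0 : ℂ) ρ⁻¹ ⊆ ball 0 (bR c N)⁻¹ :=
    ball_subset_ball (inv_anti₀ (exp_pos _) (bR_le c N))
  have h1 := lipschitz_of_bdd (inv_pos.2 hρ0) ((bχ_spec c N).1.mono hsub)
    (fun z hz => norm_bχ_le (hsub hz)) (w := 0) (w' := w⁻¹) (mem_ball_self (by positivity)) (by
      rw [mem_ball_zero_iff, norm_inv, inv_lt_comm₀ h0 (by positivity)]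
      rw [inv_div, div_inv_eq_mul]; exact hw)
  have e : bh c N w - w = w * (bχ c N w⁻¹ - 1) := by rw [bh]; ring
  rw [(bχ_spec c N).2.1, sub_zero, div_inv_eq_mul] at h1
  rw [e, norm_mul]
  calc ‖w‖ * ‖bχ c N w⁻¹ - 1‖ ≤ ‖w‖ * (4 * rexp (2 * gB c) * ρ * ‖w⁻¹‖) := by gcongr
    _ = _ := by rw [norm_inv]; field_simp

theorem bh_locBdd (c : ℂ) : LocBdd atTop (bh c) {w | rexp (G c 0) < ‖w‖} := by
  intro z hz
  have hz : rexp (G c 0) < ‖z‖ := hz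
  refine ⟨(‖z‖ - rexp (G c 0)) / 2, by linarith,
    rexp (2 * gB c) * (‖z‖ + (‖z‖ - rexp (G c 0)) / 2), ?_⟩
  filter_upwards [(bR_tendsto c).eventually_lt_const
    (show rexp (G c 0) < (‖z‖ + rexp (G c 0)) / 2 by linarith)] with N hN
  have hsub : ∀ w ∈ ball z ((‖z‖ - rexp (G c 0)) / 2), bR c N < ‖w‖ := by
    intro w hw
    rw [mem_ball_iff_norm'] at hw
    have := norm_sub_norm_le z w
    linarith
  refine ⟨(bh_hol c N).mono fun w hw => hsub w hw, fun w hw => ?_⟩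
  refine (norm_bh_le (hsub w hw)).trans ?_
  gcongr
  rw [mem_ball_iff_norm] at hw
  have := norm_sub_norm_le w z
  linarith

theorem isBott'_of_limit {c : ℂ} {𝒰 : Ultrafilter ℕ} (hl : (𝒰 : Filter ℕ) ≤ atTop) {Ψ : ℂ → ℂ}
    (hΨ : ∀ w : ℂ, rexp (G c 0) < ‖w‖ → Tendsto (bh c · w) 𝒰 (𝓝 (Ψ w))) : IsBott' c Ψ := by
  set U := {w : ℂ | rexp (G c 0) < ‖w‖} with hU
  have hUo : IsOpen U := isOpen_norm_gt _
  have hUc : IsPreconnected U := isPreconnected_norm_gt (exp_pos _)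
  have hb : LocBdd (𝒰 : Filter ℕ) (bh c) U := (bh_locBdd c).mono_filter hl
  have hd : HolOn Ψ U := hb.differentiableOn hUo hΨ
  have hev : ∀ w : ℂ, rexp (G c 0) < ‖w‖ → ∀ᶠ N in (𝒰 : Filter ℕ), bR c N < ‖w‖ := fun w hw =>
    hl ((bR_tendsto c).eventually_lt_const hw)
  have hgreen : ∀ w : ℂ, rexp (G c 0) < ‖w‖ → G c (Ψ w) = log ‖w‖ := by
    intro w hw
    have h1 : Tendsto (fun N => G c (bh c N w)) 𝒰 (𝓝 (G c (Ψ w))) :=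
      ((continuous_G.comp (f := fun z : ℂ => (c, z)) (by fun_prop)).tendsto _).comp (hΨ w hw)
    have h2 : Tendsto (fun N : ℕ => gB c / 2 ^ N) 𝒰 (𝓝 0) :=
      (tendsto_const_nhds.div_atTop (tendsto_pow_atTop_atTop_of_one_lt one_lt_two)).mono_left hl
    refine tendsto_nhds_unique h1 (tendsto_sub_nhds_zero_iff.1 (squeeze_zero_norm' ?_ h2))
    filter_upwards [hev w hw] with N hN
    rw [← gN_bh hN, norm_sub_rev]
    exact abs_gN_sub_G N c _
  refine ⟨hd, ?_, ?_, hgreen, ?_⟩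
  · intro a ha b hb' hab
    -- injectivity only holds on the domain of each approximation, so restrict to large radii
    obtain ⟨s, hs1, hs2⟩ := exists_between (lt_min (show rexp (G c 0) < ‖a‖ from ha) hb')
    have ha0 : 0 < ‖a‖ := (exp_pos _).trans ha
    have h2a : ‖a‖ < ‖2 * a‖ := by rw [norm_mul, Complex.norm_ofNat]; linarith
    have hsa := hs2.trans_le inf_le_left
    refine (hb.mono fun w hw => hs1.trans hw).injOn_of_limit (isOpen_norm_gt s)
      (isPreconnected_norm_gt ((exp_pos _).trans hs1)) (fun z hz => hΨ z (hs1.trans hz)) ?_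
      ⟨a, hsa, 2 * a, hsa.trans h2a, fun h => ?_⟩ hsa (hs2.trans_le inf_le_right) hab
    · filter_upwards [hl ((bR_tendsto c).eventually_lt_const hs1)] with N hN
      exact (bχ_spec c N).2.2.2.1.mono fun w hw => lt_trans hN hw
    · have h1 := hgreen a ha
      rw [h, hgreen _ (lt_trans ha h2a)] at h1
      exact (log_lt_log ha0 h2a).ne' h1
  · intro z hz
    have hlogb : Tendsto (fun N => log (bR c N)) atTop (𝓝 (G c 0)) := by
      simpa using (bR_tendsto c).log (exp_pos _).ne'
    have hex : ∀ᶠ N in (𝒰 : Filter ℕ), ∃ w, bR c N < ‖w‖ ∧ bh c N w = z := by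
      filter_upwards [hl (hlogb.eventually_lt (tendsto_gN c z) hz)] with N h
      have h1 : log (bR c N ^ 2 ^ N) < log (max 1 ‖(P c)^[N] z‖) := by
        rw [Real.log_pow]
        push_cast
        calc (2 : ℝ) ^ N * log (bR c N) < 2 ^ N * gN N c z := by gcongr
          _ = _ := by rw [gN, ← mul_assoc, ← mul_pow]; norm_num
      have hb1 := one_le_bR c N
      exact (bχ_spec c N).2.2.2.2 z (((lt_max_iff.1 ((Real.log_lt_log_iff (by positivity)
        (by positivity)).1 h1)).resolve_left (one_le_pow₀ hb1).not_gt))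
    obtain ⟨w, hev1⟩ := hex.choice
    have hnorm : Tendsto (fun N => ‖w N‖) 𝒰 (𝓝 (rexp (G c z))) := by
      have h1 : Tendsto (fun N => rexp (gN N c z)) 𝒰 (𝓝 (rexp (G c z))) :=
        ((continuous_exp.tendsto _).comp (tendsto_gN c z)).mono_left hl
      refine h1.congr' ?_
      filter_upwards [hev1] with N hN
      rw [← hN.2, gN_bh hN.1, exp_log (by linarith [one_le_bR c N, hN.1])]
    obtain ⟨w0, -, hw₀⟩ := exists_ultra_limit 𝒰 (f := w) (B := rexp (G c z) + 1) (by
      filter_upwards [hnorm.eventually_lt_const (show rexp (G c z) < rexp (G c z) + 1 by linarith)]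
        with N hN using hN.le)
    have hw0n : ‖w0‖ = rexp (G c z) := tendsto_nhds_unique hw₀.norm hnorm
    have hw0U : w0 ∈ U := by
      rw [hU, mem_ofPred_eq, hw0n]; exact exp_lt_exp.2 hz
    refine ⟨w0, hw0U, ?_⟩
    have hu := hb.tendstoLocallyUniformlyOn hΨ
    have h1 : Tendsto (fun N => bh c N (w N)) 𝒰 (𝓝 (Ψ w0)) :=
      hu.tendsto_comp (hd.continuousOn w0 hw0U) hw0U
        (by rw [hUo.nhdsWithin_eq hw0U]; exact hw₀)
    have h2 : Tendsto (fun N => bh c N (w N)) 𝒰 (𝓝 z) :=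
      tendsto_const_nhds.congr' (by filter_upwards [hev1] with N hN using hN.2.symm)
    exact tendsto_nhds_unique h1 h2
  · intro w hw
    have hw' : rexp (G c 0) < ‖w‖ := by
      have h1 : rexp (G c 0) ≤ rexp (G c 0 + gB c) := by
        gcongr; linarith [gB_nonneg c]
      linarith [exp_pos (G c 0 + gB c)]
    exact le_of_tendsto ((hΨ w hw').sub_const w).norm (Eventually.of_forall fun N => bh_norm_sub hw)

theorem small_of_bounded {Ψ2 : ℂ → ℂ} {C R1 : ℝ} (h : ∀ w, R1 < ‖w‖ → ‖Ψ2 w - w‖ ≤ C) :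
    ∀ ε > 0, ∃ R', ∀ w, R' < ‖w‖ → ‖Ψ2 w - w ^ 1‖ ≤ ε * ‖w ^ 1‖ := by
  intro ε hε
  refine ⟨max R1 (C / ε), fun w hw => ?_⟩
  rw [pow_one]
  refine (h w ((le_max_left _ _).trans_lt hw)).trans ?_
  have := (le_max_right R1 (C / ε)).trans_lt hw
  rw [div_lt_iff₀ hε] at this
  linarith

theorem exists_isBott (c : ℂ) : ∃ Ψ, IsBott c Ψ := by
  have hl : ((hyperfilter ℕ : Ultrafilter ℕ) : Filter ℕ) ≤ atTop := Nat.hyperfilter_le_atTop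
  obtain ⟨Ψ, hΨ⟩ := ((bh_locBdd c).mono_filter hl).exists_limit
  have h := isBott'_of_limit hl hΨ
  refine ⟨Ψ, h, ?_⟩
  refine h.eqOn (Ψ2 := fun w => Ψ w ^ 2 + c) two_ne_zero le_rfl ((h.hol.pow 2).add_const c) ?_ ?_
  · intro w hw
    have : G c (Ψ w ^ 2 + c) = 2 * G c (Ψ w) := G_P c (Ψ w)
    rw [this, h.green w hw, norm_pow, Real.log_pow]; norm_num
  · intro ε hε
    set C := 4 * rexp (2 * gB c) * rexp (G c 0 + gB c)
    have hC : 0 ≤ C := by positivity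
    refine ⟨max (2 * rexp (G c 0 + gB c)) (max 1 ((C * (C + 2) + ‖c‖) / ε)), fun w hw => ?_⟩
    have h1 := h.norm_sub w ((le_max_left _ _).trans_lt hw)
    have h2 := (le_max_right _ _).trans_lt hw
    have h3 := (le_max_left _ _).trans_lt h2
    have h4 := (le_max_right _ _).trans_lt h2
    rw [div_lt_iff₀ hε] at h4
    have e : Ψ w ^ 2 + c - w ^ 2 = (Ψ w - w) * ((Ψ w - w) + 2 * w) + c := by ring
    rw [e]
    have h5 : ‖(Ψ w - w) * ((Ψ w - w) + 2 * w) + c‖ ≤ C * (C + 2 * ‖w‖) + ‖c‖ := by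
      refine (norm_add_le _ _).trans ?_
      rw [norm_mul]
      have : ‖(Ψ w - w) + 2 * w‖ ≤ C + 2 * ‖w‖ := by
        refine (norm_add_le _ _).trans ?_
        rw [norm_mul]; norm_num; exact h1
      gcongr
    rw [norm_pow]
    have h6 : C * (C + 2 * ‖w‖) + ‖c‖ ≤ (C * (C + 2) + ‖c‖) * ‖w‖ := by
      nlinarith [mul_nonneg hC hC, norm_nonneg c]
    nlinarith

/-- The inverse Böttcher coordinate. -/
noncomputable def Ψ (c : ℂ) : ℂ → ℂ := (exists_isBott c).choose

theorem isBott (c : ℂ) : IsBott c (Ψ c) := (exists_isBott c).choose_spec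

/-- Uniqueness of the inverse Böttcher coordinate. -/
theorem eq_Ψ {c : ℂ} {Ψ2 : ℂ → ℂ} {R : ℝ} (hR : rexp (G c 0) ≤ R)
    (hd : HolOn Ψ2 {w | R < ‖w‖}) (hG : ∀ w, R < ‖w‖ → G c (Ψ2 w) = log ‖w‖)
    {C R1 : ℝ} (hC : ∀ w, R1 < ‖w‖ → ‖Ψ2 w - w‖ ≤ C) : ∀ w, R < ‖w‖ → Ψ2 w = Ψ c w := by
  have := (isBott c).toIsBott'.eqOn one_ne_zero hR hd (by simpa using hG) (small_of_bounded hC)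
  simpa using this

theorem norm_Ψ_le {c w : ℂ} (hw : rexp (G c 0) < ‖w‖) : ‖Ψ c w‖ ≤ rexp (gB c) * ‖w‖ := by
  refine (norm_le_of_G c _).trans ?_
  rw [(isBott c).green w hw, Real.exp_add, exp_log ((exp_pos _).trans hw), mul_comm]

theorem Ψ_pow {c w : ℂ} (hw : rexp (G c 0) < ‖w‖) (N : ℕ) :
    (P c)^[N] (Ψ c w) = Ψ c (w ^ 2 ^ N) := by
  induction N with
  | zero => simp
  | succ N ih =>
    have h1 : 1 ≤ ‖w‖ := (one_le_exp (G_nonneg c 0)).trans hw.le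
    rw [iterate_succ_apply', ih, pow_succ, pow_mul]
    refine (isBott c).func _ (hw.trans_le ?_)
    rw [norm_pow]
    exact le_self_pow₀ h1 (by positivity)

/-- For convergent parameters the inverse Böttcher coordinates converge locally uniformly. -/
theorem Ψ_locBdd (c0 : ℂ) {R : ℝ} (hR : rexp (G c0 0) ≤ R) :
    LocBdd (𝓝 c0) Ψ {w | R < ‖w‖} := by
  intro z hz
  have hz : R < ‖z‖ := hz
  have h0 : 0 ≤ R := (exp_pos _).le.trans hR
  refine ⟨(‖z‖ - R) / 2, by linarith, rexp (gB c0 + 1) * (‖z‖ + (‖z‖ - R) / 2), ?_⟩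
  have e1 : ∀ᶠ c in 𝓝 c0, rexp (G c 0) < (‖z‖ + R) / 2 :=
    (continuous_exp.comp continuous_G_zero).continuousAt.eventually_lt_const
      (show rexp (G c0 0) < _ by linarith)
  have e2 : ∀ᶠ c in 𝓝 c0, gB c < gB c0 + 1 :=
    continuous_gB.continuousAt.eventually_lt_const (by linarith)
  filter_upwards [e1, e2] with c h1 h2
  have hsub : ∀ w ∈ ball z ((‖z‖ - R) / 2), rexp (G c 0) < ‖w‖ := by
    intro w hw
    rw [mem_ball_iff_norm'] at hw
    have := norm_sub_norm_le z w
    linarith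
  refine ⟨(isBott c).hol.mono fun w hw => hsub w hw, fun w hw => ?_⟩
  refine (norm_Ψ_le (hsub w hw)).trans ?_
  rw [mem_ball_iff_norm] at hw
  have := norm_sub_norm_le w z
  gcongr
  linarith

attribute [local irreducible] G Ψ gB in
theorem Ψ_tendsto (c0 : ℂ) {w : ℂ} (hw : rexp (G c0 0) < ‖w‖) :
    Tendsto (fun c => Ψ c w) (𝓝 c0) (𝓝 (Ψ c0 w)) := by
  rw [tendsto_iff_ultrafilter]
  intro 𝒰 h𝒰
  have hb := (Ψ_locBdd c0 le_rfl).mono_filter h𝒰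
  obtain ⟨f, hf⟩ := hb.exists_limit
  have hd := hb.differentiableOn (isOpen_norm_gt _) hf
  suffices h : ∀ w, rexp (G c0 0) < ‖w‖ → f w = Ψ c0 w by
    have := hf w hw
    rwa [h w hw] at this
  have hev : ∀ w : ℂ, rexp (G c0 0) < ‖w‖ → ∀ᶠ c in 𝓝 c0, rexp (G c 0) < ‖w‖ := fun w hw =>
    (continuous_exp.comp continuous_G_zero).continuousAt.eventually_lt_const hw
  refine eq_Ψ (R1 := 2 * rexp (G c0 0 + gB c0))
    (C := 4 * rexp (2 * gB c0) * rexp (G c0 0 + gB c0)) le_rfl hd ?_ ?_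
  · intro w hw
    have hpair : Tendsto (fun c => (c, Ψ c w)) 𝒰 (𝓝 (c0, f w)) :=
      Tendsto.prodMk_nhds (show Tendsto (fun c : ℂ => c) 𝒰 (𝓝 c0) from h𝒰) (hf w hw)
    have h1 : Tendsto (fun c => G c (Ψ c w)) 𝒰 (𝓝 (G c0 (f w))) :=
      Tendsto.comp (g := fun p : ℂ × ℂ => G p.1 p.2) (continuous_G.tendsto (c0, f w)) hpair
    refine tendsto_nhds_unique h1 (tendsto_const_nhds.congr' ?_)
    filter_upwards [h𝒰 (hev w hw)] with c hc using ((isBott c).green w hc).symm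
  · intro w hw
    have hw' : rexp (G c0 0) < ‖w‖ := by
      have h1 : rexp (G c0 0) ≤ rexp (G c0 0 + gB c0) := by
        apply exp_le_exp.2; linarith [gB_nonneg c0]
      linarith [exp_pos (G c0 0 + gB c0)]
    have hcont : Continuous fun c => 4 * rexp (2 * gB c) * rexp (G c 0 + gB c) := by
      have := continuous_gB
      have := continuous_G_zero
      fun_prop
    have hcont2 : Continuous fun c => 2 * rexp (G c 0 + gB c) := by
      have := continuous_gB
      have := continuous_G_zero
      fun_prop
    refine le_of_tendsto_of_tendsto ((hf w hw').sub_const w).norm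
      ((hcont.tendsto c0).mono_left h𝒰) ?_
    filter_upwards [h𝒰 ((hcont2.tendsto c0).eventually_lt_const hw)] with c hc
    exact (isBott c).norm_sub w hc

theorem sqrt_one_add {x : ℂ} (hx : ‖x‖ ≤ 1 / 2) :
    ((1 + x) ^ (1 / 2 : ℂ)) ^ 2 = 1 + x ∧ ‖(1 + x) ^ (1 / 2 : ℂ) - 1‖ ≤ ‖x‖ := by
  set s := (1 + x) ^ (1 / 2 : ℂ) with hs
  have h0 : s ^ 2 = 1 + x := by
    have := Complex.cpow_nat_inv_pow (1 + x) two_ne_zero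
    rwa [show ((2 : ℕ) : ℂ)⁻¹ = 1 / 2 by norm_num] at this
  refine ⟨h0, ?_⟩
  have hre : 0 ≤ s.re := by
    have hx1 : (1 + x) ≠ 0 := by
      intro h
      have : x = -1 := by linear_combination h
      rw [this] at hx; norm_num at hx
    rw [hs, Complex.cpow_def_of_ne_zero hx1, exp_re]
    refine mul_nonneg (exp_pos _).le (Real.cos_nonneg_of_mem_Icc ?_)
    have e : (Complex.log (1 + x) * (1 / 2)).im = (1 + x).arg / 2 := by
      rw [show Complex.log (1 + x) * (1 / 2) = Complex.log (1 + x) / (2 : ℝ) by push_cast; ring,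
        Complex.div_ofReal_im, Complex.log_im]
    rw [e]
    have h1 := Complex.neg_pi_lt_arg (1 + x)
    have h2 := Complex.arg_le_pi (1 + x)
    constructor <;> linarith
  have e : (s - 1) * (s + 1) = x := by linear_combination h0
  have h1 : 1 ≤ ‖s + 1‖ := by
    refine le_trans ?_ (re_le_norm _)
    simp; linarith
  calc ‖s - 1‖ ≤ ‖s - 1‖ * ‖s + 1‖ := le_mul_of_one_le_right (norm_nonneg _) h1
    _ = ‖x‖ := by rw [← norm_mul, e]

/-- Approximations of `Ψ c w / w` for large `w`. -/
noncomputable def bφ : ℕ → ℂ → ℂ → ℂ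
  | 0, _, _ => 1
  | N + 1, c, w => (bφ N c (w ^ 2) - c / w ^ 2) ^ (1 / 2 : ℂ)

/-- Domain of uniform control. -/
def bW : Set (ℂ × ℂ) := {p | 2 < ‖p.2‖ ∧ 2 * (‖p.1‖ + 1) < ‖p.2‖ ^ 2}

theorem isOpen_bW : IsOpen bW :=
  (isOpen_lt (f := fun _ : ℂ × ℂ => (2 : ℝ)) (g := fun p => ‖p.2‖) (by fun_prop)
    (by fun_prop)).inter (isOpen_lt (f := fun p : ℂ × ℂ => 2 * (‖p.1‖ + 1))
    (g := fun p => ‖p.2‖ ^ 2) (by fun_prop) (by fun_prop))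

theorem bW_sq {c w : ℂ} (h : (c, w) ∈ bW) : (c, w ^ 2) ∈ bW := by
  obtain ⟨h1, h2⟩ := h
  simp only at h1 h2
  refine ⟨?_, ?_⟩ <;> simp only [norm_pow]
  · nlinarith
  · have : 4 < ‖w‖ ^ 2 := by nlinarith
    nlinarith

theorem bφ_arg : ∀ N c w, (c, w) ∈ bW → ‖bφ N c w - 1‖ ≤ (‖c‖ + 1) / ‖w‖ ^ 2 ∧
    ‖bφ N c (w ^ 2) - c / w ^ 2 - 1‖ ≤ (‖c‖ + 1) / ‖w‖ ^ 2 := by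
  have key : ∀ N c w, (c, w) ∈ bW → ‖bφ N c (w ^ 2) - 1‖ ≤ (‖c‖ + 1) / ‖w ^ 2‖ ^ 2 →
      ‖bφ N c (w ^ 2) - c / w ^ 2 - 1‖ ≤ (‖c‖ + 1) / ‖w‖ ^ 2 := by
    intro N c w h h3
    obtain ⟨h1, h2⟩ := h
    simp only at h1 h2
    have e : bφ N c (w ^ 2) - c / w ^ 2 - 1 = (bφ N c (w ^ 2) - 1) - c / w ^ 2 := by ring
    rw [e]
    refine (norm_sub_le _ _).trans ?_
    rw [norm_div, norm_pow]
    rw [norm_pow] at h3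
    have hw : 0 < ‖w‖ ^ 2 := by positivity
    have h4 : (‖c‖ + 1) / (‖w‖ ^ 2) ^ 2 ≤ 1 / ‖w‖ ^ 2 := by
      rw [div_le_div_iff₀ (by positivity) hw]
      nlinarith [norm_nonneg c]
    rw [add_comm ‖c‖ 1, add_div]
    linarith
  intro N
  induction N with
  | zero =>
    intro c w h
    have h0 : ∀ w : ℂ, ‖bφ 0 c w - 1‖ ≤ (‖c‖ + 1) / ‖w‖ ^ 2 := fun w => by
      simp only [bφ, sub_self, norm_zero]; positivity
    exact ⟨h0 w, key 0 c w h (h0 _)⟩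
  | succ N ih =>
    have h1 : ∀ c w, (c, w) ∈ bW → ‖bφ (N + 1) c w - 1‖ ≤ (‖c‖ + 1) / ‖w‖ ^ 2 := by
      intro c w h
      have h3 := (ih c w h).2
      have hw : 0 < ‖w‖ ^ 2 := by have := h.1; simp only at this; positivity
      have h4 : (‖c‖ + 1) / ‖w‖ ^ 2 ≤ 1 / 2 := by
        rw [div_le_iff₀ hw]; have := h.2; simp only at this; linarith
      have := (sqrt_one_add (h3.trans h4)).2
      rw [add_sub_cancel] at this
      exact this.trans h3
    exact fun c w h => ⟨h1 c w h, key _ c w h (h1 c _ (bW_sq h))⟩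

theorem bφ_le_half (N : ℕ) {c w : ℂ} (h : (c, w) ∈ bW) :
    ‖bφ N c (w ^ 2) - c / w ^ 2 - 1‖ ≤ 1 / 2 := by
  refine ((bφ_arg N c w h).2).trans ?_
  have h1 := h.1
  have h2 := h.2
  simp only at h1 h2
  rw [div_le_iff₀ (by positivity)]; linarith

theorem bφ_sq (N : ℕ) {c w : ℂ} (h : (c, w) ∈ bW) :
    bφ (N + 1) c w ^ 2 = bφ N c (w ^ 2) - c / w ^ 2 := by
  have := (sqrt_one_add (bφ_le_half N h)).1
  rwa [add_sub_cancel] at this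

theorem hol2_bφ (N : ℕ) : Hol2 (bφ N) bW := by
  induction N with
  | zero => exact differentiableOn_const 1
  | succ N ih =>
    have h1 : HolOn (fun p : ℂ × ℂ => bφ N p.1 (p.2 ^ 2)) bW :=
      Hol2.comp ih (by fun_prop) (by fun_prop) fun p hp => bW_sq hp
    have h2 : HolOn (fun p : ℂ × ℂ => bφ N p.1 (p.2 ^ 2) - p.1 / p.2 ^ 2) bW := by
      have h3 : HolOn (fun p : ℂ × ℂ => (p.2 ^ 2)⁻¹) bW := by
        refine DifferentiableOn.fun_inv (by fun_prop) fun p hp => ?_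
        have : 0 < ‖p.2‖ := by linarith [hp.1]
        exact pow_ne_zero _ (norm_pos_iff.1 this)
      simp only [div_eq_mul_inv]
      exact h1.sub (differentiableOn_fst.mul h3)
    refine h2.cpow (differentiableOn_const _) fun p hp => ?_
    have := bφ_le_half N (c := p.1) (w := p.2) hp
    left
    have h3 := (abs_re_le_norm _).trans this
    rw [sub_re, one_re, abs_le] at h3
    linarith

theorem bφ_iterate (N : ℕ) : ∀ {c w : ℂ}, (c, w) ∈ bW →
    (P c)^[N] (w * bφ N c w) = w ^ 2 ^ N := by
  induction N with
  | zero => intro c w _; simp [bφ]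
  | succ N ih =>
    intro c w h
    have hw : w ≠ 0 := norm_pos_iff.1 (by linarith [h.1])
    rw [iterate_succ_apply]
    have : P c (w * bφ (N + 1) c w) = w ^ 2 * bφ N c (w ^ 2) := by
      rw [P, mul_pow, bφ_sq N h]; field_simp; ring
    rw [this, ih (bW_sq h), ← pow_mul, pow_succ']

theorem exists_bott_large : ∃ B : ℂ → ℂ → ℂ, Hol2 B bW ∧
    (∀ c w, (c, w) ∈ bW → ‖B c w - w‖ ≤ (‖c‖ + 1) / ‖w‖) ∧
    ∀ c w, (c, w) ∈ bW → rexp (G c 0) < ‖w‖ → B c w = Ψ c w := by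
  set l : Ultrafilter ℕ := hyperfilter ℕ
  have hbd : ∀ N, ∀ p ∈ bW, ‖bφ N p.1 p.2‖ ≤ 2 := by
    intro N p hp
    have h1 := (bφ_arg N p.1 p.2 hp).1
    have h2 : (‖p.1‖ + 1) / ‖p.2‖ ^ 2 ≤ 1 := by
      have := hp.1
      rw [div_le_iff₀ (by positivity)]; nlinarith [hp.2, norm_nonneg p.1]
    have h3 := norm_sub_norm_le (bφ N p.1 p.2) 1
    rw [norm_one] at h3
    linarith
  have hex : ∀ p : ℂ × ℂ, ∃ y, p ∈ bW → Tendsto (fun N => bφ N p.1 p.2) l (𝓝 y) := by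
    intro p
    by_cases hp : p ∈ bW
    · obtain ⟨y, -, hy⟩ := exists_ultra_limit l (f := fun N => bφ N p.1 p.2) (B := 2)
        (Eventually.of_forall fun N => hbd N p hp)
      exact ⟨y, fun _ => hy⟩
    · exact ⟨0, fun h => absurd h hp⟩
  choose f hf using hex
  have hH : Hol2 (fun c w => f (c, w)) bW := by
    refine Hol2.of_limit (l := (l : Filter ℕ)) isOpen_bW (fun p hp => hf p hp) fun p hp => ?_
    obtain ⟨r, hr, h⟩ := exists_ball_prod isOpen_bW hp
    exact ⟨r, hr, 2, Eventually.of_forall fun N => ⟨(hol2_bφ N).mono h, fun q hq => hbd N q (h hq)⟩⟩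
  have hB : Hol2 (fun c w => w * f (c, w)) bW := DifferentiableOn.mul (by fun_prop) hH
  have hnorm : ∀ c w, (c, w) ∈ bW → ‖w * f (c, w) - w‖ ≤ (‖c‖ + 1) / ‖w‖ := by
    intro c w h
    have h1 : ‖f (c, w) - 1‖ ≤ (‖c‖ + 1) / ‖w‖ ^ 2 :=
      le_of_tendsto ((hf _ h).sub_const 1).norm (Eventually.of_forall fun N => (bφ_arg N c w h).1)
    have hw : 0 < ‖w‖ := by linarith [h.1]
    rw [show w * f (c, w) - w = w * (f (c, w) - 1) by ring, norm_mul]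
    calc ‖w‖ * ‖f (c, w) - 1‖ ≤ ‖w‖ * ((‖c‖ + 1) / ‖w‖ ^ 2) := by gcongr
      _ = _ := by field_simp
  have hgreen : ∀ c w, (c, w) ∈ bW → G c (w * f (c, w)) = log ‖w‖ := by
    intro c w h
    have hw1 : 1 < ‖w‖ := by linarith [h.1]
    have h1 : Tendsto (fun N => G c (w * bφ N c w)) l (𝓝 (G c (w * f (c, w)))) := by
      have hc : Continuous fun z => G c z := continuous_G.comp (f := fun z : ℂ => (c, z)) (by fun_prop)
      exact (hc.tendsto _).comp ((hf _ h).const_mul w)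
    have h2 : Tendsto (fun N => G c (w * bφ N c w)) l (𝓝 (log ‖w‖)) := by
      refine Tendsto.mono_left ?_ (show (l : Filter ℕ) ≤ atTop from Nat.hyperfilter_le_atTop)
      rw [tendsto_iff_norm_sub_tendsto_zero]
      refine squeeze_zero (g := fun N : ℕ => gB c / 2 ^ N) (fun _ => norm_nonneg _) (fun N => ?_) ?_
      · have e := G_iterate c (w * bφ N c w) N
        rw [bφ_iterate N h] at e
        have h3 := log_le_G c (w ^ 2 ^ N)
        have h4 := G_le_log c (w ^ 2 ^ N)
        have h5 : max 1 ‖w ^ 2 ^ N‖ = ‖w‖ ^ 2 ^ N := by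
          rw [norm_pow, max_eq_right (one_le_pow₀ hw1.le)]
        rw [h5, Real.log_pow, e] at h3 h4
        push_cast at h3 h4
        rw [norm_eq_abs, le_div_iff₀ (by positivity), ← abs_of_pos (show (0:ℝ) < 2 ^ N by positivity),
          ← abs_mul, abs_le]
        constructor <;> nlinarith
      · have := (tendsto_pow_atTop_nhds_zero_of_lt_one (r := (1 / 2 : ℝ)) (by norm_num)
          (by norm_num)).const_mul (gB c)
        simpa [div_eq_mul_inv] using this
    exact tendsto_nhds_unique h1 h2
  refine ⟨fun c w => w * f (c, w), hB, hnorm, fun c w h hw => ?_⟩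
  set R := max (rexp (G c 0)) (max 2 (Real.sqrt (2 * (‖c‖ + 1)))) with hR
  have hmem : ∀ w : ℂ, R < ‖w‖ → (c, w) ∈ bW := by
    intro w hw
    simp only [hR, max_lt_iff] at hw
    refine ⟨hw.2.1, ?_⟩
    exact (sqrt_lt' (by linarith [hw.2.1])).1 hw.2.2
  have hRw : R < ‖w‖ := by
    simp only [hR, max_lt_iff]
    exact ⟨hw, h.1, (sqrt_lt' (by linarith [h.1])).2 h.2⟩
  refine eq_Ψ (R := R) (R1 := R) (C := ‖c‖ + 1) (le_max_left _ _) (fun z hz => ?_)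
    (fun z hz => hgreen c z (hmem z hz)) (fun z hz => ?_) w hRw
  · exact (hB.sep₂ isOpen_bW (hmem z hz)).differentiableWithinAt
  · refine (hnorm c z (hmem z hz)).trans (div_le_self (by positivity) ?_)
    linarith [(hmem z hz).1]

theorem isOpen_Ψ_dom : IsOpen {p : ℂ × ℂ | rexp (G p.1 0) < ‖p.2‖} := by
  have := continuous_G_zero
  exact isOpen_lt (continuous_exp.comp (this.comp continuous_fst)) (by fun_prop)

theorem Ψ_ne_zero {c w : ℂ} (hw : rexp (G c 0) < ‖w‖) : Ψ c w ≠ 0 := by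
  intro h
  have := (isBott c).green w hw
  rw [h] at this
  rw [this, exp_log ((exp_pos _).trans hw)] at hw
  exact lt_irrefl _ hw

theorem Ψ_pow_dom {c w : ℂ} (hw : rexp (G c 0) < ‖w‖) (N : ℕ) (hN : 1 ≤ N) : rexp (G c 0) < ‖w ^ N‖ := by
  rw [norm_pow]
  refine hw.trans_le (le_self_pow₀ ?_ (by lia))
  exact (one_le_exp (G_nonneg c 0)).trans hw.le

theorem hol2_Ψ : Hol2 Ψ {p : ℂ × ℂ | rexp (G p.1 0) < ‖p.2‖} := by
  obtain ⟨B, hB, -, hBΨ⟩ := exists_bott_large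
  have key : ∀ N : ℕ, ∀ c w : ℂ, rexp (G c 0) < ‖w‖ → (c, w ^ 2 ^ N) ∈ bW →
      DifferentiableAt ℂ (fun c => Ψ c w) c := by
    intro N
    induction N with
    | zero =>
      intro c w hw h
      rw [pow_zero, pow_one] at h
      have h1 := hB.sep₁ isOpen_bW h
      refine h1.congr_of_eventuallyEq ?_
      have e1 : ∀ᶠ c' in 𝓝 c, rexp (G c' 0) < ‖w‖ :=
        (continuous_exp.comp continuous_G_zero).continuousAt.eventually_lt_const hw
      have e2 : ∀ᶠ c' in 𝓝 c, (c', w) ∈ bW :=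
        (Continuous.prodMk_left w).continuousAt.eventually_mem (isOpen_bW.mem_nhds h)
      filter_upwards [e1, e2] with c' h1 h2 using (hBΨ c' w h2 h1).symm
    | succ N ih =>
      intro c w hw h
      have hd := ih c (w ^ 2) (Ψ_pow_dom hw 2 (by norm_num)) (by rwa [← pow_mul, ← pow_succ'])
      refine differentiableAt_of_comp (p := fun z => z ^ 2) (g := fun c => Ψ c w)
        (by fun_prop) ?_ (Ψ_tendsto c hw) ?_
      · simpa using Ψ_ne_zero hw
      · refine (hd.sub_const 0 |>.sub differentiableAt_id).congr_of_eventuallyEq ?_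
        have e1 : ∀ᶠ c' in 𝓝 c, rexp (G c' 0) < ‖w‖ :=
          (continuous_exp.comp continuous_G_zero).continuousAt.eventually_lt_const hw
        filter_upwards [e1] with c' h1
        have := (isBott c').func w h1
        simp only [Pi.sub_apply, id, sub_zero]
        linear_combination this
  refine Hol2.of_sep isOpen_Ψ_dom (fun q hq => ?_) (fun q hq => ?_) fun p hp => ?_
  · have hq : rexp (G q.1 0) < ‖q.2‖ := hq
    have h1 : 1 < ‖q.2‖ := (one_le_exp (G_nonneg q.1 0)).trans_lt hq
    obtain ⟨m, hm⟩ := pow_unbounded_of_one_lt (2 + 2 * (‖q.1‖ + 1)) h1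
    have hm2 : ‖q.2‖ ^ m ≤ ‖q.2‖ ^ 2 ^ m := pow_le_pow_right₀ h1.le Nat.lt_two_pow_self.le
    refine key m q.1 q.2 hq ⟨?_, ?_⟩ <;> simp only [norm_pow]
    · linarith [norm_nonneg q.1]
    · have := norm_nonneg q.1
      nlinarith
  · exact ((isBott q.1).hol).differentiableAt ((isOpen_norm_gt _).mem_nhds hq)
  · refine ⟨rexp (gB p.1 + 1) * (‖p.2‖ + 1), ?_⟩
    have e1 : ∀ᶠ q : ℂ × ℂ in 𝓝 p, gB q.1 < gB p.1 + 1 :=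
      (continuous_gB.comp continuous_fst).continuousAt.eventually_lt_const (by simp)
    have e2 : ∀ᶠ q : ℂ × ℂ in 𝓝 p, ‖q.2‖ < ‖p.2‖ + 1 :=
      (continuous_snd.norm).continuousAt.eventually_lt_const (by simp)
    filter_upwards [e1, e2, isOpen_Ψ_dom.mem_nhds hp] with q h1 h2 h3
    refine (norm_Ψ_le h3).trans ?_
    gcongr

theorem G_zero_pos {c : ℂ} (h : c ∉ Mandelbrot) : 0 < G c 0 :=
  lt_of_le_of_ne (G_nonneg c 0) fun e => h ((mem_Mandelbrot_iff c).2 e.symm)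

theorem notMem_of_G_pos {c : ℂ} (h : 0 < G c 0) : c ∉ Mandelbrot := fun hc =>
  h.ne' ((mem_Mandelbrot_iff c).1 hc)

theorem compl_mem_nhds {c : ℂ} (h : c ∉ Mandelbrot) : Mandelbrotᶜ ∈ 𝓝 c :=
  isClosed_Mandelbrot.isOpen_compl.mem_nhds h

/-- The Douady–Hubbard uniformization of the complement of the Mandelbrot set. -/
noncomputable def Φ (c : ℂ) : ℂ := invFunOn (Ψ c) {w | rexp (G c 0) < ‖w‖} c

theorem Φ_spec {c : ℂ} (h : c ∉ Mandelbrot) : rexp (G c 0) < ‖Φ c‖ ∧ Ψ c (Φ c) = c :=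
  have := (isBott c).surj c (by rw [G_self]; linarith [G_zero_pos h])
  ⟨invFunOn_mem this, invFunOn_eq this⟩

theorem Φ_eq {c w : ℂ} (h : c ∉ Mandelbrot) (hw : rexp (G c 0) < ‖w‖) (hΨ : Ψ c w = c) :
    Φ c = w := (isBott c).inj (Φ_spec h).1 hw ((Φ_spec h).2.trans hΨ.symm)

theorem log_norm_Φ {c : ℂ} (h : c ∉ Mandelbrot) : log ‖Φ c‖ = 2 * G c 0 := by
  rw [← (isBott c).green _ (Φ_spec h).1, (Φ_spec h).2, G_self]

theorem norm_Φ {c : ℂ} (h : c ∉ Mandelbrot) : ‖Φ c‖ = rexp (2 * G c 0) := by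
  rw [← log_norm_Φ h, exp_log ((exp_pos _).trans (Φ_spec h).1)]

theorem one_lt_norm_Φ {c : ℂ} (h : c ∉ Mandelbrot) : 1 < ‖Φ c‖ := by
  rw [norm_Φ h, one_lt_exp_iff]; linarith [G_zero_pos h]

theorem norm_le_Φ {c : ℂ} (h : c ∉ Mandelbrot) : ‖c‖ ≤ max 4 (2 * ‖Φ c‖) := by
  rcases le_total ‖c‖ 4 with h4 | h4
  · exact h4.trans (le_max_left _ _)
  · refine le_trans ?_ (le_max_right _ _)
    have := log_le_G_self h4
    rw [G_self, ← log_norm_Φ h, Real.log_le_log_iff (by linarith)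
      (by linarith [one_lt_norm_Φ h])] at this
    linarith

theorem exists_injOn_nhds {f : ℂ → ℂ} {d a : ℂ} (hs : HasStrictDerivAt f d a) (hd : d ≠ 0) :
    ∃ N ∈ 𝓝 a, InjOn f N := by
  have h := hs.hasStrictFDerivAt_equiv hd
  exact ⟨_, h.toOpenPartialHomeomorph.open_source.mem_nhds h.mem_toOpenPartialHomeomorph_source,
    h.toOpenPartialHomeomorph.injOn⟩

attribute [local irreducible] G Ψ Φ in
theorem differentiableAt_Φ {c : ℂ} (h : c ∉ Mandelbrot) : DifferentiableAt ℂ Φ c := by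
  obtain ⟨hw, hΨ⟩ := Φ_spec h
  have hd : deriv (Ψ c) (Φ c) ≠ 0 :=
    deriv_ne_zero_of_injOn (isOpen_norm_gt _) (isBott c).hol (isBott c).inj hw
  have hm : (c, Φ c) ∈ {p : ℂ × ℂ | rexp (G p.1 0) < ‖p.2‖} := hw
  obtain ⟨r, hr, s, hs, -, hW, κ, hκ, hκ2, -, -⟩ :=
    hol2_Ψ.exists_inverse isOpen_Ψ_dom hm hd univ_mem
  rw [hΨ] at hκ hκ2
  have h1 := (hκ.comp differentiableOn_id differentiableOn_id fun _ h => ⟨h, h⟩).differentiableAt (ball_mem_nhds c hr)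
  refine h1.congr_of_eventuallyEq ?_
  filter_upwards [ball_mem_nhds c hr, compl_mem_nhds h] with c' h1 h2
  obtain ⟨h3, h4⟩ := hκ2 c' h1 c' h1
  have h5 : rexp (G c' 0) < ‖κ c' c'‖ := hW (mk_mem_prod h1 h3)
  exact Φ_eq h2 h5 h4

theorem differentiableOn_Φ : HolOn Φ Mandelbrotᶜ := fun _ h =>
  (differentiableAt_Φ h).differentiableWithinAt

theorem analyticAt_Φ {c : ℂ} (h : c ∉ Mandelbrot) : AnalyticAt ℂ Φ c :=
  differentiableOn_Φ.analyticAt (compl_mem_nhds h)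

theorem zero_mem_Mandelbrot : (0 : ℂ) ∈ Mandelbrot :=
  mem_Mandelbrot_of_bdd (B := 0) fun N => by
    have : (P 0)^[N] 0 = 0 := iterate_fixed (by simp [P]) N
    simp [this]

theorem Φ_nonconst {c : ℂ} (h : c ∉ Mandelbrot) : ¬ ∀ᶠ z in 𝓝 c, Φ z = Φ c := by
  intro hc
  set O : Set ℂ := {a | a ∉ Mandelbrot ∧ ∀ᶠ z in 𝓝 a, Φ z = Φ c} with hO
  have hopen : IsOpen O := by
    rw [isOpen_iff_mem_nhds]
    rintro a ⟨h1, h2⟩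
    filter_upwards [compl_mem_nhds h1, h2.eventually_nhds] with b h3 h4
      using ⟨h3, h4⟩
  have hG : ∀ a ∈ O, G a 0 = G c 0 := fun a ha => by
    have h1 := log_norm_Φ ha.1
    rw [ha.2.self_of_nhds, log_norm_Φ h] at h1
    linarith
  have hclosed : IsClosed O := by
    refine isClosed_of_closure_subset fun a ha => ?_
    have h1 : G a 0 = G c 0 := closure_minimal hG (isClosed_eq continuous_G_zero continuous_const) ha
    have ha' : a ∉ Mandelbrot := notMem_of_G_pos (h1 ▸ G_zero_pos h)
    refine ⟨ha', ?_⟩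
    by_contra hne
    have h2 := ((analyticAt_Φ ha').eventually_eq_or_eventually_ne analyticAt_const).resolve_left hne
    by_cases haO : a ∈ O
    · exact hne haO.2
    · rw [mem_closure_iff_frequently] at ha
      refine ha ?_
      rw [eventually_nhdsWithin_iff] at h2
      filter_upwards [h2] with z h3 h4
      have : z ≠ a := by rintro rfl; exact haO h4
      exact h3 this h4.2.self_of_nhds
  rcases isClopen_iff.1 ⟨hclosed, hopen⟩ with h1 | h1
  · exact h1.le (show c ∈ O from ⟨h, hc⟩)
  · exact (h1.ge (mem_univ 0)).1 zero_mem_Mandelbrot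

theorem nhds_le_map_Φ {c : ℂ} (h : c ∉ Mandelbrot) : 𝓝 (Φ c) ≤ map Φ (𝓝 c) :=
  (analyticAt_Φ h).eventually_constant_or_nhds_le_map_nhds.resolve_left (Φ_nonconst h)

theorem Φ_proper {ι : Type*} (𝒰 : Ultrafilter ι) {a : ι → ℂ} {w : ℂ} (hw : 1 < ‖w‖)
    (ha : ∀ᶠ i in (𝒰 : Filter ι), a i ∉ Mandelbrot) (ht : Tendsto (fun i => Φ (a i)) 𝒰 (𝓝 w)) :
    ∃ c, c ∉ Mandelbrot ∧ Tendsto a 𝒰 (𝓝 c) ∧ Φ c = w := by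
  obtain ⟨c, -, hc⟩ := exists_ultra_limit 𝒰 (f := a) (B := max 4 (2 * (‖w‖ + 1))) (by
    filter_upwards [ha, ht.norm.eventually_lt_const (lt_add_one ‖w‖)] with i h1 h2
    exact (norm_le_Φ h1).trans (by gcongr))
  have h1 : Tendsto (fun i => rexp (2 * G (a i) 0)) 𝒰 (𝓝 (rexp (2 * G c 0))) :=
    ((continuous_exp.comp (continuous_G_zero.const_mul 2)).tendsto c).comp hc
  have h2 : rexp (2 * G c 0) = ‖w‖ := by
    refine tendsto_nhds_unique h1 (ht.norm.congr' ?_)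
    filter_upwards [ha] with i hi using norm_Φ hi
  have hcM : c ∉ Mandelbrot := by
    refine notMem_of_G_pos ?_
    rw [← h2, one_lt_exp_iff] at hw
    linarith
  exact ⟨c, hcM, hc, tendsto_nhds_unique ((differentiableAt_Φ hcM).continuousAt.tendsto.comp hc) ht⟩

theorem Φ_inj_large {c₁ c₂ : ℂ} (h1 : c₁ ∉ Mandelbrot) (h2 : c₂ ∉ Mandelbrot) (h : Φ c₁ = Φ c₂)
    (hw : 13 < ‖Φ c₁‖) : c₁ = c₂ := by
  obtain ⟨B, hB, hB2, hBΨ⟩ := exists_bott_large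
  set w := Φ c₁ with hwd
  have hmem : ∀ c ∈ ball (0 : ℂ) (6 * ‖w‖), (c, w) ∈ bW := by
    intro c hc
    rw [mem_ball_zero_iff] at hc
    refine ⟨by simp only; linarith, ?_⟩
    simp only; nlinarith
  have key : ∀ c, c ∉ Mandelbrot → Φ c = w → c ∈ ball (0 : ℂ) (6 * ‖w‖ / 2) ∧ B c w = c := by
    intro c hc hΦ
    have h3 : c ∈ ball (0 : ℂ) (6 * ‖w‖ / 2) := by
      rw [mem_ball_zero_iff]
      have := norm_le_Φ hc
      rw [hΦ, max_eq_right (by linarith)] at this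
      linarith
    refine ⟨h3, ?_⟩
    rw [hBΨ c w (hmem c (ball_subset_ball (by linarith) h3)) (hΦ ▸ (Φ_spec hc).1), ← hΦ,
      (Φ_spec hc).2]
  obtain ⟨b1, e1⟩ := key c₁ h1 rfl
  obtain ⟨b2, e2⟩ := key c₂ h2 h.symm
  have hl := lipschitz_of_bdd (f := fun c => B c w - w) (z := 0) (r := 6 * ‖w‖) (M := 7)
    (by linarith) (fun c hc => ((hB.sep₁ isOpen_bW (hmem c hc)).sub_const w).differentiableWithinAt)
    (fun c hc => by
      refine (hB2 c w (hmem c hc)).trans ?_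
      rw [mem_ball_zero_iff] at hc
      rw [div_le_iff₀ (by linarith)]; linarith) b1 b2
  simp only [e1, e2, sub_sub_sub_cancel_right] at hl
  have h3 : 4 * 7 / (6 * ‖w‖) ≤ 1 / 2 := by
    rw [div_le_iff₀ (by linarith)]; linarith
  have h4 : ‖c₂ - c₁‖ ≤ 0 := by nlinarith [norm_nonneg (c₂ - c₁)]
  exact (sub_eq_zero.1 (norm_le_zero_iff.1 h4)).symm

theorem Φ_inj {c₁ c₂ : ℂ} (h1 : c₁ ∉ Mandelbrot) (h2 : c₂ ∉ Mandelbrot) (h : Φ c₁ = Φ c₂) :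
    c₁ = c₂ := by
  set B : Set ℂ := {w | ∃ a b, a ∉ Mandelbrot ∧ b ∉ Mandelbrot ∧ Φ a = w ∧ Φ b = w ∧
    (a ≠ b ∨ (a = b ∧ deriv Φ a = 0))} with hB
  have comp : ∀ a, a ∉ Mandelbrot → ∀ O ∈ 𝓝 a, Φ '' (O ∩ Mandelbrotᶜ) ∈ 𝓝 (Φ a) := fun a ha O hO =>
    nhds_le_map_Φ ha (by
      rw [mem_map]
      filter_upwards [hO, compl_mem_nhds ha] with z h1 h2 using ⟨z, ⟨h1, h2⟩, rfl⟩)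
  have hopen : IsOpen B := by
    rw [isOpen_iff_mem_nhds]
    rintro w ⟨a, b, ha, hb, ea, eb, hab | ⟨rfl, hd⟩⟩
    · obtain ⟨O1, O2, o1, o2, m1, m2, hdis⟩ := t2_separation hab
      filter_upwards [ea ▸ comp a ha O1 (o1.mem_nhds m1), eb ▸ comp b hb O2 (o2.mem_nhds m2)]
      rintro w' ⟨a', ⟨h1, h1'⟩, e1⟩ ⟨b', ⟨h2, h2'⟩, e2⟩
      exact ⟨a', b', h1', h2', e1, e2, Or.inl fun e => hdis.le_bot ⟨h1, e ▸ h2⟩⟩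
    · have h3 := eventually_exists_companion (analyticAt_Φ ha) (Φ_nonconst ha) hd
        (compl_mem_nhds ha)
      have h4 : {t | t ∉ Mandelbrot ∧ (t = a ∨ ∃ z ∈ Mandelbrotᶜ, z ≠ t ∧ Φ z = Φ t)} ∈ 𝓝 a := by
        rw [eventually_nhdsWithin_iff] at h3
        filter_upwards [h3, compl_mem_nhds ha] with t h5 h6
        exact ⟨h6, or_iff_not_imp_left.2 h5⟩
      filter_upwards [ea ▸ comp a ha _ h4]
      rintro w' ⟨t, ⟨⟨ht, ht'⟩, -⟩, rfl⟩
      rcases ht' with rfl | ⟨z, hz, hzt, e⟩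
      · exact ⟨t, t, ha, ha, rfl, rfl, Or.inr ⟨rfl, hd⟩⟩
      · exact ⟨t, z, ht, hz, rfl, e, Or.inl hzt.symm⟩
  have hclosed : closure B ∩ {w | 1 < ‖w‖} ⊆ B := by
    rintro w ⟨hwB, hw⟩
    obtain ⟨𝒰, hU1, hU2⟩ := mem_closure_iff_ultrafilter.1 hwB
    choose! p p' hp using (fun _ h => h : ∀ w' ∈ B, _)
    obtain ⟨a, ha, hta, ea⟩ := Φ_proper 𝒰 (a := p) hw (mem_of_superset hU1 fun i hi => (hp i hi).1)
      (Tendsto.congr' (mem_of_superset hU1 fun i hi => (hp i hi).2.2.1.symm) hU2)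
    obtain ⟨b, hb, htb, eb⟩ := Φ_proper 𝒰 (a := p') hw (mem_of_superset hU1 fun i hi => (hp i hi).2.1)
      (Tendsto.congr' (mem_of_superset hU1 fun i hi => (hp i hi).2.2.2.1.symm) hU2)
    refine ⟨a, b, ha, hb, ea, eb, ?_⟩
    by_contra hcon
    push Not at hcon
    obtain ⟨rfl, hd⟩ := hcon
    have hd := hd rfl
    obtain ⟨N, hN, hinj⟩ := exists_injOn_nhds (analyticAt_Φ ha).hasStrictDerivAt hd
    have hdc : ∀ᶠ z in 𝓝 a, deriv Φ z ≠ 0 := (analyticAt_Φ ha).deriv.continuousAt.eventually_ne hd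
    obtain ⟨i, hi, i1, i2, i3⟩ := (Eventually.and (p := (· ∈ B)) hU1 ((hta.eventually hN).and ((htb.eventually hN).and (hta.eventually hdc)))).exists
    obtain ⟨-, -, e1, e2, h5 | h5⟩ := hp i hi
    · exact h5 (hinj i1 i2 (e1.trans e2.symm))
    · exact i3 h5.2
  have hlarge : ∀ w ∈ B, ‖w‖ ≤ 13 := by
    rintro w ⟨a, b, ha, hb, ea, eb, hab | ⟨rfl, hd⟩⟩
    · exact not_lt.1 fun hc => hab (Φ_inj_large ha hb (ea.trans eb.symm) (ea ▸ hc))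
    · refine not_lt.1 fun hc => ?_
      have h3 := eventually_exists_companion (analyticAt_Φ ha) (Φ_nonconst ha) hd
        (compl_mem_nhds ha)
      have h4 : ∀ᶠ t in 𝓝[≠] a, t ∉ Mandelbrot ∧ 13 < ‖Φ t‖ := by
        refine eventually_nhdsWithin_of_eventually_nhds ?_
        filter_upwards [compl_mem_nhds ha,
          (differentiableAt_Φ ha).continuousAt.norm.eventually_const_lt (ea ▸ hc)] with t h1 h2 using ⟨h1, h2⟩
      obtain ⟨t, ⟨z, hz, hzt, e⟩, h5, h6⟩ := (h3.and h4).exists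
      exact hzt (Φ_inj_large h5 hz e.symm h6).symm
  by_contra hne
  have hsub := (isPreconnected_norm_gt (r := 1) one_pos).subset_of_closure_inter_subset hopen
    ⟨Φ c₁, one_lt_norm_Φ h1, c₁, c₂, h1, h2, rfl, h.symm, Or.inl hne⟩ hclosed
  have := hlarge 14 (hsub (by simp))
  norm_num at this

theorem isOpen_image_Φ {O : Set ℂ} (hO : IsOpen O) (hM : O ⊆ Mandelbrotᶜ) : IsOpen (Φ '' O) := by
  rw [isOpen_iff_mem_nhds]
  rintro _ ⟨c, hc, rfl⟩
  exact nhds_le_map_Φ (hM hc) (image_mem_map (hO.mem_nhds hc))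

theorem isPreconnected_Mandelbrot : IsPreconnected Mandelbrot := by
  rw [isPreconnected_closed_iff]
  intro X1 X2 hX1 hX2 hcov hne1 hne2
  by_contra hdis
  rw [not_nonempty_iff_eq_empty] at hdis
  have hK1 := isCompact_Mandelbrot.inter_right hX1
  have hK2 := isCompact_Mandelbrot.inter_right hX2
  obtain ⟨N1, N2, o1, o2, m1, m2, hN⟩ := SeparatedNhds.of_isCompact_isCompact hK1 hK2 (by
    rw [disjoint_iff_inter_eq_empty, ← hdis]; ext; simp; tauto)
  have hsub : Mandelbrot ⊆ N1 ∪ N2 := fun c hc => (hcov hc).imp (fun h => m1 ⟨hc, h⟩) fun h => m2 ⟨hc, h⟩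
  have hcN : ∀ c ∈ closure N1, c ∉ N2 := fun c h1 h2 => (hN.closure_left o2).le_bot ⟨h1, h2⟩
  have hcN' : ∀ c ∈ closure N2, c ∉ N1 := fun c h1 h2 => (hN.closure_right o1).le_bot ⟨h2, h1⟩
  obtain ⟨ε, hε, hεN⟩ : ∃ ε > 0, ∀ c, G c 0 < ε → c ∈ N1 ∪ N2 := by
    have hc : IsCompact (closedBall (0 : ℂ) 4 \ (N1 ∪ N2)) :=
      (isCompact_closedBall _ _).diff (o1.union o2)
    obtain ⟨ε, hε, h⟩ : ∃ ε > 0, ∀ c ∈ closedBall (0 : ℂ) 4 \ (N1 ∪ N2), ε ≤ G c 0 := by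
      rcases (closedBall (0 : ℂ) 4 \ (N1 ∪ N2)).eq_empty_or_nonempty with he | he
      · exact ⟨1, one_pos, by simp [he]⟩
      · obtain ⟨c, hc, hmin⟩ := hc.exists_isMinOn he continuous_G_zero.continuousOn
        exact ⟨G c 0, G_zero_pos fun h => hc.2 (hsub h), fun c' hc' => hmin hc'⟩
    refine ⟨min ε (log 2 / 2), lt_min hε (by positivity), fun c hcε => ?_⟩
    rw [lt_min_iff] at hcε
    by_contra hcon
    have h4 : ‖c‖ ≤ 4 := by
      by_contra h4
      push Not at h4
      have := log_le_G_self h4.le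
      have h5 : log 2 ≤ log (‖c‖ / 2) := log_le_log (by norm_num) (by linarith)
      rw [G_self] at this
      linarith [hcε.2]
    exact absurd (h c ⟨by simpa using h4, hcon⟩) (not_le.2 hcε.1)
  set A : Set ℂ := {w | 1 < ‖w‖ ∧ ‖w‖ < rexp (2 * ε)} with hA
  have hmemA : ∀ c, c ∉ Mandelbrot → (Φ c ∈ A ↔ G c 0 < ε) := fun c hc => by
    simp only [hA, mem_ofPred_eq, one_lt_norm_Φ hc, true_and]
    rw [norm_Φ hc, exp_lt_exp]
    constructor <;> intro h <;> linarith
  have main : ∀ N N' X : Set ℂ, IsOpen N → (∀ c ∈ closure N, c ∉ N') → (∀ c, G c 0 < ε → c ∈ N ∪ N') →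
      IsClosed X → (Mandelbrot ∩ X).Nonempty → N ∩ Mandelbrot = Mandelbrot ∩ X →
      A ⊆ Φ '' (N ∩ {c | G c 0 < ε} ∩ Mandelbrotᶜ) := by
    intro N N' X oN hcl hcover hX hne hNX
    have oO : IsOpen (N ∩ {c | G c 0 < ε}) :=
      oN.inter (isOpen_lt continuous_G_zero continuous_const)
    refine (isPreconnected_annulus one_pos).subset_of_closure_inter_subset
      (isOpen_image_Φ (oO.inter isClosed_Mandelbrot.isOpen_compl) inter_subset_right) ?_ ?_
    · by_contra hempty
      have h1 : N ∩ {c | G c 0 < ε} ⊆ Mandelbrot := by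
        intro c hc
        by_contra hcM
        exact hempty ⟨Φ c, (hmemA c hcM).2 hc.2, c, ⟨hc, hcM⟩, rfl⟩
      have h2 : N ∩ {c | G c 0 < ε} = Mandelbrot ∩ X := by
        rw [← hNX]
        refine Subset.antisymm (fun c hc => ⟨hc.1, h1 hc⟩) fun c hc => ⟨hc.1, ?_⟩
        rw [mem_ofPred_eq, (mem_Mandelbrot_iff c).1 hc.2]; exact hε
      rcases isClopen_iff.1 ⟨isClosed_Mandelbrot.inter hX, h2 ▸ oO⟩ with h3 | h3
      · exact hne.ne_empty h3
      · have := norm_le_of_mem_Mandelbrot (h3.ge (mem_univ 5)).1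
        norm_num at this
    · rintro w ⟨hw, hwA⟩
      obtain ⟨𝒰, hU1, hU2⟩ := mem_closure_iff_ultrafilter.1 hw
      choose! p hp using (fun _ h => h : ∀ w' ∈ Φ '' (N ∩ {c | G c 0 < ε} ∩ Mandelbrotᶜ), _)
      obtain ⟨c, hc, htc, rfl⟩ := Φ_proper 𝒰 (a := p) hwA.1
        (mem_of_superset hU1 fun i hi => (hp i hi).1.2)
        (Tendsto.congr' (mem_of_superset hU1 fun i hi => (hp i hi).2.symm) hU2)
      have hcl' : c ∈ closure N := mem_closure_of_tendsto htc
        (by filter_upwards [hU1] with i hi using (hp i hi).1.1.1)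
      have hG := (hmemA c hc).1 hwA
      exact ⟨c, ⟨⟨(hcover c hG).resolve_right (hcl c hcl'), hG⟩, hc⟩, rfl⟩
  have e1 : N1 ∩ Mandelbrot = Mandelbrot ∩ X1 :=
    Subset.antisymm (fun c hc => ⟨hc.2, (hcov hc.2).resolve_right fun h =>
      hN.le_bot ⟨hc.1, m2 ⟨hc.2, h⟩⟩⟩) fun c hc => ⟨m1 hc, hc.1⟩
  have e2 : N2 ∩ Mandelbrot = Mandelbrot ∩ X2 :=
    Subset.antisymm (fun c hc => ⟨hc.2, (hcov hc.2).resolve_left fun h =>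
      hN.le_bot ⟨m1 ⟨hc.2, h⟩, hc.1⟩⟩) fun c hc => ⟨m2 hc, hc.1⟩
  have hw : ((rexp ε : ℝ) : ℂ) ∈ A := by
    simp only [hA, mem_ofPred_eq, norm_real, norm_eq_abs, abs_of_pos (exp_pos _),
      one_lt_exp_iff, exp_lt_exp]
    constructor <;> linarith
  obtain ⟨a, ha, ea⟩ := main N1 N2 X1 o1 hcN hεN hX1 hne1 e1 hw
  obtain ⟨b, hb, eb⟩ := main N2 N1 X2 o2 hcN' (fun c h => (hεN c h).symm) hX2 hne2 e2 hw
  have := Φ_inj ha.2 hb.2 (ea.trans eb.symm)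
  exact hN.le_bot ⟨ha.1.1, this ▸ hb.1.1⟩

section Linearizer

variable {g : ℂ → ℂ} {lam : ℂ} {C s ρ : ℝ}

theorem lin_iter_le (hl : 1 < ‖lam‖) (hC0 : 0 ≤ C) (hb : ∀ z, ‖z‖ ≤ s → ‖g z - lam * z‖ ≤ C * ‖z‖ ^ 2)
    (hρs : 2 * ρ ≤ s) (h : ‖lam‖⁻¹ * (1 + 4 * C * ρ) ≤ 1) (k : ℕ) : ∀ (m : ℕ) (u : ℂ), ‖u‖ ≤ ρ →
    ‖g^[k] (u / lam ^ (k + m))‖ ≤ ‖u‖ * ‖lam‖⁻¹ ^ m * (1 + ‖lam‖⁻¹ ^ m) := by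
  have hl0 : 0 < ‖lam‖ := by linarith
  set t := ‖lam‖⁻¹ with ht
  have ht0 : 0 < t := inv_pos.2 hl0
  have ht1 : t < 1 := inv_lt_one_of_one_lt₀ hl
  induction k with
  | zero =>
    intro m u hu
    simp only [Function.iterate_zero, id, zero_add, norm_div, norm_pow]
    rw [div_eq_mul_inv, ← inv_pow, ← ht]
    exact le_mul_of_one_le_right (by positivity) (by linarith [pow_pos ht0 m])
  | succ k ih =>
    intro m u hu
    have h1 := ih (m + 1) u hu
    rw [iterate_succ_apply', show k + 1 + m = k + (m + 1) by ring]
    set z := g^[k] (u / lam ^ (k + (m + 1))) with hz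
    have hp : t ^ m ≤ 1 := pow_le_one₀ ht0.le ht1.le
    have hp0 : 0 < t ^ m := pow_pos ht0 m
    have hu0 := norm_nonneg u
    have hρ0 : 0 ≤ ρ := hu0.trans hu
    have h2 : ‖z‖ ≤ 2 * ‖u‖ * t ^ m * t := by
      refine h1.trans ?_
      rw [pow_succ]
      have : 1 + t ^ m * t ≤ 2 := by nlinarith
      calc ‖u‖ * (t ^ m * t) * (1 + t ^ m * t) ≤ ‖u‖ * (t ^ m * t) * 2 := by gcongr
        _ = _ := by ring
    have h3 : ‖z‖ ≤ s := by
      refine h2.trans (le_trans ?_ hρs)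
      calc 2 * ‖u‖ * t ^ m * t ≤ 2 * ρ * 1 * 1 := by gcongr
        _ = 2 * ρ := by ring
    have h4 : ‖g z‖ ≤ ‖lam‖ * ‖z‖ + C * ‖z‖ ^ 2 := by
      have := norm_add_le (g z - lam * z) (lam * z)
      rw [sub_add_cancel, norm_mul] at this
      linarith [hb z h3]
    have e : ‖lam‖ * t = 1 := mul_inv_cancel₀ hl0.ne'
    have h5 : ‖lam‖ * ‖z‖ ≤ ‖u‖ * t ^ m * (1 + t ^ m * t) := by
      calc ‖lam‖ * ‖z‖ ≤ ‖lam‖ * (‖u‖ * t ^ (m + 1) * (1 + t ^ (m + 1))) := by gcongr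
        _ = (‖lam‖ * t) * (‖u‖ * t ^ m * (1 + t ^ m * t)) := by rw [pow_succ]; ring
        _ = _ := by rw [e, one_mul]
    have h6 : C * ‖z‖ ^ 2 ≤ ‖u‖ * t ^ m * (t ^ m * (t * (4 * C * ρ))) := by
      calc C * ‖z‖ ^ 2 ≤ C * (2 * ‖u‖ * t ^ m * t) ^ 2 := by gcongr
        _ = ‖u‖ * t ^ m * (t ^ m * (t * (4 * C * ‖u‖))) * t := by ring
        _ ≤ ‖u‖ * t ^ m * (t ^ m * (t * (4 * C * ρ))) * 1 := by gcongr
        _ = _ := by ring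
    have h7 : t ^ m * (t * (1 + 4 * C * ρ)) ≤ t ^ m * 1 := by gcongr
    have h8 : ‖u‖ * t ^ m * (t ^ m * (t * (1 + 4 * C * ρ))) ≤ ‖u‖ * t ^ m * (t ^ m * 1) := by gcongr
    linarith

theorem lin_step (hg : Differentiable ℂ g) (hl : 1 < ‖lam‖) (hC0 : 0 ≤ C)
    (hb : ∀ z, ‖z‖ ≤ s → ‖g z - lam * z‖ ≤ C * ‖z‖ ^ 2)
    (hρs : 2 * ρ ≤ s) (h : ‖lam‖⁻¹ * (1 + 4 * C * ρ) ≤ 1) (hC : C * ρ ≤ 1 / 4) {u : ℂ}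
    (hu : ‖u‖ ≤ ρ / 4) (N : ℕ) :
    ‖g^[N + 1] (u / lam ^ (N + 1)) - g^[N] (u / lam ^ N)‖ ≤ 128 * C * ‖u‖ ^ 2 * ‖lam‖⁻¹ ^ N := by
  have hl0 : 0 < ‖lam‖ := by linarith
  have hlam : lam ≠ 0 := norm_pos_iff.1 hl0
  rcases eq_or_ne u 0 with rfl | hu0
  · have h0 : g 0 = 0 := by
      have := hb 0 (by simp; linarith [norm_nonneg (0 : ℂ)])
      simpa using this
    have := iterate_fixed h0
    simp [this]
  have hun : 0 < ‖u‖ := norm_pos_iff.2 hu0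
  set t := ‖lam‖⁻¹ with ht
  have ht0 : 0 < t := inv_pos.2 hl0
  have ht1 : t < 1 := inv_lt_one_of_one_lt₀ hl
  set R := 4 * ‖u‖ with hR
  have hRρ : R ≤ ρ := by linarith
  set w := u / lam ^ (N + 1) with hw
  have hwn : ‖w‖ = ‖u‖ * t ^ N * t := by
    rw [hw, norm_div, norm_pow, div_eq_mul_inv, ← inv_pow, ← ht, pow_succ]; ring
  have htN : t ^ N ≤ 1 := pow_le_one₀ ht0.le ht1.le
  have hws : ‖w‖ ≤ s := by
    rw [hwn]
    calc ‖u‖ * t ^ N * t ≤ ‖u‖ * 1 * 1 := by gcongr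
      _ ≤ s := by linarith
  set v := lam ^ N * g w with hv
  have hvu : ‖v - u‖ ≤ C * ‖u‖ ^ 2 * t ^ N := by
    have e : v - u = lam ^ N * (g w - lam * w) := by
      have : lam ^ N * (lam * w) = u := by
        rw [hw, pow_succ]; field_simp
      rw [hv, mul_sub, this]
    rw [e, norm_mul, norm_pow]
    calc ‖lam‖ ^ N * ‖g w - lam * w‖ ≤ ‖lam‖ ^ N * (C * ‖w‖ ^ 2) := by gcongr; exact hb w hws
      _ = (‖lam‖ * t) ^ N * (C * ‖u‖ ^ 2 * t ^ N) * t ^ 2 := by rw [hwn, mul_pow]; ring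
      _ = (C * ‖u‖ ^ 2 * t ^ N) * t ^ 2 := by rw [ht, mul_inv_cancel₀ hl0.ne', one_pow, one_mul]
      _ ≤ (C * ‖u‖ ^ 2 * t ^ N) * 1 := by gcongr; exact pow_le_one₀ ht0.le ht1.le
      _ = _ := mul_one _
  have hvu2 : ‖v - u‖ ≤ ‖u‖ / 4 := by
    refine hvu.trans ?_
    have : C * ‖u‖ ≤ 1 / 4 := by
      refine le_trans ?_ hC
      gcongr; linarith
    calc C * ‖u‖ ^ 2 * t ^ N ≤ C * ‖u‖ ^ 2 * 1 := by gcongr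
      _ = C * ‖u‖ * ‖u‖ := by ring
      _ ≤ 1 / 4 * ‖u‖ := by gcongr
      _ = _ := by ring
  have hbd : ∀ x ∈ ball (0 : ℂ) R, ‖g^[N] (x / lam ^ N)‖ ≤ 2 * R := by
    intro x hx
    rw [mem_ball_zero_iff] at hx
    have := lin_iter_le hl hC0 hb hρs h N 0 x (by linarith)
    simp at this
    linarith
  have key := lipschitz_of_bdd (f := fun x => g^[N] (x / lam ^ N)) (z := 0) (r := R) (M := 2 * R)
    (by linarith) ((hg.iterate N).comp (by fun_prop : Differentiable ℂ fun x => x / lam ^ N)).differentiableOn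
    hbd (w := u) (w' := v) (by rw [mem_ball_zero_iff]; linarith) (by
      rw [mem_ball_zero_iff]
      have := norm_sub_norm_le v u
      linarith)
  have e1 : v / lam ^ N = g w := by rw [hv]; field_simp
  simp only [e1, ← iterate_succ_apply] at key
  refine key.trans ?_
  have hR0 : R ≠ 0 := by positivity
  rw [show 4 * (2 * R) / R = 8 by rw [div_eq_iff hR0]; ring]
  have : 0 ≤ C * ‖u‖ ^ 2 * t ^ N := by positivity
  linarith

end Linearizer

theorem exists_quadratic_bound {h : ℂ → ℂ → ℂ} {W : Set (ℂ × ℂ)} (hW : IsOpen W) (hh : Hol2 h W)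
    {c0 : ℂ} (h0 : (c0, 0) ∈ W) (hz : ∀ c, (c, 0) ∈ W → h c 0 = 0 ∧ deriv (h c) 0 = 0) :
    ∃ r > 0, ∃ C, 0 ≤ C ∧ ball c0 r ×ˢ ball 0 r ⊆ W ∧
      ∀ c ∈ ball c0 r, ∀ z ∈ ball (0 : ℂ) r, ‖h c z‖ ≤ C * ‖z‖ ^ 2 := by
  have hd := hh.deriv_snd hW
  have hc := (hd.continuousAt hW h0).norm.eventually_lt_const (lt_add_one _)
  obtain ⟨r, hr, hball⟩ := eventually_nhds_iff_ball.1 (hc.and (hW.mem_nhds h0))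
  rw [← ball_prod_same] at hball
  set M := ‖deriv (h c0) 0‖ + 1 with hM
  have hM0 : 0 ≤ M := by positivity
  refine ⟨r / 2, by positivity, 4 * M / r, by positivity, fun p hp =>
    (hball p ⟨ball_subset_ball (by linarith) hp.1, ball_subset_ball (by linarith) hp.2⟩).2,
    fun c hc z hz' => ?_⟩
  have hc' : c ∈ ball c0 r := ball_subset_ball (by linarith) hc
  have hW' : ∀ z ∈ ball (0 : ℂ) r, (c, z) ∈ W := fun z hz => (hball (c, z) ⟨hc', hz⟩).2
  obtain ⟨hz1, hz2⟩ := hz c (hW' 0 (mem_ball_self hr))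
  have hlip : ∀ w ∈ ball (0 : ℂ) (r / 2), ‖deriv (h c) w‖ ≤ 4 * M / r * ‖w‖ := by
    intro w hw
    have := lipschitz_of_bdd (f := deriv (h c)) (z := 0) (M := M) hr
      (fun z hz => (hd.sep₂ hW (hW' z hz)).differentiableWithinAt)
      (fun z hz => (hball (c, z) ⟨hc', hz⟩).1.le) (mem_ball_self (by positivity)) hw
    rwa [hz2, sub_zero, sub_zero] at this
  have key := (convex_closedBall (0 : ℂ) ‖z‖).norm_image_sub_le_of_norm_deriv_le (f := h c) (x := 0) (y := z)
    (C := 4 * M / r * ‖z‖) (fun w hw => ?_) (fun w hw => ?_) (by simp) (by simp)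
  · rw [hz1, sub_zero, sub_zero] at key
    linarith
  · rw [mem_closedBall_zero_iff] at hw
    rw [mem_ball_zero_iff] at hz'
    exact hh.sep₂ hW (hW' w (by rw [mem_ball_zero_iff]; linarith))
  · rw [mem_closedBall_zero_iff] at hw
    rw [mem_ball_zero_iff] at hz'
    refine (hlip w (by rw [mem_ball_zero_iff]; linarith)).trans ?_
    gcongr

theorem Hol2.comp_iterate {f a : ℂ → ℂ → ℂ} {W : Set (ℂ × ℂ)} (hf : Hol2 f univ) (ha : Hol2 a W)
    (N : ℕ) : Hol2 (fun c z => (f c)^[N] (a c z)) W := by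
  induction N with
  | zero => exact ha
  | succ N ih =>
    simp only [iterate_succ_apply']
    exact hf.comp differentiableOn_fst ih fun _ _ => trivial

section Linearizer

variable {f : ℂ → ℂ → ℂ} {D : Set ℂ} {γ lam : ℂ → ℂ}

theorem multiplier_differentiableOn (hf : Hol2 f univ) (hγ : HolOn γ D)
    (hl : ∀ c ∈ D, lam c = deriv (f c) (γ c)) : HolOn lam D :=
  ((hf.deriv_snd isOpen_univ).comp differentiableOn_id hγ fun _ _ => trivial).congr hl

theorem Hol2.differentiable_snd (hf : Hol2 f univ) (c : ℂ) : Differentiable ℂ (f c) :=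
  fun z => hf.sep₂ isOpen_univ (mem_univ _)

theorem lin_conj (c z : ℂ) (k : ℕ) :
    (fun z => f c (γ c + z) - γ c)^[k] z = (f c)^[k] (γ c + z) - γ c := by
  induction k with
  | zero => simp
  | succ k ih => rw [iterate_succ_apply', ih, iterate_succ_apply']; simp

theorem lin_local (hf : Hol2 f univ) (hD : IsOpen D) (hγ : HolOn γ D)
    (hfix : ∀ c ∈ D, f c (γ c) = γ c) (hl : ∀ c ∈ D, lam c = deriv (f c) (γ c))
    (h1 : ∀ c ∈ D, 1 < ‖lam c‖) {c0 : ℂ} (hc0 : c0 ∈ D) :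
    ∃ r > 0, ∃ ρ > 0, ∃ K, 0 ≤ K ∧ ∃ θ, 0 ≤ θ ∧ θ < 1 ∧ ball c0 r ⊆ D ∧ ∀ c ∈ ball c0 r, ∀ u : ℂ,
      ‖u‖ < ρ → ∀ N, ‖(f c)^[N] (γ c + u / lam c ^ N) - γ c‖ ≤ 2 * ρ * 4 ∧
      ‖(f c)^[N + 1] (γ c + u / lam c ^ (N + 1)) - (f c)^[N] (γ c + u / lam c ^ N)‖ ≤
        K * ‖u‖ ^ 2 * θ ^ N := by
  have hlam := multiplier_differentiableOn hf hγ hl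
  set W : Set (ℂ × ℂ) := D ×ˢ univ with hW
  have hWo : IsOpen W := hD.prod isOpen_univ
  have hfst : ∀ {g : ℂ → ℂ}, HolOn g D → HolOn (fun p : ℂ × ℂ => g p.1) W :=
    fun hg => hg.comp differentiableOn_fst (fun p hp => hp.1)
  have hcomp : HolOn (fun p : ℂ × ℂ => f p.1 (γ p.1 + p.2)) W :=
    hf.comp differentiableOn_fst ((hfst hγ).add differentiableOn_snd) fun _ _ => trivial
  have hh : Hol2 (fun c z => f c (γ c + z) - γ c - lam c * z) W :=
    (hcomp.sub (hfst hγ)).sub ((hfst hlam).mul differentiableOn_snd)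
  obtain ⟨r, hr, C, hC0, hrW, hb⟩ := exists_quadratic_bound hWo hh (c0 := c0) ⟨hc0, mem_univ _⟩ (by
    intro c hc
    refine ⟨by simp [hfix c hc.1], ?_⟩
    have hd : HasDerivAt (f c) (lam c) (γ c + 0) := by
      rw [add_zero, hl c hc.1]; exact (hf.differentiable_snd c _).hasDerivAt
    have h2 : HasDerivAt (fun z => γ c + z) 1 0 := (hasDerivAt_id (0 : ℂ)).const_add (γ c)
    have h3 := (hd.comp 0 h2).sub_const (γ c)
    have h4 := h3.sub ((hasDerivAt_id (0 : ℂ)).const_mul (lam c))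
    have h5 : HasDerivAt (fun z => f c (γ c + z) - γ c - lam c * z) (lam c * 1 - lam c * 1) 0 := h4
    rw [h5.deriv, sub_self])
  have hc0D : ball c0 r ⊆ D := fun c hc => (hrW (show (c, 0) ∈ _ from ⟨hc, mem_ball_self hr⟩)).1
  have hinv : ‖lam c0‖⁻¹ < 1 := inv_lt_one_of_one_lt₀ (h1 c0 hc0)
  obtain ⟨θ, hθ1, hθ2⟩ := exists_between hinv
  have hθ0 : 0 < θ := lt_of_le_of_lt (by positivity) hθ1
  have hcont : ContinuousAt (fun c => ‖lam c‖⁻¹) c0 :=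
    ((hlam.continuousOn.continuousAt (hD.mem_nhds hc0)).norm).inv₀ (by
      have := h1 c0 hc0; linarith)
  obtain ⟨r1, hr1, hb₁⟩ := eventually_nhds_iff_ball.1 (hcont.eventually_lt_const hθ1)
  have t (g : ℝ → ℝ) (b : ℝ) (hg : Continuous g) (h : g 0 < b) : ∀ᶠ x in 𝓝[>] 0, g x < b :=
    nhdsWithin_le_nhds (hg.continuousAt.eventually_lt_const h)
  obtain ⟨ρ, h1ρ, h2ρ, h3ρ, hρ0⟩ := ((t (fun x => θ * (1 + 4 * C * x)) 1 (by fun_prop) (by simpa)).and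
    ((t (C * ·) (1 / 4) (by fun_prop) (by simp)).and
    ((t (2 * ·) (r / 2) (by fun_prop) (by simpa)).and self_mem_nhdsWithin))).exists
  refine ⟨min r r1, lt_min hr hr1, ρ / 4, by positivity, 128 * C, by positivity, θ, hθ0.le, hθ2,
    ball_min_left.trans hc0D, fun c hc u hu N => ?_⟩
  have hcr := ball_min_left hc
  have hcr1 := hb₁ c (ball_min_right hc)
  have hcD := hc0D hcr
  set g : ℂ → ℂ := fun z => f c (γ c + z) - γ c with hg
  have hgd : Differentiable ℂ g := ((hf.differentiable_snd c).comp
    (by fun_prop : Differentiable ℂ fun z => γ c + z)).sub_const _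
  have hgb : ∀ z : ℂ, ‖z‖ ≤ r / 2 → ‖g z - lam c * z‖ ≤ C * ‖z‖ ^ 2 := fun z hz =>
    hb c hcr z (by rw [mem_ball_zero_iff]; linarith)
  have hcond : ‖lam c‖⁻¹ * (1 + 4 * C * ρ) ≤ 1 := by
    refine le_trans ?_ h1ρ.le
    gcongr
  have e : ∀ N, (f c)^[N] (γ c + u / lam c ^ N) = g^[N] (u / lam c ^ N) + γ c := fun N => by
    rw [hg, lin_conj]; ring
  constructor
  · have := lin_iter_le (h1 c hcD) hC0 hgb h3ρ.le hcond N 0 u (by linarith)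
    rw [e, add_sub_cancel_right]
    simp at this
    linarith
  · rw [e, e, add_sub_add_right_eq_sub]
    refine (lin_step hgd (h1 c hcD) hC0 hgb h3ρ.le hcond h2ρ.le hu.le N).trans ?_
    gcongr

theorem exists_linearizer (hf : Hol2 f univ) (hD : IsOpen D) (hγ : HolOn γ D)
    (hfix : ∀ c ∈ D, f c (γ c) = γ c) (hl : ∀ c ∈ D, lam c = deriv (f c) (γ c))
    (h1 : ∀ c ∈ D, 1 < ‖lam c‖) :
    ∃ ψ : ℂ → ℂ → ℂ, Hol2 ψ (D ×ˢ univ) ∧ ∀ c ∈ D, ψ c 0 = γ c ∧ deriv (ψ c) 0 = 1 ∧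
      ∀ u, ψ c (lam c * u) = f c (ψ c u) := by
  have hlam := multiplier_differentiableOn hf hγ hl
  set F : ℕ → ℂ → ℂ → ℂ := fun N c u => (f c)^[N] (γ c + u / lam c ^ N) with hF
  have hlam0 : ∀ c ∈ D, lam c ≠ 0 := fun c hc => norm_pos_iff.1 (by linarith [h1 c hc])
  have hFk : ∀ c ∈ D, ∀ u N k, F (N + k) c u = (f c)^[k] (F N c (u / lam c ^ k)) := by
    intro c hc u N k
    simp only [hF]
    rw [← iterate_add_apply, add_comm k N, div_div, ← pow_add, add_comm k N]
  have hpow : ∀ c ∈ D, ∀ u : ℂ, ∀ ρ > 0, ∃ k, ‖u / lam c ^ k‖ < ρ := by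
    intro c hc u ρ hρ
    have := (tendsto_pow_atTop_nhds_zero_of_lt_one (r := ‖lam c‖⁻¹) (by positivity)
      (inv_lt_one_of_one_lt₀ (h1 c hc))).const_mul ‖u‖
    rw [mul_zero] at this
    obtain ⟨k, hk⟩ := (this.eventually_lt_const hρ).exists
    refine ⟨k, ?_⟩
    rwa [norm_div, norm_pow, div_eq_mul_inv, ← inv_pow]
  have hloc : ∀ c ∈ D, ∃ ρ > 0, ∃ K, 0 ≤ K ∧ ∀ u : ℂ, ‖u‖ < ρ →
      ∃ y, Tendsto (fun N => F N c u) atTop (𝓝 y) ∧ ‖γ c + u - y‖ ≤ K * ‖u‖ ^ 2 := by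
    intro c hc
    obtain ⟨r, hr, ρ, hρ, K, hK, θ, hθ0, hθ1, -, hb⟩ := lin_local hf hD hγ hfix hl h1 hc
    refine ⟨ρ, hρ, K / (1 - θ), by have := sub_pos.2 hθ1; positivity, fun u hu => ?_⟩
    have hd : ∀ N, dist (F N c u) (F (N + 1) c u) ≤ K * ‖u‖ ^ 2 * θ ^ N := fun N => by
      rw [dist_comm, dist_eq_norm]; exact (hb c (mem_ball_self hr) u hu N).2
    obtain ⟨y, hy⟩ := cauchySeq_tendsto_of_complete (cauchySeq_of_le_geometric θ _ hθ1 hd)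
    refine ⟨y, hy, ?_⟩
    have := dist_le_of_le_geometric_of_tendsto₀ θ _ hθ1 hd hy
    rw [dist_eq_norm] at this
    simpa [hF, mul_div_right_comm] using this
  have hlim : ∀ c u, c ∈ D → ∃ y, Tendsto (fun N => F N c u) atTop (𝓝 y) := by
    intro c u hc
    obtain ⟨ρ, hρ, K, -, hb⟩ := hloc c hc
    obtain ⟨k, hk⟩ := hpow c hc u ρ hρ
    obtain ⟨y, hy, -⟩ := hb _ hk
    refine ⟨(f c)^[k] y, ?_⟩
    rw [← tendsto_add_atTop_iff_nat k]
    simp only [hFk c hc u]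
    exact (((hf.differentiable_snd c).continuous.iterate k).tendsto y).comp hy
  choose! ψ hψ using hlim
  have hWo : IsOpen (D ×ˢ (univ : Set ℂ)) := hD.prod isOpen_univ
  have hfst : ∀ {g : ℂ → ℂ}, HolOn g D →
      HolOn (fun p : ℂ × ℂ => g p.1) (D ×ˢ univ) :=
    fun hg => hg.comp differentiableOn_fst (fun p hp => hp.1)
  have hdiv : ∀ N, Hol2 (fun c u => u / lam c ^ N) (D ×ˢ univ) := fun N => by
    simp only [Hol2, div_eq_mul_inv]
    exact differentiableOn_snd.mul (((hfst hlam).pow N).fun_inv fun p hp =>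
      pow_ne_zero _ (hlam0 _ hp.1))
  have hFh : ∀ N, Hol2 (F N) (D ×ˢ univ) := fun N =>
    hf.comp_iterate (a := fun c u => γ c + u / lam c ^ N) ((hfst hγ).add (hdiv N)) N
  have hψh : Hol2 ψ (D ×ˢ univ) := by
    refine Hol2.of_limit (l := atTop) (F := F) hWo (fun p hp => hψ _ _ hp.1) fun p hp => ?_
    obtain ⟨c0, u0⟩ := p
    have hc0 : c0 ∈ D := hp.1
    obtain ⟨r, hr, ρ, hρ, K, hK, θ, hθ0, hθ1, hrD, hb⟩ := lin_local hf hD hγ hfix hl h1 hc0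
    obtain ⟨k, hk⟩ := hpow c0 hc0 u0 ρ hρ
    have hcont := ((hdiv k).continuousAt hWo hp).norm.eventually_lt_const hk
    have hγc := ((hγ.continuousOn.continuousAt (hD.mem_nhds hc0)).norm).eventually_lt_const (lt_add_one _)
    obtain ⟨r1, hr1, hb₁⟩ := eventually_nhds_iff_ball.1 hcont
    obtain ⟨r2, hr2, hb₂⟩ := eventually_nhds_iff_ball.1 hγc
    set B := ‖γ c0‖ + 1 + 2 * ρ * 4
    have hcpt : IsCompact (closedBall c0 r ×ˢ closedBall (0 : ℂ) B) :=
      (isCompact_closedBall _ _).prod (isCompact_closedBall _ _)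
    obtain ⟨M, hM⟩ := hcpt.exists_bound_of_continuousOn
      (f := fun p : ℂ × ℂ => (f p.1)^[k] p.2)
      ((hf.comp_iterate (a := fun _ z => z) (W := univ) differentiableOn_snd k).continuousOn.mono
        (subset_univ _))
    refine ⟨min r (min r1 r2), lt_min hr (lt_min hr1 hr2), M, ?_⟩
    filter_upwards [eventually_ge_atTop k] with N hN
    obtain ⟨N, rfl⟩ := Nat.exists_eq_add_of_le' hN
    refine ⟨(hFh _).mono (Set.prod_mono (ball_min_left.trans hrD)
      (subset_univ _)), ?_⟩
    rintro ⟨c, u⟩ ⟨hc, hu⟩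
    simp only at hc hu ⊢
    have hcr : c ∈ ball c0 r := ball_min_left hc
    have hcr1 : c ∈ ball c0 r1 := ball_subset_ball (inf_le_right.trans inf_le_left) hc
    have hcr2 : c ∈ ball c0 r2 := ball_subset_ball (inf_le_right.trans inf_le_right) hc
    have hur1 : u ∈ ball u0 r1 := ball_subset_ball (inf_le_right.trans inf_le_left) hu
    rw [hFk c (hrD hcr)]
    refine hM (c, F N c (u / lam c ^ k)) ⟨ball_subset_closedBall hcr, ?_⟩
    rw [mem_closedBall_zero_iff]
    have h2 := (hb c hcr _ (hb₁ (c, u) (by rw [← ball_prod_same]; exact ⟨hcr1, hur1⟩)) N).1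
    have h3 := hb₂ c hcr2
    have h4 := norm_sub_norm_le (F N c (u / lam c ^ k)) (γ c)
    simp only [B]
    simp only [hF] at h4 ⊢
    linarith
  refine ⟨ψ, hψh, fun c hc => ?_⟩
  obtain ⟨ρ, hρ, K, hK, hb⟩ := hloc c hc
  have hq : ∀ u : ℂ, ‖u‖ < ρ → ‖γ c + u - ψ c u‖ ≤ K * ‖u‖ ^ 2 := fun u hu => by
    obtain ⟨y, hy, h⟩ := hb u hu
    rwa [← tendsto_nhds_unique hy (hψ c u hc)]
  have h0 : ψ c 0 = γ c := by
    have := hq 0 (by simpa using hρ)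
    simp [sub_eq_zero] at this
    exact this.symm
  refine ⟨h0, ?_, fun u => ?_⟩
  · have : HasDerivAt (ψ c) 1 0 := by
      rw [hasDerivAt_iff_isLittleO_nhds_zero]
      have : (fun h : ℂ => ψ c (0 + h) - ψ c 0 - h • (1 : ℂ)) =O[𝓝 0] fun h => ‖h‖ ^ 2 := by
        refine Asymptotics.IsBigO.of_bound K ?_
        filter_upwards [ball_mem_nhds (0 : ℂ) hρ] with h hh
        have := hq h (by simpa using hh)
        rw [h0, zero_add, smul_eq_mul, mul_one]
        rw [Real.norm_of_nonneg (by positivity)]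
        rwa [show γ c + h - ψ c h = -(ψ c h - γ c - h) by ring, norm_neg] at this
      refine this.trans_isLittleO ?_
      have := (Asymptotics.isLittleO_pow_id (𝕜 := ℝ) (n := 2) (by norm_num)).comp_tendsto (tendsto_norm_zero (E := ℂ))
      exact this.of_norm_right.trans_isBigO (by simpa using Asymptotics.isBigO_refl _ _)
    exact this.deriv
  · have h2 : Tendsto (fun N => F (N + 1) c (lam c * u)) atTop (𝓝 (ψ c (lam c * u))) :=
      (tendsto_add_atTop_iff_nat 1).2 (hψ c _ hc)
    have h3 : ∀ N, F (N + 1) c (lam c * u) = f c (F N c u) := fun N => by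
      rw [hFk c hc, pow_one, mul_div_cancel_left₀ _ (hlam0 c hc), Function.iterate_one]
    simp only [h3] at h2
    exact tendsto_nhds_unique h2 (((hf.differentiable_snd c).continuous.tendsto _).comp (hψ c u hc))

end Linearizer

/-- The right half-plane. -/
def rhp : Set ℂ := {x | 0 < x.re}

theorem isOpen_rhp : IsOpen rhp := isOpen_lt continuous_const Complex.continuous_re

theorem convex_rhp : Convex ℝ rhp := convex_halfSpace_re_gt 0

/-- A linearizer `ψ` with multiplier `exp ℓ` at a repelling fixed point of `P_c^[n]`, `c ∈ M`. -/
structure LinData (c : ℂ) (n : ℕ) (ℓ : ℂ) (ψ : ℂ → ℂ) : Prop where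
  hn : 1 ≤ n
  hc : c ∈ Mandelbrot
  hre : 0 < ℓ.re
  hψ : Differentiable ℂ ψ
  hd : deriv ψ 0 = 1
  hfun : ∀ u, ψ (exp ℓ * u) = (P c)^[n] (ψ u)

/-- The preimage of the complement of the filled Julia set in logarithmic coordinates. -/
def escLog (c : ℂ) (ψ : ℂ → ℂ) : Set ℂ := {ζ | 0 < G c (ψ (exp ζ))}

/-- `E` lifts `x ↦ Ψ c (exp x)` through `ζ ↦ ψ (exp ζ)`. -/
def IsLift (c : ℂ) (ψ E : ℂ → ℂ) : Prop :=
  HolOn E rhp ∧ ∀ x ∈ rhp, ψ (exp (E x)) = Ψ c (exp x)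

theorem exp_mem_dom {c : ℂ} (hc : c ∈ Mandelbrot) {x : ℂ} (hx : x ∈ rhp) :
    rexp (G c 0) < ‖exp x‖ := by
  rw [(mem_Mandelbrot_iff c).1 hc, norm_exp]
  exact exp_lt_exp.2 hx

theorem G_Ψ_exp {c : ℂ} (hc : c ∈ Mandelbrot) {x : ℂ} (hx : x ∈ rhp) :
    G c (Ψ c (exp x)) = x.re := by
  rw [(isBott c).green _ (exp_mem_dom hc hx), norm_exp, log_exp]

theorem exists_Ψ_exp {c z : ℂ} (hc : c ∈ Mandelbrot) (hz : 0 < G c z) :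
    ∃ x ∈ rhp, Ψ c (exp x) = z := by
  obtain ⟨w, hw, h⟩ := (isBott c).surj z (by rwa [(mem_Mandelbrot_iff c).1 hc])
  have hw0 : w ≠ 0 := norm_pos_iff.1 ((exp_pos _).trans hw)
  refine ⟨Complex.log w, ?_, by rwa [Complex.exp_log hw0]⟩
  rw [rhp, mem_ofPred_eq, Complex.log_re]
  rw [(mem_Mandelbrot_iff c).1 hc, Real.exp_zero] at hw
  exact log_pos hw

theorem Ψ_exp_inj {c : ℂ} (hc : c ∈ Mandelbrot) {x y : ℂ} (hx : x ∈ rhp) (hy : y ∈ rhp)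
    (h : Ψ c (exp x) = Ψ c (exp y)) : exp x = exp y :=
  (isBott c).inj (exp_mem_dom hc hx) (exp_mem_dom hc hy) h

theorem iterate_Ψ_exp {c : ℂ} (hc : c ∈ Mandelbrot) {x : ℂ} (hx : x ∈ rhp) (N : ℕ) :
    (P c)^[N] (Ψ c (exp x)) = Ψ c (exp (2 ^ N * x)) := by
  rw [Ψ_pow (exp_mem_dom hc hx), ← exp_nat_mul]
  push_cast; rfl

theorem differentiableOn_Ψ_exp {c : ℂ} (hc : c ∈ Mandelbrot) :
    HolOn (fun x => Ψ c (exp x)) rhp :=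
  (isBott c).hol.comp differentiable_exp.differentiableOn fun _ hx => exp_mem_dom hc hx

namespace LinData

variable {c ℓ : ℂ} {n : ℕ} {ψ : ℂ → ℂ} (L : LinData c n ℓ ψ)
include L

theorem fix : (P c)^[n] (ψ 0) = ψ 0 := by
  have := L.hfun 0
  rw [mul_zero] at this
  exact this.symm

theorem G_fix : G c (ψ 0) = 0 := by
  have := G_iterate c (ψ 0) n
  rw [L.fix] at this
  have h2 : (2 : ℝ) ≤ 2 ^ n := by
    calc (2 : ℝ) = 2 ^ 1 := by norm_num
      _ ≤ _ := pow_le_pow_right₀ (by norm_num) L.hn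
  have := G_nonneg c (ψ 0)
  nlinarith

theorem fun_pow (u : ℂ) (k : ℕ) : ψ (exp ℓ ^ k * u) = (P c)^[n * k] (ψ u) := by
  induction k with
  | zero => simp
  | succ k ih => rw [pow_succ', mul_assoc, L.hfun, ih, ← iterate_add_apply, mul_add_one, add_comm]

theorem G_pow (u : ℂ) (k : ℕ) : G c (ψ (exp ℓ ^ k * u)) = 2 ^ (n * k) * G c (ψ u) := by
  rw [L.fun_pow, G_iterate]

theorem one_lt : 1 < ‖exp ℓ‖ := by
  rw [norm_exp]; exact one_lt_exp_iff.2 L.hre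

theorem exists_local_inverse : ∃ φ : ℂ → ℂ, ∃ N ∈ 𝓝 (ψ 0), HolOn φ N ∧
    (∀ z ∈ N, ψ (φ z) = z ∧ φ ((P c)^[n] z) = exp ℓ * φ z) ∧ φ (ψ 0) = 0 ∧
    ∀ᶠ u in 𝓝 0, φ (ψ u) = u := by
  have hd0 : deriv ψ 0 ≠ 0 := by rw [L.hd]; exact one_ne_zero
  obtain ⟨N, hN, hi⟩ := exists_injOn_nhds
    (hasStrictDerivAt_of_holo isOpen_univ L.hψ.differentiableOn (mem_univ 0)) hd0
  obtain ⟨s, hs, hsN⟩ := Metric.mem_nhds_iff.1 hN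
  have hi' := hi.mono hsN
  obtain ⟨φ, hφd, hφ1, hφ2⟩ := exists_inverse_of_injOn isOpen_ball L.hψ.differentiableOn hi'
  have hm := L.one_lt
  have hm0 : 0 < ‖exp ℓ‖ := by linarith
  set s' := s / ‖exp ℓ‖ with hs'
  have hs'0 : 0 < s' := by positivity
  have hss : ball (0 : ℂ) s' ⊆ ball 0 s := ball_subset_ball (div_le_self hs.le hm.le)
  refine ⟨φ, ψ '' ball 0 s', ?_, hφd.mono (image_mono hss), ?_, hφ1 0 (mem_ball_self hs), ?_⟩
  · exact (isOpen_image_of_injOn isOpen_ball L.hψ.differentiableOn (hi'.mono hss)).mem_nhds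
      (mem_image_of_mem _ (mem_ball_self hs'0))
  · rintro _ ⟨v, hv, rfl⟩
    refine ⟨by rw [hφ1 v (hss hv)], ?_⟩
    rw [← L.hfun, hφ1 v (hss hv), hφ1]
    rw [mem_ball_zero_iff, norm_mul]
    rw [mem_ball_zero_iff, hs', lt_div_iff₀ hm0] at hv
    linarith
  · filter_upwards [ball_mem_nhds (0 : ℂ) hs] with u hu using hφ1 u hu

theorem tendsto_div_pow (u : ℂ) : Tendsto (fun k : ℕ => u / exp ℓ ^ k) atTop (𝓝 0) := by
  have h := (tendsto_pow_atTop_nhds_zero_of_norm_lt_one (x := (exp ℓ)⁻¹)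
    (by rw [norm_inv]; exact inv_lt_one_of_one_lt₀ L.one_lt)).const_mul u
  simpa [div_eq_mul_inv] using h

attribute [local irreducible] G Ψ gB in
theorem exists_lift {ζ0 x0 : ℂ} (hx₀ : x0 ∈ rhp)
    (h0 : ψ (exp ζ0) = Ψ c (exp x0)) :
    ∃ E, IsLift c ψ E ∧ E x0 = ζ0 ∧ InjOn (fun x => exp (E x)) rhp := by
  obtain ⟨φ, N, hN, hφd, hφ, hφ0, hφψ⟩ := L.exists_local_inverse
  have hm := L.one_lt
  set μ := exp ℓ with hμ
  have hμ0 : μ ≠ 0 := exp_ne_zero _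
  set u0 := exp ζ0 with hu₀
  have hGk : ∀ k, G c (ψ (u0 / μ ^ k)) * 2 ^ (n * k) = x0.re := fun k => by
    rw [mul_comm, ← L.G_pow, mul_div_cancel₀ _ (pow_ne_zero _ hμ0), h0, G_Ψ_exp L.hc hx₀]
  have hGp : ∀ k, 0 < G c (ψ (u0 / μ ^ k)) := fun k => by
    have h1 : 0 < x0.re := hx₀
    rw [← hGk k] at h1
    exact pos_of_mul_pos_left h1 (by positivity)
  choose y hy hyz using fun k => exists_Ψ_exp L.hc (hGp k)
  have hyre : ∀ k, (y k).re * 2 ^ (n * k) = x0.re := fun k => by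
    rw [← hGk k, ← hyz k, G_Ψ_exp L.hc (hy k)]
  set A : ℕ → ℂ → ℂ := fun k x => y k + (x - x0) / ((2 ^ (n * k) : ℝ) : ℂ) with hA
  have hAre : ∀ k x, (A k x).re = x.re / 2 ^ (n * k) := fun k x => by
    have : (0 : ℝ) < 2 ^ (n * k) := by positivity
    simp only [hA, add_re, div_ofReal_re, sub_re]
    rw [← hyre k]
    field_simp
    ring
  have hAr : ∀ k, ∀ x ∈ rhp, A k x ∈ rhp := fun k x hx => by
    rw [rhp, mem_ofPred_eq, hAre]; exact div_pos hx (by positivity)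
  have hAd : ∀ k, Differentiable ℂ (A k) := fun k => by fun_prop
  set E : ℕ → ℂ → ℂ := fun k x => Ψ c (exp (A k x)) with hE
  have hEd : ∀ k, HolOn (E k) rhp := fun k =>
    (differentiableOn_Ψ_exp L.hc).comp (hAd k).differentiableOn (hAr k)
  have hEx0 : ∀ k, E k x0 = ψ (u0 / μ ^ k) := fun k => by simp [hE, hA, hyz]
  have hexpy : ∀ k, exp (2 ^ n * y (k + 1)) = exp (y k) := fun k => by
    refine Ψ_exp_inj L.hc ?_ (hy k) ?_
    · have h1 : 0 < (y (k + 1)).re := hy (k + 1)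
      rw [rhp, mem_ofPred_eq, show (2 : ℂ) ^ n = ((2 ^ n : ℝ) : ℂ) by push_cast; rfl, re_ofReal_mul]
      positivity
    · rw [← iterate_Ψ_exp L.hc (hy _), hyz, hyz, ← L.hfun, ← hμ, pow_succ', ← mul_div_assoc,
        mul_div_mul_left _ _ hμ0]
  have hEf : ∀ k, ∀ x ∈ rhp, (P c)^[n] (E (k + 1) x) = E k x := fun k x hx => by
    simp only [hE]
    rw [iterate_Ψ_exp L.hc (hAr _ x hx)]
    simp only [hA]
    rw [mul_add, exp_add, hexpy, ← exp_add]
    congr 3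
    rw [mul_add_one, pow_add]
    push_cast
    field_simp
  have hlb : LocBdd atTop (fun k x => E k x - ψ 0) rhp := by
    intro z hz
    obtain ⟨r, hr, hball⟩ := isOpen_iff.1 isOpen_rhp z hz
    refine ⟨min r 1, by positivity, rexp (gB c) * rexp (z.re + 1) + ‖ψ 0‖, Eventually.of_forall fun k =>
      ⟨((hEd k).mono fun x hx => hball (ball_min_left hx)).sub_const _, fun w hw => ?_⟩⟩
    have hwr := hball (ball_min_left hw)
    have hw0 : 0 < w.re := hwr
    have hw1 : w.re ≤ z.re + 1 := by
      have h1 := (abs_re_le_norm (w - z)).trans_lt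
        (by simpa [dist_eq_norm] using (ball_min_right hw : w ∈ ball z 1))
      rw [sub_re] at h1
      linarith [(abs_lt.1 h1).2]
    refine (norm_sub_le _ _).trans (add_le_add_left ((norm_Ψ_le (exp_mem_dom L.hc (hAr k w hwr))).trans ?_) _)
    refine mul_le_mul_of_nonneg_left ?_ (exp_pos _).le
    rw [norm_exp, hAre, exp_le_exp]
    exact (div_le_self hw0.le (one_le_pow₀ (by norm_num))).trans hw1
  have hne : ∀ᶠ k in atTop, ∀ x ∈ rhp, E k x - ψ 0 ≠ 0 := Eventually.of_forall fun k x hx h => by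
    have h1 := G_Ψ_exp L.hc (hAr k x hx)
    have h2 : 0 < (A k x).re := hAr k x hx
    rw [← h1] at h2
    simp only [hE, sub_eq_zero] at h
    rw [h, L.G_fix] at h2
    exact lt_irrefl _ h2
  have hEx0t : Tendsto (fun k => E k x0 - ψ 0) atTop (𝓝 0) := by
    simp only [hEx0]
    have := (L.hψ.continuous.tendsto 0).comp (L.tendsto_div_pow u0)
    simpa using this.sub_const (ψ 0)
  have hlim := hlb.tendsto_zero_of_ne_zero isOpen_rhp convex_rhp.isPreconnected hne hx₀ hEx0t
  have hunif := hlb.tendstoLocallyUniformlyOn hlim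
  have hloc : ∀ x ∈ rhp, ∃ t ∈ 𝓝 x, t ⊆ rhp ∧ ∃ k0, ∀ k ≥ k0, ∀ y ∈ t, E k y ∈ interior N := by
    intro x hx
    obtain ⟨ε, hε, hεN⟩ := Metric.mem_nhds_iff.1 (interior_mem_nhds.2 hN)
    obtain ⟨t, ht, h⟩ := tendstoLocallyUniformlyOn_iff.1 hunif ε hε x hx
    rw [isOpen_rhp.nhdsWithin_eq hx] at ht
    obtain ⟨k0, hk₀⟩ := eventually_atTop.1 h
    refine ⟨t ∩ rhp, inter_mem ht (isOpen_rhp.mem_nhds hx), inter_subset_right, k0, fun k hk y hy => hεN ?_⟩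
    have := hk₀ k hk y hy.1
    rwa [dist_zero_left, ← dist_eq_norm] at this
  have hconst : ∀ x ∈ rhp, ∀ k0, (∀ k ≥ k0, E k x ∈ interior N) → ∀ k ≥ k0,
      μ ^ k * φ (E k x) = μ ^ k0 * φ (E k0 x) := by
    intro x hx k0 h k hk
    induction k, hk using Nat.le_induction with
    | base => rfl
    | succ k hk ih =>
      rw [← ih, ← hEf k x hx, (hφ _ (interior_subset (h (k + 1) (by omega)))).2, pow_succ, mul_assoc]
  have hex : ∀ x ∈ rhp, ∃ w, ∀ᶠ k in atTop, μ ^ k * φ (E k x) = w ∧ E k x ∈ N := by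
    intro x hx
    obtain ⟨t, ht, -, k0, h⟩ := hloc x hx
    exact ⟨_, eventually_atTop.2 ⟨k0, fun k hk => ⟨hconst x hx k0
      (fun j hj => h j hj x (mem_of_mem_nhds ht)) k hk, interior_subset (h k hk x (mem_of_mem_nhds ht))⟩⟩⟩
  choose! W hW using hex
  have hWd : HolOn W rhp := by
    intro x hx
    obtain ⟨t, ht, htr, k0, h⟩ := hloc x hx
    have hd : DifferentiableAt ℂ (fun x => μ ^ k0 * φ (E k0 x)) x := by
      refine DifferentiableAt.const_mul (DifferentiableAt.comp (g := φ) x ?_ ((hEd k0).differentiableAt (isOpen_rhp.mem_nhds hx))) _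
      exact hφd.differentiableAt (mem_interior_iff_mem_nhds.1 (h k0 le_rfl x (mem_of_mem_nhds ht)))
    refine (hd.congr_of_eventuallyEq ?_).differentiableWithinAt
    filter_upwards [ht] with y hy
    obtain ⟨k, hk, hk2⟩ := ((hW y (htr hy)).and (eventually_ge_atTop k0)).exists
    rw [← hk.1, hconst y (htr hy) k0 (fun j hj => h j hj y hy) k hk2]
  have hWψ : ∀ x ∈ rhp, ψ (W x) = Ψ c (exp x) := by
    intro x hx
    obtain ⟨k, hk, hkN⟩ := (hW x hx).exists
    rw [← hk, L.fun_pow, (hφ _ hkN).1]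
    have : ∀ k, (P c)^[n * k] (E k x) = E 0 x := fun k => by
      induction k with
      | zero => rfl
      | succ k ih => rw [mul_add_one, iterate_add_apply, hEf k x hx, ih]
    rw [this k]
    simp only [hE, hA]
    have hy0 : exp (y 0) = exp x0 := by
      refine Ψ_exp_inj L.hc (hy 0) hx₀ ?_
      rw [hyz 0, ← h0, pow_zero, div_one]
    rw [exp_add, hy0, ← exp_add]
    congr 2
    simp
  have hW0 : ∀ x ∈ rhp, W x ≠ 0 := by
    intro x hx h
    have h1 := hWψ x hx
    rw [h] at h1
    have h2 := G_Ψ_exp L.hc hx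
    rw [← h1, L.G_fix] at h2
    exact (ne_of_gt hx) h2.symm
  have hWi : InjOn W rhp := by
    intro x₁ h₁ x₂ h₂ h
    have hsm : Tendsto (fun k : ℕ => ‖x₁ - x₂‖ / 2 ^ (n * k)) atTop (𝓝 0) := by
      refine tendsto_const_nhds.div_atTop ?_
      simp only [pow_mul]
      exact tendsto_pow_atTop_atTop_of_one_lt (one_lt_pow₀ (by norm_num) (by have := L.hn; omega))
    obtain ⟨k, ⟨hk1, hN1⟩, ⟨hk2, hN2⟩, hk3⟩ := ((hW x₁ h₁).and ((hW x₂ h₂).and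
      (hsm.eventually_lt_const one_pos))).exists
    rw [← h, ← hk1] at hk2
    have e1 : E k x₁ = E k x₂ := by
      rw [← (hφ _ hN1).1, ← (hφ _ hN2).1, mul_left_cancel₀ (pow_ne_zero _ hμ0) hk2]
    have e2 := Ψ_exp_inj L.hc (hAr k _ h₁) (hAr k _ h₂) e1
    obtain ⟨m, hm⟩ := exp_eq_exp_iff_exists_int.1 e2
    simp only [hA] at hm
    have e3 : (x₁ - x₂) / ((2 ^ (n * k) : ℝ) : ℂ) = m * (2 * π * I) := by
      have : (x₁ - x₂) / ((2 ^ (n * k) : ℝ) : ℂ) = (x₁ - x0) / ((2 ^ (n * k) : ℝ) : ℂ) - (x₂ - x0) / ((2 ^ (n * k) : ℝ) : ℂ) := by ring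
      rw [this]
      linear_combination hm
    have e4 : ‖(x₁ - x₂) / ((2 ^ (n * k) : ℝ) : ℂ)‖ < 1 := by
      rw [norm_div, norm_real, Real.norm_of_nonneg (by positivity)]; exact hk3
    have hm0 : m = 0 := by
      by_contra hm0
      have : (1 : ℝ) ≤ |(m : ℝ)| := by exact_mod_cast Int.one_le_abs hm0
      rw [e3] at e4
      simp [abs_of_pos pi_pos] at e4
      nlinarith [Real.pi_gt_three]
    rw [hm0, Int.cast_zero, zero_mul, div_eq_zero_iff] at e3
    rcases e3 with e3 | e3
    · exact sub_eq_zero.1 e3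
    · exact absurd e3 (by norm_cast; positivity)
  obtain ⟨g, hgd, hg⟩ := exists_log isOpen_rhp (convex_rhp.starConvex (x := 1) (by simp [rhp])) hWd hW0
  have hWx0 : W x0 = u0 := by
    obtain ⟨k, hk, h2⟩ := ((hW x0 hx₀).and ((L.tendsto_div_pow u0).eventually hφψ)).exists
    rw [← hk.1, hEx0, h2, mul_div_cancel₀ _ (pow_ne_zero _ hμ0)]
  obtain ⟨m, hm⟩ := exp_eq_exp_iff_exists_int.1 (show exp ζ0 = exp (g x0) by
    rw [hg x0 hx₀, hWx0])
  have hexp : ∀ x, exp (g x + m * (2 * π * I)) = exp (g x) := fun x =>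
    exp_eq_exp_iff_exists_int.2 ⟨m, rfl⟩
  refine ⟨fun x => g x + m * (2 * π * I), ⟨hgd.add_const _, fun x hx => ?_⟩, hm.symm, ?_⟩
  · rw [hexp, hg x hx, hWψ x hx]
  · intro x₁ h₁ x₂ h₂ h
    simp only [hexp, hg x₁ h₁, hg x₂ h₂] at h
    exact hWi h₁ h₂ h

end LinData

theorem deriv_Ψ_exp_ne_zero {c : ℂ} (hc : c ∈ Mandelbrot) {a : ℝ} (ha : 0 < a) {x : ℂ} (hx : x ∈ rhp) :
    ∃ d ≠ 0, HasDerivAt (fun x : ℂ => Ψ c (exp (a * x))) d x := by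
  have hax : (a : ℂ) * x ∈ rhp := by
    have hx : 0 < x.re := hx
    rw [rhp, mem_ofPred_eq, re_ofReal_mul]; positivity
  have ho : IsOpen {w : ℂ | rexp (G c 0) < ‖w‖} := isOpen_norm_gt _
  have h1 := ((isBott c).hol.differentiableAt (ho.mem_nhds (exp_mem_dom hc hax))).hasDerivAt
  have h2 : HasDerivAt (fun x : ℂ => exp (a * x)) (exp (a * x) * (a * 1)) x :=
    ((hasDerivAt_id x).const_mul (a : ℂ)).cexp
  refine ⟨_, ?_, h1.comp x h2⟩
  refine mul_ne_zero (deriv_ne_zero_of_injOn ho (isBott c).hol (isBott c).inj (exp_mem_dom hc hax))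
    (mul_ne_zero (exp_ne_zero _) ?_)
  simpa using ha.ne'

theorem lift_eqOn {c : ℂ} (hc : c ∈ Mandelbrot) {ψ g1 g2 : ℂ → ℂ} (hψ : Differentiable ℂ ψ) {a : ℝ}
    (ha : 0 < a) (h₁ : HolOn g1 rhp) (h₂ : HolOn g2 rhp)
    (e₁ : ∀ x ∈ rhp, ψ (exp (g1 x)) = Ψ c (exp (a * x)))
    (e₂ : ∀ x ∈ rhp, ψ (exp (g2 x)) = Ψ c (exp (a * x)))
    {x : ℂ} (hx : x ∈ rhp) (h : g1 x = g2 x) : EqOn g1 g2 rhp := by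
  obtain ⟨d, hd, hdx⟩ := deriv_Ψ_exp_ne_zero hc ha hx
  set p : ℂ → ℂ := fun ζ => ψ (exp ζ) with hp
  have hpd : Differentiable ℂ p := hψ.comp differentiable_exp
  have hp' : deriv p (g1 x) ≠ 0 := by
    intro h0
    have h3 : HasDerivAt (fun y => p (g1 y)) _ x :=
      (hpd (g1 x)).hasDerivAt.comp x (h₁.differentiableAt (isOpen_rhp.mem_nhds hx)).hasDerivAt
    rw [h0, zero_mul] at h3
    have h4 := h3.congr_of_eventuallyEq (f₁ := fun x : ℂ => Ψ c (exp (a * x))) (by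
      filter_upwards [isOpen_rhp.mem_nhds hx] with y hy using (e₁ y hy).symm)
    exact hd (hdx.unique h4)
  obtain ⟨N, hN, hi⟩ := exists_injOn_nhds
    (hasStrictDerivAt_of_holo isOpen_univ hpd.differentiableOn (mem_univ _)) hp'
  refine eqOn_of_eventuallyEq_holo isOpen_rhp convex_rhp.isPreconnected h₁ h₂ hx ?_
  have c₁ := (h₁.continuousOn.continuousAt (isOpen_rhp.mem_nhds hx))
  have c₂ := (h₂.continuousOn.continuousAt (isOpen_rhp.mem_nhds hx))
  refine Filter.Eventually.frequently (Filter.Eventually.filter_mono nhdsWithin_le_nhds ?_)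
  filter_upwards [c₁ hN, c₂ (by rwa [← h]), isOpen_rhp.mem_nhds hx] with y hy₁ hy₂ hy
  exact hi hy₁ hy₂ (by simp only [hp]; rw [e₁ y hy, e₂ y hy])

/-- The lattice vector `a ℓ + 2π i b`. -/
noncomputable def lat (ℓ : ℂ) (a b : ℤ) : ℂ := a * ℓ + b * (2 * π * I)

theorem lat_add (ℓ : ℂ) (a b a' b' : ℤ) : lat ℓ (a + a') (b + b') = lat ℓ a b + lat ℓ a' b' := by
  simp only [lat]; push_cast; ring

theorem lat_re (ℓ : ℂ) (a b : ℤ) : (lat ℓ a b).re = a * ℓ.re := by simp [lat]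

/-- `ζ` and its translate by a lattice vector lie in one component. -/
abbrev Joins (c ℓ : ℂ) (ψ : ℂ → ℂ) (ζ : ℂ) (a b : ℤ) : Prop :=
  JoinedIn (escLog c ψ) ζ (ζ + lat ℓ a b)

theorem exp_lat (ℓ : ℂ) (a : ℕ) (b : ℤ) : exp (lat ℓ a b) = exp ℓ ^ a := by
  rw [lat, exp_add, Complex.exp_int_mul_two_pi_mul_I, mul_one, ← exp_nat_mul]
  push_cast; rfl

namespace LinData

variable {c ℓ : ℂ} {n : ℕ} {ψ : ℂ → ℂ} (L : LinData c n ℓ ψ)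
include L

theorem mem_escLog_lat {ζ : ℂ} (a : ℕ) (b : ℤ) : ζ + lat ℓ a b ∈ escLog c ψ ↔ ζ ∈ escLog c ψ := by
  simp only [escLog, mem_ofPred_eq]
  rw [exp_add, exp_lat, mul_comm, L.G_pow]
  have : (0 : ℝ) < 2 ^ (n * a) := by positivity
  exact mul_pos_iff_of_pos_left this

theorem mem_escLog_lat' {ζ : ℂ} (a b : ℤ) : ζ + lat ℓ a b ∈ escLog c ψ ↔ ζ ∈ escLog c ψ := by
  obtain ⟨k, rfl | rfl⟩ := a.eq_nat_or_neg
  · exact L.mem_escLog_lat k b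
  · rw [← L.mem_escLog_lat (ζ := ζ + lat ℓ (-k) b) k (-b), add_assoc, ← lat_add]
    simp [lat]

theorem exists_lift_mem {ζ : ℂ} (hζ : ζ ∈ escLog c ψ) :
    ∃ E, IsLift c ψ E ∧ ∃ x ∈ rhp, E x = ζ := by
  obtain ⟨x, hx, h⟩ := exists_Ψ_exp L.hc hζ
  obtain ⟨E, hE, h2, -⟩ := L.exists_lift hx h.symm
  exact ⟨E, hE, x, hx, h2⟩

theorem lift_unique {E1 E2 : ℂ → ℂ} (h₁ : IsLift c ψ E1) (h₂ : IsLift c ψ E2) {x : ℂ} (hx : x ∈ rhp)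
    (h : E1 x = E2 x) : EqOn E1 E2 rhp :=
  lift_eqOn L.hc L.hψ one_pos h₁.1 h₂.1 (by simpa using h₁.2) (by simpa using h₂.2) hx h

theorem injOn_exp_lift {E : ℂ → ℂ} (h : IsLift c ψ E) : InjOn (fun x => exp (E x)) rhp := by
  have h1 : (1 : ℂ) ∈ rhp := by simp [rhp]
  obtain ⟨E', hE', h2, hi⟩ := L.exists_lift h1 (h.2 1 h1)
  refine hi.congr fun x hx => ?_
  simp only
  rw [L.lift_unique hE' h h1 h2 hx]

theorem mem_escLog_lift {E : ℂ → ℂ} (h : IsLift c ψ E) {x : ℂ} (hx : x ∈ rhp) : E x ∈ escLog c ψ := by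
  simp only [escLog, mem_ofPred_eq]
  rw [h.2 x hx, G_Ψ_exp L.hc hx]; exact hx

theorem lift_translate {E1 E2 : ℂ → ℂ} (h₁ : IsLift c ψ E1) (h₂ : IsLift c ψ E2) {x₁ x₂ : ℂ}
    (hx₁ : x₁ ∈ rhp) (hx2 : x₂ ∈ rhp) (a : ℕ) (b : ℤ) (h : E1 x₁ + lat ℓ a b = E2 x₂) :
    ∃ m : ℤ, x₂ = 2 ^ (n * a) * x₁ + m * (2 * π * I) ∧
      ∀ x ∈ rhp, E1 x + lat ℓ a b = E2 (2 ^ (n * a) * x + m * (2 * π * I)) := by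
  have e₁ : ∀ x ∈ rhp, ψ (exp (E1 x + lat ℓ a b)) =
      Ψ c (exp (((2 ^ (n * a) : ℝ) : ℂ) * x)) := fun x hx => by
    rw [exp_add, exp_lat, mul_comm, L.fun_pow, h₁.2 x hx, iterate_Ψ_exp L.hc hx]
    push_cast; rfl
  have hpow : ((2 ^ (n * a) : ℝ) : ℂ) = 2 ^ (n * a) := by push_cast; rfl
  have hr : ∀ x ∈ rhp, ∀ m : ℤ, (2 : ℂ) ^ (n * a) * x + m * (2 * π * I) ∈ rhp := by
    intro x hx m
    have hx : 0 < x.re := hx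
    rw [← hpow, rhp, mem_ofPred_eq, add_re, re_ofReal_mul]
    simp
    positivity
  have h3 := e₁ x₁ hx₁
  rw [h, h₂.2 x₂ hx2, hpow] at h3
  have h4 := Ψ_exp_inj L.hc hx2 (by simpa using hr x₁ hx₁ 0) h3
  obtain ⟨m, hm⟩ := exp_eq_exp_iff_exists_int.1 h4
  refine ⟨m, hm, ?_⟩
  refine lift_eqOn L.hc L.hψ (a := 2 ^ (n * a)) (by positivity) (h₁.1.add_const _)
    (h₂.1.comp (by fun_prop) fun x hx => hr x hx m) e₁ (fun x hx => ?_) hx₁ (h.trans (by rw [hm]))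
  rw [h₂.2 _ (hr x hx m), exp_add, Complex.exp_int_mul_two_pi_mul_I, mul_one, hpow]

theorem lift_injOn {E : ℂ → ℂ} (h : IsLift c ψ E) : InjOn E rhp := fun _ hx _ hy hxy =>
  L.injOn_exp_lift h hx hy (by simp only [hxy])

theorem isOpen_lift_image {E : ℂ → ℂ} (h : IsLift c ψ E) : IsOpen (E '' rhp) :=
  isOpen_image_of_injOn isOpen_rhp h.1 (L.lift_injOn h)

theorem mem_lift_of_joinedIn {E : ℂ → ℂ} (h : IsLift c ψ E) {ζ ζ' : ℂ} (hζ : ζ ∈ E '' rhp)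
    (hj : JoinedIn (escLog c ψ) ζ ζ') : ζ' ∈ E '' rhp := by
  obtain ⟨p, hp⟩ := hj
  have hs : IsPreconnected (range p) := isPreconnected_range p.continuous
  refine hs.subset_of_closure_inter_subset (L.isOpen_lift_image h) ⟨ζ, ⟨0, p.source⟩, hζ⟩ ?_ ⟨1, p.target⟩
  rintro z ⟨hz, ⟨t, rfl⟩⟩
  obtain ⟨E', hE', y, hy, hyt⟩ := L.exists_lift_mem (hp t)
  obtain ⟨w, ⟨y', hy', rfl⟩, x, hx, hxy⟩ := mem_closure_iff.1 hz _ (L.isOpen_lift_image hE') ⟨y, hy, hyt⟩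
  obtain ⟨m, hm, hall⟩ := L.lift_translate h hE' hx hy' 0 0 (by simp [lat, hxy])
  refine ⟨y - m * (2 * π * I), ?_, ?_⟩
  · have hy : 0 < y.re := hy
    simp [rhp, hy]
  · have := hall (y - m * (2 * π * I)) (by
      have hy : 0 < y.re := hy
      simp [rhp, hy])
    simpa [lat, hyt] using this

theorem joinedIn_lift {E : ℂ → ℂ} (h : IsLift c ψ E) {x y : ℂ} (hx : x ∈ rhp) (hy : y ∈ rhp) :
    JoinedIn (escLog c ψ) (E x) (E y) := by
  have hp : IsPathConnected rhp := convex_rhp.isPathConnected ⟨x, hx⟩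
  have := (hp.image' h.1.continuousOn).joinedIn _ (mem_image_of_mem E hx) _ (mem_image_of_mem E hy)
  exact this.mono (by rintro _ ⟨z, hz, rfl⟩; exact L.mem_escLog_lift h hz)

theorem joinedIn_translate {ζ ζ' : ℂ} (h : JoinedIn (escLog c ψ) ζ ζ') (a b : ℤ) :
    JoinedIn (escLog c ψ) (ζ + lat ℓ a b) (ζ' + lat ℓ a b) := by
  obtain ⟨p, hp⟩ := h
  exact ⟨p.map (f := fun z => z + lat ℓ a b) (by fun_prop), fun t => (L.mem_escLog_lat' a b).2 (hp t)⟩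

theorem joinedIn_lat_add {ζ : ℂ} {a b a' b' : ℤ} (h : Joins c ℓ ψ ζ a b)
    (h' : Joins c ℓ ψ ζ a' b') :
    Joins c ℓ ψ ζ (a + a') (b + b') := by
  have := h.trans (L.joinedIn_translate h' a b)
  rwa [add_assoc, add_comm (lat ℓ a' b'), ← lat_add] at this

theorem joinedIn_lat_neg {ζ : ℂ} {a b : ℤ} (h : Joins c ℓ ψ ζ a b) :
    Joins c ℓ ψ ζ (-a) (-b) := by
  have := (L.joinedIn_translate h (-a) (-b)).symm
  rwa [add_assoc, ← lat_add, show lat ℓ (a + -a) (b + -b) = 0 by simp [lat], add_zero] at this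

theorem joinedIn_lat_mul {ζ : ℂ} {a b : ℤ} (h : Joins c ℓ ψ ζ a b) (k : ℤ) :
    Joins c ℓ ψ ζ (k * a) (k * b) := by
  have hz : Joins c ℓ ψ ζ 0 0 := by
    simpa [Joins, lat] using JoinedIn.refl h.source_mem
  have hnat : ∀ k : ℕ, Joins c ℓ ψ ζ (k * a) (k * b) := fun k => by
    induction k with
    | zero => simpa using hz
    | succ k ih => simpa [add_mul] using L.joinedIn_lat_add ih h
  obtain ⟨j, rfl | rfl⟩ := k.eq_nat_or_neg
  · exact hnat j
  · simpa using L.joinedIn_lat_neg (hnat j)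

theorem joinedIn_lat_zero {ζ : ℂ} {b : ℤ} (h : Joins c ℓ ψ ζ 0 b) : b = 0 := by
  obtain ⟨E, hE, x, hx, rfl⟩ := L.exists_lift_mem h.source_mem
  obtain ⟨y, hy, hxy⟩ := L.mem_lift_of_joinedIn hE ⟨x, hx, rfl⟩ h
  have : x = y := L.injOn_exp_lift hE hx hy (by
    simp only
    rw [hxy, exp_add, show (0 : ℤ) = ((0 : ℕ) : ℤ) by rfl, exp_lat, pow_zero, mul_one])
  subst this
  simp [lat] at hxy
  exact hxy

/-- Lattice vectors joining points of one component are parallel. -/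
theorem joinedIn_lat_parallel {ζ : ℂ} {a b a' b' : ℤ} (h : Joins c ℓ ψ ζ a b)
    (h' : Joins c ℓ ψ ζ a' b') : a' * b = a * b' := by
  have := L.joinedIn_lat_add (L.joinedIn_lat_mul h a') (L.joinedIn_lat_mul h' (-a))
  rw [show a' * a + -a * a' = 0 by ring] at this
  have := L.joinedIn_lat_zero this
  linarith

end LinData

open MeasureTheory in
theorem volume_le_of_lat {ℓ : ℂ} (hℓ : 0 < ℓ.re) {A : Set ℂ} (hA : IsOpen A)
    (h : ∀ x ∈ A, ∀ y ∈ A, ∀ a b : ℤ, x + lat ℓ a b = y → lat ℓ a b = 0) :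
    volume A ≤ ENNReal.ofReal (2 * π * ℓ.re) := by
  set v : Fin 2 → ℂ := ![ℓ, 2 * π * I] with hv
  have hli : LinearIndependent ℝ v := by
    rw [LinearIndependent.pair_iff]
    intro s t hst
    have h1 := congrArg Complex.re hst
    have h2 := congrArg Complex.im hst
    simp at h1 h2
    have hs : s = 0 := by
      rcases h1 with h1 | h1
      · exact h1
      · exact absurd h1 hℓ.ne'
    subst hs
    simpa [Real.pi_ne_zero] using h2
  set b := basisOfLinearIndependentOfCardEqFinrank hli (by simp [Complex.finrank_real_complex]) with hb
  have hbv : ⇑b = v := coe_basisOfLinearIndependentOfCardEqFinrank _ _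
  have hvol : volume (ZSpan.fundamentalDomain b) = ENNReal.ofReal (2 * π * ℓ.re) := by
    rw [ZSpan.measure_fundamentalDomain b volume Complex.orthonormalBasisOneI.toBasis,
      measure_congr (ZSpan.fundamentalDomain_ae_parallelepiped _ volume),
      OrthonormalBasis.coe_toBasis, Complex.orthonormalBasisOneI.volume_parallelepiped, mul_one]
    congr 1
    rw [Complex.toBasis_orthonormalBasisOneI, Module.Basis.det_apply, Matrix.det_fin_two]
    simp [Module.Basis.toMatrix_apply, hbv, hv, Complex.basisOneI]
    rw [abs_of_pos hℓ, abs_of_pos pi_pos]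
    ring
  by_contra hlt
  rw [not_le, ← hvol] at hlt
  have : VAddInvariantMeasure (Submodule.span ℤ (range b)) ℂ volume :=
    inferInstanceAs <| VAddInvariantMeasure (Submodule.span ℤ (range b)).toAddSubgroup ℂ volume
  obtain ⟨x, hx, y, hy, ⟨g, hg⟩, hg0, hxy⟩ := (ZSpan.isAddFundamentalDomain b volume).exists_ne_zero_vadd_eq
    hA.measurableSet.nullMeasurableSet hlt
  obtain ⟨k, hk⟩ := (Submodule.mem_span_range_iff_exists_fun ℤ).1 hg
  rw [Fin.sum_univ_two, hbv] at hk
  have hgl : lat ℓ (k 0) (k 1) = g := by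
    rw [← hk]; simp [lat, hv]
  have hxy' : g + x = y := hxy
  have := h x hx y hy (k 0) (k 1) (by rw [hgl, add_comm]; exact hxy')
  exact hg0 (Subtype.ext (hgl.symm.trans this))

open MeasureTheory in
theorem norm_sub_sq_le_integral {h : ℂ → ℂ} {T y : ℝ} (hT : 0 < T)
    {U : Set ℂ} (hU : IsOpen U) (hh : HolOn h U)
    (hy : ∀ x ∈ Icc 0 T, ((x : ℂ) + y * I) ∈ U) :
    ENNReal.ofReal (‖h (T + y * I) - h (y * I)‖ ^ 2 / T) ≤
      ∫⁻ x in Ioo 0 T, ENNReal.ofReal (‖deriv h (x + y * I)‖ ^ 2) := by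
  set g : ℝ → ℂ := fun x => deriv h (x + y * I) with hg
  have hgc : ContinuousOn g (Icc 0 T) :=
    ((hh.deriv hU).continuousOn).comp (by fun_prop) hy
  have hgc' : ContinuousOn (fun x => ‖g x‖) (Icc 0 T) := hgc.norm
  have hgc2 : ContinuousOn (fun x => ‖g x‖ ^ 2) (Icc 0 T) := hgc'.pow 2
  have huI : uIcc 0 T = Icc 0 T := uIcc_of_le hT.le
  have hint : ∫ x in (0 : ℝ)..T, g x = h (T + y * I) - h (y * I) := by
    have := intervalIntegral.integral_eq_sub_of_hasDerivAt (a := 0) (b := T)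
      (f := fun x : ℝ => h (x + y * I)) (f' := g) (fun x hx => ?_) (by
        apply ContinuousOn.intervalIntegrable; rwa [huI])
    · simpa using this
    · rw [huI] at hx
      have h1 := (hh.differentiableAt (hU.mem_nhds (hy x hx))).hasDerivAt
      have h2 : HasDerivAt (fun z : ℂ => h (z + y * I)) (g x) (x : ℂ) :=
        h1.comp_add_const (x : ℂ) (y * I)
      exact h2.comp_ofReal
  set δ := ‖h (T + y * I) - h (y * I)‖ with hδ
  have h1 : δ ≤ ∫ x in (0 : ℝ)..T, ‖g x‖ := by
    rw [hδ, ← hint]; exact intervalIntegral.norm_integral_le_integral_norm hT.le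
  have hδ0 : 0 ≤ δ := norm_nonneg _
  have h2 : ∫ x in (0 : ℝ)..T, (2 * (δ / T) * ‖g x‖ - (δ / T) ^ 2) ≤ ∫ x in (0 : ℝ)..T, ‖g x‖ ^ 2 := by
    refine intervalIntegral.integral_mono_on hT.le ?_ ?_ fun x _ => ?_
    · apply ContinuousOn.intervalIntegrable; rw [huI]; fun_prop
    · apply ContinuousOn.intervalIntegrable; rwa [huI]
    · nlinarith [sq_nonneg (‖g x‖ - δ / T)]
  rw [intervalIntegral.integral_sub (by apply ContinuousOn.intervalIntegrable; rw [huI]; fun_prop)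
    (by simp), intervalIntegral.integral_const_mul, intervalIntegral.integral_const] at h2
  have h3 : δ ^ 2 / T ≤ ∫ x in (0 : ℝ)..T, ‖g x‖ ^ 2 := by
    refine le_trans ?_ h2
    simp only [sub_zero, smul_eq_mul]
    have : 2 * (δ / T) * δ ≤ 2 * (δ / T) * ∫ x in (0 : ℝ)..T, ‖g x‖ := by gcongr
    have e : δ ^ 2 / T = 2 * (δ / T) * δ - T * (δ / T) ^ 2 := by field_simp; ring
    rw [e]; linarith
  rw [intervalIntegral.integral_of_le hT.le, integral_Ioc_eq_integral_Ioo] at h3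
  refine (ENNReal.ofReal_le_ofReal h3).trans ?_
  rw [ofReal_integral_eq_lintegral_ofReal]
  · exact (hgc2.integrableOn_Icc).mono_set Ioo_subset_Icc_self
  · exact Eventually.of_forall fun x => by positivity

theorem det_smul_one (d : ℂ) : (d • (1 : ℂ →L[ℝ] ℂ)).det = ‖d‖ ^ 2 := by
  rw [← Complex.normSq_eq_norm_sq, ← Algebra.norm_complex_apply, Algebra.norm_apply, ContinuousLinearMap.det]
  congr 1

open MeasureTheory in
/-- The length-area inequality for maps injective modulo a lattice. -/
theorem length_area {ℓ : ℂ} (hℓ : 0 < ℓ.re) {h : ℂ → ℂ} {T θ δ : ℝ} (hT : 0 < T) (hδ : 0 ≤ δ)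
    {U : Set ℂ} (hU : IsOpen U) (hh : HolOn h U)
    (hy : ∀ x ∈ Icc 0 T, ∀ y ∈ Ioo (-θ) θ, ((x : ℂ) + y * I) ∈ U)
    (hinj : ∀ u ∈ Ioo 0 T ×ℂ Ioo (-θ) θ, ∀ v ∈ Ioo 0 T ×ℂ Ioo (-θ) θ, ∀ a b : ℤ,
      h u + lat ℓ a b = h v → u = v)
    (hlow : ∀ y ∈ Ioo (-θ) θ, δ ≤ ‖h (T + y * I) - h (y * I)‖) :
    θ * δ ^ 2 ≤ T * π * ℓ.re := by
  set R : Set ℂ := Ioo 0 T ×ℂ Ioo (-θ) θ with hR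
  have hRo : IsOpen R := isOpen_Ioo.reProdIm isOpen_Ioo
  have hRU : R ⊆ U := fun u hu => by
    have := hy u.re (Ioo_subset_Icc_self hu.1) u.im hu.2
    rwa [re_add_im] at this
  have hi : InjOn h R := fun u hu v hv huv => hinj u hu v hv 0 0 (by simpa [lat] using huv)
  have h1 := volume_le_of_lat hℓ (isOpen_image_of_injOn hRo (hh.mono hRU) hi) (by
    rintro _ ⟨u, hu, rfl⟩ _ ⟨v, hv, rfl⟩ a b hab
    have := hinj u hu v hv a b hab
    rw [this] at hab
    simpa using hab)
  rw [← lintegral_abs_det_fderiv_eq_addHaar_image volume hRo.measurableSet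
    (f' := fun u => deriv h u • (1 : ℂ →L[ℝ] ℂ)) (fun u hu =>
      ((hh.differentiableAt (hU.mem_nhds (hRU hu))).hasDerivAt.complexToReal_fderiv).hasFDerivWithinAt) hi] at h1
  simp only [det_smul_one, abs_pow, abs_norm] at h1
  set F : ℂ → ENNReal := R.indicator fun u => ENNReal.ofReal (‖deriv h u‖ ^ 2) with hF
  have hFm : Measurable F := by
    refine Measurable.indicator ?_ hRo.measurableSet
    exact ((measurable_deriv h).norm.pow_const 2).ennreal_ofReal
  rw [← lintegral_indicator hRo.measurableSet, ← hF,
    ← (Complex.volume_preserving_equiv_real_prod.symm).lintegral_comp_emb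
      (measurableEquivRealProd.symm.measurableEmbedding), Measure.volume_eq_prod,
    lintegral_prod_symm (fun z => F (measurableEquivRealProd.symm z))
      (hFm.comp measurableEquivRealProd.symm.measurable).aemeasurable] at h1
  have h2 : ∫⁻ y in Ioo (-θ) θ, ENNReal.ofReal (δ ^ 2 / T) ≤
      ∫⁻ y, ∫⁻ x, F (measurableEquivRealProd.symm (x, y)) := by
    rw [← lintegral_indicator measurableSet_Ioo]
    refine lintegral_mono fun y => ?_
    by_cases hyθ : y ∈ Ioo (-θ) θ
    · rw [indicator_of_mem hyθ]
      have h3 := norm_sub_sq_le_integral hT hU hh (fun x hx => hy x hx y hyθ)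
      refine le_trans (ENNReal.ofReal_le_ofReal ?_) (h3.trans ?_)
      · have := hlow y hyθ
        gcongr
      · rw [← lintegral_indicator measurableSet_Ioo]
        refine lintegral_mono fun x => ?_
        by_cases hx : x ∈ Ioo 0 T
        · rw [indicator_of_mem hx, hF, Complex.measurableEquivRealProd_symm_apply, indicator_of_mem]
          · simp [Complex.mk_eq_add_mul_I]
          · exact ⟨hx, hyθ⟩
        · rw [indicator_of_notMem hx]; exact zero_le
    · rw [indicator_of_notMem hyθ]; exact zero_le
  have h4 := h2.trans h1
  rw [setLIntegral_const, Real.volume_Ioo, ← ENNReal.ofReal_mul (by positivity),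
    ENNReal.ofReal_le_ofReal_iff (by positivity)] at h4
  have e : δ ^ 2 / T * (θ - -θ) = 2 * (θ * δ ^ 2) / T := by ring
  rw [e, div_le_iff₀ hT] at h4
  linarith

theorem exists_bound_of_translate {C : ℝ → ℂ} {τ : ℂ} (hC : Continuous C) (h : ∀ t, C (t + 1) = C t + τ) :
    ∃ B, ∀ t : ℝ, ‖C t - t * τ‖ ≤ B := by
  have hp : Function.Periodic (fun t : ℝ => C t - t * τ) 1 := fun t => by
    beta_reduce; rw [h]; push_cast; ring
  obtain ⟨B, hB⟩ := (isCompact_Icc (a := (0 : ℝ)) (b := 1)).exists_bound_of_continuousOn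
    (f := fun t : ℝ => C t - t * τ) (by fun_prop)
  refine ⟨B, fun t => ?_⟩
  obtain ⟨y, hy, hty⟩ := hp.exists_mem_Ico₀ one_pos t
  rw [hty]; exact hB y (Ico_subset_Icc_self hy)

/-- Two periodic curves with independent translation vectors cross. -/
theorem exists_crossing {C₁ C₂ : ℝ → ℂ} {τ1 τ2 : ℂ} (h₁ : Continuous C₁) (h₂ : Continuous C₂)
    (e₁ : ∀ t, C₁ (t + 1) = C₁ t + τ1) (e₂ : ∀ t, C₂ (t + 1) = C₂ t + τ2)
    (hind : ∀ s t : ℝ, (s : ℂ) * τ1 = t * τ2 → s = 0 ∧ t = 0) : ∃ s t, C₁ s = C₂ t := by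
  by_contra! hne
  obtain ⟨B1, hB₁⟩ := exists_bound_of_translate h₁ e₁
  obtain ⟨B2, hB₂⟩ := exists_bound_of_translate h₂ e₂
  set H : ℂ → ℂ := fun v => C₁ v.re - C₂ v.im with hH
  set A : ℂ →ₗ[ℝ] ℂ := reLm.smulRight τ1 - imLm.smulRight τ2 with hA
  have hAv : ∀ v, A v = v.re * τ1 - v.im * τ2 := fun v => by simp [hA]
  have hker : LinearMap.ker A = ⊥ := by
    rw [LinearMap.ker_eq_bot']
    intro v hv
    rw [hAv, sub_eq_zero] at hv
    exact Complex.ext (hind _ _ hv).1 (hind _ _ hv).2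
  obtain ⟨K, hK, hKA⟩ := A.exists_antilipschitzWith hker
  have hlow : ∀ v, ‖v‖ ≤ K * ‖A v‖ := fun v => by simpa using hKA.le_mul_dist v 0
  set B := B1 + B2 with hBdef
  have hB : ∀ v, ‖H v - A v‖ ≤ B := fun v => by
    rw [hAv, show H v - (v.re * τ1 - v.im * τ2) = (C₁ v.re - v.re * τ1) - (C₂ v.im - v.im * τ2) by
      simp only [hH]; ring]
    exact (norm_sub_le _ _).trans (add_le_add (hB₁ _) (hB₂ _))
  have hB0 : 0 ≤ B := (norm_nonneg _).trans (hB 0)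
  obtain ⟨L, hL, hLH⟩ := Complex.exists_continuousOn_eqOn_exp_comp (g := H)
    (isSimplyConnected_of_convex convex_univ univ_nonempty) isOpen_univ (by fun_prop)
    (by rintro ⟨v, -, hv⟩; exact hne _ _ (sub_eq_zero.1 hv))
  rw [continuousOn_univ] at hL
  have hexp : ∀ v, exp (L v) = H v := fun v => hLH (mem_univ v)
  set R : ℝ := K * (3 * B + 1) with hR
  have hR0 : 0 < R := by have : (0 : ℝ) < K := hK; positivity
  have hanti : ∀ v : ℂ, ‖v‖ = R → (exp (L v - L (-v))).re < 0 := by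
    intro v hv
    have h1 : 3 * B + 1 ≤ ‖A v‖ := by
      have := hlow v
      rw [hv, hR] at this
      exact le_of_mul_le_mul_left this hK
    have h2 := hB v
    have h3 := hB (-v)
    rw [map_neg] at h3
    have hHv : H (-v) ≠ 0 := by rw [← hexp]; exact exp_ne_zero _
    rw [exp_sub, hexp, hexp]
    set a := A v
    obtain ⟨x, hx⟩ : ∃ x, x = H v - a := ⟨_, rfl⟩
    obtain ⟨y, hy⟩ : ∃ y, y = H (-v) - -a := ⟨_, rfl⟩
    rw [← hx] at h2; rw [← hy] at h3
    have hx' : H v = a + x := by rw [hx]; ring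
    have hy' : H (-v) = -a + y := by rw [hy]; ring
    rw [hy'] at hHv
    rw [hx', hy']
    rw [div_re, ← add_div]
    refine div_neg_of_neg_of_pos ?_ (Complex.normSq_pos.2 hHv)
    have e : (a + x).re * (-a + y).re + (a + x).im * (-a + y).im =
      -‖a‖ ^ 2 + (a * star y).re - (x * star a).re + (x * star y).re := by
      rw [← Complex.normSq_eq_norm_sq, Complex.normSq_apply]; simp; ring
    rw [e]
    have n1 := (re_le_norm (a * star y))
    have n2 := (re_le_norm (-(x * star a)))
    have n3 := (re_le_norm (x * star y))
    rw [norm_mul, norm_star] at n1 n3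
    rw [norm_neg, norm_mul, norm_star, neg_re] at n2
    have m1 : ‖a‖ * ‖y‖ ≤ ‖a‖ * B := by gcongr
    have m2 : ‖x‖ * ‖a‖ ≤ B * ‖a‖ := by gcongr
    have m3 : ‖x‖ * ‖y‖ ≤ B * B := by gcongr
    nlinarith
  obtain ⟨v, hv, hv0⟩ : ∃ v : ℂ, ‖v‖ = R ∧ (L v - L (-v)).im = 0 := by
    set g : ℝ → ℝ := fun t => (L (R * exp (t * I)) - L (-(R * exp (t * I)))).im with hg
    have hgc : Continuous g := by
      simp only [hg]
      exact Complex.continuous_im.comp ((hL.comp (by fun_prop)).sub (hL.comp (by fun_prop)))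
    have hodd : g π = -g 0 := by
      simp only [hg, Complex.exp_pi_mul_I, ofReal_zero, zero_mul, Complex.exp_zero]
      simp
    have : (0 : ℝ) ∈ uIcc (g 0) (g π) := by
      rw [hodd, mem_uIcc]
      rcases le_total 0 (g 0) with h | h
      · right; constructor <;> linarith
      · left; constructor <;> linarith
    obtain ⟨t, -, ht⟩ := intermediate_value_uIcc hgc.continuousOn this
    exact ⟨R * exp (t * I), by simp [Complex.norm_exp_ofReal_mul_I, abs_of_pos hR0], ht⟩
  have := hanti v hv
  rw [exp_re, hv0, Real.cos_zero, mul_one] at this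
  exact absurd this (not_lt.2 (exp_pos _).le)

theorem re_exp_pos {u : ℂ} (hu : |u.im| < π / 2) : 0 < (exp u).re := by
  rw [exp_re]
  exact mul_pos (exp_pos _) (Real.cos_pos_of_mem_Ioo ⟨(abs_lt.1 hu).1, (abs_lt.1 hu).2⟩)

theorem isOpen_im_strip : IsOpen {u : ℂ | |u.im| < π / 2} :=
  isOpen_lt (by fun_prop) continuous_const

theorem exp_inj_of_im {u v : ℂ} (hu : |u.im| < π / 2) (hv : |v.im| < π / 2)
    (h : exp u = exp v) : u = v := by
  rw [abs_lt] at hu hv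
  exact Complex.exp_inj_of_neg_pi_lt_of_le_pi (by linarith) (by linarith) (by linarith) (by linarith) h

namespace LinData

variable {c ℓ : ℂ} {n : ℕ} {ψ : ℂ → ℂ} (L : LinData c n ℓ ψ)
include L

theorem exists_line {ζ : ℂ} {a : ℕ} (ha : 1 ≤ a) {b : ℤ} (h : Joins c ℓ ψ ζ a b) :
    ∃ E, IsLift c ψ E ∧ ζ ∈ E '' rhp ∧ ∃ xf : ℂ, xf.re = 0 ∧
      ∀ z ∈ rhp, E (xf + 2 ^ (n * a) * z) = E (xf + z) + lat ℓ a b := by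
  obtain ⟨E, hE, x, hx, rfl⟩ := L.exists_lift_mem h.source_mem
  obtain ⟨y, hy, hxy⟩ := L.mem_lift_of_joinedIn hE ⟨x, hx, rfl⟩ h
  obtain ⟨m, hm, hall⟩ := L.lift_translate hE hE hx hy a b hxy.symm
  have hna : n * a ≠ 0 := Nat.mul_ne_zero (by have := L.hn; omega) (by omega)
  have h1 : (1 : ℝ) < 2 ^ (n * a) := one_lt_pow₀ (by norm_num) hna
  set κ : ℝ := 2 ^ (n * a) with hκ
  have hκc : (2 : ℂ) ^ (n * a) = (κ : ℂ) := by simp [hκ]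
  have hκ1 : ((κ : ℂ) - 1) ≠ 0 := by
    rw [← ofReal_one, ← Complex.ofReal_sub, Complex.ofReal_ne_zero]; linarith
  obtain ⟨xf, hxf⟩ : ∃ xf, xf = ((-(m * 2 * π / (κ - 1)) : ℝ) : ℂ) * I := ⟨_, rfl⟩
  have hre : xf.re = 0 := by rw [hxf]; simp only [mul_I_re, ofReal_im, neg_zero]
  refine ⟨E, hE, ⟨x, hx, rfl⟩, xf, hre, fun z hz => ?_⟩
  rw [hall (xf + z) (by simpa [rhp, hre] using hz), hκc, hxf]
  congr 1
  push_cast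
  field_simp
  ring

omit L in
theorem add_exp_mem {xf u : ℂ} (hxf : xf.re = 0) (hu : |u.im| < π / 2) : xf + exp u ∈ rhp := by
  have := re_exp_pos hu
  simpa [rhp, hxf] using this

theorem exists_curve {ζ : ℂ} {a : ℕ} (ha : 1 ≤ a) {b : ℤ} (h : Joins c ℓ ψ ζ a b) :
    ∃ C : ℝ → ℂ, Continuous C ∧ (∀ t, C (t + 1) = C t + lat ℓ a b) ∧
      ∀ t, JoinedIn (escLog c ψ) (C t) (C t + lat ℓ a b) := by
  obtain ⟨E, hE, ⟨x, hx, rfl⟩, xf, hxf, hl⟩ := L.exists_line ha h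
  set e : ℝ → ℂ := fun t => ((t * (n * a : ℕ) * log 2 : ℝ) : ℂ) with he
  have hm : ∀ t, xf + exp (e t) ∈ rhp := fun t => add_exp_mem hxf (by
    simp only [he, ofReal_im, abs_zero]; positivity)
  refine ⟨fun t => E (xf + exp (e t)), ?_, fun t => ?_, fun t => ?_⟩
  · exact hE.1.continuousOn.comp_continuous (by fun_prop) hm
  · rw [← hl _ (by simpa using add_exp_mem (xf := 0) rfl (u := e t) (by
      simp only [he, ofReal_im, abs_zero]; positivity))]
    have : exp (e (t + 1)) = 2 ^ (n * a) * exp (e t) := by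
      rw [show e (t + 1) = ((n * a : ℕ) : ℂ) * log 2 + e t by simp only [he]; push_cast; ring,
        exp_add, exp_nat_mul, ← ofReal_exp, exp_log (by norm_num)]
      norm_num
    simp only [this]
  · have := L.joinedIn_lift hE (hm t) hx
    exact (this.trans h).trans (L.joinedIn_translate this.symm a b)

/-- All translations joining points of components are parallel. -/
theorem slope_unique {ζ ζ' : ℂ} {a a' : ℕ} (ha : 1 ≤ a) (ha' : 1 ≤ a') {b b' : ℤ}
    (h : Joins c ℓ ψ ζ a b) (h' : Joins c ℓ ψ ζ' a' b') :
    (a' : ℤ) * b = a * b' := by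
  by_contra hne
  obtain ⟨C, hC, hC1, hCj⟩ := L.exists_curve ha h
  obtain ⟨C', hC', hC1', hCj'⟩ := L.exists_curve ha' h'
  obtain ⟨s, t, hst⟩ := exists_crossing hC hC' hC1 hC1' (fun s t hst => by
    have h1 := congrArg Complex.re hst
    have h2 := congrArg Complex.im hst
    rw [re_ofReal_mul, re_ofReal_mul, lat_re, lat_re] at h1
    simp [lat] at h1 h2
    have ha0 : (a' : ℝ) ≠ 0 := by positivity
    have e1 : s * a = t * a' := mul_right_cancel₀ L.hre.ne' (by linarith)
    have e2 : s * b = t * b' := by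
      have : s * b * (2 * π) = t * b' * (2 * π) := by linear_combination h2 - ℓ.im * e1
      exact mul_right_cancel₀ (by positivity) this
    have e3 : s * ((a : ℝ) * b' - a' * b) = 0 := by linear_combination (b' : ℝ) * e1 - a' * e2
    have e4 : ((a : ℝ) * b' - a' * b) ≠ 0 := by
      rw [sub_ne_zero]; exact_mod_cast fun h : (a : ℤ) * b' = a' * b => hne h.symm
    have hs : s = 0 := (mul_eq_zero.1 e3).resolve_right e4
    refine ⟨hs, ?_⟩
    rw [hs, zero_mul, eq_comm, mul_eq_zero] at e1
    exact e1.resolve_right ha0)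
  have j := hCj s
  rw [hst] at j
  exact hne (L.joinedIn_lat_parallel j (hCj' t))

attribute [local irreducible] G in
theorem log_re_le : ∃ A > 0, ∃ B, ∀ E, IsLift c ψ E → ∀ x ∈ rhp, log x.re ≤ A * max 0 (E x).re + B := by
  have hp : Continuous fun u : ℂ => (c, ψ u) := continuous_const.prodMk L.hψ.continuous
  have hGc : Continuous fun u => G c (ψ u) := Continuous.comp (g := fun p : ℂ × ℂ => G p.1 p.2) continuous_G hp
  obtain ⟨M, hM⟩ := (isCompact_closedBall (0 : ℂ) 1).exists_bound_of_continuousOn hGc.continuousOn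
  have hn : (0 : ℝ) < n := by have := L.hn; positivity
  have hl2 : 0 < log 2 := log_pos (by norm_num)
  have hℓ := L.hre
  refine ⟨n * log 2 / ℓ.re, by positivity, n * log 2 + log M, fun E hE x hx => ?_⟩
  set s := max 0 (E x).re with hs
  set k := ⌈s / ℓ.re⌉₊ with hk
  have hk1 : (k : ℝ) ≤ s / ℓ.re + 1 := (Nat.ceil_lt_add_one (by positivity)).le
  have hk2 : s ≤ k * ℓ.re := (div_le_iff₀ hℓ).1 (Nat.le_ceil _)
  set v := exp (E x) / exp ℓ ^ k with hv
  have hv1 : ‖v‖ ≤ 1 := by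
    rw [hv, ← exp_nat_mul, ← exp_sub, norm_exp, Real.exp_le_one_iff]
    have : (E x).re ≤ s := le_max_right _ _
    simp; linarith
  have hmul : exp ℓ ^ k * v = exp (E x) := by
    rw [hv]; field_simp
  have h1 : x.re = 2 ^ (n * k) * G c (ψ v) := by
    rw [← L.G_pow, hmul, hE.2 x hx, G_Ψ_exp L.hc hx]
  have h2 : G c (ψ v) ≤ M := (le_abs_self _).trans (hM v (by simpa using hv1))
  have hx0 : 0 < x.re := hx
  have hM0 : 0 < M := by
    by_contra hM0
    have : G c (ψ v) ≤ 0 := h2.trans (not_lt.1 hM0)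
    have h3 : (0 : ℝ) < 2 ^ (n * k) := by positivity
    nlinarith
  have h3 : x.re ≤ 2 ^ (n * k) * M := by rw [h1]; gcongr
  calc log x.re ≤ log (2 ^ (n * k) * M) := log_le_log hx0 h3
    _ = k * (n * log 2) + log M := by
      rw [log_mul (by positivity) hM0.ne', Real.log_pow]; push_cast; ring
    _ ≤ (s / ℓ.re + 1) * (n * log 2) + log M := by gcongr
    _ = _ := by ring

theorem exists_mem_escLog : ∃ ζ, ζ ∈ escLog c ψ := by
  by_contra! h
  have hz : ∀ u, G c (ψ u) = 0 := fun u => by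
    rcases eq_or_ne u 0 with rfl | hu
    · exact L.G_fix
    · refine le_antisymm (not_lt.1 fun h1 => h (Complex.log u) ?_) (G_nonneg _ _)
      simpa only [escLog, mem_ofPred_eq, Complex.exp_log hu] using h1
  have hb : Bornology.IsBounded (range ψ) := isBounded_iff_forall_norm_le.2
    ⟨rexp (gB c), by rintro _ ⟨u, rfl⟩; simpa [hz u] using norm_le_of_G c (ψ u)⟩
  have h0 : ∀ u, ψ u = ψ 0 := fun u => L.hψ.apply_eq_apply_of_bounded hb u 0
  have := L.hd
  rw [show ψ = fun _ => ψ 0 from funext h0, deriv_const] at this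
  exact zero_ne_one this

theorem exists_translation : ∃ a : ℕ, 1 ≤ a ∧ ∃ b : ℤ, ∃ ζ, Joins c ℓ ψ ζ a b := by
  obtain ⟨ζ, hζ⟩ := L.exists_mem_escLog
  obtain ⟨E, hE, -⟩ := L.exists_lift_mem hζ
  by_contra! hno
  obtain ⟨A, hA, B, hAB⟩ := L.log_re_le
  have hpi := pi_pos
  set e : ℂ → ℂ := fun u => E (exp u) with he
  set U : Set ℂ := {u : ℂ | |u.im| < π / 2} with hU
  have hmem : ∀ u ∈ U, exp u ∈ rhp := fun u hu => re_exp_pos hu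
  have hed : HolOn e U := hE.1.comp differentiable_exp.differentiableOn hmem
  have hzero : ∀ ζ, ∀ a b : ℤ, Joins c ℓ ψ ζ a b → a = 0 ∧ b = 0 := by
    intro ζ a b hj
    have ha : a = 0 := by
      obtain ⟨k, rfl | rfl⟩ := a.eq_nat_or_neg
      · by_contra hk
        exact hno k (by omega) b ζ hj
      · by_contra hk
        exact hno k (by omega) (-b) ζ (by simpa using L.joinedIn_lat_neg hj)
    subst ha
    exact ⟨rfl, L.joinedIn_lat_zero hj⟩
  have hinj : ∀ u ∈ U, ∀ v ∈ U, ∀ a b : ℤ, e u + lat ℓ a b = e v → u = v := by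
    intro u hu v hv a b huv
    have hj := L.joinedIn_lift hE (hmem u hu) (hmem v hv)
    obtain ⟨rfl, rfl⟩ := hzero (e u) a b (by rw [Joins, huv]; exact hj)
    have : E (exp u) = E (exp v) := by simpa [lat] using huv
    exact exp_inj_of_im hu hv (L.lift_injOn hE (hmem u hu) (hmem v hv) this)
  obtain ⟨B', hB'⟩ := (isCompact_Icc (a := -(π / 4)) (b := π / 4)).exists_bound_of_continuousOn
    (f := fun y : ℝ => e (y * I)) (hed.continuousOn.comp (by fun_prop) (fun y hy => by
      simp only [hU, mem_ofPred_eq, mul_I_im, ofReal_re, abs_lt]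
      constructor <;> linarith [hy.1, hy.2]))
  set D := (B + log 2) / A + B' with hD
  have key : ∀ T : ℝ, 0 < T → 0 ≤ T / A - D →
      π / 4 * (T / A - D) ^ 2 ≤ T * π * ℓ.re := by
    intro T hT hδ
    have hmemR : ∀ x : ℝ, ∀ y ∈ Ioo (-(π / 4)) (π / 4), ((x : ℂ) + y * I) ∈ U := fun x y hy => by
      simp only [hU, mem_ofPred_eq, add_im, ofReal_im, mul_I_im, ofReal_re, abs_lt]
      constructor <;> linarith [hy.1, hy.2]
    have hRU : Ioo 0 T ×ℂ Ioo (-(π / 4)) (π / 4) ⊆ U := fun u hu => by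
      have := hmemR u.re u.im hu.2
      rwa [re_add_im] at this
    refine length_area L.hre hT hδ isOpen_im_strip hed (fun x _ y hy => hmemR x y hy)
      (fun u hu v hv a b => hinj u (hRU hu) v (hRU hv) a b) fun y hy => ?_
    have h1 := hAB E hE _ (hmem _ (hmemR T y hy))
    have h2 := hB' y (Ioo_subset_Icc_self hy)
    have h3 : T - log 2 ≤ log (exp (T + y * I)).re := by
      rw [exp_re, ← log_exp (T - log 2)]
      refine log_le_log (exp_pos _) ?_
      rw [Real.exp_sub, exp_log (by norm_num), div_eq_mul_inv]
      simp only [add_re, ofReal_re, mul_I_re, ofReal_im, add_im,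
        mul_I_im, neg_zero, add_zero, zero_add]
      gcongr
      have h4 : cos (π / 3) ≤ cos |y| :=
        Real.cos_le_cos_of_nonneg_of_le_pi (abs_nonneg _) (by linarith)
          ((abs_lt.2 hy).le.trans (by linarith))
      rw [Real.cos_abs, Real.cos_pi_div_three] at h4
      linarith
    have h5 : T / A - (B + log 2) / A ≤ max 0 (e (T + y * I)).re := by
      rw [← sub_div, div_le_iff₀ hA]
      linarith
    have h6 : max 0 (e (T + y * I)).re ≤ ‖e (T + y * I)‖ :=
      max_le (norm_nonneg _) (re_le_norm _)
    have h7 := norm_sub_norm_le (e (T + y * I)) (e (y * I))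
    simp only [hD]
    linarith
  have hlim : Tendsto (fun T : ℝ => T / A - D) atTop atTop :=
    (tendsto_id.atTop_div_const hA).atTop_add tendsto_const_nhds
  set K := 4 * A * ℓ.re with hK
  obtain ⟨T, hT, hT1⟩ := ((eventually_gt_atTop (0 : ℝ)).and
    (hlim.eventually_ge_atTop (K + |D| * K + |D| + 2))).exists
  have hℓ := L.hre
  have hK0 : 0 < K := by positivity
  have hX : 0 ≤ T / A - D := le_trans (by positivity) hT1
  have h8 := key T hT hX
  set X := T / A - D with hXd
  have hTX : T = A * (X + D) := by rw [hXd]; field_simp; ring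
  rw [hTX] at h8
  have h9 : X ^ 2 ≤ K * (X + D) := by
    have : π / 4 * X ^ 2 ≤ π / 4 * (K * (X + D)) := h8.trans (by rw [hK]; apply le_of_eq; ring)
    exact le_of_mul_le_mul_left this (by positivity)
  have h10 : D ≤ |D| := le_abs_self D
  have h11 := abs_nonneg D
  nlinarith [mul_nonneg h11 hK0.le]

/-- Existence of a translation whose slope satisfies the Yoccoz-type inequality. -/
theorem exists_slope : ∃ q : ℕ, 1 ≤ q ∧ ∃ b : ℤ, (∃ ζ, Joins c ℓ ψ ζ q b) ∧
    ‖lat ℓ q b‖ ^ 2 ≤ 4 * (n * q * log 2) * ℓ.re := by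
  classical
  obtain ⟨a, ha, b₀, ζ, hj0⟩ := L.exists_translation
  have hex : ∃ q : ℕ, 1 ≤ q ∧ ∃ b : ℤ, Joins c ℓ ψ ζ q b := ⟨a, ha, b₀, hj0⟩
  set q := Nat.find hex with hq
  obtain ⟨hq1, b, hj⟩ := Nat.find_spec hex
  rw [← hq] at hq1 hj
  have hS : ∀ a b' : ℤ, Joins c ℓ ψ ζ a b' → ∃ k : ℤ, a = k * q ∧ b' = k * b := by
    intro a b' h
    have h1 := L.joinedIn_lat_add h (L.joinedIn_lat_mul hj (-(a / q)))
    have hr : a + -(a / q) * q = a % q := by rw [Int.emod_def]; ring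
    have hq0 : (0 : ℤ) < q := by omega
    have hr0 : a % q = 0 := by
      by_contra hne
      have hp := Int.emod_nonneg a hq0.ne'
      have hlt := Int.emod_lt_of_pos a hq0
      obtain ⟨r, hr'⟩ := Int.eq_ofNat_of_zero_le hp
      have := Nat.find_min hex (m := r) (by omega)
      exact this ⟨by omega, b' + -(a / q) * b, by rw [hr, hr'] at h1; exact h1⟩
    rw [hr, hr0] at h1
    have := L.joinedIn_lat_zero h1
    refine ⟨a / q, ?_, by linarith⟩
    rw [hr0] at hr; linarith
  refine ⟨q, hq1, b, ⟨ζ, hj⟩, ?_⟩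
  obtain ⟨E, hE, ⟨x, hx, hxζ⟩, xf, hxf, hl⟩ := L.exists_line hq1 hj
  have hln : ∀ k : ℕ, ∀ z ∈ rhp, E (xf + (2 ^ (n * q)) ^ k * z) = E (xf + z) + k * lat ℓ q b := by
    intro k
    induction k with
    | zero => intro z _; simp
    | succ k ih =>
      intro z hz
      rw [pow_succ, mul_assoc, ih _ (by
        have : (0 : ℝ) < 2 ^ (n * q) := by positivity
        have hz : 0 < z.re := hz
        rw [rhp, mem_ofPred_eq, show (2 : ℂ) ^ (n * q) = ((2 ^ (n * q) : ℝ) : ℂ) by push_cast; rfl,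
          re_ofReal_mul]; positivity), hl z hz]
      push_cast; ring
  have hpi := pi_pos
  set T : ℝ := n * q * log 2 with hT
  have hT0 : 0 < T := by
    have := L.hn
    have h2 : 0 < log 2 := log_pos (by norm_num)
    positivity
  have hexpT : ∀ k : ℕ, exp (k * T) = (2 ^ (n * q)) ^ k := fun k => by
    rw [exp_nat_mul, hT, show ((n * q * log 2 : ℝ) : ℂ) = ((n * q : ℕ) : ℂ) * log 2 by push_cast; rfl,
      exp_nat_mul, ← ofReal_exp, exp_log (by norm_num)]
    norm_num
  set U : Set ℂ := {u : ℂ | |u.im| < π / 2} with hU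
  set e : ℂ → ℂ := fun u => E (xf + exp u) with he
  have hmem : ∀ u ∈ U, xf + exp u ∈ rhp := fun u hu => add_exp_mem hxf hu
  have hed : HolOn e U := hE.1.comp (by fun_prop) hmem
  have heT : ∀ k : ℕ, ∀ u ∈ U, e (u + k * T) = e u + k * lat ℓ q b := fun k u hu => by
    simp only [he]
    rw [exp_add, hexpT, mul_comm, hln k _ (re_exp_pos hu)]
  have hUT : ∀ k : ℕ, ∀ u ∈ U, u + k * T ∈ U := fun k u hu => by
    simpa [hU] using hu
  have hmemR : ∀ x : ℝ, ∀ y ∈ Ioo (-(π / 4)) (π / 4), ((x : ℂ) + y * I) ∈ U := fun x y hy => by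
    simp only [hU, mem_ofPred_eq, add_im, ofReal_im, mul_I_im, ofReal_re, abs_lt]
    constructor <;> linarith [hy.1, hy.2]
  have hRU : Ioo 0 T ×ℂ Ioo (-(π / 4)) (π / 4) ⊆ U := fun u hu => by
    have := hmemR u.re u.im hu.2
    rwa [re_add_im] at this
  have heinj : InjOn e U := fun u hu v hv huv =>
    exp_inj_of_im hu hv (add_left_cancel (L.lift_injOn hE (hmem u hu) (hmem v hv) huv))
  have hnat : ∀ u ∈ Ioo 0 T ×ℂ Ioo (-(π / 4)) (π / 4),
      ∀ v ∈ Ioo 0 T ×ℂ Ioo (-(π / 4)) (π / 4), ∀ k : ℕ, e u + k * lat ℓ q b = e v → u = v := by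
    intro u hu v hv k huv
    rw [← heT k u (hRU hu)] at huv
    have h1 := heinj (hUT k u (hRU hu)) (hRU hv) huv
    have h2 := congrArg Complex.re h1
    simp at h2
    have hu1 := hu.1.1
    have hv1 := hv.1.2
    have hk : k = 0 := by
      by_contra hk
      have : (1 : ℝ) ≤ k := by exact_mod_cast Nat.one_le_iff_ne_zero.2 hk
      nlinarith
    subst hk
    simpa using h1
  have hmain := length_area (T := T) (θ := π / 4) (δ := ‖lat ℓ q b‖) L.hre hT0 (norm_nonneg _)
    isOpen_im_strip hed (fun x _ y hy => hmemR x y hy) (fun u hu v hv a b' huv => by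
      have j1 := L.joinedIn_lift hE hx (hmem u (hRU hu))
      have j2 := L.joinedIn_lift hE (hmem u (hRU hu)) (hmem v (hRU hv))
      have j3 : Joins c ℓ ψ ζ a b' := by
        rw [hxζ] at j1
        have j4 : JoinedIn (escLog c ψ) (e u) (e u + lat ℓ a b') := by rw [huv]; exact j2
        exact (j1.trans j4).trans (L.joinedIn_translate j1.symm a b')
      obtain ⟨k, rfl, rfl⟩ := hS a b' j3
      rw [show lat ℓ (k * q) (k * b) = k * lat ℓ q b by simp only [lat]; push_cast; ring] at huv
      obtain ⟨k, rfl | rfl⟩ := k.eq_nat_or_neg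
      · exact hnat u hu v hv k (by exact_mod_cast huv)
      · refine (hnat v hv u hu k ?_).symm
        rw [← huv]; push_cast; ring) (fun y hy => by
      have := heT 1 (y * I) (by simpa using hmemR 0 y hy)
      rw [Nat.cast_one, one_mul, one_mul, add_comm] at this
      rw [this, add_sub_cancel_left])
  have h3 : π / 4 * ‖lat ℓ q b‖ ^ 2 ≤ π / 4 * (4 * T * ℓ.re) := hmain.trans (le_of_eq (by ring))
  exact le_of_mul_le_mul_left h3 (by positivity)

end LinData

/-- The parameters whose dynamical rotation number at the repelling fixed point is `s`. -/
def limb (D : Set ℂ) (ℓ : ℂ → ℂ) (ψ : ℂ → ℂ → ℂ) (s : ℚ) : Set ℂ :=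
  {c | c ∈ Mandelbrot ∧ c ∈ D ∧ ∃ q : ℕ, 1 ≤ q ∧ ∃ p : ℤ, (p : ℚ) / q = s ∧
    ∃ ζ, Joins c (ℓ c) (ψ c) ζ q (-p)}

section limb

variable {n : ℕ} {D : Set ℂ} {ℓ : ℂ → ℂ} {ψ : ℂ → ℂ → ℂ}
  (L : ∀ c ∈ D, c ∈ Mandelbrot → LinData c n (ℓ c) (ψ c))
include L

theorem limb_disjoint {s s' : ℚ} {c : ℂ} (h : c ∈ limb D ℓ ψ s) (h' : c ∈ limb D ℓ ψ s') : s = s' := by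
  obtain ⟨hM, hD, q, hq, p, rfl, ζ, hj⟩ := h
  obtain ⟨-, -, q', hq', p', rfl, ζ', hj'⟩ := h'
  have := (L c hD hM).slope_unique hq hq' hj hj'
  rw [div_eq_div_iff (by positivity) (by positivity)]
  have h2 : (p : ℤ) * q' = p' * q := by linarith
  exact_mod_cast h2

theorem exists_mem_limb {c : ℂ} (hM : c ∈ Mandelbrot) (hD : c ∈ D) : ∃ s, c ∈ limb D ℓ ψ s := by
  obtain ⟨q, hq, b, ⟨ζ, hj⟩, -⟩ := (L c hD hM).exists_slope
  exact ⟨_, hM, hD, q, hq, -b, rfl, ζ, by rwa [neg_neg]⟩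

theorem limb_bound {s : ℚ} {c : ℂ} (h : c ∈ limb D ℓ ψ s) :
    ‖ℓ c - 2 * π * s * I‖ ^ 2 ≤ 4 * n * log 2 / s.den * (ℓ c).re := by
  obtain ⟨hM, hD, -⟩ := id h
  obtain ⟨q, hq, b, ⟨ζ, hj⟩, hle⟩ := (L c hD hM).exists_slope
  have hc : c ∈ limb D ℓ ψ (((-b : ℤ) : ℚ) / q) := ⟨hM, hD, q, hq, -b, rfl, ζ, by rwa [neg_neg]⟩
  have hs := limb_disjoint L h hc
  have hq0 : (0 : ℝ) < q := by positivity
  have hden : (s.den : ℝ) ≤ q := by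
    have h1 : s.den ∣ q := by
      have := Rat.den_dvd (-b) q
      rw [hs]; exact_mod_cast this
    exact_mod_cast Nat.le_of_dvd (by omega) h1
  have hden0 : (0 : ℝ) < s.den := by exact_mod_cast s.den_pos
  have e : lat (ℓ c) q b = q * (ℓ c - 2 * π * s * I) := by
    rw [lat, hs]; push_cast
    have : (q : ℂ) ≠ 0 := by exact_mod_cast hq0.ne'
    field_simp; ring
  rw [e, norm_mul, Complex.norm_natCast, mul_pow] at hle
  have hre := (L c hD hM).hre
  have hl2 : 0 < log 2 := log_pos (by norm_num)
  calc _ ≤ 4 * n * log 2 / q * (ℓ c).re := by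
        rw [div_mul_eq_mul_div, le_div_iff₀ hq0]
        refine le_of_mul_le_mul_left ?_ hq0
        calc _ = (q : ℝ) ^ 2 * ‖ℓ c - 2 * π * s * I‖ ^ 2 := by ring
          _ ≤ _ := hle
          _ = _ := by ring
    _ ≤ _ := by gcongr

omit L in
attribute [local irreducible] G in
theorem limb_mem_nhdsWithin (hDo : IsOpen D) (hℓ : ContinuousOn ℓ D) (hψ : Hol2 ψ (D ×ˢ univ)) {s : ℚ} {c : ℂ}
    (h : c ∈ limb D ℓ ψ s) : ∀ᶠ c' in 𝓝[Mandelbrot] c, c' ∈ limb D ℓ ψ s := by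
  obtain ⟨hM, hD, q, hq, p, hs, ζ, γ, hγ⟩ := h
  set Γ : ℂ → unitInterval → ℂ := fun c' t => γ t + t * (q * (ℓ c' - ℓ c)) with hΓ
  have hev : ∀ᶠ c' in 𝓝 c, ∀ t ∈ (univ : Set unitInterval), 0 < G c' (ψ c' (exp (Γ c' t))) := by
    refine isCompact_univ.eventually_forall_of_forall_eventually fun t _ => ?_
    have hℓc : ContinuousAt ℓ c := hℓ.continuousAt (hDo.mem_nhds hD)
    have h1 : ContinuousAt (fun z : ℂ × unitInterval => Γ z.1 z.2) (c, t) := by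
      have : ContinuousAt (fun z : ℂ × unitInterval => ℓ z.1) (c, t) :=
        ContinuousAt.comp (f := Prod.fst) hℓc continuousAt_fst
      have h2 : ContinuousAt (fun z : ℂ × unitInterval => (z.2 : ℂ)) (c, t) := by fun_prop
      have h3 : ContinuousAt (fun z : ℂ × unitInterval => γ z.2) (c, t) := by fun_prop
      simp only [hΓ]
      fun_prop
    have h2 := (hψ.continuousAt (hDo.prod isOpen_univ) (q := (c, exp (Γ c t))) ⟨hD, mem_univ _⟩)
    have h3 : ContinuousAt (fun z : ℂ × unitInterval => (z.1, exp (Γ z.1 z.2))) (c, t) :=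
      continuousAt_fst.prodMk h1.cexp
    have h4 : ContinuousAt (fun z : ℂ × unitInterval => ψ z.1 (exp (Γ z.1 z.2))) (c, t) :=
      ContinuousAt.comp (f := fun z : ℂ × unitInterval => (z.1, exp (Γ z.1 z.2)))
        (g := fun p : ℂ × ℂ => ψ p.1 p.2) h2 h3
    have h5 : ContinuousAt (fun z : ℂ × unitInterval => G z.1 (ψ z.1 (exp (Γ z.1 z.2)))) (c, t) :=
      ContinuousAt.comp (f := fun z : ℂ × unitInterval => (z.1, ψ z.1 (exp (Γ z.1 z.2))))
        (g := fun p : ℂ × ℂ => G p.1 p.2) continuous_G.continuousAt (continuousAt_fst.prodMk h4)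
    refine h5.eventually_const_lt ?_
    have := hγ t
    simpa [hΓ, escLog] using this
  filter_upwards [self_mem_nhdsWithin, nhdsWithin_le_nhds (hDo.mem_nhds hD), nhdsWithin_le_nhds hev]
    with c' hM' hD' hp
  refine ⟨hM', hD', q, hq, p, hs, ζ, ⟨⟨fun t => Γ c' t, ?_⟩, ?_, ?_⟩, fun t => hp t (mem_univ _)⟩
  · simp only [hΓ]; fun_prop
  · simp [hΓ]
  · have h1 := γ.target
    change γ 1 + (((1 : unitInterval) : ℝ) : ℂ) * (q * (ℓ c' - ℓ c)) = _
    rw [h1, Set.Icc.coe_one]; simp only [lat]; push_cast; ring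

omit L in
theorem exists_open_limb (hDo : IsOpen D) (hℓ : ContinuousOn ℓ D) (hψ : Hol2 ψ (D ×ˢ univ)) (s : ℚ) :
    ∃ O, IsOpen O ∧ ∀ c ∈ Mandelbrot, c ∈ O ↔ c ∈ limb D ℓ ψ s := by
  have : ∀ c ∈ limb D ℓ ψ s, ∃ O, IsOpen O ∧ c ∈ O ∧ O ∩ Mandelbrot ⊆ limb D ℓ ψ s := fun c hc =>
    by
      obtain ⟨O, hO, hcO, hs⟩ := mem_nhdsWithin.1 (limb_mem_nhdsWithin hDo hℓ hψ hc)
      exact ⟨O, hO, hcO, hs⟩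
  choose! O hO hcO hs using this
  refine ⟨⋃ c ∈ limb D ℓ ψ s, O c, isOpen_biUnion hO, fun c hM => ⟨fun h => ?_, fun h => ?_⟩⟩
  · obtain ⟨x, hx, hcx⟩ := mem_iUnion₂.1 h
    exact hs x hx ⟨hcx, hM⟩
  · exact mem_iUnion₂.2 ⟨c, h, hcO c h⟩

/-- The closure of a limb adds at most the root point. -/
theorem mem_limb_of_mem_closure (hDo : IsOpen D) (hψ : Hol2 ψ (D ×ˢ univ)) {B : Set ℂ} (hB : IsOpen B)
    (hD : D = B ∩ {c | 0 < (ℓ c).re}) (hℓ : ContinuousOn ℓ B) {s : ℚ} {x : ℂ} (hx : x ∈ closure (limb D ℓ ψ s))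
    (hxB : x ∈ B) : x ∈ limb D ℓ ψ s ∨ ℓ x = 2 * π * s * I := by
  have hxM : x ∈ Mandelbrot := closure_minimal (fun c hc => hc.1) isClosed_Mandelbrot hx
  have hℓx : ContinuousAt ℓ x := hℓ.continuousAt (hB.mem_nhds hxB)
  rcases lt_or_ge 0 (ℓ x).re with hp | hn
  · left
    have hxD : x ∈ D := by rw [hD]; exact ⟨hxB, hp⟩
    obtain ⟨s', hs'⟩ := exists_mem_limb L hxM hxD
    obtain ⟨O, hO, h⟩ := exists_open_limb hDo (hℓ.mono (by rw [hD]; exact inter_subset_left)) hψ s'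
    obtain ⟨y, hyO, hy⟩ := mem_closure_iff.1 hx O hO ((h x hxM).2 hs')
    rwa [limb_disjoint L hy ((h y hy.1).1 hyO)]
  · right
    have hfr := mem_closure_iff_frequently.1 hx
    have h1 : ‖ℓ x - 2 * π * s * I‖ ^ 2 ≤ 4 * n * log 2 / s.den * (ℓ x).re := by
      by_contra! hlt
      have h2 : ContinuousAt (fun c => ‖ℓ c - 2 * π * s * I‖ ^ 2) x := by fun_prop
      have h3 : ContinuousAt (fun c => 4 * n * log 2 / s.den * (ℓ c).re) x := by fun_prop
      have h4 := h3.eventually_lt h2 hlt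
      obtain ⟨y, hy, hy'⟩ := (hfr.and_eventually h4).exists
      exact absurd (limb_bound L hy) (not_le.2 hy')
    have hl2 : 0 < log 2 := log_pos (by norm_num)
    have h2 : 4 * n * log 2 / s.den * (ℓ x).re ≤ 0 := mul_nonpos_of_nonneg_of_nonpos (by positivity) hn
    have h3 : ‖ℓ x - 2 * π * s * I‖ ^ 2 = 0 := le_antisymm (h1.trans h2) (by positivity)
    rw [sq_eq_zero_iff, norm_eq_zero, sub_eq_zero] at h3
    exact h3

theorem isPreconnected_closure_limb (hDo : IsOpen D) (hψ : Hol2 ψ (D ×ˢ univ)) {B : Set ℂ} (hB : IsOpen B)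
    (hD : D = B ∩ {c | 0 < (ℓ c).re}) (hℓ : ContinuousOn ℓ B) (hinj : InjOn ℓ B) {s : ℚ}
    (hsub : closure (limb D ℓ ψ s) ⊆ B) : IsPreconnected (closure (limb D ℓ ψ s)) := by
  set X := closure (limb D ℓ ψ s) with hX
  have hXM : X ⊆ Mandelbrot := closure_minimal (fun c hc => hc.1) isClosed_Mandelbrot
  obtain ⟨O, hO, hOs⟩ := exists_open_limb hDo (hℓ.mono (by rw [hD]; exact inter_subset_left)) hψ s
  have key : ∀ t t' : Set ℂ, IsClosed t → IsClosed t' → X ⊆ t ∪ t' → (X ∩ t).Nonempty → (X ∩ t').Nonempty →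
      X ∩ t' ⊆ limb D ℓ ψ s → (X ∩ (t ∩ t')).Nonempty := by
    intro t t' ht ht' hsubt hne hne' hlimb
    by_contra hemp
    rw [not_nonempty_iff_eq_empty, eq_empty_iff_forall_notMem] at hemp
    obtain ⟨x, hx, hxt⟩ := hne
    obtain ⟨y, hy, hyt⟩ := hne'
    obtain ⟨z, hzM, ⟨hzO, hzt⟩, hzX⟩ := isPreconnected_Mandelbrot (O \ t) (X ∩ t')ᶜ (hO.sdiff ht)
      (isClosed_closure.inter ht').isOpen_compl (fun z hz => by
        by_cases hzX : z ∈ X ∩ t'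
        · exact Or.inl ⟨(hOs z hz).2 (hlimb hzX), fun h => hemp z ⟨hzX.1, h, hzX.2⟩⟩
        · exact Or.inr hzX)
      ⟨y, hXM hy, (hOs y (hXM hy)).2 (hlimb ⟨hy, hyt⟩), fun h => hemp y ⟨hy, h, hyt⟩⟩
      ⟨x, hXM hx, fun h => hemp x ⟨hx, hxt, h.2⟩⟩
    have hzX' : z ∈ X := subset_closure ((hOs z hzM).1 hzO)
    exact hzX ⟨hzX', (hsubt hzX').resolve_left hzt⟩
  have hroot : ∀ x ∈ X, x ∉ limb D ℓ ψ s → ∀ y ∈ X, y ∉ limb D ℓ ψ s → x = y := by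
    intro x hx hx' y hy hy'
    have h1 := (mem_limb_of_mem_closure L hDo hψ hB hD hℓ hx (hsub hx)).resolve_left hx'
    have h2 := (mem_limb_of_mem_closure L hDo hψ hB hD hℓ hy (hsub hy)).resolve_left hy'
    exact hinj (hsub hx) (hsub hy) (h1.trans h2.symm)
  rw [isPreconnected_closed_iff]
  intro t t' ht ht' hsubt hne hne'
  by_cases h' : X ∩ t' ⊆ limb D ℓ ψ s
  · exact key t t' ht ht' hsubt hne hne' h'
  by_cases h : X ∩ t ⊆ limb D ℓ ψ s
  · rw [inter_comm t t']
    exact key t' t ht' ht (by rwa [union_comm]) hne' hne h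
  obtain ⟨x, hx, hx'⟩ := not_subset.1 h
  obtain ⟨y, hy, hy'⟩ := not_subset.1 h'
  have := hroot x hx.1 hx' y hy.1 hy'
  subst this
  exact ⟨x, hx.1, hx.2, hy.2⟩

end limb

theorem exists_limb {n : ℕ} (hn : 1 ≤ n) {c0 : ℂ} {r0 : ℝ} (hr₀ : 0 < r0) {α ℓ : ℂ → ℂ}
    (hα : HolOn α (ball c0 r0)) (hfix : ∀ c ∈ ball c0 r0, (P c)^[n] (α c) = α c)
    (hℓ : HolOn ℓ (ball c0 r0))
    (hexp : ∀ c ∈ ball c0 r0, exp (ℓ c) = deriv ((P c)^[n]) (α c)) (hinj : InjOn ℓ (ball c0 r0))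
    {t : ℝ} (ht : Irrational t) (h0 : ℓ c0 = 2 * π * t * I) {ε : ℝ} (hε : 0 < ε) :
    ∃ δ > 0, ∀ A ⊆ Mandelbrot ∩ ball c0 δ, IsPreconnected A → (∀ c ∈ A, 1 < ‖deriv ((P c)^[n]) (α c)‖) →
      ∀ c' ∈ closure A, c' ∈ ball c0 δ → (∀ k : ℕ, 1 ≤ k → (deriv ((P c')^[n]) (α c')) ^ k ≠ 1) →
      ∃ V ⊆ Mandelbrot, IsConnected V ∧ V ∈ 𝓝[Mandelbrot] c' ∧ V ⊆ ball c0 ε := by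
  set B := ball c0 r0 with hB
  set D := B ∩ {c | 0 < (ℓ c).re} with hD
  have hDo : IsOpen D := hℓ.continuousOn.isOpen_inter_preimage isOpen_ball isOpen_rhp
  have hnorm : ∀ c ∈ B, (1 < ‖deriv ((P c)^[n]) (α c)‖ ↔ 0 < (ℓ c).re) := fun c hc => by
    rw [← hexp c hc, norm_exp, one_lt_exp_iff]
  have hP : Hol2 (fun c z => (P c)^[n] z) univ := hol2_iterate (a := fun _ z => z) differentiableOn_snd n
  obtain ⟨ψ, hψ, hψ'⟩ := exists_linearizer (f := fun c => (P c)^[n]) hP hDo (hα.mono inter_subset_left)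
    (lam := fun c => exp (ℓ c)) (fun c hc => hfix c hc.1) (fun c hc => hexp c hc.1)
    (fun c hc => by simp only [hexp c hc.1]; exact (hnorm c hc.1).2 hc.2)
  have L : ∀ c ∈ D, c ∈ Mandelbrot → LinData c n (ℓ c) (ψ c) := fun c hc hM =>
    ⟨hn, hM, hc.2, fun u => hψ.sep₂ (hDo.prod isOpen_univ) ⟨hc, mem_univ _⟩, (hψ' c hc).2.1,
      (hψ' c hc).2.2⟩
  set K := 4 * n * log 2 with hK
  have hl2 : 0 < log 2 := log_pos (by norm_num)
  have hK0 : 0 < K := by positivity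
  set r1 := min (r0 / 2) (ε / 2) with hr1
  have hr10 : 0 < r1 := by positivity
  have hr1B : closedBall c0 r1 ⊆ B := closedBall_subset_ball (inf_le_left.trans_lt (by linarith))
  have hr1B' : ball c0 r1 ⊆ B := ball_subset_closedBall.trans hr1B
  obtain ⟨η, hη, hηB⟩ := isOpen_iff.1 (isOpen_image_of_injOn isOpen_ball (hℓ.mono hr1B') (hinj.mono hr1B'))
    (ℓ c0) (mem_image_of_mem _ (mem_ball_self hr10))
  obtain ⟨N, hN⟩ := exists_nat_gt (4 * K / η)
  have hev : ∀ᶠ m in 𝓝[>] (0 : ℝ), ∀ r : ℚ, r.den ≤ N → m ≤ dist t r :=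
    nhdsWithin_le_nhds (ht.eventually_forall_le_dist_cast_rat_of_den_le N)
  obtain ⟨m, hm, hm0⟩ := (hev.and self_mem_nhdsWithin).exists
  have hm0 : 0 < m := hm0
  have hpi := pi_pos
  obtain ⟨η', hη', h1, h2, h3⟩ : ∃ η' > 0, η' < η / 4 ∧ η' ≤ π * m ∧ K * η' < (π * m) ^ 2 := by
    refine ⟨min (min (η / 5) (π * m)) ((π * m) ^ 2 / (2 * K)), by positivity, ?_, ?_, ?_⟩
    · exact (inf_le_left.trans inf_le_left).trans_lt (by linarith)
    · exact inf_le_left.trans inf_le_right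
    · calc K * _ ≤ K * ((π * m) ^ 2 / (2 * K)) := by gcongr; exact inf_le_right
        _ = (π * m) ^ 2 / 2 := by field_simp
        _ < _ := half_lt_self (by positivity)
  obtain ⟨δ1, hδ₁, hδ⟩ := Metric.continuousAt_iff.1
    (hℓ.continuousOn.continuousAt (isOpen_ball.mem_nhds (mem_ball_self hr₀))) η' hη'
  refine ⟨min δ1 r1, by positivity, fun A hA hAc hrep c' hc' hcδ hk => ?_⟩
  have hAB : A ⊆ B := fun a ha => hr1B' (ball_min_right (hA ha).2)
  have hAD : A ⊆ D := fun a ha => ⟨hAB ha, (hnorm a (hAB ha)).1 (hrep a ha)⟩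
  have hc'B : c' ∈ B := hr1B' (ball_min_right hcδ)
  obtain ⟨a, ha⟩ := closure_nonempty_iff.1 ⟨c', hc'⟩
  obtain ⟨s, hs⟩ := exists_mem_limb L (hA ha).1 (hAD ha)
  have hopen := exists_open_limb hDo (hℓ.continuousOn.mono inter_subset_left) hψ
  have hAs : A ⊆ limb D ℓ ψ s := by
    choose O hO hOs using hopen
    intro x hx
    obtain ⟨s', hs'⟩ := exists_mem_limb L (hA hx).1 (hAD hx)
    rcases eq_or_ne s' s with rfl | hne
    · exact hs'
    exfalso
    obtain ⟨y, hy, hy1, hy2⟩ := hAc (O s) (⋃ s' ∈ {s' | s' ≠ s}, O s') (hO s) (isOpen_biUnion fun s' _ => hO s')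
      (fun y hy => by
        obtain ⟨s', hs'⟩ := exists_mem_limb L (hA hy).1 (hAD hy)
        rcases eq_or_ne s' s with rfl | hne
        · exact Or.inl ((hOs _ y (hA hy).1).2 hs')
        · exact Or.inr (mem_iUnion₂.2 ⟨s', hne, (hOs _ y (hA hy).1).2 hs'⟩))
      ⟨a, ha, (hOs _ a (hA ha).1).2 hs⟩ ⟨x, hx, mem_iUnion₂.2 ⟨s', hne, (hOs _ x (hA hx).1).2 hs'⟩⟩
    obtain ⟨s'', hne'', hy2⟩ := mem_iUnion₂.1 hy2
    exact hne'' (limb_disjoint L ((hOs _ y (hA hy).1).1 hy2) ((hOs _ y (hA hy).1).1 hy1))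
  have hden0 : (0 : ℝ) < s.den := by exact_mod_cast s.den_pos
  set w : ℂ := 2 * π * s * I with hw
  have hball : ∀ c ∈ limb D ℓ ψ s, ‖ℓ c - w‖ ≤ K / s.den := by
    intro c hc
    have e1 := limb_bound L hc
    have e2 : (ℓ c).re ≤ ‖ℓ c - w‖ := by
      have := re_le_norm (ℓ c - w)
      simpa [hw] using this
    rw [← hw, ← hK] at e1
    rcases (norm_nonneg (ℓ c - w)).eq_or_lt with h | h
    · rw [← h]; positivity
    · refine le_of_mul_le_mul_right ?_ h
      rw [← sq]
      exact e1.trans (by gcongr)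
  have haη : ‖ℓ a - ℓ c0‖ < η' := by
    rw [← dist_eq_norm]
    exact hδ (ball_min_left (hA ha).2)
  have hNs : N < s.den := by
    by_contra! hle
    have e1 := hm s hle
    have e2 := limb_bound L hs
    rw [← hw, ← hK] at e2
    have e3 : (ℓ a).re ≤ η' := by
      have := (re_le_norm (ℓ a - ℓ c0)).trans haη.le
      simpa [h0] using this
    have e4 : ‖ℓ a - w‖ ^ 2 < (π * m) ^ 2 := by
      refine lt_of_le_of_lt (e2.trans ?_) h3
      have : K / s.den ≤ K := div_le_self hK0.le (by exact_mod_cast s.den_pos)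
      have hre : 0 < (ℓ a).re := (hAD ha).2
      gcongr
    have e5 := lt_of_pow_lt_pow_left₀ 2 (by positivity) e4
    have e6 : ‖ℓ c0 - w‖ < 2 * (π * m) := by
      have := norm_sub_le_norm_sub_add_norm_sub (ℓ c0) (ℓ a) w
      rw [norm_sub_rev (ℓ c0) (ℓ a)] at this
      linarith
    rw [h0, hw, show 2 * π * t * I - 2 * π * s * I =
      ((2 * π * (t - s) : ℝ) : ℂ) * I by push_cast; ring, norm_mul, norm_I, mul_one,
      norm_real, norm_eq_abs, abs_mul, abs_of_pos (by positivity : 0 < 2 * π)] at e6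
    rw [dist_eq] at e1
    nlinarith
  have hKd : K / s.den < η / 4 := by
    have : (N : ℝ) < s.den := by exact_mod_cast hNs
    rw [div_lt_iff₀ hden0]
    rw [div_lt_iff₀ hη] at hN
    nlinarith
  have hsub : limb D ℓ ψ s ⊆ ball c0 r1 := by
    intro c hc
    have e1 := hball c hc
    have e2 := hball a hs
    have e3 : ℓ c ∈ ball (ℓ c0) η := by
      rw [mem_ball, dist_eq_norm, show ℓ c - ℓ c0 = (ℓ c - w) - (ℓ a - w) + (ℓ a - ℓ c0) by ring]
      have := norm_add_le ((ℓ c - w) - (ℓ a - w)) (ℓ a - ℓ c0)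
      have := norm_sub_le (ℓ c - w) (ℓ a - w)
      linarith
    obtain ⟨x, hx, hxc⟩ := hηB e3
    rwa [← hinj (hr1B' hx) hc.2.1.1 hxc]
  have hcl : closure (limb D ℓ ψ s) ⊆ closedBall c0 r1 :=
    closure_minimal (hsub.trans ball_subset_closedBall) isClosed_closedBall
  have hc's : c' ∈ limb D ℓ ψ s := by
    refine (mem_limb_of_mem_closure L hDo hψ isOpen_ball rfl hℓ.continuousOn (closure_mono hAs hc') hc'B).resolve_right
      fun h => hk s.den s.den_pos ?_
    rw [← hexp c' hc'B, h, ← exp_nat_mul, Complex.exp_eq_one_iff]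
    refine ⟨s.num, ?_⟩
    have : (s.den : ℂ) * (s : ℂ) = s.num := by exact_mod_cast Rat.den_mul_eq_num s
    rw [← this]; ring
  refine ⟨closure (limb D ℓ ψ s), closure_minimal (fun c hc => hc.1) isClosed_Mandelbrot,
    ⟨⟨c', subset_closure hc's⟩, isPreconnected_closure_limb L hDo hψ isOpen_ball rfl hℓ.continuousOn hinj
      (hcl.trans hr1B)⟩, ?_, hcl.trans (closedBall_subset_ball (inf_le_right.trans_lt (by linarith)))⟩
  exact mem_of_superset (limb_mem_nhdsWithin hDo (hℓ.continuousOn.mono inter_subset_left) hψ hc's) subset_closure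

theorem exists_seq_of_step {X : Type*} {p : ℕ → X → Prop} {r : ℕ → X → X → Prop} {a : X} (h0 : p 0 a)
    (step : ∀ m x, p m x → ∃ y, p (m + 1) y ∧ r m x y) :
    ∃ s : ℕ → X, s 0 = a ∧ ∀ m, p m (s m) ∧ r m (s m) (s (m + 1)) := by
  have : Nonempty X := ⟨a⟩
  choose! nxt hn using step
  set s : ℕ → X := fun m => Nat.rec a (fun m x => nxt m x) m with hs
  have hp : ∀ m, p m (s m) := fun m => by
    induction m with
    | zero => exact h0
    | succ m ih => exact (hn m _ ih).1
  exact ⟨s, rfl, fun m => ⟨hp m, (hn m _ (hp m)).2⟩⟩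

/-- A quadratic-like map `f` on the disc of radius `ρ`, whose inverse branches are `±√(q y)`. -/
structure QL (ρ : ℝ) (f q : ℂ → ℂ) : Prop where
  pos : 0 < ρ
  hf : Differentiable ℂ f
  hq : HolOn q (ball 0 ρ)
  lt : ∀ y, ‖y‖ < ρ → ‖q y‖ < ρ ^ 2
  iff : ∀ z y, ‖z‖ < ρ → ‖y‖ < ρ → (f z = y ↔ z ^ 2 = q y)
  d0 : deriv f 0 = 0

theorem exists_QL_family {n : ℕ} {ρ : ℝ} {D : Set ℂ} (hD : IsOpen D) (hQL : ∀ c ∈ D, QLAt n ρ c) :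
    ∃ q : ℂ → ℂ → ℂ, Hol2 q (D ×ˢ ball 0 ρ) ∧ ∀ c ∈ D, QL ρ ((P c)^[n]) (q c) := by
  set q : ℂ → ℂ → ℂ := fun c => invFunOn (Q n c) (ball 0 (ρ ^ 2)) with hq
  have hm : ∀ c ∈ D, ∀ y ∈ ball (0 : ℂ) ρ, q c y ∈ ball (0 : ℂ) (ρ ^ 2) ∧ Q n c (q c y) = y := fun c hc y hy =>
    have := (hQL c hc).2.2.2 (ball_subset_closedBall hy)
    ⟨invFunOn_mem this, invFunOn_eq this⟩
  have hh : Hol2 q (D ×ˢ ball 0 ρ) := by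
    rintro ⟨c, y⟩ ⟨hc, hy⟩
    obtain ⟨h1, h2⟩ := hm c hc y hy
    have hd := deriv_ne_zero_of_injOn isOpen_ball (differentiable_Q n c).differentiableOn (hQL c hc).2.2.1 h1
    obtain ⟨r, hr, s, hs, hsN, -, κ, hκ, hκ', -, -⟩ := (hol2_Q n univ).exists_inverse isOpen_univ
      (mem_univ (c, q c y)) hd (isOpen_ball.mem_nhds h1)
    rw [h2] at hκ hκ'
    have hnb : ball c r ×ˢ ball y r ∈ 𝓝 (c, y) := (isOpen_ball.prod isOpen_ball).mem_nhds
      ⟨mem_ball_self hr, mem_ball_self hr⟩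
    refine ((hκ.differentiableAt hnb).congr_of_eventuallyEq ?_).differentiableWithinAt
    filter_upwards [hnb, (hD.prod isOpen_ball).mem_nhds (⟨hc, hy⟩ : (c, y) ∈ D ×ˢ ball 0 ρ)]
    rintro ⟨c', y'⟩ ⟨h3, h4⟩ ⟨h5, h6⟩
    exact (hQL c' h5).2.2.1 (hm c' h5 y' h6).1 (hsN (hκ' c' h3 y' h4).1)
      ((hm c' h5 y' h6).2.trans (hκ' c' h3 y' h4).2.symm)
  refine ⟨q, hh, fun c hc => ?_⟩
  obtain ⟨hn, hρ, hi, -⟩ := hQL c hc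
  refine ⟨hρ, differentiable_iterate n c, fun y hy => ?_, fun y hy => ?_, fun z y hz hy => ?_, ?_⟩
  · exact (hh.sep₂ (hD.prod isOpen_ball) ⟨hc, hy⟩).differentiableWithinAt
  · simpa using (hm c hc y (by simpa using hy)).1
  · obtain ⟨h1, h2⟩ := hm c hc y (by simpa using hy)
    rw [iterate_eq_Q hn]
    refine ⟨fun h => hi ?_ h1 (h.trans h2.symm), fun h => by rw [h, h2]⟩
    rw [mem_ball_zero_iff, norm_pow]
    exact pow_lt_pow_left₀ hz (norm_nonneg _) two_ne_zero
  · have h1 : HasDerivAt (fun z : ℂ => Q n c (z ^ 2)) (deriv (Q n c) (0 ^ 2) * (2 * 0)) 0 := by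
      have := HasDerivAt.comp (0 : ℂ) (h₂ := Q n c) (h := fun z : ℂ => z ^ 2)
        (differentiable_Q n c _).hasDerivAt (hasDerivAt_pow 2 0)
      exact this.congr_deriv (by simp)
    rw [funext fun z => iterate_eq_Q hn c z, h1.deriv]; simp

namespace QL

variable {ρ : ℝ} {f q : ℂ → ℂ}

theorem norm_lt (h : QL ρ f q) {z y : ℂ} (hy : ‖y‖ < ρ) (hz : z ^ 2 = q y) : ‖z‖ < ρ := by
  have := h.lt y hy
  rw [← hz, norm_pow] at this
  exact lt_of_pow_lt_pow_left₀ 2 h.pos.le this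

theorem deriv_ne_zero (h : QL ρ f q) {z : ℂ} (hz : ‖z‖ < ρ) (hfz : ‖f z‖ < ρ) (h0 : z ≠ 0) : deriv f z ≠ 0 := by
  intro hd
  have h1 := (h.hq.differentiableAt (isOpen_ball.mem_nhds (mem_ball_zero_iff.2 hfz))).hasDerivAt
  have h2 := h1.comp z (h.hf z).hasDerivAt
  rw [hd, mul_zero] at h2
  have h3 : (q ∘ f) =ᶠ[𝓝 z] fun w => w ^ 2 := by
    filter_upwards [continuous_norm.continuousAt.eventually_lt_const hz,
      (h.hf.continuous.norm.continuousAt).eventually_lt_const hfz] with w hw hfw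
    exact ((h.iff w (f w) hw hfw).1 rfl).symm
  have h4 := h3.deriv_eq
  rw [h2.deriv] at h4
  simp at h4
  exact h0 h4

theorem f_zero_ne (h : QL ρ f q) {γ : ℂ} (hγ : ‖γ‖ < ρ) (hfix : f γ = γ) (hd : deriv f γ ≠ 0) : f 0 ≠ γ := by
  intro h0
  have h1 := (h.iff γ γ hγ hγ).1 hfix
  have h2 := (h.iff 0 γ (by simpa using h.pos) hγ).1 h0
  rw [← h2] at h1
  have : γ = 0 := by simpa using h1
  exact hd (this ▸ h.d0)

/-- Inverse branches along a backward orbit exist on star-shaped sets avoiding the critical orbit. -/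
theorem exists_branches (h : QL ρ f q) {S : Set ℂ} {x : ℂ} (hS : IsOpen S) (hst : StarConvex ℝ x S)
    (hSρ : S ⊆ ball 0 ρ) {y : ℕ → ℂ} (hyS : y 0 ∈ S) (hyρ : ∀ m, ‖y m‖ < ρ) (hy : ∀ m, f (y (m + 1)) = y m)
    (hcrit : ∀ m, (∀ i ≤ m, ‖f^[i + 1] 0‖ < ρ) → f^[m + 1] 0 ∈ S → f^[m + 1] 0 = y 0 ∧ f 0 ≠ y m) :
    ∃ g : ℕ → ℂ → ℂ, (∀ z, g 0 z = z) ∧ ∀ m, HolOn (g m) S ∧ g m (y 0) = y m ∧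
      ∀ z ∈ S, ‖g m z‖ < ρ ∧ f (g (m + 1) z) = g m z := by
  obtain ⟨g, hg0, hg⟩ := exists_seq_of_step (X := ℂ → ℂ) (a := id)
    (p := fun m g => HolOn g S ∧ g (y 0) = y m ∧ ∀ z ∈ S, f^[m] (g z) = z ∧ ∀ i ≤ m, ‖f^[i] (g z)‖ < ρ)
    (r := fun _ g g' => ∀ z ∈ S, f (g' z) = g z)
    ⟨differentiableOn_id, rfl, fun z hz => ⟨rfl, fun i hi => by
      rw [Nat.le_zero.1 hi]; simpa using hSρ hz⟩⟩
    (fun m g ⟨hgd, hgy, hgS⟩ => by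
      have hgρ : ∀ z ∈ S, ‖g z‖ < ρ := fun z hz => by simpa using (hgS z hz).2 0 (Nat.zero_le _)
      obtain ⟨k, hkd, hk⟩ := exists_sqrt hS hst (h.hq.comp hgd fun z hz => mem_ball_zero_iff.2 (hgρ z hz))
        (fun z hz h0 => by
          have h1 : f 0 = g z := (h.iff 0 (g z) (by simpa using h.pos) (hgρ z hz)).2 (by
            rw [← comp_apply (f := q), h0]; simp)
          have h2 : ∀ i, f^[i + 1] 0 = f^[i] (g z) := fun i => by rw [iterate_succ_apply, h1]
          have h3 := hcrit m (fun i hi => by rw [h2]; exact (hgS z hz).2 i hi) (by rw [h2, (hgS z hz).1]; exact hz)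
          rw [h2, (hgS z hz).1] at h3
          rw [h1, h3.1, hgy] at h3
          exact h3.2 rfl)
      have hsgn : ∃ ε : ℂ, ε ^ 2 = 1 ∧ ε * k (y 0) = y (m + 1) := by
        have h1 := hk _ hyS
        have h2 := (h.iff _ _ (hyρ (m + 1)) (hyρ m)).1 (hy m)
        rw [comp_apply, hgy, ← h2] at h1
        rcases sq_eq_sq_iff_eq_or_eq_neg.1 h1 with h | h
        · exact ⟨1, by simp, by simp [h]⟩
        · exact ⟨-1, by simp, by simp [h]⟩
      obtain ⟨ε, hε, hεy⟩ := hsgn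
      have hsq : ∀ z ∈ S, (ε * k z) ^ 2 = q (g z) := fun z hz => by rw [mul_pow, hε, one_mul, hk z hz]; rfl
      have hlt : ∀ z ∈ S, ‖ε * k z‖ < ρ := fun z hz => h.norm_lt (hgρ z hz) (hsq z hz)
      have hfk : ∀ z ∈ S, f (ε * k z) = g z := fun z hz => (h.iff _ _ (hlt z hz) (hgρ z hz)).2 (hsq z hz)
      refine ⟨fun z => ε * k z, ⟨hkd.const_mul ε, hεy, fun z hz => ⟨?_, fun i hi => ?_⟩⟩, hfk⟩
      · rw [iterate_succ_apply, hfk z hz, (hgS z hz).1]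
      · rcases i with _ | i
        · exact hlt z hz
        · rw [iterate_succ_apply, hfk z hz]; exact (hgS z hz).2 i (by omega))
  refine ⟨g, fun z => by rw [hg0]; rfl, fun m => ⟨(hg m).1.1, (hg m).1.2.1, fun z hz => ⟨?_, (hg m).2 z hz⟩⟩⟩
  simpa using ((hg m).1.2.2 z hz).2 0 (Nat.zero_le _)

/-- Near a common fixed point the branches stay uniformly close to it. -/
theorem branches_near {S : Set ℂ} {s : ℝ} {γ : ℂ} (hS : IsOpen S) (hγ : γ ∈ S) {g : ℕ → ℂ → ℂ}
    (hg : ∀ m, HolOn (g m) S ∧ g m γ = γ ∧ ∀ z ∈ S, ‖g m z‖ < ρ) (hs : 0 < s) :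
    ∀ᶠ z in 𝓝 γ, z ∈ S ∧ ∀ m, ‖g m z - γ‖ < s := by
  obtain ⟨r, hr, hrS⟩ := isOpen_iff.1 hS γ hγ
  have h1 : ∀ᶠ z in 𝓝 γ, 4 * ρ / r * ‖z - γ‖ < s := by
    have : Continuous fun z : ℂ => 4 * ρ / r * ‖z - γ‖ := by fun_prop
    exact this.continuousAt.eventually_lt_const (by simpa using hs)
  filter_upwards [h1, ball_mem_nhds γ (half_pos hr), ball_mem_nhds γ hr] with z hz hz' hz''
  refine ⟨hrS hz'', fun m => lt_of_le_of_lt ?_ hz⟩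
  have := lipschitz_of_bdd hr ((hg m).1.mono hrS) (fun w hw => ((hg m).2.2 w (hrS hw)).le)
    (mem_ball_self (half_pos hr)) hz'
  rwa [(hg m).2.1] at this

end QL

theorem eventually_expand {f : ℂ → ℂ} {μ γ : ℂ} (hf : HasDerivAt f μ γ) (hfix : f γ = γ) {k : ℝ} (hk : k < ‖μ‖) :
    ∀ᶠ z in 𝓝 γ, k * ‖z - γ‖ ≤ ‖f z - γ‖ := by
  have h1 := hf.isLittleO.def (sub_pos.2 hk)
  filter_upwards [h1] with z hz
  rw [hfix] at hz
  have h2 := norm_sub_norm_le ((z - γ) • μ) (f z - γ)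
  rw [norm_sub_rev ((z - γ) • μ), norm_smul] at h2
  nlinarith

theorem eventually_contract {f : ℂ → ℂ} {μ γ : ℂ} (hf : HasDerivAt f μ γ) (hfix : f γ = γ) {k : ℝ} (hk : ‖μ‖ < k) :
    ∀ᶠ z in 𝓝 γ, ‖f z - γ‖ ≤ k * ‖z - γ‖ := by
  have h1 := hf.isLittleO.def (sub_pos.2 hk)
  filter_upwards [h1] with z hz
  rw [hfix] at hz
  have h2 := norm_le_norm_add_norm_sub' (f z - γ) ((z - γ) • μ)
  rw [norm_smul] at h2
  nlinarith

namespace QL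

variable {ρ : ℝ} {f q : ℂ → ℂ}

theorem branches_tendsto {S : Set ℂ} {γ μ : ℂ} (hS : IsOpen S) (hc : IsPreconnected S) (hγ : γ ∈ S)
    (hf : HasDerivAt f μ γ) (hfix : f γ = γ) (hμ : 1 < ‖μ‖) {g : ℕ → ℂ → ℂ}
    (hg : ∀ m, HolOn (g m) S ∧ g m γ = γ ∧ ∀ z ∈ S, ‖g m z‖ < ρ)
    (hgf : ∀ m, ∀ z ∈ S, f (g (m + 1) z) = g m z) {z : ℂ} (hz : z ∈ S) : Tendsto (fun m => g m z) atTop (𝓝 γ) := by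
  obtain ⟨k, hk1, hkμ⟩ := exists_between hμ
  obtain ⟨s, hs, hexp⟩ := Metric.eventually_nhds_iff.1 (eventually_expand hf hfix hkμ)
  refine LocBdd.vitali (F := g) (f := fun _ => γ) hS hc (LocBdd.of_bdd hS (M := ρ) (.of_forall fun m => (hg m).1)
    (.of_forall fun m z hz => ((hg m).2.2 z hz).le)) (differentiableOn_const _) hγ
    (((branches_near hS hγ hg hs).filter_mono nhdsWithin_le_nhds).mono fun w hw => ?_).frequently z hz
  have h1 : ∀ m, ‖g m w - γ‖ ≤ k⁻¹ ^ m * ‖g 0 w - γ‖ := fun m => by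
    induction m with
    | zero => simp
    | succ m ih =>
      have := hexp (y := g (m + 1) w) (by rw [dist_eq_norm]; exact hw.2 _)
      rw [hgf m w hw.1] at this
      rw [pow_succ', mul_assoc, inv_mul_eq_div, le_div_iff₀ (by linarith)]
      linarith
  rw [tendsto_iff_norm_sub_tendsto_zero]
  refine squeeze_zero (fun _ => norm_nonneg _) h1 ?_
  have := (tendsto_pow_atTop_nhds_zero_of_lt_one (r := k⁻¹) (by positivity) (inv_lt_one_of_one_lt₀ hk1)).mul_const
    ‖g 0 w - γ‖
  simpa using this

/-- The critical point is attracted to an attracting fixed point, without ever landing on it. -/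
theorem attracts (h : QL ρ f q) {α μ : ℂ} (hα : ‖α‖ < ρ) (hfix : f α = α) (hf : HasDerivAt f μ α) (h0 : μ ≠ 0)
    (h1 : ‖μ‖ < 1) : (∀ i, ‖f^[i] 0‖ < ρ) ∧ (∀ i, f^[i] 0 ≠ α) ∧ Tendsto (fun i => f^[i] 0) atTop (𝓝 α) := by
  obtain ⟨k, hkμ, hk1⟩ := exists_between h1
  have hk0 : 0 < k := (norm_nonneg μ).trans_lt hkμ
  have hμ0 : 0 < ‖μ‖ := norm_pos_iff.2 h0
  obtain ⟨s, hs, hsb⟩ := eventually_nhds_iff_ball.1 ((eventually_contract hf hfix hkμ).and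
    ((eventually_expand hf hfix (half_lt_self hμ0)).and (isOpen_ball.mem_nhds (mem_ball_zero_iff.2 hα))))
  have hcon : ∀ z ∈ ball α s, f z ∈ ball α s := fun z hz => by
    have := (hsb z hz).1
    rw [mem_ball, dist_eq_norm] at hz ⊢
    nlinarith [norm_nonneg (z - α)]
  have hne : ∀ z ∈ ball α s, z ≠ α → f z ≠ α := fun z hz hzα hfz => by
    have := (hsb z hz).2.1
    rw [hfz, sub_self, norm_zero] at this
    have := norm_pos_iff.2 (sub_ne_zero.2 hzα)
    nlinarith
  obtain ⟨m, hm, hmS, hmα⟩ : ∃ m, (∀ i ≤ m, ‖f^[i + 1] 0‖ < ρ) ∧ f^[m + 1] 0 ∈ ball α s ∧ f^[m + 1] 0 ≠ α := by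
    by_contra! hcontra
    obtain ⟨g, hg0, hg⟩ := h.exists_branches isOpen_ball ((convex_ball α s).starConvex (mem_ball_self hs))
      (fun z hz => (hsb z hz).2.2) (y := fun _ => α) (mem_ball_self hs) (fun _ => hα) (fun _ => hfix)
      (fun m hm hmS => ⟨hcontra m hm hmS, h.f_zero_ne hα hfix (by rw [hf.deriv]; exact h0)⟩)
    obtain ⟨z, hz, hzα⟩ := (((branches_near isOpen_ball (mem_ball_self hs) (fun m => ⟨(hg m).1, (hg m).2.1,
      fun z hz => ((hg m).2.2 z hz).1⟩) hs).filter_mono nhdsWithin_le_nhds).and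
      (self_mem_nhdsWithin (s := {α}ᶜ))).exists
    have hpos : 0 < ‖z - α‖ := norm_pos_iff.2 (sub_ne_zero.2 hzα)
    have h2 : ∀ m, ‖z - α‖ ≤ k ^ m * s := fun m => by
      have : ∀ m, ‖z - α‖ ≤ k ^ m * ‖g m z - α‖ := fun m => by
        induction m with
        | zero => simp [hg0]
        | succ m ih =>
          have h3 := (hsb (g (m + 1) z) (by rw [mem_ball, dist_eq_norm]; exact hz.2 _)).1
          rw [((hg m).2.2 z hz.1).2] at h3
          calc _ ≤ k ^ m * ‖g m z - α‖ := ih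
            _ ≤ k ^ m * (k * ‖g (m + 1) z - α‖) := by gcongr
            _ = _ := by ring
      exact (this m).trans (by have := (hz.2 m).le; gcongr)
    have h3 := (tendsto_pow_atTop_nhds_zero_of_lt_one hk0.le hk1).mul_const s
    rw [zero_mul] at h3
    exact absurd (ge_of_tendsto' h3 h2) (not_le.2 hpos)
  have hit : ∀ j, f^[m + 1 + j] 0 ∈ ball α s ∧ f^[m + 1 + j] 0 ≠ α := fun j => by
    induction j with
    | zero => exact ⟨hmS, hmα⟩
    | succ j ih => rw [← add_assoc, iterate_succ_apply']; exact ⟨hcon _ ih.1, hne _ ih.1 ih.2⟩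
  have hle : ∀ j, ‖f^[m + 1 + j] 0 - α‖ ≤ k ^ j * s := fun j => by
    induction j with
    | zero => simpa [dist_eq_norm] using (mem_ball.1 hmS).le
    | succ j ih =>
      rw [← add_assoc, iterate_succ_apply', pow_succ', mul_assoc]
      exact (hsb _ (hit j).1).1.trans (by gcongr)
  refine ⟨fun i => ?_, fun i hi => ?_, ?_⟩
  · rcases i with _ | i
    · simpa using h.pos
    · rcases le_or_gt i m with him | him
      · exact hm i him
      · obtain ⟨j, hj⟩ := Nat.exists_eq_add_of_lt him
        rw [show i + 1 = m + 1 + (j + 1) by omega]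
        exact mem_ball_zero_iff.1 (hsb _ (hit (j + 1)).1).2.2
  · have h2 : f^[m + 1 + i] 0 = α := by
      rw [iterate_add_apply, hi]
      exact iterate_fixed hfix _
    exact (hit i).2 h2
  · rw [← tendsto_add_atTop_iff_nat (m + 1), tendsto_iff_norm_sub_tendsto_zero]
    refine squeeze_zero (g := fun j => k ^ j * s) (fun _ => norm_nonneg _)
      (fun j => by rw [add_comm j]; exact hle j) ?_
    simpa using (tendsto_pow_atTop_nhds_zero_of_lt_one hk0.le hk1).mul_const s

end QL

namespace QL

variable {ρ : ℝ} {f q : ℂ → ℂ}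

/-- The points of the critical orbit, up to the first escape. -/
def pc (ρ : ℝ) (f : ℂ → ℂ) : Set ℂ := {x | ∃ m, (∀ i ≤ m, ‖f^[i + 1] 0‖ < ρ) ∧ f^[m + 1] 0 = x}

/-- Backward orbits converging to a repelling fixed point. -/
theorem exists_backward (h : QL ρ f q) {γ w μ : ℂ} (hγ : ‖γ‖ < ρ) (hw : ‖w‖ < ρ) (hfix : f γ = γ)
    (hf : HasDerivAt f μ γ) (hμ : 1 < ‖μ‖) (hwγ : w ≠ γ) (hfin : (pc ρ f).Finite) (hwn : w ∉ pc ρ f) :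
    ∃ z : ℕ → ℂ, z 0 = w ∧ (∀ i, ‖z i‖ < ρ ∧ f (z (i + 1)) = z i) ∧ Tendsto z atTop (𝓝 γ) := by
  set X : Set ℂ := pc ρ f \ {γ} with hX
  have hXf : X.Finite := hfin.sdiff
  have hd0 : γ - w ≠ 0 := sub_ne_zero.2 hwγ.symm
  obtain ⟨t, hpρ, ht⟩ : ∃ t : ℝ, ‖(γ + w) / 2 + t * I * (γ - w)‖ < ρ ∧
      t ∉ ((fun x : ℂ => -(1 / 2) * (((x - γ) / (γ - w)).im / ((x - γ) / (γ - w)).re)) '' X ∪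
        (fun x : ℂ => 1 / 2 * (((x - w) / (γ - w)).im / ((x - w) / (γ - w)).re)) '' X) := by
    have h1 : Continuous fun t : ℝ => ‖(γ + w) / 2 + t * I * (γ - w)‖ := by fun_prop
    have h2 : ‖(γ + w) / 2 + ((0 : ℝ) : ℂ) * I * (γ - w)‖ < ρ := by
      have := norm_add_le γ w
      rw [ofReal_zero, zero_mul, zero_mul, add_zero, norm_div]
      norm_num
      linarith
    exact (((h1.continuousAt.eventually_lt_const h2).filter_mono nhdsWithin_le_nhds).and
      (((hXf.image _).union (hXf.image _)).eventually_cofinite_notMem.filter_mono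
        (nhdsNE_le_cofinite 0))).exists
  set p := (γ + w) / 2 + t * I * (γ - w) with hp
  set S : Set ℂ := {z | ‖z‖ < ρ ∧ ∀ s ∈ Icc (0 : ℝ) 1, p + s * (z - p) ∉ X} with hSdef
  have hSo : IsOpen S := by
    rw [isOpen_iff_mem_nhds]
    rintro z ⟨hz, hzX⟩
    have : ∀ᶠ z' in 𝓝 z, ∀ s ∈ Icc (0 : ℝ) 1, p + s * (z' - p) ∉ X := by
      refine isCompact_Icc.eventually_forall_of_forall_eventually fun s hs => ?_
      have h1 : Continuous fun y : ℂ × ℝ => p + y.2 * (y.1 - p) := by fun_prop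
      exact (h1.continuousAt (x := (z, s))).eventually (hXf.isClosed.isOpen_compl.mem_nhds (hzX s hs))
    filter_upwards [this, continuous_norm.continuousAt.eventually_lt_const hz] with z' h1 h2 using ⟨h2, h1⟩
  have hst : StarConvex ℝ p S := by
    rintro z ⟨hz, hzX⟩ a b ha hb hab
    have e : a • p + b • z = p + b * (z - p) := by
      rw [eq_sub_of_add_eq hab, Complex.real_smul, Complex.real_smul]; push_cast; ring
    refine ⟨?_, fun s hs => ?_⟩
    · exact mem_ball_zero_iff.1 (convex_ball (0 : ℂ) ρ (mem_ball_zero_iff.2 hpρ) (mem_ball_zero_iff.2 hz) ha hb hab)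
    · have := hzX (s * b) ⟨mul_nonneg hs.1 hb, mul_le_one₀ hs.2 hb (by linarith)⟩
      rw [e]
      convert this using 2
      push_cast; ring
  have hseg : ∀ (v : ℂ) (κ : ℝ), ‖v‖ < ρ → v ∉ X → κ ≠ 0 → (p - v) / (γ - w) = κ + t * I →
      t ∉ (fun x : ℂ => κ * (((x - v) / (γ - w)).im / ((x - v) / (γ - w)).re)) '' X → v ∈ S := by
    intro v κ hv hvX hκ hpv htv
    refine ⟨hv, fun s hs hx => htv ⟨_, hx, ?_⟩⟩
    have e : (p + s * (v - p) - v) / (γ - w) = (1 - s : ℝ) * (κ + t * I) := by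
      rw [← hpv]; push_cast; ring
    have hs1 : 1 - s ≠ 0 := fun h0 => hvX (by
      have : s = 1 := by linarith
      rw [this] at hx
      simpa using hx)
    beta_reduce
    rw [e, re_ofReal_mul, Complex.im_ofReal_mul]
    simp
    field_simp
  rw [mem_union, not_or] at ht
  have hγS : γ ∈ S := hseg γ (-(1 / 2)) hγ (fun h => h.2 rfl) (by norm_num)
    (by rw [div_eq_iff hd0, hp]; push_cast; ring) ht.1
  have hwS : w ∈ S := hseg w (1 / 2) hw (fun h => hwn h.1) (by norm_num)
    (by rw [div_eq_iff hd0, hp]; push_cast; ring) ht.2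
  have hpS : p ∈ S := ⟨hpρ, fun s _ => by have := hγS.2 0 (by simp); simpa using this⟩
  have hpc : IsPreconnected S := (hst.isPathConnected hpS).isConnected.isPreconnected
  have hμ0 : μ ≠ 0 := norm_pos_iff.1 (by linarith)
  obtain ⟨g, hg0, hg⟩ := h.exists_branches hSo hst (fun z hz => mem_ball_zero_iff.2 hz.1) (y := fun _ => γ) hγS
    (fun _ => hγ) (fun _ => hfix) (fun m hm hmS => ⟨by
      by_contra hne
      have := hmS.2 1 (by simp)
      rw [ofReal_one, one_mul, add_sub_cancel] at this
      exact this ⟨⟨m, hm, rfl⟩, hne⟩, h.f_zero_ne hγ hfix (by rw [hf.deriv]; exact hμ0)⟩)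
  refine ⟨fun m => g m w, hg0 w, fun i => (hg i).2.2 w hwS, ?_⟩
  exact branches_tendsto hSo hpc hγS hf hfix hμ (fun m => ⟨(hg m).1, (hg m).2.1, fun z hz => ((hg m).2.2 z hz).1⟩)
    (fun m z hz => ((hg m).2.2 z hz).2) hwS

end QL

theorem differentiable_crit (N : ℕ) : Differentiable ℂ fun c => (P c)^[N] 0 := fun c =>
  (hol2_iterate (W := univ) (a := fun _ _ => 0) (differentiableOn_const _) N).sep₁ isOpen_univ (z := 0) trivial

theorem exp_gB_le {c : ℂ} (hc : ‖c‖ < 5) : rexp (gB c) ≤ 12 := by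
  rw [exp_gB]; linarith

theorem norm_iterate_add_le {c b : ℂ} (hc : ‖c‖ < 5) (hb : ‖b‖ < 4) (N : ℕ) :
    ‖(P c)^[N] 0 + b‖ ≤ 16 * rexp (2 ^ N * G c 0) := by
  have h1 := norm_le_of_G c ((P c)^[N] 0)
  rw [G_iterate, Real.exp_add] at h1
  have h2 : 1 ≤ rexp (2 ^ N * G c 0) := one_le_exp (mul_nonneg (by positivity) (G_nonneg _ _))
  have := norm_add_le ((P c)^[N] 0) b
  have := exp_gB_le hc
  nlinarith

theorem le_norm_iterate_add {c b : ℂ} (hc : ‖c‖ < 5) (hb : ‖b‖ < 4) {N : ℕ} (hN : 96 ≤ rexp (2 ^ N * G c 0)) :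
    rexp (2 ^ N * G c 0) ≤ 24 * ‖(P c)^[N] 0 + b‖ := by
  have h1 := G_le_log c ((P c)^[N] 0)
  rw [G_iterate, ← exp_le_exp, Real.exp_add, exp_log (by positivity)] at h1
  have h2 := exp_gB_le hc
  have h3 : rexp (2 ^ N * G c 0) ≤ max 1 ‖(P c)^[N] 0‖ * 12 := h1.trans (by gcongr)
  have h4 := norm_sub_le_norm_add ((P c)^[N] 0) b
  rcases max_cases 1 ‖(P c)^[N] 0‖ with h | h <;> rw [h.1] at h3 <;> linarith

theorem tendsto_div_two_pow (a : ℝ) : Tendsto (fun N : ℕ => a / 2 ^ N) atTop (𝓝 0) := by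
  have := (tendsto_pow_atTop_nhds_zero_of_lt_one (r := (1 / 2 : ℝ)) (by norm_num) (by norm_num)).const_mul a
  rw [mul_zero] at this
  refine this.congr fun N => ?_
  rw [one_div, inv_pow, div_eq_mul_inv]

/-- Near a parameter where both behaviours occur, the critical orbit can be made to land on a repelling
fixed point. -/
theorem exists_hit {x : ℂ} {r : ℝ} {β : ℂ → ℂ} (hr : 0 < r) (hx : x ∈ Mandelbrot)
    (hesc : ∃ c ∈ ball x r, c ∉ Mandelbrot) (hb : ∀ c ∈ ball x r, ‖c‖ < 5) (hβ : HolOn β (ball x r))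
    (hfix : ∀ c ∈ ball x r, β c ^ 2 + c = β c) (hβ4 : ∀ c ∈ ball x r, ‖β c‖ < 4)
    (h1 : ∀ c ∈ ball x r, 1 < ‖2 * β c‖) : ∃ c ∈ ball x r, ∃ N, (P c)^[N] 0 = β c := by
  by_contra! hne
  set D := ball x r with hD
  have hDo : IsOpen D := isOpen_ball
  have hst : StarConvex ℝ x D := (convex_ball x r).starConvex (mem_ball_self hr)
  have hpc : IsPreconnected D := (convex_ball x r).isPreconnected
  have hne' : ∀ N, ∀ c ∈ D, (P c)^[N] 0 + β c ≠ 0 := fun N c hc h0 => hne c hc (N + 1) (by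
    rw [iterate_succ_apply', eq_neg_of_add_eq_zero_left h0, P, neg_sq, hfix c hc])
  choose L hLd hL using fun N => exists_log hDo hst ((differentiable_crit N).differentiableOn.add hβ) (hne' N)
  set φ : ℕ → ℂ → ℂ := fun N c => exp (L N c / 2 ^ N) with hφ
  have hLn : ∀ N, ∀ c ∈ D, rexp (L N c).re = ‖(P c)^[N] 0 + β c‖ := fun N c hc => by
    rw [← norm_exp, hL N c hc]; rfl
  have hφn : ∀ N c, ‖φ N c‖ = rexp ((L N c).re / 2 ^ N) := fun N c => by
    rw [hφ, norm_exp, show ((2 : ℂ) ^ N) = ((2 ^ N : ℝ) : ℂ) by push_cast; rfl, div_ofReal_re]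
  have hφp : ∀ N, ∀ c ∈ D, ‖φ N c‖ ^ 2 ^ N = ‖(P c)^[N] 0 + β c‖ := fun N c hc => by
    rw [hφn, ← Real.exp_nat_mul, ← hLn N c hc]
    congr 1
    push_cast
    field_simp
  have hLle : ∀ N, ∀ c ∈ D, (L N c).re / 2 ^ N ≤ G c 0 + log 16 / 2 ^ N := fun N c hc => by
    have := norm_iterate_add_le (hb c hc) (hβ4 c hc) N
    rw [← hLn N c hc, ← exp_log (show (0 : ℝ) < 16 by norm_num), ← Real.exp_add, exp_le_exp] at this
    rw [div_le_iff₀ (by positivity), add_mul, div_mul_cancel₀ _ (by positivity)]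
    linarith
  have hφb : ∀ N, ∀ c ∈ D, ‖φ N c‖ ≤ rexp (log 12 + log 16) := fun N c hc => by
    rw [hφn, exp_le_exp]
    refine (hLle N c hc).trans (add_le_add ?_ (div_le_self (log_nonneg (by norm_num)) (one_le_pow₀ (by norm_num))))
    have := G_le_log c 0
    have h2 := exp_gB_le (hb c hc)
    rw [← exp_log (show (0 : ℝ) < 12 by norm_num), exp_le_exp] at h2
    simp at this
    linarith
  have hφd : ∀ N, HolOn (φ N) D := fun N => ((hLd N).div_const _).cexp
  set 𝒰 := hyperfilter ℕ
  have hle : (𝒰 : Filter ℕ) ≤ atTop := Nat.hyperfilter_le_atTop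
  have hB1 : LocBdd 𝒰 φ D := LocBdd.of_bdd hDo (.of_forall hφd) (.of_forall hφb)
  have hB2 : LocBdd 𝒰 (fun N => φ (N + 1)) D :=
    LocBdd.of_bdd hDo (.of_forall fun N => hφd _) (.of_forall fun N => hφb _)
  obtain ⟨f, hf⟩ := hB1.exists_limit
  obtain ⟨f', hf'⟩ := hB2.exists_limit
  have hfd := hB1.differentiableOn hDo hf
  have hfd' := hB2.differentiableOn hDo hf'
  have hlim : ∀ c ∈ D, c ∉ Mandelbrot → Tendsto (fun N => ‖φ N c‖) atTop (𝓝 (rexp (G c 0))) := by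
    intro c hc hcM
    have hG := G_zero_pos hcM
    simp only [hφn]
    refine (continuous_exp.tendsto _).comp ?_
    have h2 : Tendsto (fun N : ℕ => rexp (2 ^ N * G c 0)) atTop atTop :=
      Real.tendsto_exp_atTop.comp ((tendsto_pow_atTop_atTop_of_one_lt (by norm_num : (1 : ℝ) < 2)).atTop_mul_const hG)
    refine tendsto_of_tendsto_of_tendsto_of_le_of_le' (g := fun N : ℕ => G c 0 - log 24 / 2 ^ N)
      (h := fun N : ℕ => G c 0 + log 16 / 2 ^ N)
      (by simpa using (tendsto_div_two_pow (log 24)).const_sub (G c 0))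
      (by simpa using (tendsto_div_two_pow (log 16)).const_add (G c 0)) ?_ (.of_forall fun N => hLle N c hc)
    filter_upwards [h2.eventually_ge_atTop 96] with N hN
    have := le_norm_iterate_add (hb c hc) (hβ4 c hc) hN
    rw [← hLn N c hc, ← exp_log (show (0 : ℝ) < 24 by norm_num), ← Real.exp_add, exp_le_exp] at this
    rw [le_div_iff₀ (by positivity), sub_mul, div_mul_cancel₀ _ (by positivity)]
    linarith
  have he1 : ∀ c ∈ D, c ∉ Mandelbrot → ‖f c‖ = rexp (G c 0) := fun c hc hcM =>
    tendsto_nhds_unique (hf c hc).norm ((hlim c hc hcM).mono_left hle)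
  have he2 : ∀ c ∈ D, c ∉ Mandelbrot → ‖f' c‖ = rexp (G c 0) := fun c hc hcM =>
    tendsto_nhds_unique (hf' c hc).norm (((hlim c hc hcM).comp (tendsto_add_atTop_nat 1)).mono_left hle)
  obtain ⟨c₁, hc1, hc1M⟩ := hesc
  have hnz : ∀ c ∈ D, f c ≠ 0 := (hB1.zero_or_ne_zero hDo hpc hf
    (.of_forall fun N z _ => exp_ne_zero _)).resolve_left fun h0 => by
      have := he1 c₁ hc1 hc1M
      rw [h0 c₁ hc1, norm_zero] at this
      exact (exp_pos _).ne this
  have hratio : ∀ c ∈ D, ‖f' c‖ = ‖f c‖ := by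
    obtain ⟨s, hs, hsD⟩ := isOpen_iff.1 (hDo.inter isClosed_Mandelbrot.isOpen_compl) c₁ ⟨hc1, hc1M⟩
    set h : ℂ → ℂ := fun c => f' c / f c with hh
    have hhd : HolOn h D := hfd'.div hfd hnz
    have hh1 : ∀ c ∈ ball c₁ s, ‖h c‖ = 1 := fun c hc => by
      rw [hh, norm_div, he1 c (hsD hc).1 (hsD hc).2, he2 c (hsD hc).1 (hsD hc).2, div_self (exp_pos _).ne']
    have hmax : IsMaxOn (norm ∘ h) (ball c₁ s) c₁ := fun c hc => by
      simp only [mem_ofPred_eq, comp_apply, hh1 c hc, hh1 c₁ (mem_ball_self hs), le_refl]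
    have h3 := Complex.eqOn_of_isPreconnected_of_isMaxOn_norm (convex_ball c₁ s).isPreconnected isOpen_ball
      (hhd.mono fun c hc => (hsD hc).1) (mem_ball_self hs) hmax
    have h4 := eqOn_of_eventuallyEq_holo hDo hpc hhd (differentiableOn_const (h c₁)) hc1
      (((eventually_of_mem (ball_mem_nhds c₁ hs) h3).filter_mono nhdsWithin_le_nhds).frequently)
    intro c hc
    have h5 := congr_arg norm (h4 hc)
    rw [hh1 c₁ (mem_ball_self hs), hh, norm_div, div_eq_one_iff_eq (norm_ne_zero_iff.2 (hnz c hc))] at h5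
    exact h5
  have hge : ∀ c ∈ D, 1 ≤ ‖f c‖ := by
    intro c hc
    by_contra! hlt
    obtain ⟨k, hk1, hk2⟩ := exists_between hlt
    have hk0 := (norm_nonneg _).trans_lt hk1
    have h2 : Tendsto (fun N => (P c)^[N] 0 + β c) 𝒰 (𝓝 0) := by
      refine squeeze_zero_norm' (a := fun N : ℕ => k ^ 2 ^ N) ?_
        (((tendsto_pow_atTop_nhds_zero_of_lt_one hk0.le hk2).comp
          (tendsto_pow_atTop_atTop_of_one_lt (r := 2) (by norm_num))).mono_left hle)
      filter_upwards [(hf c hc).norm.eventually_lt_const hk1] with N hN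
      rw [← hφp N c hc]
      gcongr
    have h3 : Tendsto (fun N => (P c)^[N + 1] 0 + β c) 𝒰 (𝓝 (2 * β c)) := by
      have h4 : Tendsto (fun N => ((P c)^[N] 0 + β c) * ((P c)^[N] 0 + β c) - 2 * β c * ((P c)^[N] 0 + β c) + 2 * β c)
          𝒰 (𝓝 (0 * 0 - 2 * β c * 0 + 2 * β c)) := ((h2.mul h2).sub (h2.const_mul _)).add_const _
      rw [mul_zero, mul_zero, sub_zero, zero_add] at h4
      refine h4.congr fun N => ?_
      rw [iterate_succ_apply', P]
      linear_combination -(hfix c hc)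
    have h5 : 1 ≤ ‖f' c‖ := by
      refine ge_of_tendsto (hf' c hc).norm ?_
      filter_upwards [h3.norm.eventually_const_lt (h1 c hc)] with N hN
      by_contra! hlt
      have := hφp (N + 1) c hc
      have h6 := pow_le_one₀ (n := 2 ^ (N + 1)) (norm_nonneg _) hlt.le
      linarith
    rw [hratio c hc] at h5
    linarith
  have hx1 : ‖f x‖ ≤ 1 := by
    refine le_of_tendsto_of_tendsto (hf x (mem_ball_self hr)).norm
      (((continuous_exp.tendsto _).comp (tendsto_div_two_pow (log 16))).mono_left hle |>.trans
        (by rw [Real.exp_zero])) (.of_forall fun N => ?_)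
    have := hLle N x (mem_ball_self hr)
    rw [(mem_Mandelbrot_iff x).1 hx, zero_add] at this
    exact (hφn N x).trans_le (exp_le_exp.2 this)
  have hmax : IsMaxOn (norm ∘ fun c => (f c)⁻¹) D x := fun c hc => by
    simp only [mem_ofPred_eq, comp_apply, norm_inv]
    exact inv_anti₀ (norm_pos_iff.2 (hnz x (mem_ball_self hr))) (hx1.trans (hge c hc))
  have h3 := Complex.eqOn_of_isPreconnected_of_isMaxOn_norm hpc hDo (hfd.fun_inv hnz) (mem_ball_self hr) hmax hc1
  have h4 : f c₁ = f x := inv_injective h3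
  have h5 := he1 c₁ hc1 hc1M
  rw [h4] at h5
  have := one_lt_exp_iff.2 (G_zero_pos hc1M)
  linarith

/-- The critical orbit of a family of quadratic-like maps lands on a repelling fixed point at `c0`,
but not persistently. -/
structure Landing (n : ℕ) (ρ : ℝ) (D : Set ℂ) (β : ℂ → ℂ) (c0 : ℂ) (N : ℕ) : Prop where
  isOpen : IsOpen D
  ql : ∀ c ∈ D, QLAt n ρ c
  diff : HolOn β D
  fix : ∀ c ∈ D, (P c)^[n] (β c) = β c
  lt : ∀ c ∈ D, ‖β c‖ < ρ
  rep : ∀ c ∈ D, 1 < ‖deriv ((P c)^[n]) (β c)‖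
  mem : c0 ∈ D
  orb : ∀ i ≤ N, ‖((P c0)^[n])^[i] 0‖ < ρ
  hit : ((P c0)^[n])^[N] 0 = β c0
  ne : ¬ ∀ᶠ c in 𝓝 c0, ((P c)^[n])^[N] 0 = β c

theorem deriv_P (c z : ℂ) : deriv (P c) z = 2 * z := by
  have : HasDerivAt (P c) (2 * z) z :=
    ((hasDerivAt_pow 2 z).add_const c).congr_deriv (by simp)
  exact this.deriv

theorem exists_landing {x : ℂ} (hx : x ∈ frontier Mandelbrot) (hx4 : x ≠ 1 / 4) {ε : ℝ} (hε : 0 < ε) :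
    ∃ D β c0 N, D ⊆ ball x ε ∧ Landing 1 20 D β c0 N := by
  have hxM : x ∈ Mandelbrot := isClosed_Mandelbrot.frontier_subset hx
  have hx4' : 0 < ‖1 / 4 - x‖ := norm_pos_iff.2 (sub_ne_zero.2 hx4.symm)
  set r1 := min ε (min 1 ‖1 / 4 - x‖) with hr1
  have hr10 : 0 < r1 := lt_min hε (lt_min one_pos hx4')
  obtain ⟨s, hsd, hs⟩ := exists_sqrt (f := fun c => 1 / 4 - c) isOpen_ball
    ((convex_ball x r1).starConvex (mem_ball_self hr10)) (differentiableOn_id.const_sub (1 / 4)) (fun c hc h0 => by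
      have h1 : ‖1 / 4 - x‖ = dist c x := by rw [dist_eq_norm, ← sub_eq_zero.1 h0]
      have h2 := (mem_ball.1 hc).trans_le (inf_le_right.trans inf_le_right)
      exact h2.ne h1.symm)
  have hs0 : s x ≠ 0 := fun h0 => by
    have := hs x (mem_ball_self hr10)
    rw [h0] at this
    exact hx4 (by linear_combination this)
  obtain ⟨σ, hσ, hσ1⟩ : ∃ σ : ℂ, σ ^ 2 = 1 ∧ 1 < ‖1 + 2 * (σ * s x)‖ := by
    by_contra! hcon
    have h1 := hcon 1 (by simp)
    have h2 := hcon (-1) (by simp)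
    have h3 := parallelogram_law_with_norm ℝ (1 : ℂ) (2 * (1 * s x))
    rw [show (1 : ℂ) - 2 * (1 * s x) = 1 + 2 * (-1 * s x) by ring] at h3
    have h4 : 0 < ‖2 * (1 * s x)‖ := norm_pos_iff.2 (by simpa using hs0)
    rw [norm_one] at h3
    nlinarith [norm_nonneg (1 + 2 * (1 * s x)), norm_nonneg (1 + 2 * (-1 * s x))]
  set β : ℂ → ℂ := fun c => 1 / 2 + σ * s c with hβ
  have hβd : HolOn β (ball x r1) := (hsd.const_mul σ).const_add _
  have h2β : ∀ᶠ c in 𝓝 x, 1 < ‖2 * β c‖ := by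
    have h1 : ContinuousAt (fun c => ‖2 * β c‖) x :=
      ((hβd.differentiableAt (ball_mem_nhds x hr10)).continuousAt.const_mul 2).norm
    refine h1.eventually_const_lt ?_
    show 1 < ‖2 * (1 / 2 + σ * s x)‖
    rw [mul_add, mul_one_div_cancel two_ne_zero]
    exact hσ1
  obtain ⟨r, hr, hrb⟩ := eventually_nhds_iff_ball.1 (h2β.and (ball_mem_nhds x hr10))
  have hfix : ∀ c ∈ ball x r, β c ^ 2 + c = β c := fun c hc => by
    have := hs c (hrb c hc).2
    rw [hβ]
    linear_combination σ ^ 2 * this + (1 / 4 - c) * hσ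
  have hb : ∀ c ∈ ball x r, ‖c‖ < 5 := fun c hc => by
    have h1 := (mem_ball.1 (hrb c hc).2).trans_le (inf_le_right.trans inf_le_left)
    rw [dist_eq_norm] at h1
    linarith [norm_le_norm_add_norm_sub' c x, norm_le_of_mem_Mandelbrot hxM]
  have hβ4 : ∀ c ∈ ball x r, ‖β c‖ < 4 := fun c hc => by
    by_contra! h4
    have h1 : ‖β c‖ ^ 2 ≤ ‖β c‖ + ‖c‖ := by
      rw [← norm_pow, show β c ^ 2 = β c - c by linear_combination hfix c hc]
      exact norm_sub_le _ _
    nlinarith [hb c hc]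
  obtain ⟨c₁, hc1, hc1M⟩ : ∃ c ∈ ball x r, c ∉ Mandelbrot := by
    have h1 := hx.2
    rw [mem_interior_iff_mem_nhds] at h1
    by_contra! h2
    exact h1 (mem_of_superset (ball_mem_nhds x hr) h2)
  have hM : ∀ c ∈ ball x r, ∀ N, (P c)^[N] 0 = β c → G c 0 = 0 := fun c hc N hN => by
    have h1 : G c (β c) = 0 := G_eq_zero_of_bdd (B := ‖β c‖) fun k => by
      rw [iterate_fixed (show P c (β c) = β c from hfix c hc)]
    have h2 := G_iterate c 0 N
    rw [hN, h1] at h2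
    exact (mul_eq_zero.1 h2.symm).resolve_left (by positivity)
  obtain ⟨c0, hc0, N, hN⟩ := exists_hit hr hxM ⟨c₁, hc1, hc1M⟩ hb (hβd.mono fun c hc => (hrb c hc).2) hfix hβ4
    fun c hc => (hrb c hc).1
  refine ⟨ball x r, β, c0, N, fun c hc => ball_min_left (hrb c hc).2, isOpen_ball,
    fun c hc => ⟨le_rfl, by norm_num, fun a _ b _ h => ?_, fun y hy => ⟨y - c, ?_, ?_⟩⟩,
    hβd.mono fun c hc => (hrb c hc).2, fun c hc => hfix c hc, fun c hc => (hβ4 c hc).trans (by norm_num),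
    fun c hc => ?_, hc0, fun i _ => ?_, by rw [Function.iterate_one]; exact hN, fun hev => ?_⟩
  · simpa [Q] using h
  · rw [mem_ball_zero_iff]
    have := norm_sub_le y c
    have := hb c hc
    have := mem_closedBall_zero_iff.1 hy
    linarith
  · simp [Q]
  · rw [Function.iterate_one, deriv_P]; exact (hrb c hc).1
  · rw [Function.iterate_one]
    have h1 := norm_le_of_G c0 ((P c0)^[i] 0)
    rw [G_iterate, hM c0 hc0 N hN, mul_zero, zero_add] at h1
    linarith [exp_gB_le (hb c0 hc0)]
  · simp only [Function.iterate_one] at hev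
    have h1 := eqOn_of_eventuallyEq_holo isOpen_ball (convex_ball x r).isPreconnected
      (differentiable_crit N).differentiableOn (hβd.mono fun c hc => (hrb c hc).2) hc0
      (hev.filter_mono nhdsWithin_le_nhds).frequently
    exact hc1M ((mem_Mandelbrot_iff c₁).2 (hM c₁ hc1 N (h1 hc1)))

/-- The multiplier of a marked fixed point of `P_c^n`. -/
noncomputable def mult (n : ℕ) (α : ℂ → ℂ) (c : ℂ) : ℂ := deriv ((P c)^[n]) (α c)

/-- A family of quadratic-like maps with marked fixed points, one of which is neutral at the centre `x`. -/
structure Neutral (n : ℕ) (ρ : ℝ) (x : ℂ) (r : ℝ) (α β : ℂ → ℂ) : Prop where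
  pos : 0 < r
  ql : ∀ c ∈ ball x r, QLAt n ρ c
  dα : HolOn α (ball x r)
  dβ : HolOn β (ball x r)
  fixα : ∀ c ∈ ball x r, (P c)^[n] (α c) = α c
  fixβ : ∀ c ∈ ball x r, (P c)^[n] (β c) = β c
  ltα : ∀ c ∈ ball x r, ‖α c‖ < ρ
  ltβ : ∀ c ∈ ball x r, ‖β c‖ < ρ
  ne : ∀ c ∈ ball x r, β c ≠ α c
  rep : ∀ c ∈ ball x r, 1 < ‖mult n β c‖
  inj : InjOn (mult n α) (ball x r)
  norm_one : ‖mult n α x‖ = 1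

theorem frequently_lt_norm {w : ℂ} (hw : 1 ≤ ‖w‖) : ∃ᶠ y in 𝓝 w, 1 < ‖y‖ := by
  have h1 : Tendsto (fun t : ℝ => (t : ℂ) * w) (𝓝[>] 1) (𝓝 w) := by
    have : Continuous fun t : ℝ => (t : ℂ) * w := by fun_prop
    have h2 := this.tendsto 1
    rw [ofReal_one, one_mul] at h2
    exact h2.mono_left nhdsWithin_le_nhds
  refine h1.frequently (Eventually.frequently ?_)
  filter_upwards [self_mem_nhdsWithin (a := (1 : ℝ)) (s := Ioi 1)] with t ht
  have : (1 : ℝ) < t := ht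
  rw [norm_mul, norm_real, norm_eq_abs, abs_of_pos (by linarith)]
  nlinarith

theorem frequently_norm_lt {w : ℂ} (hw : ‖w‖ ≤ 1) : ∃ᶠ y in 𝓝 w, y ≠ 0 ∧ ‖y‖ < 1 := by
  rcases eq_or_ne w 0 with rfl | h0
  · have h1 : ∀ᶠ y in 𝓝[≠] (0 : ℂ), y ≠ 0 ∧ ‖y‖ < 1 := by
      filter_upwards [self_mem_nhdsWithin, nhdsWithin_le_nhds (ball_mem_nhds (0 : ℂ) one_pos)] with y h1 h2
      exact ⟨h1, mem_ball_zero_iff.1 h2⟩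
    exact h1.frequently.filter_mono nhdsWithin_le_nhds
  have h1 : Tendsto (fun t : ℝ => (t : ℂ) * w) (𝓝[<] 1) (𝓝 w) := by
    have : Continuous fun t : ℝ => (t : ℂ) * w := by fun_prop
    have h2 := this.tendsto 1
    rw [ofReal_one, one_mul] at h2
    exact h2.mono_left nhdsWithin_le_nhds
  refine h1.frequently (Eventually.frequently ?_)
  filter_upwards [self_mem_nhdsWithin (a := (1 : ℝ)) (s := Iio 1),
    nhdsWithin_le_nhds (Ioi_mem_nhds (zero_lt_one : (0 : ℝ) < 1))] with t ht ht0
  have h2 : t < 1 := ht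
  have h3 : (0 : ℝ) < t := ht0
  refine ⟨mul_ne_zero (by exact_mod_cast h3.ne') h0, ?_⟩
  rw [norm_mul, norm_real, norm_eq_abs, abs_of_pos h3]
  have := norm_pos_iff.2 h0
  nlinarith

theorem differentiable_crit_iterate (n N : ℕ) : Differentiable ℂ fun c => ((P c)^[n])^[N] 0 := by
  simp only [← iterate_mul]
  exact differentiable_crit _

theorem mult_differentiableOn {n : ℕ} {α : ℂ → ℂ} {D : Set ℂ} (h : HolOn α D) :
    HolOn (mult n α) D :=
  multiplier_differentiableOn (f := fun c => (P c)^[n]) (hol2_iterate (a := fun _ z => z)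
    (W := univ) differentiable_snd.differentiableOn n) h fun _ _ => rfl

/-- If `F N c → α c` for repelling fixed points `α c`, then `F N = α` for some `N` on an open set. -/
theorem eventually_eq_of_tendsto_repelling {D : Set ℂ} (hD : IsOpen D) (hne : D.Nonempty) {f : ℂ → ℂ → ℂ} {α μ : ℂ → ℂ}
    (hα : ContinuousOn α D) (hfix : ∀ c ∈ D, f c (α c) = α c) (hf : ∀ c ∈ D, HasDerivAt (f c) (μ c) (α c))
    (hμ : ∀ c ∈ D, 1 < ‖μ c‖) (hF : ∀ N, Continuous fun c => (f c)^[N] 0)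
    (ht : ∀ c ∈ D, Tendsto (fun N => (f c)^[N] 0) atTop (𝓝 (α c))) :
    ∃ N, ∃ p ∈ D, ∀ᶠ c in 𝓝 p, (f c)^[N] 0 = α c := by
  have hland : ∀ c ∈ D, ∃ N, (f c)^[N] 0 = α c := by
    intro c hc
    by_contra! hcon
    obtain ⟨k, hk, hkμ⟩ := exists_between (hμ c hc)
    obtain ⟨N, hN⟩ := eventually_atTop.1 ((ht c hc).eventually (eventually_expand (hf c hc) (hfix c hc) hkμ))
    have h1 : ∀ j, ‖(f c)^[N] 0 - α c‖ ≤ ‖(f c)^[N + j] 0 - α c‖ := fun j => by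
      induction j with
      | zero => rfl
      | succ j ih =>
        have := hN (N + j) (by omega)
        rw [← add_assoc, iterate_succ_apply']
        nlinarith [norm_nonneg ((f c)^[N + j] 0 - α c)]
    have h2 : Tendsto (fun j => ‖(f c)^[N + j] 0 - α c‖) atTop (𝓝 0) := by
      have := ((ht c hc).comp (tendsto_add_atTop_nat N))
      rw [tendsto_iff_norm_sub_tendsto_zero] at this
      refine this.congr fun j => ?_
      rw [comp_apply, add_comm]
    have := norm_pos_iff.2 (sub_ne_zero.2 (hcon N))
    exact absurd (ge_of_tendsto' h2 h1) (not_le.2 this)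
  obtain ⟨x, hx⟩ := hne
  obtain ⟨r, hr, hrD⟩ := nhds_basis_closedBall.mem_iff.1 (hD.mem_nhds hx)
  have h1 := dense_iUnion_interior_of_closed (f := fun N => {c ∈ closedBall x r | (f c)^[N] 0 = α c} ∪ (ball x r)ᶜ)
    (fun N => ((isClosed_closedBall.isClosed_eq (hF N).continuousOn (hα.mono hrD))).union isOpen_ball.isClosed_compl)
    (eq_univ_of_forall fun c => by
      by_cases hc : c ∈ ball x r
      · obtain ⟨N, hN⟩ := hland c (hrD (ball_subset_closedBall hc))
        exact mem_iUnion.2 ⟨N, .inl ⟨ball_subset_closedBall hc, hN⟩⟩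
      · exact mem_iUnion.2 ⟨0, .inr hc⟩)
  obtain ⟨p, hp, hpi⟩ := h1.inter_open_nonempty (ball x r) isOpen_ball ⟨x, mem_ball_self hr⟩
  obtain ⟨N, hN⟩ := mem_iUnion.1 hpi
  refine ⟨N, p, hrD (ball_subset_closedBall hp), ?_⟩
  filter_upwards [mem_interior_iff_mem_nhds.1 hN, isOpen_ball.mem_nhds hp] with c h2 h3
  exact (h2.resolve_right fun h => h h3).2

namespace Neutral

variable {n : ℕ} {ρ r : ℝ} {x : ℂ} {α β : ℂ → ℂ}

theorem mult_diff (h : Neutral n ρ x r α β) : HolOn (mult n α) (ball x r) := mult_differentiableOn h.dα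

theorem map_nhds (h : Neutral n ρ x r α β) {c : ℂ} (hc : c ∈ ball x r) :
    map (mult n α) (𝓝 c) = 𝓝 (mult n α c) :=
  (hasStrictDerivAt_of_holo isOpen_ball h.mult_diff hc).map_nhds_eq
    (deriv_ne_zero_of_injOn isOpen_ball h.mult_diff h.inj hc)

theorem hasDerivAt (_ : Neutral n ρ x r α β) (c : ℂ) : HasDerivAt ((P c)^[n]) (mult n α c) (α c) :=
  (differentiable_iterate n c _).hasDerivAt

theorem attracts (h : Neutral n ρ x r α β) {c : ℂ} (hc : c ∈ ball x r) (h0 : mult n α c ≠ 0) (h1 : ‖mult n α c‖ < 1) :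
    (∀ i, ‖((P c)^[n])^[i] 0‖ < ρ) ∧ (∀ i, ((P c)^[n])^[i] 0 ≠ α c) ∧
      Tendsto (fun i => ((P c)^[n])^[i] 0) atTop (𝓝 (α c)) :=
  have ⟨_, _, hq⟩ := exists_QL_family isOpen_ball h.ql
  (hq c hc).attracts (h.ltα c hc) (h.fixα c hc) (h.hasDerivAt c) h0 h1

theorem exists_attracting (h : Neutral n ρ x r α β) : ∃ c ∈ ball x r, mult n α c ≠ 0 ∧ ‖mult n α c‖ < 1 := by
  have h1 := frequently_norm_lt h.norm_one.le
  rw [← h.map_nhds (mem_ball_self h.pos), frequently_map] at h1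
  obtain ⟨c, h2, h3⟩ := (h1.and_eventually (ball_mem_nhds x h.pos)).exists
  exact ⟨c, h3, h2⟩

theorem continuousAt_mult (h : Neutral n ρ x r α β) {c : ℂ} (hc : c ∈ ball x r) : ContinuousAt (mult n α) c :=
  (h.mult_diff.differentiableAt (isOpen_ball.mem_nhds hc)).continuousAt

theorem norm_crit_le (h : Neutral n ρ x r α β)
    (hcon : ∀ c ∈ ball x r, 1 < ‖mult n α c‖ → ∀ N, ‖((P c)^[n])^[N] 0‖ < ρ) {c : ℂ} (hc : c ∈ ball x r) (N : ℕ) :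
    ‖((P c)^[n])^[N] 0‖ ≤ ρ := by
  by_contra! hlt
  have h1 : ∀ᶠ c' in 𝓝 c, c' ∈ ball x r ∧ ρ < ‖((P c')^[n])^[N] 0‖ :=
    Eventually.and (isOpen_ball.mem_nhds hc)
      ((differentiable_crit_iterate n N).continuous.norm.continuousAt.eventually_const_lt hlt)
  rcases le_or_gt ‖mult n α c‖ 1 with hle | hgt
  · have h2 := frequently_norm_lt hle
    rw [← h.map_nhds hc, frequently_map] at h2
    obtain ⟨c', ⟨h3, h4⟩, h5, h6⟩ := (h2.and_eventually h1).exists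
    exact h6.not_gt ((h.attracts h5 h3 h4).1 N)
  · exact hlt.not_gt (hcon c hc hgt N)

/-- Some parameter with repelling `α` has an escaping critical orbit. -/
theorem exists_escaping (h : Neutral n ρ x r α β) :
    ∃ c ∈ ball x r, 1 < ‖mult n α c‖ ∧ ∃ N, ρ ≤ ‖((P c)^[n])^[N] 0‖ := by
  by_contra! hcon
  have hpc := (convex_ball x r).isPreconnected
  obtain ⟨c₂, hc₂, h20, h21⟩ := h.exists_attracting
  have hev : ∀ᶠ c in 𝓝 c₂, c ∈ ball x r ∧ mult n α c ≠ 0 ∧ ‖mult n α c‖ < 1 :=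
    Eventually.and (isOpen_ball.mem_nhds hc₂)
      (((h.continuousAt_mult hc₂).eventually_ne h20).and ((h.continuousAt_mult hc₂).norm.eventually_lt_const h21))
  have ht := LocBdd.vitali (l := atTop) (F := fun N c => ((P c)^[n])^[N] 0) (f := α) isOpen_ball hpc
    (LocBdd.of_bdd isOpen_ball (.of_forall fun N => (differentiable_crit_iterate n N).differentiableOn)
      (.of_forall fun N c hc => h.norm_crit_le hcon hc N)) h.dα hc₂
    ((hev.filter_mono nhdsWithin_le_nhds).frequently.mono fun c hc => (h.attracts hc.1 hc.2.1 hc.2.2).2.2)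
  have h1 := frequently_lt_norm h.norm_one.ge
  rw [← h.map_nhds (mem_ball_self h.pos), frequently_map] at h1
  obtain ⟨c₁, h2, h3⟩ := (h1.and_eventually (ball_mem_nhds x h.pos)).exists
  have hOo : IsOpen (ball x r ∩ {c | 1 < ‖mult n α c‖}) :=
    h.mult_diff.continuousOn.norm.isOpen_inter_preimage isOpen_ball isOpen_Ioi
  obtain ⟨N, p, hp, hpe⟩ := eventually_eq_of_tendsto_repelling (f := fun c => (P c)^[n]) (α := α) (μ := mult n α)
    hOo ⟨c₁, h3, h2⟩ (h.dα.continuousOn.mono inter_subset_left) (fun c hc => h.fixα c hc.1) (fun c _ => h.hasDerivAt c)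
    (fun c hc => hc.2) (fun N => (differentiable_crit_iterate n N).continuous) fun c hc => ht c hc.1
  have h4 := eqOn_of_eventuallyEq_holo isOpen_ball hpc (differentiable_crit_iterate n N).differentiableOn h.dα hp.1
    (hpe.filter_mono nhdsWithin_le_nhds).frequently
  exact (h.attracts hc₂ h20 h21).2.1 N (h4 hc₂)

end Neutral

namespace Neutral

variable {n : ℕ} {ρ r : ℝ} {x : ℂ} {α β : ℂ → ℂ}

/-- Near a neutral parameter the critical orbit can be made to land on `β`. -/
theorem exists_landing (h : Neutral n ρ x r α β) : ∃ c0 N, Landing n ρ (ball x r) β c0 N := by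
  have hpc := (convex_ball x r).isPreconnected
  have hst := (convex_ball x r).starConvex (mem_ball_self h.pos)
  obtain ⟨q, hq2, hq⟩ := exists_QL_family isOpen_ball h.ql
  obtain ⟨c₂, hc₂, h20, h21⟩ := h.exists_attracting
  have hρ : 0 < ρ := (hq c₂ hc₂).pos
  suffices H : ∃ c0 ∈ ball x r, ∃ N, (∀ i ≤ N, ‖((P c0)^[n])^[i] 0‖ < ρ) ∧ ((P c0)^[n])^[N] 0 = β c0 by
    obtain ⟨c0, hc0, N, horb, hhit⟩ := H
    refine ⟨c0, N, isOpen_ball, h.ql, h.dβ, h.fixβ, h.ltβ, h.rep, hc0, horb, hhit, fun hev => ?_⟩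
    have h4 := eqOn_of_eventuallyEq_holo isOpen_ball hpc (differentiable_crit_iterate n N).differentiableOn h.dβ hc0
      (hev.filter_mono nhdsWithin_le_nhds).frequently hc₂
    have h5 : Tendsto (fun i => ((P c₂)^[n])^[i] 0) atTop (𝓝 (β c₂)) := by
      rw [← tendsto_add_atTop_iff_nat N]
      refine tendsto_const_nhds.congr fun i => ?_
      rw [iterate_add_apply, show ((P c₂)^[n])^[N] 0 = β c₂ from h4, iterate_fixed (h.fixβ c₂ hc₂)]
    exact h.ne c₂ hc₂ (tendsto_nhds_unique h5 (h.attracts hc₂ h20 h21).2.2)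
  by_contra! hcon
  obtain ⟨c₁, hc1, h11, N0, hN0⟩ := h.exists_escaping
  have horb : ∀ c, ∀ m, (∀ i ≤ m, ‖((P c)^[n])^[i + 1] 0‖ < ρ) → ∀ i ≤ m + 1, ‖((P c)^[n])^[i] 0‖ < ρ := by
    intro c m hm i hi
    rcases i with _ | i
    · simpa using hρ
    · exact hm i (by omega)
  obtain ⟨z, hz0, hz, hzt⟩ := (hq c₁ hc1).exists_backward (h.ltα c₁ hc1) (h.ltβ c₁ hc1) (h.fixα c₁ hc1)
    (h.hasDerivAt c₁) h11 (h.ne c₁ hc1)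
    (((finite_Iio N0).image fun m => ((P c₁)^[n])^[m + 1] 0).subset fun y ⟨m, hm, hy⟩ => ⟨m, by
      by_contra hlt
      have h1 : N0 ≤ m := not_lt.1 hlt
      exact (horb c₁ m hm N0 (by omega)).not_ge hN0, hy⟩)
    fun ⟨m, hm, hy⟩ => hcon c₁ hc1 (m + 1) (horb c₁ m hm) hy
  obtain ⟨g, hg0, hg⟩ := exists_seq_of_step (X := ℂ → ℂ) (a := β)
    (p := fun m g => HolOn g (ball x r) ∧ g c₁ = z m ∧
      ∀ c ∈ ball x r, ((P c)^[n])^[m] (g c) = β c ∧ ∀ i ≤ m, ‖((P c)^[n])^[i] (g c)‖ < ρ)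
    (r := fun _ _ _ => True)
    ⟨h.dβ, hz0.symm, fun c hc => ⟨rfl, fun i hi => by
      rw [Nat.le_zero.1 hi]; exact h.ltβ c hc⟩⟩
    (fun m g ⟨hgd, hgy, hgS⟩ => by
      have hgρ : ∀ c ∈ ball x r, ‖g c‖ < ρ := fun c hc => (hgS c hc).2 0 (Nat.zero_le _)
      have hqd : HolOn (fun c => q c (g c)) (ball x r) :=
        Hol2.comp (f := q) hq2 differentiableOn_id hgd fun c hc => ⟨hc, mem_ball_zero_iff.2 (hgρ c hc)⟩
      obtain ⟨k, hkd, hk⟩ := exists_sqrt isOpen_ball hst hqd (fun c hc h0 => by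
          have h1 : (P c)^[n] 0 = g c := ((hq c hc).iff 0 (g c) (by simpa using hρ) (hgρ c hc)).2 (by rw [h0]; simp)
          have h2 : ∀ i, ((P c)^[n])^[i + 1] 0 = ((P c)^[n])^[i] (g c) := fun i => by
            rw [iterate_succ_apply, h1]
          exact hcon c hc (m + 1) (horb c m fun i hi => by rw [h2]; exact (hgS c hc).2 i hi)
            (by rw [h2, (hgS c hc).1]))
      obtain ⟨ε, hε, hεy⟩ : ∃ ε : ℂ, ε ^ 2 = 1 ∧ ε * k c₁ = z (m + 1) := by
        have h1 := hk _ hc1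
        have h2 := ((hq c₁ hc1).iff _ _ (hz (m + 1)).1 (hz m).1).1 (hz m).2
        rw [hgy, ← h2] at h1
        rcases sq_eq_sq_iff_eq_or_eq_neg.1 h1 with h | h
        · exact ⟨1, by simp, by simp [h]⟩
        · exact ⟨-1, by simp, by simp [h]⟩
      have hsq : ∀ c ∈ ball x r, (ε * k c) ^ 2 = q c (g c) := fun c hc => by rw [mul_pow, hε, one_mul, hk c hc]
      have hlt : ∀ c ∈ ball x r, ‖ε * k c‖ < ρ := fun c hc => (hq c hc).norm_lt (hgρ c hc) (hsq c hc)
      have hfk : ∀ c ∈ ball x r, (P c)^[n] (ε * k c) = g c := fun c hc =>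
        ((hq c hc).iff _ _ (hlt c hc) (hgρ c hc)).2 (hsq c hc)
      refine ⟨fun c => ε * k c, ⟨hkd.const_mul ε, hεy, fun c hc => ⟨?_, fun i hi => ?_⟩⟩, trivial⟩
      · rw [iterate_succ_apply, hfk c hc, (hgS c hc).1]
      · rcases i with _ | i
        · exact hlt c hc
        · rw [iterate_succ_apply, hfk c hc]; exact (hgS c hc).2 i (by omega))
  have ht := LocBdd.tendsto_zero_of_ne_zero (l := atTop) (F := fun m c => g m c - α c) isOpen_ball hpc
    (LocBdd.of_bdd isOpen_ball (M := ρ + ρ) (.of_forall fun m => (hg m).1.1.sub h.dα) (.of_forall fun m c hc =>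
      (norm_sub_le _ _).trans (add_le_add ((hg m).1.2.2 c hc |>.2 0 (Nat.zero_le _)).le (h.ltα c hc).le)))
    (.of_forall fun m c hc h0 => h.ne c hc (by
      rw [← ((hg m).1.2.2 c hc).1, sub_eq_zero.1 h0, iterate_fixed (h.fixα c hc)])) hc1
    (by
      rw [← sub_self (α c₁)]
      refine (hzt.sub_const (α c₁)).congr fun m => ?_
      rw [(hg m).1.2.1]) c₂ hc₂
  obtain ⟨s, hs, hsb⟩ := eventually_nhds_iff_ball.1
    (eventually_contract (h.hasDerivAt c₂) (h.fixα c₂ hc₂) h21)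
  have hd : 0 < ‖β c₂ - α c₂‖ := norm_pos_iff.2 (sub_ne_zero.2 (h.ne c₂ hc₂))
  obtain ⟨m, hm⟩ := (ht.norm.eventually_lt_const (show ‖(0 : ℂ)‖ < min s ‖β c₂ - α c₂‖ by simp [hs, hd])).exists
  have h1 : ∀ i, ‖((P c₂)^[n])^[i] (g m c₂) - α c₂‖ ≤ ‖g m c₂ - α c₂‖ := fun i => by
    induction i with
    | zero => rfl
    | succ i ih =>
      rw [iterate_succ_apply']
      refine (hsb _ ?_).trans (by rwa [one_mul])
      rw [mem_ball, dist_eq_norm]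
      exact ih.trans_lt (hm.trans_le inf_le_left)
  have h2 := h1 m
  rw [((hg m).1.2.2 c₂ hc₂).1] at h2
  exact (hm.trans_le inf_le_right).not_ge h2

end Neutral

theorem QL.exists_homoclinic {ρ : ℝ} {f q : ℂ → ℂ} (h : QL ρ f q) {γ μ : ℂ} (hγ : ‖γ‖ < ρ) (hfix : f γ = γ)
    (hf : HasDerivAt f μ γ) (hμ : 1 < ‖μ‖) (hfin : (QL.pc ρ f).Finite) (h0 : (0 : ℂ) ∉ QL.pc ρ f) {ψ : ℂ → ℂ}
    (hψ : Differentiable ℂ ψ) (hψ0 : ψ 0 = γ) (hψ1 : deriv ψ 0 ≠ 0) (hψμ : ∀ u, ψ (μ * u) = f (ψ u)) :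
    ∃ u, ψ u = 0 ∧ deriv ψ u ≠ 0 ∧ ∀ i : ℕ, ‖ψ ((μ ^ i)⁻¹ * u)‖ < ρ := by
  have hμ0 : μ ≠ 0 := norm_pos_iff.1 (by linarith)
  have hγ0 : (0 : ℂ) ≠ γ := by
    rintro rfl
    exact hμ0 (by rw [← hf.deriv, h.d0])
  obtain ⟨z, hz0, hz, hzt⟩ := h.exists_backward hγ (by simpa using h.pos) hfix hf hμ hγ0 hfin h0
  have hit : ∀ i k, f^[i] (z (i + k)) = z k := fun i => by
    induction i with
    | zero => intro k; simp
    | succ i ih => intro k; rw [iterate_succ_apply, show i + 1 + k = i + k + 1 by omega, (hz _).2, ih]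
  have hzne : ∀ i, z (i + 1) ≠ 0 := fun i hi => h0 ⟨i, fun k hk => by
    have := hit (k + 1) (i - k)
    rw [show k + 1 + (i - k) = i + 1 by omega, hi] at this
    rw [this]
    exact (hz _).1, by have := hit (i + 1) 0; rwa [add_zero, hi, hz0] at this⟩
  obtain ⟨S, hS, hSi⟩ := exists_injOn_nhds
    (hf.deriv ▸ hasStrictDerivAt_of_holo isOpen_univ h.hf.differentiableOn (mem_univ γ)) hμ0
  have hs0 := hasStrictDerivAt_of_holo isOpen_univ hψ.differentiableOn (mem_univ 0)
  have hmap := hs0.map_nhds_eq hψ1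
  rw [hψ0] at hmap
  have hcd : ContinuousAt (deriv ψ) 0 := (hψ.analyticAt 0).deriv.continuousAt
  obtain ⟨η, hη, hηb⟩ := eventually_nhds_iff_ball.1
    ((hψ.continuous.continuousAt.eventually (hψ0.symm ▸ hS : ∀ᶠ y in 𝓝 (ψ 0), y ∈ S)).and (hcd.eventually_ne hψ1))
  have him : ψ '' ball 0 η ∈ 𝓝 γ := hmap ▸ image_mem_map (ball_mem_nhds 0 hη)
  obtain ⟨i0, hi0⟩ := eventually_atTop.1 (hzt.eventually (him : ∀ᶠ y in 𝓝 γ, y ∈ ψ '' ball 0 η) |>.and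
    (hzt.eventually (hS : ∀ᶠ y in 𝓝 γ, y ∈ S)))
  obtain ⟨u0, hu₀, hψu0⟩ := (hi0 i0 le_rfl).1
  have hback : ∀ k : ℕ, ψ ((μ ^ k)⁻¹ * u0) = z (i0 + k) := fun k => by
    induction k with
    | zero => simpa using hψu0
    | succ k ih =>
      have hb : (μ ^ (k + 1))⁻¹ * u0 ∈ ball (0 : ℂ) η := by
        rw [mem_ball_zero_iff] at hu₀ ⊢
        rw [norm_mul, norm_inv, norm_pow]
        exact (mul_le_of_le_one_left (norm_nonneg _) (inv_le_one_of_one_le₀ (one_le_pow₀ hμ.le))).trans_lt hu₀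
      refine hSi (hηb _ hb).1 (hi0 _ (by omega)).2 ?_
      rw [← hψμ, ← add_assoc, (hz _).2, ← ih]
      congr 1
      rw [pow_succ']
      field_simp
  have hfor : ∀ k, ψ (μ ^ k * u0) = f^[k] (z i0) := fun k => by
    induction k with
    | zero => simpa using hψu0
    | succ k ih => rw [pow_succ', mul_assoc, hψμ, ih, iterate_succ_apply']
  have hfor' : ∀ k ≤ i0, ψ (μ ^ k * u0) = z (i0 - k) := fun k hk => by
    rw [hfor, ← hit k (i0 - k), Nat.add_sub_cancel' hk]
  have hder : ∀ k ≤ i0, deriv ψ (μ ^ k * u0) ≠ 0 := fun k => by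
    induction k with
    | zero => intro _; simpa using (hηb _ hu₀).2
    | succ k ih =>
      intro hk hd
      have h1 : HasDerivAt (fun u => ψ (μ * u)) (deriv ψ (μ * (μ ^ k * u0)) * μ) (μ ^ k * u0) :=
        (hψ _).hasDerivAt.comp (μ ^ k * u0) (by simpa using (hasDerivAt_id (μ ^ k * u0)).const_mul μ)
      have h2 : HasDerivAt (fun u => f (ψ u)) (deriv f (ψ (μ ^ k * u0)) * deriv ψ (μ ^ k * u0)) (μ ^ k * u0) :=
        (h.hf _).hasDerivAt.comp (μ ^ k * u0) (hψ _).hasDerivAt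
      simp only [hψμ] at h1
      have h3 := h1.unique h2
      rw [← mul_assoc, ← pow_succ', hd, zero_mul, hfor' k (by omega)] at h3
      obtain ⟨i, hi⟩ : ∃ i, i0 - k = i + 1 := ⟨i0 - k - 1, by omega⟩
      rw [hi] at h3
      exact mul_ne_zero (h.deriv_ne_zero (hz _).1 (by rw [(hz _).2]; exact (hz _).1) (hzne i)) (ih (by omega)) h3.symm
  refine ⟨μ ^ i0 * u0, ?_, hder i0 le_rfl, fun i => ?_⟩
  · rw [hfor' i0 le_rfl, Nat.sub_self, hz0]
  · have : ψ ((μ ^ i)⁻¹ * (μ ^ i0 * u0)) = z i := by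
      rcases le_total i i0 with hi | hi
      · obtain ⟨k, rfl⟩ := Nat.exists_eq_add_of_le hi
        rw [pow_add, mul_assoc, inv_mul_cancel_left₀ (pow_ne_zero _ hμ0), hfor' k (by omega), Nat.add_sub_cancel]
      · obtain ⟨k, rfl⟩ := Nat.exists_eq_add_of_le hi
        rw [← hback, pow_add, mul_inv]
        field_simp
    rw [this]
    exact (hz i).1

namespace Landing

variable {n N : ℕ} {ρ : ℝ} {D : Set ℂ} {β : ℂ → ℂ} {c0 : ℂ}

theorem crit_ne_zero (h : Landing n ρ D β c0 N) {i : ℕ} (hi : 1 ≤ i) : ((P c0)^[n])^[i] 0 ≠ 0 := by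
  intro h0
  have h1 : ((P c0)^[n])^[i * N] 0 = 0 := by rw [iterate_mul]; exact iterate_fixed h0 _
  have h2 : ((P c0)^[n])^[i * N] 0 = β c0 := by
    rw [show i * N = (i - 1) * N + N by rw [Nat.sub_mul]; have := Nat.mul_le_mul_right N hi; omega,
      iterate_add_apply, h.hit, iterate_fixed (h.fix c0 h.mem)]
  obtain ⟨q, -, hq⟩ := exists_QL_family h.isOpen h.ql
  have h3 := h.rep c0 h.mem
  rw [← h2, h1, (hq c0 h.mem).d0, norm_zero] at h3
  linarith

theorem orb' (h : Landing n ρ D β c0 N) (i : ℕ) : ‖((P c0)^[n])^[i] 0‖ < ρ := by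
  rcases le_total i N with hi | hi
  · exact h.orb i hi
  · obtain ⟨k, rfl⟩ := Nat.exists_eq_add_of_le' hi
    rw [iterate_add_apply, h.hit, iterate_fixed (h.fix c0 h.mem)]
    exact h.lt c0 h.mem

theorem one_le (h : Landing n ρ D β c0 N) : 1 ≤ N := by
  by_contra hN
  have h1 := h.hit
  obtain ⟨q, -, hq⟩ := exists_QL_family h.isOpen h.ql
  have h3 := h.rep c0 h.mem
  rw [← h1, Nat.lt_one_iff.1 (not_le.1 hN), Function.iterate_zero_apply, (hq c0 h.mem).d0, norm_zero] at h3
  linarith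

theorem pc_finite (h : Landing n ρ D β c0 N) : (QL.pc ρ ((P c0)^[n])).Finite := by
  refine ((finite_Iic N).image fun m => ((P c0)^[n])^[m] 0).subset ?_
  rintro y ⟨m, -, hy⟩
  rcases le_total (m + 1) N with hi | hi
  · exact ⟨m + 1, hi, hy⟩
  · obtain ⟨k, hk⟩ := Nat.exists_eq_add_of_le' hi
    rw [hk, iterate_add_apply, h.hit, iterate_fixed (h.fix c0 h.mem)] at hy
    exact ⟨N, mem_Iic.2 le_rfl, h.hit.trans hy⟩

/-- Factoring the first return to the fixed point through `z ↦ z²`, the outer factor is unramified. -/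
theorem deriv_Q_ne_zero (h : Landing n ρ D β c0 N) : deriv (Q (n * N) c0) 0 ≠ 0 := by
  obtain ⟨q, -, hq⟩ := exists_QL_family h.isOpen h.ql
  obtain ⟨hn, hρ, hi, -⟩ := h.ql c0 h.mem
  have hQ : ∀ k w, Q (n * (k + 1)) c0 w = ((P c0)^[n])^[k] (Q n c0 w) := fun k w => by
    rw [Q, Q, ← iterate_mul, ← iterate_add_apply]
    congr 2
    rw [Nat.mul_succ]; omega
  have h1 : ∀ k, deriv (Q (n * (k + 1)) c0) 0 ≠ 0 := fun k => by
    induction k with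
    | zero =>
      rw [zero_add, mul_one]
      exact deriv_ne_zero_of_injOn isOpen_ball (differentiable_Q n c0).differentiableOn hi (mem_ball_self (by positivity))
    | succ k ih =>
      have e : Q (n * (k + 1 + 1)) c0 = fun w => (P c0)^[n] (Q (n * (k + 1)) c0 w) := by
        funext w
        rw [hQ, hQ, iterate_succ_apply']
      have hv : Q (n * (k + 1)) c0 0 = ((P c0)^[n])^[k + 1] 0 := by
        have := iterate_eq_Q (n := n * (k + 1)) (Nat.mul_pos hn (Nat.succ_pos k)) c0 0
        rw [← iterate_mul, this]; simp
      have h2 : HasDerivAt (fun w => (P c0)^[n] (Q (n * (k + 1)) c0 w)) _ 0 :=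
        ((hq c0 h.mem).hf _).hasDerivAt.comp (0 : ℂ) (differentiable_Q (n * (k + 1)) c0 0).hasDerivAt
      rw [e, h2.deriv, hv]
      refine mul_ne_zero ((hq c0 h.mem).deriv_ne_zero (h.orb' _) ?_ (h.crit_ne_zero (by omega))) ih
      rw [← iterate_succ_apply' ((P c0)^[n])]
      exact h.orb' _
  obtain ⟨k, rfl⟩ := Nat.exists_eq_add_of_le' h.one_le
  exact h1 k

end Landing

theorem norm_mul_sub_mul_le {A A' A0 B B' B0 : ℂ} (hA : ‖A - A0‖ ≤ 1 / 1000 * ‖A0‖) (hA' : ‖A' - A0‖ ≤ 1 / 1000 * ‖A0‖)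
    (hB : ‖B - B0‖ ≤ 1 / 1000 * ‖B0‖) (hB' : ‖B' - B0‖ ≤ 1 / 1000 * ‖B0‖) :
    ‖A * B - A' * B'‖ ≤ 1 / 100 * ‖A' * B'‖ := by
  have e : A * B - A' * B' = (A - A0) * (B - B0) + A0 * (B - B0) - A0 * (B' - B0) + (A - A0) * B0 - (A' - A0) * B0
      - (A' - A0) * (B' - B0) := by ring
  have e' : A0 * B0 = A' * B' - (A' - A0) * (B' - B0) - A0 * (B' - B0) - (A' - A0) * B0 := by ring
  have a0 := norm_nonneg A0
  have b0 := norm_nonneg B0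
  have k : ∀ x y : ℂ, ‖x‖ ≤ 1 / 1000 * ‖A0‖ → ‖y‖ ≤ 1 / 1000 * ‖B0‖ → ‖x * y‖ ≤ 1 / 1000000 * (‖A0‖ * ‖B0‖) :=
    fun x y hx hy => by
      rw [norm_mul]
      calc ‖x‖ * ‖y‖ ≤ (1 / 1000 * ‖A0‖) * (1 / 1000 * ‖B0‖) := by gcongr
        _ = _ := by ring
  have k1 : ∀ y : ℂ, ‖y‖ ≤ 1 / 1000 * ‖B0‖ → ‖A0 * y‖ ≤ 1 / 1000 * (‖A0‖ * ‖B0‖) := fun y hy => by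
    rw [norm_mul]
    nlinarith
  have k2 : ∀ x : ℂ, ‖x‖ ≤ 1 / 1000 * ‖A0‖ → ‖x * B0‖ ≤ 1 / 1000 * (‖A0‖ * ‖B0‖) := fun x hx => by
    rw [norm_mul]
    nlinarith
  have h1 : ‖A * B - A' * B'‖ ≤ 5 / 1000 * (‖A0‖ * ‖B0‖) := by
    rw [e]
    refine (norm_sub_le _ _).trans ?_
    have := norm_sub_le ((A - A0) * (B - B0) + A0 * (B - B0) - A0 * (B' - B0) + (A - A0) * B0) ((A' - A0) * B0)
    have := norm_add_le ((A - A0) * (B - B0) + A0 * (B - B0) - A0 * (B' - B0)) ((A - A0) * B0)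
    have := norm_sub_le ((A - A0) * (B - B0) + A0 * (B - B0)) (A0 * (B' - B0))
    have := norm_add_le ((A - A0) * (B - B0)) (A0 * (B - B0))
    linarith [k _ _ hA hB, k _ _ hA' hB', k1 _ hB, k1 _ hB', k2 _ hA, k2 _ hA', mul_nonneg a0 b0]
  have h2 : ‖A0‖ * ‖B0‖ ≤ ‖A' * B'‖ + 3 / 1000 * (‖A0‖ * ‖B0‖) := by
    rw [← norm_mul A0 B0]
    nth_rewrite 1 [e']
    refine (norm_sub_le _ _).trans ?_
    have := norm_sub_le (A' * B' - (A' - A0) * (B' - B0)) (A0 * (B' - B0))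
    have := norm_sub_le (A' * B') ((A' - A0) * (B' - B0))
    rw [norm_mul A0 B0]
    linarith [k _ _ hA' hB', k1 _ hB', k2 _ hA', mul_nonneg a0 b0]
  linarith [mul_nonneg a0 b0]

/-- Branches `K c (λ(c)^{-j} Θ c x)` are uniformly almost affine in `x` for large `j`. -/
theorem eventually_almost_affine {K Θ : ℂ → ℂ → ℂ} {lam : ℂ → ℂ} {c0 : ℂ} {W : Set (ℂ × ℂ)} (hlam : ContinuousAt lam c0)
    (hlam1 : 1 < ‖lam c0‖) (hld : ∀ᶠ c in 𝓝 c0, DifferentiableAt ℂ lam c) (hW : IsOpen W) (hW0 : (c0, (0 : ℂ)) ∈ W)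
    (hK : Hol2 K W) (hΘ : Hol2 Θ W) (hK0 : deriv (K c0) 0 ≠ 0) (hΘ0 : deriv (Θ c0) 0 ≠ 0) :
    ∃ R > 0, ∀ ε > 0, ∀ᶠ j : ℕ in atTop,
      Hol2 (fun c x => K c ((lam c ^ j)⁻¹ * Θ c x)) (ball c0 R ×ˢ ball 0 R) ∧ ∀ c ∈ ball c0 R,
      deriv (fun x => K c ((lam c ^ j)⁻¹ * Θ c x)) 0 ≠ 0 ∧ ‖deriv (fun x => K c ((lam c ^ j)⁻¹ * Θ c x)) 0‖ < ε ∧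
      ‖K c ((lam c ^ j)⁻¹ * Θ c 0) - K c 0‖ < ε ∧ ∀ x ∈ ball 0 R, (c, (lam c ^ j)⁻¹ * Θ c x) ∈ W ∧
      ‖deriv (fun x => K c ((lam c ^ j)⁻¹ * Θ c x)) x - deriv (fun x => K c ((lam c ^ j)⁻¹ * Θ c x)) 0‖ ≤
        1 / 100 * ‖deriv (fun x => K c ((lam c ^ j)⁻¹ * Θ c x)) 0‖ := by
  obtain ⟨k, hk1, hk⟩ := exists_between hlam1
  set A0 := deriv (K c0) 0
  set B0 := deriv (Θ c0) 0
  have hA0 := norm_pos_iff.2 hK0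
  have hB0 := norm_pos_iff.2 hΘ0
  have hcl : ∀ {f : ℂ → ℂ → ℂ}, Hol2 f W → deriv (f c0) 0 ≠ 0 →
      ∀ᶠ q : ℂ × ℂ in 𝓝 (c0, 0), ‖deriv (f q.1) q.2 - deriv (f c0) 0‖ ≤ 1 / 1000 * ‖deriv (f c0) 0‖ := by
    intro f hf h0
    have := ((hf.deriv_snd hW).continuousAt hW hW0).eventually
      (closedBall_mem_nhds _ (show 0 < 1 / 1000 * ‖deriv (f c0) 0‖ by have := norm_pos_iff.2 h0; positivity))
    filter_upwards [this] with q hq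
    simpa [dist_eq_norm] using hq
  set M := ‖Θ c0 0‖ + 1
  have hM0 : 0 < M := by positivity
  have hΘM : ∀ᶠ q : ℂ × ℂ in 𝓝 (c0, 0), ‖Θ q.1 q.2‖ < M :=
    (hΘ.continuousAt hW hW0).norm.eventually (gt_mem_nhds (show ‖Θ c0 0‖ < M by linarith))
  obtain ⟨η, hη, hηb⟩ := eventually_nhds_iff_ball.1
    (Eventually.and (hW.mem_nhds hW0) ((hcl hK hK0).and ((hcl hΘ hΘ0).and hΘM)))
  obtain ⟨η', hη', hηb'⟩ := eventually_nhds_iff_ball.1 ((hlam.norm.eventually (lt_mem_nhds hk)).and hld)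
  have hm : ∀ {c x : ℂ}, ‖c - c0‖ < η → ‖x‖ < η → (c, x) ∈ ball (c0, (0 : ℂ)) η := fun {c x} h1 h2 => by
    rw [← ball_prod_same]
    exact ⟨mem_ball_iff_norm.2 h1, mem_ball_zero_iff.2 h2⟩
  set R := min η η'
  have hR : 0 < R := lt_min hη hη'
  refine ⟨R, hR, fun ε hε => ?_⟩
  have hT : Tendsto (fun j : ℕ => (k ^ j)⁻¹) atTop (𝓝 0) := by
    simpa using tendsto_pow_atTop_nhds_zero_of_lt_one (r := k⁻¹) (by positivity) (inv_lt_one_of_one_lt₀ hk1)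
  have hTc : ∀ a b : ℝ, 0 < b → ∀ᶠ j : ℕ in atTop, a * (k ^ j)⁻¹ < b := fun a b hb => by
    have := hT.const_mul a
    rw [mul_zero] at this
    exact this.eventually (gt_mem_nhds hb)
  filter_upwards [hTc M η hη, hTc (2 * ‖A0‖ * M) ε hε, hTc (4 * ‖A0‖ * ‖B0‖) ε hε] with j hj1 hj2 hj3
  set g : ℂ → ℂ → ℂ := fun c x => K c ((lam c ^ j)⁻¹ * Θ c x)
  have hkp : 0 < k := by linarith
  have hli : ∀ c ∈ ball c0 R, lam c ≠ 0 ∧ ‖(lam c ^ j)⁻¹‖ ≤ (k ^ j)⁻¹ := fun c hc => by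
    have h1 := (hηb' c (ball_min_right hc)).1
    refine ⟨norm_pos_iff.1 (by linarith), ?_⟩
    rw [norm_inv, norm_pow]
    gcongr
  have hsm : ∀ c ∈ ball c0 R, ‖c - c0‖ < η := fun c hc => mem_ball_iff_norm.1 (ball_min_left hc)
  have hsx : ∀ x ∈ ball (0 : ℂ) R, ‖x‖ < η := fun c hc => mem_ball_zero_iff.1 (ball_min_left hc)
  have hu : ∀ c ∈ ball c0 R, ∀ x ∈ ball (0 : ℂ) R, ‖(lam c ^ j)⁻¹ * Θ c x‖ ≤ M * (k ^ j)⁻¹ :=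
    fun c hc x hx => by
      rw [norm_mul, mul_comm]
      exact mul_le_mul (hηb _ (hm (hsm c hc) (hsx x hx))).2.2.2.le (hli c hc).2 (norm_nonneg _) hM0.le
  have hA : ∀ c ∈ ball c0 R, ∀ x ∈ ball (0 : ℂ) R, (c, (lam c ^ j)⁻¹ * Θ c x) ∈ ball (c0, (0 : ℂ)) η :=
    fun c hc x hx => hm (hsm c hc) ((hu c hc x hx).trans_lt hj1)
  have hder : ∀ c ∈ ball c0 R, ∀ x ∈ ball (0 : ℂ) R,
      deriv (g c) x = (lam c ^ j)⁻¹ * (deriv (K c) ((lam c ^ j)⁻¹ * Θ c x) * deriv (Θ c) x) := fun c hc x hx => by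
    have h1 := (hK.sep₂ hW (hηb _ (hA c hc x hx)).1).hasDerivAt
    have h2 := (hΘ.sep₂ hW (hηb _ (hm (hsm c hc) (hsx x hx))).1).hasDerivAt
    have h3 : HasDerivAt (g c) _ x := h1.comp x (h2.const_mul ((lam c ^ j)⁻¹))
    rw [h3.deriv]
    ring
  have hx0 : (0 : ℂ) ∈ ball (0 : ℂ) R := mem_ball_self hR
  refine ⟨hK.comp (u := Prod.fst) (v := fun p => (lam p.1 ^ j)⁻¹ * Θ p.1 p.2) differentiableOn_fst ?_ fun q hq => (hηb _ (hA q.1 hq.1 q.2 hq.2)).1,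
    fun c hc => ?_⟩
  · refine DifferentiableOn.mul ?_ (hΘ.mono fun q hq => (hηb _ (hm (hsm q.1 hq.1) (hsx q.2 hq.2))).1)
    intro q hq
    have h1 := (((hηb' q.1 (ball_min_right hq.1)).2.pow j).fun_inv (pow_ne_zero j (hli q.1 hq.1).1))
    exact (h1.comp q differentiableAt_fst).differentiableWithinAt
  have hA1 := (hηb _ (hA c hc 0 hx0)).2.1
  have hB1 := (hηb _ (hm (hsm c hc) (hsx 0 hx0))).2.2.1
  have ha : ∀ x ∈ ball (0 : ℂ) R, ‖deriv (g c) x - deriv (g c) 0‖ ≤ 1 / 100 * ‖deriv (g c) 0‖ := fun x hx => by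
    rw [hder c hc x hx, hder c hc 0 hx0, ← mul_sub, norm_mul, norm_mul _ (_ * _), mul_left_comm]
    exact mul_le_mul_of_nonneg_left (norm_mul_sub_mul_le (hηb _ (hA c hc x hx)).2.1 hA1
      (hηb _ (hm (hsm c hc) (hsx x hx))).2.2.1 hB1) (norm_nonneg _)
  have hne : ∀ a b : ℂ, b ≠ 0 → ‖a - b‖ ≤ 1 / 1000 * ‖b‖ → a ≠ 0 := by
    rintro a b hb h rfl
    rw [zero_sub, norm_neg] at h
    linarith [norm_pos_iff.2 hb]
  have hle : ∀ a b : ℂ, ‖a - b‖ ≤ 1 / 1000 * ‖b‖ → ‖a‖ ≤ 2 * ‖b‖ := fun a b h => by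
    have := norm_sub_norm_le a b
    linarith [norm_nonneg b]
  refine ⟨?_, ?_, ?_, fun x hx => ⟨(hηb _ (hA c hc x hx)).1, ha x hx⟩⟩
  · rw [hder c hc 0 hx0]
    exact mul_ne_zero (inv_ne_zero (pow_ne_zero j (hli c hc).1)) (mul_ne_zero (hne _ _ hK0 hA1) (hne _ _ hΘ0 hB1))
  · rw [hder c hc 0 hx0, norm_mul, norm_mul]
    calc _ ≤ (k ^ j)⁻¹ * ((2 * ‖A0‖) * (2 * ‖B0‖)) := by
            gcongr
            · exact (hli c hc).2
            · exact hle _ _ hA1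
            · exact hle _ _ hB1
      _ = 4 * ‖A0‖ * ‖B0‖ * (k ^ j)⁻¹ := by ring
      _ < ε := hj3
  · have h1 : ∀ u ∈ ball (0 : ℂ) η, ‖deriv (K c) u‖ ≤ 2 * ‖A0‖ := fun u hu =>
      hle _ _ (hηb _ (hm (hsm c hc) (mem_ball_zero_iff.1 hu))).2.1
    have h2 := (convex_ball (0 : ℂ) η).norm_image_sub_le_of_norm_deriv_le
      (fun u hu => hK.sep₂ hW (hηb _ (hm (hsm c hc) (mem_ball_zero_iff.1 hu))).1) h1 (mem_ball_self hη)
      (mem_ball_zero_iff.2 ((hu c hc 0 hx0).trans_lt hj1))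
    rw [sub_zero] at h2
    refine h2.trans_lt (lt_of_le_of_lt ?_ hj2)
    rw [mul_assoc (2 * ‖A0‖)]
    exact mul_le_mul_of_nonneg_left (hu c hc 0 hx0) (by positivity)

theorem hol2_renorm (n : ℕ) (W : Set (ℂ × ℂ)) : Hol2 (fun c z => (P c)^[n] z) W :=
  hol2_iterate (a := fun _ z => z) differentiableOn_snd n

theorem Landing.exists_return {n N : ℕ} {ρ : ℝ} {D : Set ℂ} {β : ℂ → ℂ} {c0 : ℂ} (h : Landing n ρ D β c0 N) :
    ∃ R > 0, ∃ (g : ℕ → ℂ → ℂ → ℂ) (E : ℂ → ℂ), ball c0 R ⊆ D ∧ HolOn E (ball c0 R) ∧ E c0 = 0 ∧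
      (∀ᶠ c in 𝓝[≠] c0, E c ≠ 0) ∧ ∀ ε > 0, ∀ᶠ j : ℕ in atTop, Hol2 (g j) (ball c0 R ×ˢ ball 0 R) ∧
      ∀ c ∈ ball c0 R, deriv (g j c) 0 ≠ 0 ∧ ‖deriv (g j c) 0‖ < ε ∧ ‖g j c 0 - E c‖ < ε ∧ ∀ x ∈ ball 0 R,
        ‖deriv (g j c) x - deriv (g j c) 0‖ ≤ 1 / 100 * ‖deriv (g j c) 0‖ ∧ Q (n * (N + j)) c (g j c x) = x ∧
        ∀ z, z ^ 2 = g j c x → ∀ i < N + j, ‖((P c)^[n])^[i] z‖ ≤ ρ := by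
  obtain ⟨q, -, hq⟩ := exists_QL_family h.isOpen h.ql
  have hm := h.mem
  have hn : 1 ≤ n := (h.ql c0 hm).1
  have hN := h.one_le
  have hD := h.isOpen
  have hWo : IsOpen (D ×ˢ (univ : Set ℂ)) := hD.prod isOpen_univ
  obtain ⟨ψ, hψ, hψc⟩ := exists_linearizer (hol2_renorm n univ) hD h.diff h.fix (lam := mult n β) (fun c _ => rfl) h.rep
  obtain ⟨hψ0, hψ1, hψμ⟩ := hψc c0 hm
  have hlamd := mult_differentiableOn (n := n) h.diff
  have hlam : ContinuousAt (mult n β) c0 := (hlamd.differentiableAt (hD.mem_nhds hm)).continuousAt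
  obtain ⟨u1, hu0, hu1, hub⟩ := (hq c0 hm).exists_homoclinic (h.lt c0 hm) (h.fix c0 hm)
    ((hq c0 hm).hf _).hasDerivAt (h.rep c0 hm) h.pc_finite (fun ⟨m, _, hm'⟩ => h.crit_ne_zero (Nat.succ_pos m) hm')
    (fun u => hψ.sep₂ hWo ⟨hm, trivial⟩) hψ0 (by rw [hψ1]; exact one_ne_zero) hψμ
  -- the backward orbit stays in the domain for nearby parameters
  have hback : ∀ᶠ p : ℂ × ℂ in 𝓝 (c0, u1), ∀ i : ℕ, ‖ψ p.1 ((mult n β p.1 ^ i)⁻¹ * p.2)‖ < ρ := by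
    obtain ⟨k, hk1, hk⟩ := exists_between (h.rep c0 hm)
    have h1 : ∀ᶠ p : ℂ × ℂ in 𝓝 (c0, 0), ‖ψ p.1 p.2‖ < ρ :=
      (hψ.continuousAt hWo (q := (c0, 0)) ⟨hm, trivial⟩).norm.eventually
        (gt_mem_nhds (by simp only [hψ0]; exact h.lt c0 hm))
    have hl0 : mult n β c0 ≠ 0 := norm_pos_iff.1 (one_pos.trans (h.rep c0 hm))
    obtain ⟨η, hη, hηb⟩ := eventually_nhds_iff_ball.1 h1
    have hT : Tendsto (fun j : ℕ => (k ^ j)⁻¹ * (‖u1‖ + 1)) atTop (𝓝 0) := by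
      simpa using (tendsto_pow_atTop_nhds_zero_of_lt_one (r := k⁻¹) (by positivity)
        (inv_lt_one_of_one_lt₀ hk1)).mul_const (‖u1‖ + 1)
    obtain ⟨I, hI⟩ := eventually_atTop.1 (hT.eventually (gt_mem_nhds hη))
    have h2 : ∀ᶠ p : ℂ × ℂ in 𝓝 (c0, u1), ∀ i ∈ Iio I, ‖ψ p.1 ((mult n β p.1 ^ i)⁻¹ * p.2)‖ < ρ := by
      refine (eventually_all_finite (finite_Iio I)).2 fun i _ => ?_
      have hc : ContinuousAt (fun p : ℂ × ℂ => ψ p.1 ((mult n β p.1 ^ i)⁻¹ * p.2)) (c0, u1) := by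
        have h3 : ContinuousAt (fun p : ℂ × ℂ => mult n β p.1) (c0, u1) :=
          ContinuousAt.comp (f := Prod.fst) (x := (c0, u1)) hlam continuousAt_fst
        have h4 : ContinuousAt (fun p : ℂ × ℂ => (p.1, (mult n β p.1 ^ i)⁻¹ * p.2)) (c0, u1) :=
          continuousAt_fst.prodMk (((h3.pow i).inv₀ (pow_ne_zero i hl0)).mul continuousAt_snd)
        exact ContinuousAt.comp (g := fun p : ℂ × ℂ => ψ p.1 p.2)
          (f := fun p : ℂ × ℂ => (p.1, (mult n β p.1 ^ i)⁻¹ * p.2)) (x := (c0, u1))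
          (hψ.continuousAt hWo (q := (c0, _)) ⟨hm, trivial⟩) h4
      exact hc.norm.eventually (gt_mem_nhds (hub i))
    have h3 : ∀ᶠ p : ℂ × ℂ in 𝓝 (c0, u1), k < ‖mult n β p.1‖ ∧ p.1 ∈ ball c0 η ∧ ‖p.2‖ < ‖u1‖ + 1 := by
      have hf : Tendsto Prod.fst (𝓝 (c0, u1)) (𝓝 c0) := continuousAt_fst
      have hs : Tendsto Prod.snd (𝓝 (c0, u1)) (𝓝 u1) := continuousAt_snd
      refine (hf.eventually (hlam.norm.eventually (lt_mem_nhds hk))).and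
        ((hf.eventually_mem (ball_mem_nhds c0 hη)).and (hs.norm.eventually (gt_mem_nhds (by simp))))
    filter_upwards [h2, h3] with p h2 ⟨h3, h4, h5⟩ i
    rcases lt_or_ge i I with hi | hi
    · exact h2 i hi
    · refine hηb (p.1, (mult n β p.1 ^ i)⁻¹ * p.2) ?_
      rw [← ball_prod_same]
      refine ⟨h4, mem_ball_zero_iff.2 (lt_of_le_of_lt ?_ (hI i hi))⟩
      rw [norm_mul, norm_inv, norm_pow]
      gcongr
  obtain ⟨b, hb, hbb⟩ := eventually_nhds_iff_ball.1 hback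
  -- the zero of `ψ` and the inverse of `Q` move holomorphically
  obtain ⟨r1, hr1, s1, hs₁, hs1b, hW1, Θ, hΘ, hΘc, -⟩ :=
    hψ.exists_inverse hWo (c0 := c0) (z0 := u1) ⟨hm, trivial⟩ hu1 (ball_mem_nhds u1 hb)
  rw [hu0] at hΘ hΘc
  have hpre : ∀ᶠ p : ℂ × ℂ in 𝓝 (c0, 0), ∀ i ∈ Iio N, ‖((P p.1)^[n])^[i] p.2‖ < ρ := by
    refine (eventually_all_finite (finite_Iio N)).2 fun i hi => ?_
    simp only [← iterate_mul]
    refine ((hol2_renorm (n * i) univ).continuousAt isOpen_univ (q := (c0, 0)) trivial).norm.eventually (gt_mem_nhds ?_)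
    simp only [iterate_mul]
    exact h.orb i (mem_Iio.1 hi).le
  obtain ⟨d, hd, hdb⟩ := eventually_nhds_iff_ball.1 hpre
  have hQ0 : Q (n * N) c0 0 = β c0 := by
    have := iterate_eq_Q (n := n * N) (Nat.mul_pos hn hN) c0 0
    rw [iterate_mul, h.hit] at this
    simpa using this.symm
  obtain ⟨r2, hr2, s2, hs₂, hs2b, -, κ, hκ, hκc, hκi, -⟩ :=
    (hol2_Q (n * N) univ).exists_inverse isOpen_univ (c0 := c0) (z0 := 0) trivial h.deriv_Q_ne_zero
      (ball_mem_nhds (0 : ℂ) (pow_pos hd 2))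
  rw [hQ0] at hκ hκc
  have hψn : ∀ᶠ p : ℂ × ℂ in 𝓝 (c0, 0), ψ p.1 p.2 ∈ ball (β c0) r2 :=
    (hψ.continuousAt hWo (q := (c0, 0)) ⟨hm, trivial⟩).eventually (by simp only [hψ0]; exact ball_mem_nhds _ hr2)
  obtain ⟨r3, hr3, hr3b⟩ := eventually_nhds_iff_ball.1 hψn
  obtain ⟨r₄, hr₄, hr₄b⟩ := isOpen_iff.1 hD c0 hm
  set r := min (min (min r1 b) (min r2 d)) (min r3 r₄)
  have hr : 0 < r := by positivity
  have e1 : r ≤ r1 := inf_le_left.trans (inf_le_left.trans inf_le_left)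
  have e2 : r ≤ b := inf_le_left.trans (inf_le_left.trans inf_le_right)
  have e3 : r ≤ r2 := inf_le_left.trans (inf_le_right.trans inf_le_left)
  have e4 : r ≤ d := inf_le_left.trans (inf_le_right.trans inf_le_right)
  have e5 : r ≤ r3 := inf_le_right.trans inf_le_left
  have e6 : r ≤ r₄ := inf_le_right.trans inf_le_right
  have hrD : ball c0 r ⊆ D := (ball_subset_ball e6).trans hr₄b
  have hψr : ∀ c ∈ ball c0 r, ∀ u ∈ ball (0 : ℂ) r, ψ c u ∈ ball (β c0) r2 := fun c hc u hu =>
    hr3b (c, u) (by rw [← ball_prod_same]; exact ⟨ball_subset_ball e5 hc, ball_subset_ball e5 hu⟩)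
  have hWr : IsOpen (ball c0 r ×ˢ ball (0 : ℂ) r) := isOpen_ball.prod isOpen_ball
  have hW0 : (c0, (0 : ℂ)) ∈ ball c0 r ×ˢ ball (0 : ℂ) r := ⟨mem_ball_self hr, mem_ball_self hr⟩
  have hW0' : ∀ c ∈ ball c0 r, (c, (0 : ℂ)) ∈ ball c0 r ×ˢ ball (0 : ℂ) r := fun c hc => ⟨hc, mem_ball_self hr⟩
  have hK : Hol2 (fun c u => κ c (ψ c u)) (ball c0 r ×ˢ ball 0 r) :=
    hκ.comp differentiableOn_fst (hψ.mono (prod_mono hrD (subset_univ _))) fun p hp => ⟨ball_subset_ball e3 hp.1, hψr _ hp.1 _ hp.2⟩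
  have hΘ' : Hol2 Θ (ball c0 r ×ˢ ball 0 r) := hΘ.mono (prod_mono (ball_subset_ball e1) (ball_subset_ball e1))
  have hΘ0 : deriv (Θ c0) 0 ≠ 0 := by
    intro h0
    have h1 := (hΘ'.sep₂ hWr hW0).hasDerivAt
    have h2 : HasDerivAt (fun x => ψ c0 (Θ c0 x)) _ 0 :=
      (hψ.sep₂ hWo ⟨hm, trivial⟩).hasDerivAt.comp 0 h1
    rw [h0, mul_zero] at h2
    have h3 : (fun x => ψ c0 (Θ c0 x)) =ᶠ[𝓝 0] id := by
      filter_upwards [ball_mem_nhds 0 hr1] with x hx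
      exact (hΘc c0 (mem_ball_self hr1) x hx).2
    exact zero_ne_one ((h2.congr_of_eventuallyEq h3.symm).unique (hasDerivAt_id 0))
  have hK0 : deriv (fun u => κ c0 (ψ c0 u)) 0 ≠ 0 := by
    intro h0
    have h1 : HasDerivAt (fun u => κ c0 (ψ c0 u)) _ 0 := (hK.sep₂ hWr hW0).hasDerivAt
    have h2 : HasDerivAt (fun x => Q (n * N) c0 (κ c0 (ψ c0 x))) _ 0 :=
      HasDerivAt.comp (h₂ := Q (n * N) c0) 0 (differentiable_Q (n * N) c0 (κ c0 (ψ c0 0))).hasDerivAt h1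
    rw [h0, mul_zero] at h2
    have h3 : (fun x => Q (n * N) c0 (κ c0 (ψ c0 x))) =ᶠ[𝓝 0] ψ c0 := by
      filter_upwards [ball_mem_nhds 0 hr] with x hx
      exact (hκc c0 (mem_ball_self hr2) _ (hψr c0 (mem_ball_self hr) x hx)).2
    have h4 := (h2.congr_of_eventuallyEq h3.symm).deriv
    rw [hψ1] at h4
    exact one_ne_zero h4
  obtain ⟨R0, hR₀, hmain⟩ := eventually_almost_affine hlam (h.rep c0 hm)
    (by filter_upwards [hD.mem_nhds hm] with c hc using hlamd.differentiableAt (hD.mem_nhds hc)) hWr hW0 hK hΘ' hK0 hΘ0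
  set R := min R0 r
  have hR : 0 < R := lt_min hR₀ hr
  have hRr : R ≤ r := inf_le_right
  have hEc : ∀ c ∈ ball c0 r, Q (n * N) c (κ c (ψ c 0)) = β c := fun c hc => by
    rw [(hκc c (ball_subset_ball e3 hc) _ (hψr c hc 0 (mem_ball_self hr))).2, (hψc c (hrD hc)).1]
  have hE0 : κ c0 (ψ c0 0) = 0 := hκi c0 (mem_ball_self hr2)
    (hκc c0 (mem_ball_self hr2) _ (hψr c0 (mem_ball_self hr) 0 (mem_ball_self hr))).1 (mem_ball_self hs₂)
    ((hEc c0 (mem_ball_self hr)).trans hQ0.symm)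
  have hEd : HolOn (fun c => κ c (ψ c 0)) (ball c0 r) := fun c hc =>
    (hK.sep₁ hWr (hW0' c hc)).differentiableWithinAt
  refine ⟨R, hR, fun j c x => κ c (ψ c ((mult n β c ^ j)⁻¹ * Θ c x)), fun c => κ c (ψ c 0),
    (ball_subset_ball hRr).trans hrD, hEd.mono (ball_subset_ball hRr), hE0, ?_, fun ε hε => ?_⟩
  · have h1 := (hEd.analyticOnNhd isOpen_ball c0 (mem_ball_self hr)).eventually_eq_zero_or_eventually_ne_zero
    refine h1.resolve_left fun h2 => h.ne ?_
    filter_upwards [h2, ball_mem_nhds c0 hr] with c h2 hc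
    rw [← hEc c hc, h2, ← iterate_mul, iterate_eq_Q (Nat.mul_pos hn hN)]
    simp
  filter_upwards [hmain ε hε] with j ⟨hj, hj'⟩
  refine ⟨hj.mono (prod_mono ball_min_left ball_min_left), fun c hc => ?_⟩
  obtain ⟨h1, h2, h3, h4⟩ := hj' c (ball_min_left hc)
  refine ⟨h1, h2, h3, fun x hx => ?_⟩
  obtain ⟨h5, h6⟩ := h4 x (ball_min_left hx)
  have hcr := ball_subset_ball hRr hc
  obtain ⟨hθ, hθx⟩ := hΘc c (ball_subset_ball e1 hcr) x (ball_subset_ball (hRr.trans e1) hx)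
  have hl0 : mult n β c ≠ 0 := norm_pos_iff.1 (one_pos.trans (h.rep c (hrD hcr)))
  have hfor : ∀ i ≤ j, ((P c)^[n])^[i] (ψ c ((mult n β c ^ j)⁻¹ * Θ c x)) = ψ c ((mult n β c ^ (j - i))⁻¹ * Θ c x) :=
    fun i => by
      induction i with
      | zero => intro _; rfl
      | succ i ih =>
        intro hi
        rw [iterate_succ_apply', ih (by omega), ← (hψc c (hrD hcr)).2.2, show j - i = j - (i + 1) + 1 by omega,
          pow_succ']
        congr 1
        field_simp
  obtain ⟨hk1, hk2⟩ := hκc c (ball_subset_ball e3 hcr) _ (hψr c hcr _ h5.2)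
  have hz : ∀ z, z ^ 2 = κ c (ψ c ((mult n β c ^ j)⁻¹ * Θ c x)) → ∀ i ≤ j,
      ((P c)^[n])^[N + i] z = ψ c ((mult n β c ^ (j - i))⁻¹ * Θ c x) := fun z hz i hi => by
    rw [add_comm, iterate_add_apply, ← iterate_mul _ n N, iterate_eq_Q (Nat.mul_pos hn hN), hz, hk2,
      hfor i hi]
  refine ⟨h6, ?_, fun z hzz i hi => ?_⟩
  · obtain ⟨z, hzz⟩ := IsAlgClosed.exists_pow_nat_eq (κ c (ψ c ((mult n β c ^ j)⁻¹ * Θ c x))) two_pos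
    rw [← hzz, ← iterate_eq_Q (Nat.mul_pos hn (by omega)), iterate_mul, hz z hzz j le_rfl]
    simpa using hθx
  · rcases lt_or_ge i N with hiN | hiN
    · refine (hdb (c, z) ?_ i hiN).le
      rw [← ball_prod_same]
      refine ⟨ball_subset_ball e4 hcr, mem_ball_zero_iff.2 ?_⟩
      have := mem_ball_zero_iff.1 (hs2b hk1)
      rw [← hzz, norm_pow] at this
      exact lt_of_pow_lt_pow_left₀ 2 hd.le this
    · obtain ⟨i, rfl⟩ := Nat.exists_eq_add_of_le hiN
      rw [hz z hzz i (by omega)]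
      refine (hbb (c, Θ c x) ?_ _).le
      rw [← ball_prod_same]
      exact ⟨ball_subset_ball e2 hcr, hs1b hθ⟩

/-- A square root on the right half plane. -/
noncomputable def csqrt (w : ℂ) : ℂ := exp (Complex.log w / 2)

theorem csqrt_sq {w : ℂ} (hw : 0 < w.re) : csqrt w ^ 2 = w := by
  have h0 : w ≠ 0 := by rintro rfl; simp at hw
  rw [csqrt, ← exp_nat_mul]
  conv_rhs => rw [← Complex.exp_log h0]
  congr 1
  push_cast
  ring

theorem csqrt_re_pos {w : ℂ} (hw : 0 < w.re) : 0 < (csqrt w).re := by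
  rw [csqrt, exp_re]
  have h := abs_lt.1 (Complex.abs_arg_lt_pi_div_two_iff.2 (Or.inl hw))
  have e : (Complex.log w / 2).im = w.arg / 2 := by simp [Complex.log_im]
  rw [e]
  exact mul_pos (exp_pos _) (Real.cos_pos_of_mem_Ioo ⟨by linarith [pi_pos], by linarith [pi_pos]⟩)

theorem re_le_csqrt_re_sq {w : ℂ} (hw : 0 < w.re) : w.re ≤ (csqrt w).re ^ 2 := by
  have := congrArg Complex.re (csqrt_sq hw)
  rw [pow_two, mul_re] at this
  nlinarith [sq_nonneg (csqrt w).im]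

theorem csqrt_re_gt {w : ℂ} (hw : 1 / 50 ≤ w.re) : 7 / 50 < (csqrt w).re := by
  nlinarith [csqrt_re_pos (w := w) (by linarith), re_le_csqrt_re_sq (w := w) (by linarith)]

theorem norm_csqrt_sub_le {w w' : ℂ} (hw : 1 / 50 ≤ w.re) (hw' : 1 / 50 ≤ w'.re) :
    ‖csqrt w - csqrt w'‖ ≤ 4 * ‖w - w'‖ := by
  have e : w - w' = (csqrt w - csqrt w') * (csqrt w + csqrt w') := by
    linear_combination csqrt_sq (w := w') (by linarith) - csqrt_sq (w := w) (by linarith)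
  have h := re_le_norm (csqrt w + csqrt w')
  rw [add_re] at h
  rw [e, norm_mul]
  nlinarith [csqrt_re_gt hw, csqrt_re_gt hw', norm_nonneg (csqrt w - csqrt w')]

theorem norm_csqrt_sq {w : ℂ} (hw : 0 < w.re) : ‖csqrt w‖ ^ 2 = ‖w‖ := by
  rw [← norm_pow, csqrt_sq hw]

/-- Fixed points of a holomorphic family of contractions are holomorphic. -/
theorem exists_fixed_family {V : Set ℂ} (hV : IsOpen V) {A : ℝ} (hA : 0 ≤ A) {T : ℂ → ℂ → ℂ}
    (hT : ∀ c ∈ V, ∀ z, ‖z‖ ≤ A → ‖T c z‖ ≤ A)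
    (hTl : ∀ c ∈ V, ∀ z z', ‖z‖ ≤ A → ‖z'‖ ≤ A → ‖T c z - T c z'‖ ≤ 1 / 2 * ‖z - z'‖)
    (hTd : ∀ u : ℂ → ℂ, HolOn u V → (∀ c ∈ V, ‖u c‖ ≤ A) → HolOn (fun c => T c (u c)) V) :
    ∃ Z : ℂ → ℂ, HolOn Z V ∧ ∀ c ∈ V, ‖Z c‖ ≤ A ∧ T c (Z c) = Z c := by
  set u : ℕ → ℂ → ℂ := fun k c => (T c)^[k] 0 with hu
  have hus : ∀ k c, u (k + 1) c = T c (u k c) := fun k c => iterate_succ_apply' _ _ _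
  have hub : ∀ k, ∀ c ∈ V, ‖u k c‖ ≤ A := fun k c hc => by
    induction k with
    | zero => simpa [hu] using hA
    | succ k ih => rw [hus]; exact hT c hc _ ih
  have hud : ∀ k, HolOn (u k) V := fun k => by
    induction k with
    | zero => exact differentiableOn_const _
    | succ k ih => simp only [funext (hus k)]; exact hTd _ ih (hub k)
  have hstep : ∀ c ∈ V, ∀ k, dist (u k c) (u (k + 1) c) ≤ A * (1 / 2) ^ k := fun c hc k => by
    induction k with
    | zero => simpa [hu] using hT c hc 0 (by simpa using hA)
    | succ k ih =>
      have h1 := hTl c hc _ _ (hub k c hc) (hub (k + 1) c hc)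
      rw [← hus, ← hus, ← dist_eq_norm, ← dist_eq_norm] at h1
      rw [pow_succ]
      linarith
  have hlim : ∀ c ∈ V, ∃ z, Tendsto (fun k => u k c) atTop (𝓝 z) := fun c hc =>
    cauchySeq_tendsto_of_complete (cauchySeq_of_le_geometric (1 / 2) A (by norm_num) (hstep c hc))
  choose! Z hZ using hlim
  have hZA : ∀ c ∈ V, ‖Z c‖ ≤ A := fun c hc => le_of_tendsto (hZ c hc).norm (Eventually.of_forall fun k => hub k c hc)
  refine ⟨Z, (LocBdd.of_bdd (l := atTop) (F := u) (M := A) hV (Eventually.of_forall hud)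
    (Eventually.of_forall hub)).differentiableOn hV hZ, fun c hc => ⟨hZA c hc, ?_⟩⟩
  have h1 : Tendsto (fun k => T c (u k c)) atTop (𝓝 (T c (Z c))) := by
    rw [tendsto_iff_norm_sub_tendsto_zero]
    refine squeeze_zero (g := fun k => 1 / 2 * ‖u k c - Z c‖) (fun _ => norm_nonneg _)
      (fun k => hTl c hc _ _ (hub k c hc) (hZA c hc)) ?_
    simpa using (tendsto_iff_norm_sub_tendsto_zero.1 (hZ c hc)).const_mul (1 / 2 : ℝ)
  simp only [← hus] at h1
  exact tendsto_nhds_unique h1 ((hZ c hc).comp (tendsto_add_atTop_nat 1))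

/-- The two fixed points of a small perturbation of `z² - e`. -/
theorem exists_fixed_of_perturbation {V : Set ℂ} (hV : IsOpen V) {H : ℂ → ℂ → ℂ} (hH0 : ∀ c ∈ V, ‖H c 0 - 1‖ < 6 / 5)
    (hHl : ∀ c ∈ V, ∀ z z', ‖z‖ ≤ 3 → ‖z'‖ ≤ 3 → ‖H c z - H c z'‖ ≤ 1 / 100 * ‖z - z'‖)
    (hHd : ∀ u : ℂ → ℂ, HolOn u V → (∀ c ∈ V, ‖u c‖ ≤ 3) → HolOn (fun c => H c (u c)) V)
    {s : ℂ} (hs : s ^ 2 = 1) :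
    ∃ Z : ℂ → ℂ, HolOn Z V ∧ ∀ c ∈ V, ‖Z c‖ ≤ 3 ∧ (Z c - 1 / 2) ^ 2 = 1 / 4 + H c (Z c) ∧
      7 / 50 < (s * (Z c - 1 / 2)).re ∧ (1 / 4 + H c (Z c)).re ≤ (s * (Z c - 1 / 2)).re ^ 2 := by
  have hs1 : ‖s‖ = 1 := by
    have := congrArg norm hs
    rw [norm_pow, norm_one] at this
    exact (pow_eq_one_iff_of_nonneg (norm_nonneg _) two_ne_zero).1 this
  have hHb : ∀ c ∈ V, ∀ z, ‖z‖ ≤ 3 → ‖H c z - H c 0‖ ≤ 3 / 100 := fun c hc z hz => by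
    have := hHl c hc z 0 hz (by simp)
    rw [sub_zero] at this
    linarith
  have hre : ∀ c ∈ V, ∀ z, ‖z‖ ≤ 3 → 1 / 50 ≤ (1 / 4 + H c z).re := fun c hc z hz => by
    have h1 := (abs_le.1 (abs_re_le_norm (H c z - H c 0))).1
    have h2 := (abs_le.1 (abs_re_le_norm (H c 0 - 1))).1
    have h3 := hH0 c hc
    have h4 := hHb c hc z hz
    simp only [sub_re, one_re] at h1 h2
    rw [add_re, show ((1 / 4 : ℂ)).re = 1 / 4 by norm_num]
    linarith
  obtain ⟨Z, hZd, hZ⟩ := exists_fixed_family hV (A := 3) (by norm_num) (T := fun c z => 1 / 2 + s * csqrt (1 / 4 + H c z))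
    (fun c hc z hz => by
      have h1 := norm_csqrt_sq (w := 1 / 4 + H c z) (by linarith [hre c hc z hz])
      have h2 : ‖1 / 4 + H c z‖ ≤ 1 / 4 + (1 + 6 / 5) + 3 / 100 := by
        rw [show 1 / 4 + H c z = 1 / 4 + (1 + (H c 0 - 1)) + (H c z - H c 0) by ring]
        refine (norm_add_le _ _).trans (add_le_add ((norm_add_le _ _).trans (add_le_add (by norm_num)
          ((norm_add_le _ _).trans (add_le_add (by norm_num) (hH0 c hc).le)))) (hHb c hc z hz))
      have h3 : ‖(1 / 2 : ℂ) + s * csqrt (1 / 4 + H c z)‖ ≤ 1 / 2 + ‖csqrt (1 / 4 + H c z)‖ := by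
        refine (norm_add_le _ _).trans (add_le_add (by norm_num) ?_)
        rw [norm_mul, hs1, one_mul]
      nlinarith [norm_nonneg (csqrt (1 / 4 + H c z))])
    (fun c hc z z' hz hz' => by
      rw [add_sub_add_left_eq_sub, ← mul_sub, norm_mul, hs1, one_mul]
      refine (norm_csqrt_sub_le (hre c hc z hz) (hre c hc z' hz')).trans ?_
      rw [add_sub_add_left_eq_sub]
      linarith [hHl c hc z z' hz hz', norm_nonneg (z - z')])
    (fun u hu hub => by
      intro c hc
      have h1 := ((hHd u hu hub).differentiableAt (hV.mem_nhds hc)).const_add (1 / 4)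
      have h2 := ((h1.clog (Or.inl (by linarith [hre c hc _ (hub c hc)]))).div_const 2).cexp
      exact ((h2.const_mul s).const_add (1 / 2)).differentiableWithinAt)
  refine ⟨Z, hZd, fun c hc => ?_⟩
  obtain ⟨h1, h2⟩ := hZ c hc
  have h3 : Z c - 1 / 2 = s * csqrt (1 / 4 + H c (Z c)) := by rw [sub_eq_iff_eq_add', h2]
  have h4 : s * (Z c - 1 / 2) = csqrt (1 / 4 + H c (Z c)) := by rw [h3, ← mul_assoc, ← pow_two, hs, one_mul]
  have h5 := hre c hc _ h1
  refine ⟨h1, ?_, ?_, ?_⟩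
  · rw [h3, mul_pow, hs, one_mul, csqrt_sq (by linarith)]
  · rw [h4]
    exact csqrt_re_gt h5
  · rw [h4]
    exact re_le_csqrt_re_sq (by linarith)

theorem exists_irrational_value {m : ℂ → ℂ} {c₁ : ℂ} (hm : AnalyticAt ℂ m c₁) (h1 : ‖m c₁‖ = 1)
    (hnc : ¬∀ᶠ c in 𝓝 c₁, m c = m c₁) {N : Set ℂ} (hN : N ∈ 𝓝 c₁) {C : Set ℂ} (hC : C.Countable) :
    ∃ c ∈ N, c ∉ C ∧ deriv m c ≠ 0 ∧ ∃ t : ℝ, Irrational t ∧ m c = exp (2 * π * t * I) := by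
  have hd : ∀ᶠ c in 𝓝[≠] c₁, deriv m c ≠ 0 := by
    refine hm.deriv.eventually_eq_zero_or_eventually_ne_zero.resolve_left fun h => hnc ?_
    obtain ⟨s, hs, hsb⟩ := eventually_nhds_iff_ball.1 (h.and hm.eventually_analyticAt)
    filter_upwards [ball_mem_nhds c₁ hs] with c hc
    exact isOpen_ball.is_const_of_deriv_eq_zero (convex_ball c₁ s).isPreconnected
      (fun y hy => (hsb y hy).2.differentiableAt.differentiableWithinAt) (fun y hy => (hsb y hy).1) hc (mem_ball_self hs)
  have hopen := hm.eventually_constant_or_nhds_le_map_nhds.resolve_left hnc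
  have hN' : N ∩ {c | c ≠ c₁ → deriv m c ≠ 0} ∈ 𝓝 c₁ := inter_mem hN (eventually_nhdsWithin_iff.1 hd)
  set t0 : ℝ := (m c₁).arg / (2 * π) with ht₀
  have hpi := pi_pos
  have het : exp (2 * π * t0 * I) = m c₁ := by
    rw [← Complex.norm_mul_exp_arg_mul_I (m c₁), h1, ofReal_one, one_mul, ht₀]
    congr 2
    push_cast
    field_simp
  have hcont : Continuous fun t : ℝ => exp (2 * π * t * I) := by fun_prop
  have hev : ∀ᶠ t : ℝ in 𝓝 t0, exp (2 * π * t * I) ∈ m '' (N ∩ {c | c ≠ c₁ → deriv m c ≠ 0}) :=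
    (hcont.tendsto t0).eventually_mem (by rw [het]; exact hopen (image_mem_map hN'))
  obtain ⟨δ, hδ, hδb⟩ := eventually_nhds_iff_ball.1 hev
  have hsub : ∀ t ∈ Ioo t0 (t0 + min δ 1), t ∈ ball t0 δ := fun t ht => by
    rw [mem_ball, dist_eq, abs_lt]
    exact ⟨by linarith [ht.1], by linarith [ht.2, min_le_left δ 1]⟩
  choose! y hyN hy using fun t ht => hδb t (hsub t ht)
  by_contra! hcon
  have hbad : Ioo t0 (t0 + min δ 1) ⊆ range ((↑) : ℚ → ℝ) ∪ {t | t ∈ Ioo t0 (t0 + min δ 1) ∧ y t ∈ C ∪ {c₁}} := by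
    intro t ht
    by_cases hr : Irrational t
    · refine Or.inr ⟨ht, ?_⟩
      by_contra hyC
      rw [mem_union, not_or] at hyC
      exact hcon (y t) (hyN t ht).1 hyC.1 ((hyN t ht).2 hyC.2) t hr (hy t ht)
    · exact Or.inl (not_not.1 hr)
  have hinj : InjOn y {t | t ∈ Ioo t0 (t0 + min δ 1) ∧ y t ∈ C ∪ {c₁}} := by
    rintro t ⟨ht, -⟩ t' ⟨ht', -⟩ he
    have h2 := (hy t ht).symm.trans ((congrArg m he).trans (hy t' ht'))
    obtain ⟨k, hk⟩ := exp_eq_exp_iff_exists_int.1 h2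
    have h3 : (t : ℂ) = t' + k := by
      have : (2 * π * I : ℂ) ≠ 0 := by simp [hpi.ne']
      apply mul_left_cancel₀ this
      linear_combination hk
    have h4 : t = t' + k := by exact_mod_cast h3
    have h5 : |(k : ℝ)| < 1 := by
      rw [abs_lt]
      exact ⟨by linarith [ht.1, ht.2, ht'.1, ht'.2, min_le_right δ 1], by linarith [ht.1, ht.2, ht'.1, ht'.2, min_le_right δ 1]⟩
    have h6 : k = 0 := Int.abs_lt_one_iff.1 (by exact_mod_cast h5)
    rw [h4, h6]
    simp
  have hcount := ((countable_range ((↑) : ℚ → ℝ)).union (MapsTo.countable_of_injOn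
    (fun t (ht : t ∈ {t | t ∈ Ioo t0 (t0 + min δ 1) ∧ y t ∈ C ∪ {c₁}}) => ht.2) hinj (hC.union (countable_singleton c₁)))).mono hbad
  linarith [Cardinal.Real.Ioo_countable_iff.1 hcount, lt_min hδ one_pos]

theorem exists_neutral_of_branch {c0 : ℂ} {r r1 R : ℝ} (hr : 0 < r) (hrr : r < r1) (hR : 0 < R) {g : ℂ → ℂ → ℂ}
    (hg : Hol2 g (ball c0 r1 ×ˢ ball 0 R)) (hne : ∀ c ∈ ball c0 r1, deriv (g c) 0 ≠ 0)
    (hsm : ∀ c ∈ ball c0 r1, ‖deriv (g c) 0‖ < R / 100)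
    (haff : ∀ c ∈ ball c0 r1, ∀ x ∈ ball 0 R, ‖deriv (g c) x - deriv (g c) 0‖ ≤ 1 / 100 * ‖deriv (g c) 0‖)
    (hcirc : ∀ c, dist c c0 = r → 10 * ‖deriv (g c) 0‖ ^ 2 ≤ ‖g c 0‖) (hz : ∃ c ∈ ball c0 r, g c 0 = 0)
    {C : Set ℂ} (hC : C.Countable) :
    ∃ c' r' t, ∃ α β : ℂ → ℂ, 0 < r' ∧ ball c' r' ⊆ ball c0 r ∧ c' ∉ C ∧ Irrational t ∧
      2 * α c' / deriv (g c') (α c') = exp (2 * π * t * I) ∧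
      InjOn (fun c => 2 * α c / deriv (g c) (α c)) (ball c' r') ∧
      HolOn α (ball c' r') ∧ HolOn β (ball c' r') ∧ ∀ c ∈ ball c' r',
      g c (α c) = α c ^ 2 ∧ g c (β c) = β c ^ 2 ∧ ‖α c‖ < 6 * ‖deriv (g c') 0‖ ∧ ‖β c‖ < 6 * ‖deriv (g c') 0‖ ∧
      β c ≠ α c ∧ 1 < ‖2 * β c / deriv (g c) (β c)‖ ∧
      (∀ x, ‖x‖ ≤ 6 * ‖deriv (g c') 0‖ → ‖g c x‖ < (6 * ‖deriv (g c') 0‖) ^ 2) ∧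
      ∀ w, ‖w‖ ≤ (6 * ‖deriv (g c') 0‖) ^ 2 → ∃ x ∈ ball 0 R, g c x = w := by
  have hW : IsOpen (ball c0 r1 ×ˢ ball (0 : ℂ) R) := isOpen_ball.prod isOpen_ball
  have h0R : (0 : ℂ) ∈ ball (0 : ℂ) R := mem_ball_self hR
  set a : ℂ → ℂ := fun c => deriv (g c) 0 with ha
  set B := ball c0 r1 with hB
  have hrB : ball c0 r ⊆ B := ball_subset_ball hrr.le
  have had : HolOn a B := fun c hc =>
    ((hg.deriv_snd hW).sep₁ hW ⟨hc, h0R⟩).differentiableWithinAt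
  set e : ℂ → ℂ := fun c => g c 0 / a c ^ 2 with he
  have hed : HolOn e B := fun c hc =>
    ((hg.sep₁ hW ⟨hc, h0R⟩).div ((had.differentiableAt (isOpen_ball.mem_nhds hc)).pow 2)
      (pow_ne_zero 2 (hne c hc))).differentiableWithinAt
  have hL : ∀ c ∈ B, ∀ x ∈ ball 0 R, ∀ x' ∈ ball 0 R,
      ‖(g c x - a c * x) - (g c x' - a c * x')‖ ≤ 1 / 100 * ‖a c‖ * ‖x - x'‖ := fun c hc x hx x' hx' => by
    have hd : ∀ y ∈ ball 0 R, HasDerivAt (fun y => g c y - a c * y) (deriv (g c) y - a c) y := fun y hy =>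
      ((hg.sep₂ hW ⟨hc, hy⟩).hasDerivAt.fun_sub ((hasDerivAt_id' y).const_mul (a c))).congr_deriv (by rw [mul_one])
    exact (convex_ball (0 : ℂ) R).norm_image_sub_le_of_norm_deriv_le (fun y hy => (hd y hy).differentiableAt)
      (fun y hy => by rw [(hd y hy).deriv]; exact haff c hc y hy) hx' hx
  set V := ball c0 r ∩ e ⁻¹' ball 1 (6 / 5) with hV
  have hVo : IsOpen V := (hed.mono hrB).continuousOn.isOpen_inter_preimage isOpen_ball isOpen_ball
  have hVB : V ⊆ B := fun c hc => hrB hc.1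
  have hVe : ∀ c ∈ V, ‖e c - 1‖ < 6 / 5 := fun c hc => mem_ball_iff_norm.1 hc.2
  have haX : ∀ c ∈ B, ∀ X : ℂ, ‖X‖ ≤ 3 → a c * X ∈ ball 0 R := fun c hc X hX => by
    rw [mem_ball_zero_iff, norm_mul]
    nlinarith [hsm c hc, norm_nonneg (a c)]
  set H : ℂ → ℂ → ℂ := fun c X => g c (a c * X) / a c ^ 2 - X with hH
  have hH0 : ∀ c, H c 0 = e c := fun c => by simp [hH, he]
  have hHl : ∀ c ∈ V, ∀ z z', ‖z‖ ≤ 3 → ‖z'‖ ≤ 3 → ‖H c z - H c z'‖ ≤ 1 / 100 * ‖z - z'‖ := fun c hc z z' hz hz' => by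
    have h1 := hL c (hVB hc) _ (haX c (hVB hc) z hz) _ (haX c (hVB hc) z' hz')
    have h0 : a c ≠ 0 := hne c (hVB hc)
    have e1 : (g c (a c * z) - a c * (a c * z)) - (g c (a c * z') - a c * (a c * z')) = a c ^ 2 * (H c z - H c z') := by
      simp only [hH]
      field_simp
    rw [e1, ← mul_sub, norm_mul, norm_mul, norm_pow] at h1
    have h2 : 0 < ‖a c‖ ^ 2 := pow_pos (norm_pos_iff.2 h0) 2
    nlinarith
  have hHd : ∀ u : ℂ → ℂ, HolOn u V → (∀ c ∈ V, ‖u c‖ ≤ 3) → HolOn (fun c => H c (u c)) V := by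
    intro u hu hub
    have h1 : HolOn (fun c => g c (a c * u c)) V :=
      hg.comp differentiableOn_id ((had.mono hVB).mul hu) fun c hc => ⟨hVB hc, haX c (hVB hc) _ (hub c hc)⟩
    exact (h1.div ((had.mono hVB).pow 2) fun c hc => pow_ne_zero 2 (hne c (hVB hc))).sub hu
  obtain ⟨Zα, hZαd, hZα⟩ := exists_fixed_of_perturbation hVo (fun c hc => (hH0 c).symm ▸ hVe c hc) hHl hHd (s := -1) (by norm_num)
  obtain ⟨Zβ, hZβd, hZβ⟩ := exists_fixed_of_perturbation hVo (fun c hc => (hH0 c).symm ▸ hVe c hc) hHl hHd (s := 1) (by norm_num)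
  have hfix : ∀ c ∈ V, ∀ Z : ℂ, (Z - 1 / 2) ^ 2 = 1 / 4 + H c Z → g c (a c * Z) = (a c * Z) ^ 2 := fun c hc Z hZ => by
    have h0 := hne c (hVB hc)
    have h1 : Z ^ 2 = g c (a c * Z) / a c ^ 2 := by linear_combination hZ
    rw [mul_pow, h1, mul_div_cancel₀ _ (pow_ne_zero 2 h0)]
  have hder : ∀ c ∈ V, ∀ Z : ℂ, ‖Z‖ ≤ 3 → deriv (g c) (a c * Z) ≠ 0 ∧ ‖deriv (g c) (a c * Z)‖ ≤ 101 / 100 * ‖a c‖ :=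
    fun c hc Z hZ => by
      have h1 := haff c (hVB hc) _ (haX c (hVB hc) Z hZ)
      have h0 := norm_pos_iff.2 (hne c (hVB hc))
      refine ⟨fun h => ?_, by linarith [norm_sub_norm_le (deriv (g c) (a c * Z)) (a c)]⟩
      rw [h, zero_sub, norm_neg] at h1
      linarith
  have hexp : ∀ c ∈ V, ∀ Z : ℂ, ‖Z‖ ≤ 3 → 51 / 100 < ‖Z‖ → 1 < ‖2 * (a c * Z) / deriv (g c) (a c * Z)‖ := fun c hc Z hZ hZ' => by
    obtain ⟨h1, h2⟩ := hder c hc Z hZ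
    have h0 := norm_pos_iff.2 (hne c (hVB hc))
    rw [norm_div, one_lt_div (norm_pos_iff.2 h1), norm_mul, norm_mul, Complex.norm_ofNat]
    refine h2.trans_lt ?_
    nlinarith
  set m : ℂ → ℂ := fun c => 2 * (a c * Zα c) / deriv (g c) (a c * Zα c) with hm
  have hmd : HolOn m V := by
    have h1 : HolOn (fun c => deriv (g c) (a c * Zα c)) V :=
      (hg.deriv_snd hW).comp differentiableOn_id ((had.mono hVB).mul hZαd) fun c hc => ⟨hVB hc, haX c (hVB hc) _ (hZα c hc).1⟩
    exact (((had.mono hVB).mul hZαd).const_mul 2).div h1 fun c hc => (hder c hc _ (hZα c hc).1).1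
  -- a parameter in the closure of the attracting region at which the fixed point is neutral
  obtain ⟨c₁, hc1V, hc11, hc1f⟩ : ∃ c ∈ V, ‖m c‖ = 1 ∧ ∃ᶠ y in 𝓝 c, ‖m y‖ < 1 := by
    by_contra! hcon
    set V1 := V ∩ m ⁻¹' ball 0 1 with hV1
    have hV1o : IsOpen V1 := hmd.continuousOn.isOpen_inter_preimage hVo isOpen_ball
    have hcl : ∀ c ∈ V, c ∈ closure V1 → c ∈ V1 := fun c hc hcc => by
      have hf : ∃ᶠ y in 𝓝 c, ‖m y‖ < 1 := (mem_closure_iff_frequently.1 hcc).mono fun y hy => mem_ball_zero_iff.1 hy.2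
      refine ⟨hc, mem_ball_zero_iff.2 (lt_of_le_of_ne ?_ fun h =>
        hf ((hcon c hc h).mono fun y hy => not_lt.2 hy))⟩
      by_contra! h1
      refine hf ?_
      filter_upwards [(hmd.differentiableAt (hVo.mem_nhds hc)).continuousAt.norm.eventually (lt_mem_nhds h1)] with y hy
      exact not_lt.2 hy.le
    have hcr : c0 + r ∈ B := by
      rw [hB, mem_ball_iff_norm, add_sub_cancel_left, norm_real, Real.norm_of_nonneg hr.le]
      exact hrr
    have hecirc : ∀ c, dist c c0 = r → 10 ≤ ‖e c‖ := fun c hc => by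
      have h0 := norm_pos_iff.2 (hne c (show dist c c0 < r1 by rw [hc]; exact hrr))
      rw [he, norm_div, norm_pow, le_div_iff₀ (by positivity)]
      exact hcirc c hc
    obtain ⟨cz, hcz, hcz0⟩ := hz
    have hez : e cz = 0 := by simp only [he, hcz0, zero_div]
    have heo : ∀ s ⊆ B, IsOpen s → IsOpen (e '' s) := by
      refine ((hed.analyticOnNhd isOpen_ball).is_constant_or_isOpen (convex_ball c0 r1).isPreconnected).resolve_left ?_
      rintro ⟨w, hw⟩
      have h1 := hecirc (c0 + r) (by simp [abs_of_pos hr])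
      rw [hw _ hcr, ← hw _ (hrB hcz), hez, norm_zero] at h1
      linarith
    have hsub := (convex_ball (1 : ℂ) (6 / 5)).isPreconnected.subset_of_closure_inter_subset
      (heo V1 (fun c hc => hVB hc.1) hV1o) ⟨0, by norm_num, cz, ?_, hez⟩ ?_
    · obtain ⟨c, hc, hc2⟩ := hsub (show (2 : ℂ) ∈ ball 1 (6 / 5) by rw [mem_ball_iff_norm]; norm_num)
      obtain ⟨h1, -, h3, h4⟩ := hZα c hc.1
      have h5 := hHl c hc.1 (Zα c) 0 h1 (by simp)
      rw [hH0, hc2, sub_zero] at h5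
      have h6 := (abs_le.1 (abs_re_le_norm (H c (Zα c) - 2))).1
      have h7 := re_le_norm (-Zα c)
      rw [norm_neg] at h7
      norm_num at h3 h4 h6 h7
      have h8 : 51 / 100 < ‖Zα c‖ := by nlinarith
      exact absurd (hexp c hc.1 _ h1 h8) (mem_ball_zero_iff.1 hc.2).not_gt
    · have hczV : cz ∈ V := ⟨hcz, by simp only [mem_preimage, hez]; norm_num⟩
      obtain ⟨h1, h2, h3, -⟩ := hZα cz hczV
      have h5 := hHl cz hczV (Zα cz) 0 h1 (by simp)
      rw [hH0, hez, sub_zero, sub_zero] at h5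
      have h6 : Zα cz = 0 := by
        by_contra h0
        have e1 : H cz (Zα cz) = Zα cz * (Zα cz - 1) := by linear_combination -h2
        rw [e1, norm_mul] at h5
        have h7 := norm_pos_iff.2 h0
        have h8 := (abs_le.1 (abs_re_le_norm (Zα cz - 1))).1
        norm_num at h3 h8
        nlinarith
      exact ⟨hczV, by simp [hm, h6]⟩
    · rintro w ⟨hw, hw1⟩
      obtain ⟨y, hy, hyw⟩ := mem_closure_iff_seq_limit.1 hw
      choose x hx hxy using hy
      obtain ⟨c, hc, φ, hφ, hlim⟩ := (isCompact_closedBall c0 r).tendsto_subseq fun k => ball_subset_closedBall (hx k).1.1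
      have hcB : c ∈ B := closedBall_subset_ball hrr hc
      have h1 : Tendsto (fun k => e (x (φ k))) atTop (𝓝 (e c)) :=
        ((hed.differentiableAt (isOpen_ball.mem_nhds hcB)).continuousAt.tendsto).comp hlim
      simp only [hxy] at h1
      have h2 : e c = w := tendsto_nhds_unique h1 (hyw.comp hφ.tendsto_atTop)
      have h3 : c ∈ ball c0 r := by
        refine mem_ball.2 (lt_of_le_of_ne (mem_closedBall.1 hc) fun h => ?_)
        have h4 := hecirc c h
        rw [h2] at h4
        have h5 := norm_sub_norm_le w 1
        rw [norm_one] at h5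
        linarith [mem_ball_iff_norm.1 hw1]
      exact ⟨c, hcl c ⟨h3, by rw [mem_preimage, h2]; exact hw1⟩
        (mem_closure_of_tendsto hlim (Eventually.of_forall fun k => hx _)), h2⟩
  have hma : AnalyticAt ℂ m c₁ := hmd.analyticAt (hVo.mem_nhds hc1V)
  obtain ⟨c', hc'V, hc'C, hc'd, t, ht, hc't⟩ := exists_irrational_value hma hc11 (fun h => by
    obtain ⟨y, h1, h2⟩ := (hc1f.and_eventually h).exists
    rw [h2, hc11] at h1
    exact lt_irrefl _ h1) (hVo.mem_nhds hc1V) hC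
  obtain ⟨S, hS, hSi⟩ := exists_injOn_nhds (hasStrictDerivAt_of_holo hVo hmd hc'V) hc'd
  have hb := norm_pos_iff.2 (hne c' (hVB hc'V))
  have hac := (had.differentiableAt (isOpen_ball.mem_nhds (hVB hc'V))).continuousAt.norm
  obtain ⟨r', hr', hrb⟩ := eventually_nhds_iff_ball.1 (Eventually.and (hVo.mem_nhds hc'V) (Eventually.and hS
    ((hac.eventually (lt_mem_nhds (show 9 / 10 * ‖a c'‖ < ‖a c'‖ by linarith))).and
      (hac.eventually (gt_mem_nhds (show ‖a c'‖ < 11 / 10 * ‖a c'‖ by linarith))))))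
  have hsub : ball c' r' ⊆ V := fun c hc => (hrb c hc).1
  have hbR := hsm c' (hVB hc'V)
  refine ⟨c', r', t, fun c => a c * Zα c, fun c => a c * Zβ c, hr', fun c hc => (hsub hc).1, hc'C, ht, hc't,
    hSi.mono fun c hc => (hrb c hc).2.1, ((had.mono hVB).mul hZαd).mono hsub, ((had.mono hVB).mul hZβd).mono hsub,
    fun c hc => ?_⟩
  obtain ⟨hcV, -, ha1, ha2⟩ := hrb c hc
  obtain ⟨a1, a2, a3, -⟩ := hZα c hcV
  obtain ⟨b1, b2, b3, -⟩ := hZβ c hcV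
  norm_num at a3 b3
  have hcB := hVB hcV
  have hg0 : ‖g c 0‖ ≤ 11 / 5 * ‖a c‖ ^ 2 := by
    have h1 := hVe c hcV
    have h2 : ‖e c‖ ≤ 11 / 5 := by
      have := norm_sub_norm_le (e c) 1
      rw [norm_one] at this
      linarith
    rwa [he, norm_div, norm_pow, div_le_iff₀ (pow_pos (norm_pos_iff.2 (hne c hcB)) 2)] at h2
  have hg0' : ‖g c 0‖ ≤ 27 / 10 * ‖a c'‖ ^ 2 := by nlinarith
  refine ⟨hfix c hcV _ a2, hfix c hcV _ b2, ?_, ?_, ?_, hexp c hcV _ b1 ?_, fun x hx => ?_, fun w hw => ?_⟩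
  · rw [norm_mul]
    nlinarith [norm_nonneg (Zα c)]
  · rw [norm_mul]
    nlinarith [norm_nonneg (Zβ c)]
  · intro h
    have := mul_left_cancel₀ (hne c hcB) h
    rw [this] at b3
    linarith
  · linarith [re_le_norm (Zβ c)]
  · have h1 := hL c hcB x (mem_ball_zero_iff.2 (by linarith)) 0 h0R
    have e1 : g c x = ((g c x - a c * x) - (g c 0 - a c * 0)) + g c 0 + a c * x := by ring
    have h2 : ‖g c x‖ ≤ 1 / 100 * ‖a c‖ * ‖x‖ + ‖g c 0‖ + ‖a c‖ * ‖x‖ := by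
      rw [sub_zero x] at h1
      rw [e1, ← norm_mul]
      exact norm_add₃_le.trans (by gcongr)
    have h3 : ‖a c‖ * ‖x‖ ≤ (11 / 10 * ‖a c'‖) * (6 * ‖a c'‖) := by gcongr
    nlinarith
  · have h0 := norm_pos_iff.2 (hne c hcB)
    have hsb : ∀ z : ℂ, ‖z‖ ≤ R / 2 → z ∈ ball (0 : ℂ) R := fun z hz => mem_ball_zero_iff.2 (by linarith)
    have e1 : ∀ z z' : ℂ, ‖z‖ ≤ R / 2 → ‖z'‖ ≤ R / 2 →
        ‖(z - (g c z - w) / a c) - (z' - (g c z' - w) / a c)‖ ≤ 1 / 100 * ‖z - z'‖ := fun z z' hz hz' => by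
      have h2 := hL c hcB z (hsb z hz) z' (hsb z' hz')
      have e2 : (g c z - a c * z) - (g c z' - a c * z') = -a c * ((z - (g c z - w) / a c) - (z' - (g c z' - w) / a c)) := by
        have : a c ≠ 0 := hne c hcB
        field_simp
        ring
      rw [e2, norm_mul, norm_neg, mul_right_comm, mul_comm] at h2
      exact le_of_mul_le_mul_right h2 h0
    obtain ⟨Z, -, hZ⟩ := exists_fixed_family (V := univ) isOpen_univ (A := R / 2) (by linarith)
      (T := fun _ z => z - (g c z - w) / a c) (fun _ _ z hz => by
        have h2 := e1 z 0 hz (by simpa using (half_pos hR).le)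
        have h3 : ‖(0 : ℂ) - (g c 0 - w) / a c‖ ≤ 49 / 100 * R := by
          rw [zero_sub, norm_neg, norm_div, div_le_iff₀ h0]
          refine (norm_sub_le _ _).trans ?_
          nlinarith
        rw [sub_zero z] at h2
        have := norm_sub_norm_le (z - (g c z - w) / a c) (0 - (g c 0 - w) / a c)
        linarith)
      (fun _ _ z z' hz hz' => (e1 z z' hz hz').trans (by linarith [norm_nonneg (z - z')]))
      (fun u hu hub => by
        have h2 : HolOn (fun y => g c (u y)) univ :=
          hg.comp (differentiableOn_const c) hu fun y hy => ⟨hcB, hsb _ (hub y hy)⟩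
        exact hu.sub ((h2.sub_const w).div_const (a c)))
    obtain ⟨h2, h3⟩ := hZ 0 trivial
    refine ⟨Z 0, hsb _ h2, ?_⟩
    have h4 : (g c (Z 0) - w) / a c = 0 := by linear_combination -h3
    exact sub_eq_zero.1 ((div_eq_zero_iff.1 h4).resolve_right (hne c hcB))

/-- The multiplier of a fixed point in terms of an inverse branch `g` of `Q n c`. -/
theorem mult_eq_of_branch {n : ℕ} (hn : 1 ≤ n) {c : ℂ} {R : ℝ} {g : ℂ → ℂ} (hg : HolOn g (ball 0 R))
    (hQ : ∀ x ∈ ball 0 R, Q n c (g x) = x) {z : ℂ} (hz : z ∈ ball 0 R) (h : g z = z ^ 2) :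
    (P c)^[n] z = z ∧ deriv ((P c)^[n]) z = 2 * z / deriv g z := by
  have e : (P c)^[n] = fun z => Q n c (z ^ 2) := funext fun z => iterate_eq_Q hn c z
  have h1 := (hg.differentiableAt (isOpen_ball.mem_nhds hz)).hasDerivAt
  have h2 : HasDerivAt (Q n c) (deriv (Q n c) (z ^ 2)) (g z) := h ▸ (differentiable_Q n c _).hasDerivAt
  have h3 : deriv (Q n c) (z ^ 2) * deriv g z = 1 := (h2.comp z h1).unique
    ((hasDerivAt_id z).congr_of_eventuallyEq (Filter.eventually_of_mem (isOpen_ball.mem_nhds hz) hQ))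
  have h4 : HasDerivAt ((P c)^[n]) (deriv (Q n c) (z ^ 2) * (2 * z)) z := by
    rw [e]
    refine ((h ▸ h2 : HasDerivAt (Q n c) _ (z ^ 2)).comp z (hasDerivAt_pow 2 z)).congr_deriv ?_
    norm_num
  refine ⟨by rw [e]; simp only [← h, hQ z hz], ?_⟩
  rw [h4.deriv, eq_div_iff (right_ne_zero_of_mul_eq_one h3)]
  linear_combination (2 * z) * h3

theorem Landing.exists_neutral {n N : ℕ} {ρ : ℝ} {D : Set ℂ} {β : ℂ → ℂ} {c0 : ℂ} (h : Landing n ρ D β c0 N)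
    {ε : ℝ} (hε : 0 < ε) {W : Set ℂ} (hW : W ∈ 𝓝 c0) {C : Set ℂ} (hC : C.Countable) :
    ∃ m ≥ 2, ∃ ρ' c' r' t, ∃ α' β' : ℂ → ℂ, ρ' < ε ∧ ball c' r' ⊆ W ∧ c' ∉ C ∧ Irrational t ∧
      mult (n * m) α' c' = exp (2 * π * t * I) ∧ Neutral (n * m) ρ' c' r' α' β' ∧
      ∀ c ∈ ball c' r', ∀ z : ℂ, ‖z‖ ≤ ρ' → ∀ i < m, ‖((P c)^[n])^[i] z‖ ≤ ρ := by
  have hn : 1 ≤ n := (h.ql c0 h.mem).1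
  obtain ⟨R, hR, g, E, -, hEd, hE0, hEne, hgj⟩ := h.exists_return
  obtain ⟨r1, hr1, hb⟩ := eventually_nhds_iff_ball.1 (Eventually.and hW (Eventually.and (ball_mem_nhds c0 hR)
    (eventually_nhdsWithin_iff.1 hEne)))
  have hr : 0 < r1 / 2 := half_pos hr1
  have hrr : r1 / 2 < r1 := half_lt_self hr1
  have hcl : closedBall c0 (r1 / 2) ⊆ ball c0 r1 := closedBall_subset_ball hrr
  have hsubR : ball c0 r1 ⊆ ball c0 R := fun c hc => (hb c hc).2.1
  have hEc : ContinuousOn E (closedBall c0 (r1 / 2)) := hEd.continuousOn.mono (hcl.trans hsubR)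
  obtain ⟨M, hM⟩ := (isCompact_closedBall c0 (r1 / 2)).exists_bound_of_continuousOn hEc
  obtain ⟨x, hx, hmin⟩ := (isCompact_sphere c0 (r1 / 2)).exists_isMinOn (NormedSpace.sphere_nonempty.2 hr.le)
    (hEc.mono sphere_subset_closedBall).norm
  have hm₀ : 0 < ‖E x‖ := norm_pos_iff.2 ((hb x (hcl (sphere_subset_closedBall hx))).2.2 (ne_of_mem_sphere hx hr.ne'))
  set δ := min (min (R / 100) (ε / 6)) (min 1 (‖E x‖ / 20)) with hδ
  have hδ0 : 0 < δ := by positivity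
  have hδ1 : δ ≤ R / 100 := inf_le_left.trans inf_le_left
  have hδ2 : δ ≤ ε / 6 := inf_le_left.trans inf_le_right
  have hδ3 : δ ≤ 1 := inf_le_right.trans inf_le_left
  have hδ4 : δ ≤ ‖E x‖ / 20 := inf_le_right.trans inf_le_right
  have hsr : ball c0 (r1 / 2) ⊆ ball c0 R := (ball_subset_ball hrr.le).trans hsubR
  have h0R : (0 : ℂ) ∈ ball (0 : ℂ) R := mem_ball_self hR
  have hWo : IsOpen (ball c0 R ×ˢ ball (0 : ℂ) R) := isOpen_ball.prod isOpen_ball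
  have hzero : ∀ᶠ j in atTop, ∃ c ∈ ball c0 (r1 / 2), g j c 0 = 0 := by
    have hbd : LocBdd atTop (fun j c => g j c 0) (ball c0 (r1 / 2)) := LocBdd.of_bdd isOpen_ball
      ((hgj 1 one_pos).mono fun j hj c hc =>
        (hj.1.sep₁ hWo ⟨hsr hc, h0R⟩).differentiableWithinAt) (M := M + 1)
      ((hgj 1 one_pos).mono fun j hj c hc => by
        have h1 := (hj.2 c (hsr hc)).2.2.1
        have h2 := hM c (ball_subset_closedBall hc)
        have h3 := norm_sub_norm_le (g j c 0) (E c)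
        linarith)
    refine hbd.eventually_exists_zero isOpen_ball (f := E) (fun c hc => ?_) (mem_ball_self hr) hE0 (fun h0 => ?_)
      (ball_mem_nhds c0 hr)
    · rw [Metric.tendsto_nhds]
      intro η hη
      exact (hgj η hη).mono fun j hj => by rw [dist_eq_norm]; exact (hj.2 c (hsr hc)).2.2.1
    · obtain ⟨c, h1, h2⟩ := (hEne.and (h0.filter_mono nhdsWithin_le_nhds)).exists
      exact h1 h2
  obtain ⟨j, ⟨hg, hgc⟩, hz, hj2⟩ := ((hgj δ hδ0).and (hzero.and (eventually_ge_atTop 2))).exists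
  obtain ⟨c', r', t, α, β', hr', hsub, hcC, ht, hmt, hinj, hα, hβ, hc'⟩ := exists_neutral_of_branch hr hrr hR
    (hg.mono (prod_mono hsubR subset_rfl)) (fun c hc => (hgc c (hsubR hc)).1)
    (fun c hc => (hgc c (hsubR hc)).2.1.trans_le hδ1)
    (fun c hc y hy => ((hgc c (hsubR hc)).2.2.2 y hy).1) (fun c hc => by
      have h1 := hgc c (hsubR (hcl hc.le))
      have h2 := isMinOn_iff.1 hmin c hc
      have h3 := norm_sub_norm_le (E c) (g j c 0)
      rw [norm_sub_rev] at h3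
      nlinarith [norm_nonneg (deriv (g j c) 0), h1.2.1, h1.2.2.1]) hz hC
  have hcR : ∀ c ∈ ball c' r', c ∈ ball c0 R := fun c hc => hsr (hsub hc)
  have hnm : 1 ≤ n * (N + j) := Nat.mul_pos hn (by lia)
  have hself := mem_ball_self (x := c') hr'
  have hb0 : 0 < ‖deriv (g j c') 0‖ := norm_pos_iff.2 (hgc c' (hcR c' hself)).1
  have hbδ := (hgc c' (hcR c' hself)).2.1
  set ρ' := 6 * ‖deriv (g j c') 0‖ with hρ'
  have hρR : ρ' < R := by linarith
  have hbr : ∀ c ∈ ball c' r', ∀ z : ℂ, ‖z‖ < ρ' → g j c z = z ^ 2 →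
      (P c)^[n * (N + j)] z = z ∧ deriv ((P c)^[n * (N + j)]) z = 2 * z / deriv (g j c) z := fun c hc z hz hgz =>
    mult_eq_of_branch hnm (fun y hy => (hg.sep₂ hWo ⟨hcR c hc, hy⟩).differentiableWithinAt)
      (fun y hy => ((hgc c (hcR c hc)).2.2.2 y hy).2.1) (mem_ball_zero_iff.2 (hz.trans hρR)) hgz
  have hmα : ∀ c ∈ ball c' r', mult (n * (N + j)) α c = 2 * α c / deriv (g j c) (α c) := fun c hc =>
    (hbr c hc _ (hc' c hc).2.2.1 (hc' c hc).1).2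
  refine ⟨N + j, by lia, ρ', c', r', t, α, β', by linarith, fun c hc => (hb c (ball_subset_ball hrr.le (hsub hc))).1, hcC,
    ht, (hmα c' hself).trans hmt,
    ⟨hr', fun c hc => ⟨hnm, by positivity, ?_, ?_⟩, hα, hβ, fun c hc => (hbr c hc _ (hc' c hc).2.2.1 (hc' c hc).1).1,
      fun c hc => (hbr c hc _ (hc' c hc).2.2.2.1 (hc' c hc).2.1).1, fun c hc => (hc' c hc).2.2.1,
      fun c hc => (hc' c hc).2.2.2.1, fun c hc => (hc' c hc).2.2.2.2.1, fun c hc => ?_,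
      hinj.congr fun c hc => (hmα c hc).symm, ?_⟩, fun c hc z hz i hi => ?_⟩
  · intro w hw w' hw' hQ
    obtain ⟨y, hy, rfl⟩ := (hc' c hc).2.2.2.2.2.2.2 w (mem_ball_zero_iff.1 hw).le
    obtain ⟨y', hy', rfl⟩ := (hc' c hc).2.2.2.2.2.2.2 w' (mem_ball_zero_iff.1 hw').le
    rw [((hgc c (hcR c hc)).2.2.2 y hy).2.1, ((hgc c (hcR c hc)).2.2.2 y' hy').2.1] at hQ
    rw [hQ]
  · intro y hy
    have hy' := mem_closedBall_zero_iff.1 hy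
    exact ⟨g j c y, mem_ball_zero_iff.2 ((hc' c hc).2.2.2.2.2.2.1 y hy'),
      ((hgc c (hcR c hc)).2.2.2 y (mem_ball_zero_iff.2 (hy'.trans_lt hρR))).2.1⟩
  · rw [mult, (hbr c hc _ (hc' c hc).2.2.2.1 (hc' c hc).2.1).2]
    exact (hc' c hc).2.2.2.2.2.1
  · rw [hmα c' hself, hmt, show (2 * π * t * I : ℂ) = ((2 * π * t : ℝ) : ℂ) * I by push_cast; ring]
    exact Complex.norm_exp_ofReal_mul_I _
  · obtain ⟨y, hy, hyz⟩ := (hc' c hc).2.2.2.2.2.2.2 (z ^ 2) (by rw [norm_pow]; gcongr)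
    exact ((hgc c (hcR c hc)).2.2.2 y hy).2.2 z hyz.symm i hi

theorem mem_Mandelbrot_of_iterate {n : ℕ} (hn : 1 ≤ n) {c : ℂ} {ρ : ℝ} (h : ∀ i, ‖((P c)^[n])^[i] 0‖ ≤ ρ) :
    c ∈ Mandelbrot := by
  have hb : ∀ i, ∃ B, ∀ z ∈ closedBall (0 : ℂ) ρ, ‖(P c)^[i] z‖ ≤ B := fun i =>
    (isCompact_closedBall 0 ρ).exists_bound_of_continuousOn (differentiable_iterate i c).continuous.continuousOn
  choose B hB using hb
  refine mem_Mandelbrot_of_bdd (B := ∑ i ∈ Finset.range n, |B i|) fun k => ?_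
  rw [← Nat.mod_add_div k n, iterate_add_apply, iterate_mul]
  refine ((hB _ _ (mem_closedBall_zero_iff.2 (h (k / n)))).trans (le_abs_self _)).trans ?_
  exact Finset.single_le_sum (f := fun i => |B i|) (fun i _ => abs_nonneg _) (Finset.mem_range.2 (Nat.mod_lt k hn))

namespace Neutral

variable {n : ℕ} {ρ r : ℝ} {x : ℂ} {α β : ℂ → ℂ}

theorem restrict (h : Neutral n ρ x r α β) {s : ℝ} (hs : 0 < s) (hsr : s ≤ r) : Neutral n ρ x s α β :=
  have hb := ball_subset_ball (x := x) hsr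
  ⟨hs, fun c hc => h.ql c (hb hc), h.dα.mono hb, h.dβ.mono hb, fun c hc => h.fixα c (hb hc), fun c hc => h.fixβ c (hb hc),
    fun c hc => h.ltα c (hb hc), fun c hc => h.ltβ c (hb hc), fun c hc => h.ne c (hb hc), fun c hc => h.rep c (hb hc),
    h.inj.mono hb, h.norm_one⟩

theorem fix_ne_zero (h : Neutral n ρ x r α β) {c : ℂ} (hc : c ∈ ball x r) (h0 : mult n α c ≠ 0) : α c ≠ 0 := fun h1 => by
  obtain ⟨q, -, hq⟩ := exists_QL_family isOpen_ball h.ql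
  rw [mult, h1] at h0
  exact h0 (hq c hc).d0

/-- A logarithm of the multiplier, near an irrationally neutral parameter. -/
theorem exists_log_mult (h : Neutral n ρ x r α β) {t : ℝ}
    (hm : mult n α x = exp (2 * π * t * I)) :
    ∃ s > 0, s ≤ r ∧ (∀ c ∈ ball x s, mult n α c ≠ 0) ∧ ∃ ℓ : ℂ → ℂ, HolOn ℓ (ball x s) ∧
      (∀ c ∈ ball x s, exp (ℓ c) = mult n α c) ∧ InjOn ℓ (ball x s) ∧ ℓ x = 2 * π * t * I := by
  have hx := mem_ball_self (x := x) h.pos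
  have h0 : mult n α x ≠ 0 := hm ▸ exp_ne_zero _
  obtain ⟨s, hs, hsb⟩ := eventually_nhds_iff_ball.1 ((h.continuousAt_mult hx).eventually_ne h0)
  have hb : ball x (min s r) ⊆ ball x r := ball_min_right
  have hpos : 0 < min s r := lt_min hs h.pos
  have hne : ∀ c ∈ ball x (min s r), mult n α c ≠ 0 := fun c hc => hsb c (ball_min_left hc)
  obtain ⟨ℓ, hℓ, hℓe⟩ := exists_log isOpen_ball ((convex_ball x (min s r)).starConvex (mem_ball_self hpos))
    (h.mult_diff.mono hb) hne
  have hexp : ∀ c ∈ ball x (min s r), exp (ℓ c + (2 * π * t * I - ℓ x)) = mult n α c := fun c hc => by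
    rw [exp_add, exp_sub, hℓe c hc, hℓe x (mem_ball_self hpos), hm, div_self (exp_ne_zero _), mul_one]
  refine ⟨min s r, hpos, inf_le_right, hne, fun c => ℓ c + (2 * π * t * I - ℓ x), hℓ.add_const _, hexp,
    fun c hc c' hc' hcc => ?_, by ring⟩
  refine h.inj (hb hc) (hb hc') ?_
  rw [← hexp c hc, ← hexp c' hc']
  exact congrArg _ hcc

theorem countable_root (h : Neutral n ρ x r α β) : {c ∈ ball x r | ∃ k : ℕ, 1 ≤ k ∧ mult n α c ^ k = 1}.Countable := by
  have h1 : {w : ℂ | ∃ k : ℕ, 1 ≤ k ∧ w ^ k = 1}.Countable := by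
    have : {w : ℂ | ∃ k : ℕ, 1 ≤ k ∧ w ^ k = 1} = ⋃ k : ℕ, {w : ℂ | 1 ≤ k ∧ w ^ k = 1} := by ext; simp
    rw [this]
    refine countable_iUnion fun k => ?_
    by_cases hk : 1 ≤ k
    · refine ((Polynomial.nthRoots k (1 : ℂ)).toFinset.countable_toSet).mono fun w hw => ?_
      rw [Finset.mem_coe, Multiset.mem_toFinset, Polynomial.mem_nthRoots hk]
      exact hw.2
    · simp [hk]
  exact MapsTo.countable_of_injOn (f := mult n α) (fun c hc => hc.2) (h.inj.mono fun c hc => hc.1) h1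

/-- Attracting parameters accumulate at `x` through a connected set. -/
theorem exists_attracting_set (h : Neutral n ρ x r α β) :
    ∃ A ⊆ ball x r, IsPreconnected A ∧ x ∈ closure A ∧ ∀ c ∈ A, mult n α c ≠ 0 ∧ ‖mult n α c‖ < 1 := by
  have hx := mem_ball_self (x := x) h.pos
  obtain ⟨g, hg, hgl, hgr⟩ := exists_inverse_of_injOn isOpen_ball h.mult_diff h.inj
  have hI : mult n α '' ball x r ∈ 𝓝 (mult n α x) := by
    rw [← h.map_nhds hx]
    exact image_mem_map (isOpen_ball.mem_nhds hx)
  obtain ⟨η, hη, hηb⟩ := Metric.mem_nhds_iff.1 hI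
  set S := ball (mult n α x) (min η 1) ∩ ball 0 1 with hS
  have hSI : S ⊆ mult n α '' ball x r := fun w hw => hηb (ball_min_left hw.1)
  refine ⟨g '' S, ?_, ?_, ?_, ?_⟩
  · rintro _ ⟨w, hw, rfl⟩
    exact (hgr w (hSI hw)).1
  · exact ((convex_ball _ _).inter (convex_ball _ _)).isPreconnected.image g (hg.continuousOn.mono hSI)
  · rw [← hgl x hx]
    refine mem_closure_image (hg.continuousOn.continuousAt hI) (mem_closure_iff_frequently.2 ?_)
    exact ((frequently_norm_lt h.norm_one.le).and_eventually (ball_mem_nhds _ (lt_min hη one_pos))).mono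
      fun y hy => ⟨hy.2, mem_ball_zero_iff.2 hy.1.2⟩
  · rintro _ ⟨w, hw, rfl⟩
    rw [(hgr w (hSI hw)).2]
    refine ⟨fun h0 => ?_, mem_ball_zero_iff.1 hw.2⟩
    have h1 := mem_ball_iff_norm'.1 hw.1
    rw [h0, sub_zero, h.norm_one] at h1
    exact (h1.trans_le inf_le_right).false

/-- Small renormalization copies near an irrationally neutral parameter lie in connected neighbourhoods. -/
theorem exists_next (h : Neutral n ρ x r α β) {t : ℝ} (ht : Irrational t)
    (hm : mult n α x = exp (2 * π * t * I)) {η : ℝ} (hη : 0 < η) :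
    ∃ m ≥ 2, ∃ ρ' x' r' t', ∃ α' β' : ℂ → ℂ, Neutral (n * m) ρ' x' r' α' β' ∧ Irrational t' ∧
      mult (n * m) α' x' = exp (2 * π * t' * I) ∧ r' < η ∧ closedBall x' r' ⊆ ball x r ∧
      (∀ c ∈ closedBall x' r', ∀ z : ℂ, ‖z‖ ≤ ρ' → ∀ i < m, ‖((P c)^[n])^[i] z‖ ≤ ρ) ∧
      ∃ V ⊆ Mandelbrot, IsConnected V ∧ V ⊆ ball x r ∧ ∀ c ∈ ball x' r', V ∈ 𝓝[Mandelbrot] c := by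
  have hn : 1 ≤ n := (h.ql x (mem_ball_self h.pos)).1
  obtain ⟨s, hs, hsr, hs0, ℓ, hℓ, hℓe, hℓi, hℓx⟩ := h.exists_log_mult hm
  have hN := h.restrict hs hsr
  obtain ⟨δ, hδ, hlimb⟩ := exists_limb hn hs hN.dα hN.fixα hℓ hℓe hℓi ht hℓx h.pos
  have hδs : 0 < min δ s := lt_min hδ hs
  have hN' := hN.restrict hδs inf_le_right
  obtain ⟨c0, N, hL⟩ := hN'.exists_landing
  have hα0 : 0 < ‖α c0‖ :=
    norm_pos_iff.2 (hN'.fix_ne_zero hL.mem (hs0 c0 (ball_min_right hL.mem)))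
  have hW : {c | c ∈ ball x (min δ s) ∧ ‖α c0‖ / 2 < ‖α c‖} ∈ 𝓝 c0 := Eventually.and (isOpen_ball.mem_nhds hL.mem)
    ((hN'.dα.differentiableAt (isOpen_ball.mem_nhds hL.mem)).continuousAt.norm.eventually (lt_mem_nhds (half_lt_self hα0)))
  obtain ⟨m, hm2, ρ', x', r', t', α', β', hρ', hsub, hC, ht', hm', h', hnest⟩ :=
    hL.exists_neutral (half_pos hα0) hW h.countable_root
  have hx' := mem_ball_self (x := x') h'.pos
  have hs' : ball x (min δ s) ⊆ ball x s := ball_min_right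
  obtain ⟨A, hA, hAp, hAc, hAm⟩ := h'.exists_attracting_set
  have hrep : ∀ c ∈ ball x' r', mult (n * m) α' c ≠ 0 → ‖mult (n * m) α' c‖ < 1 → 1 ≤ ‖mult n α c‖ :=
    fun c hc h0 h1 => by
      by_contra! hlt
      have hcs := (hsub hc).1
      have h2 := (hN'.attracts hcs (hs0 c (hs' hcs)) hlt).2.2
      have h3 := (h'.attracts hc h0 h1).2.2
      have h4 : Tendsto (fun i => ((P c)^[n * m])^[i] 0) atTop (𝓝 (α c)) := by
        have := h2.comp (tendsto_id.const_mul_atTop' (show 0 < m by lia))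
        refine this.congr fun i => ?_
        rw [comp_apply, iterate_mul, id, iterate_mul]
      have h5 := h'.ltα c hc
      rw [tendsto_nhds_unique h3 h4] at h5
      linarith [(hsub hc).2]
  obtain ⟨V, hVM, hVc, hV, hVb⟩ := hlimb A
    (fun c hc => ⟨mem_Mandelbrot_of_iterate (h'.ql c (hA hc)).1 fun i =>
      ((h'.attracts (hA hc) (hAm c hc).1 (hAm c hc).2).1 i).le, ball_min_left (hsub (hA hc)).1⟩)
    hAp (fun c hc => by
      by_contra! hle
      have hcr : c ∈ ball x (min δ s) := (hsub (hA hc)).1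
      have h1 := frequently_norm_lt hle
      rw [← mult, ← hN'.map_nhds hcr, frequently_map] at h1
      obtain ⟨y, ⟨-, h2⟩, h3, h4, h5⟩ := (h1.and_eventually (Eventually.and (isOpen_ball.mem_nhds (hA hc))
        (((h'.continuousAt_mult (hA hc)).eventually_ne (hAm c hc).1).and
          ((h'.continuousAt_mult (hA hc)).norm.eventually_lt_const (hAm c hc).2)))).exists
      exact (hrep y h3 h4 h5).not_gt h2)
    x' hAc (ball_min_left (hsub hx').1)
    fun k hk hk1 => hC ⟨ball_subset_ball hsr (hs' (hsub hx').1), k, hk, hk1⟩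
  obtain ⟨u, hu, hxu, huV⟩ := mem_nhdsWithin.1 hV
  obtain ⟨σ, hσ, hσu⟩ := isOpen_iff.1 hu x' hxu
  set τ := min (min (r' / 2) σ) (η / 2) with hτ
  have hτ0 : 0 < τ := lt_min (lt_min (half_pos h'.pos) hσ) (half_pos hη)
  have hτr : τ < r' := (inf_le_left.trans inf_le_left).trans_lt (half_lt_self h'.pos)
  have hcl : closedBall x' τ ⊆ ball x' r' := closedBall_subset_ball hτr
  exact ⟨m, hm2, ρ', x', τ, t', α', β', h'.restrict hτ0 hτr.le, ht', hm',
    inf_le_right.trans_lt (half_lt_self hη), fun c hc => ball_subset_ball hsr (hs' (hsub (hcl hc)).1),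
    fun c hc => hnest c (hcl hc), V, hVM, hVc, hVb, fun c hc => mem_nhdsWithin.2
      ⟨u, hu, hσu (ball_subset_ball (inf_le_left.trans inf_le_right) hc), huV⟩⟩

end Neutral

theorem isClosed_orbit_le (n : ℕ) (ρ : ℝ) : IsClosed {c : ℂ | ∀ i, ‖((P c)^[n])^[i] 0‖ ≤ ρ} := by
  simp only [ofPred_forall]
  exact isClosed_iInter fun i => isClosed_le (differentiable_crit_iterate n i).continuous.norm continuous_const

theorem norm_orbit_le_of_nest {n m : ℕ} (hm : 0 < m) {ρ ρ' : ℝ} {c : ℂ}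
    (hnest : ∀ z : ℂ, ‖z‖ ≤ ρ' → ∀ i < m, ‖((P c)^[n])^[i] z‖ ≤ ρ) (h : ∀ i, ‖((P c)^[n * m])^[i] 0‖ ≤ ρ') (i : ℕ) :
    ‖((P c)^[n])^[i] 0‖ ≤ ρ := by
  rw [← Nat.mod_add_div i m, iterate_add_apply, iterate_mul ((P c)^[n]) m,
    show ((P c)^[n])^[m] = (P c)^[n * m] from (iterate_mul (P c) n m).symm]
  exact hnest _ (h _) _ (Nat.mod_lt i hm)

theorem exists_infinitely_renormalizable {n : ℕ} (hn : 2 ≤ n) {ρ r t : ℝ} {x : ℂ} {α β : ℂ → ℂ} (h : Neutral n ρ x r α β)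
    (ht : Irrational t) (hm : mult n α x = exp (2 * π * t * I)) :
    ∃ c ∈ ball x r, c ∈ Mandelbrot ∧ InfinitelyRenormalizable c ∧ LocallyConnectedAt Mandelbrot c := by
  obtain ⟨s, hs0, hs⟩ := exists_seq_of_step (X := ℕ × ℝ × ℂ × ℝ) (a := (n, ρ, x, r))
    (p := fun k s => 2 ≤ s.1 ∧ (1 ≤ k → s.2.2.2 < 1 / k) ∧ ∃ t : ℝ, ∃ α β : ℂ → ℂ, Neutral s.1 s.2.1 s.2.2.1 s.2.2.2 α β ∧
      Irrational t ∧ mult s.1 α s.2.2.1 = exp (2 * π * t * I))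
    (r := fun _ s s' => s.1 < s'.1 ∧ closedBall s'.2.2.1 s'.2.2.2 ⊆ ball s.2.2.1 s.2.2.2 ∧
      (∀ c ∈ closedBall s'.2.2.1 s'.2.2.2, (∀ i, ‖((P c)^[s'.1])^[i] 0‖ ≤ s'.2.1) → ∀ i, ‖((P c)^[s.1])^[i] 0‖ ≤ s.2.1) ∧
      ∃ V ⊆ Mandelbrot, IsConnected V ∧ V ⊆ ball s.2.2.1 s.2.2.2 ∧ ∀ c ∈ ball s'.2.2.1 s'.2.2.2, V ∈ 𝓝[Mandelbrot] c)
    ⟨hn, fun h => absurd h (by simp), t, α, β, h, ht, hm⟩ (by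
      rintro k ⟨n, ρ, x, r⟩ ⟨hn, -, t, α, β, h, ht, hm⟩
      obtain ⟨m, hm2, ρ', x', r', t', α', β', h', ht', hm', hr', hcl, hnest, hV⟩ :=
        h.exists_next ht hm (η := 1 / (k + 1 : ℕ)) (by positivity)
      have hlt : n < n * m := lt_mul_of_one_lt_right (by lia) (by lia)
      exact ⟨(n * m, ρ', x', r'), ⟨hn.trans hlt.le, fun _ => hr', t', α', β', h', ht', hm'⟩, hlt, hcl,
        fun c hc => norm_orbit_le_of_nest (by lia) (hnest c hc), hV⟩)
  set K : ℕ → Set ℂ := fun k => closedBall (s k).2.2.1 (s k).2.2.2 ∩ {c | ∀ i, ‖((P c)^[(s k).1])^[i] 0‖ ≤ (s k).2.1} with hK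
  have hKc : ∀ k, IsClosed (K k) := fun k => isClosed_closedBall.inter (isClosed_orbit_le _ _)
  obtain ⟨c, hc⟩ := IsCompact.nonempty_iInter_of_sequence_nonempty_isCompact_isClosed K
    (fun k c hc => ⟨ball_subset_closedBall ((hs k).2.2.1 hc.1), (hs k).2.2.2.1 c hc.1 hc.2⟩)
    (fun k => by
      obtain ⟨⟨-, -, t, α, β, h, -⟩, -⟩ := hs k
      obtain ⟨c, hc, h0, h1⟩ := h.exists_attracting
      exact ⟨c, ball_subset_closedBall hc, fun i => ((h.attracts hc h0 h1).1 i).le⟩)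
    ((isCompact_closedBall _ _).inter_right (isClosed_orbit_le _ _)) hKc
  have hcK : ∀ k, c ∈ K k := mem_iInter.1 hc
  have hcb : ∀ k, c ∈ ball (s k).2.2.1 (s k).2.2.2 := fun k => (hs k).2.2.1 (hcK (k + 1)).1
  have hmono : StrictMono fun k => (s k).1 := strictMono_nat_of_lt_succ fun k => (hs k).2.1
  have hql : ∀ k, QLAt (s k).1 (s k).2.1 c := fun k => by
    obtain ⟨⟨-, -, t, α, β, h, -⟩, -⟩ := hs k
    exact h.ql c (hcb k)
  have hx := hcb 0
  rw [hs0] at hx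
  refine ⟨c, hx, mem_Mandelbrot_of_iterate (hql 0).1 (hcK 0).2,
    infinite_of_injective_forall_mem hmono.injective fun k =>
      (hql k).renormalizable (hs k).1.1 fun i => mem_closedBall_zero_iff.2 ((hcK k).2 i), fun W hW => ?_⟩
  obtain ⟨ε, hε, hεW⟩ := Metric.mem_nhds_iff.1 hW
  obtain ⟨k, hk⟩ := exists_nat_gt (2 / ε)
  have hk0 : (0 : ℝ) < k := (by positivity : 0 < 2 / ε).trans hk
  obtain ⟨-, -, -, V, hVM, hVc, hVb, hV⟩ := (hs k).2
  refine ⟨V, hVM, fun z hz => hεW ?_, hVc, hV c (hcb (k + 1))⟩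
  have h1 := (hs k).1.2.1 (by exact_mod_cast hk0)
  have h2 : 2 * (1 / (k : ℝ)) < ε := by
    rw [div_lt_iff₀ hε] at hk
    rw [mul_one_div, div_lt_iff₀ hk0]
    linarith
  have h3 := dist_triangle_right z c (s k).2.2.1
  exact mem_ball.2 (by linarith [mem_ball.1 (hVb hz), mem_ball.1 (hcb k)])

/-- A frontier point other than `1 / 4` is a limit of the parameters we want. -/
theorem exists_mem_ball {x : ℂ} (hx : x ∈ frontier Mandelbrot) (hx4 : x ≠ 1 / 4) {ε : ℝ} (hε : 0 < ε) :
    ∃ c ∈ ball x ε, c ∈ Mandelbrot ∧ InfinitelyRenormalizable c ∧ LocallyConnectedAt Mandelbrot c := by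
  obtain ⟨D, β, c0, N, hD, hL⟩ := exists_landing hx hx4 hε
  obtain ⟨m, hm2, ρ', x', r', t', α', β', -, hsub, -, ht', hm', h', -⟩ :=
    hL.exists_neutral one_pos (hL.isOpen.mem_nhds hL.mem) countable_empty
  obtain ⟨c, hc, h⟩ := exists_infinitely_renormalizable (by lia) h' ht' hm'
  exact ⟨c, hD (hsub hc), h⟩

theorem quarter_sub_mem_Mandelbrot {δ : ℝ} (h0 : 0 ≤ δ) (h1 : δ ≤ 1 / 2) : (1 / 4 - δ : ℂ) ∈ Mandelbrot :=
  mem_Mandelbrot_of_bdd (B := 1 / 2) fun N => by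
    have hc : ‖(1 / 4 - δ : ℂ)‖ ≤ 1 / 4 := by
      rw [show (1 / 4 - δ : ℂ) = ((1 / 4 - δ : ℝ) : ℂ) by push_cast; ring, norm_real, norm_eq_abs, abs_le]
      constructor <;> linarith
    induction N with
    | zero => simp
    | succ N ih =>
      rw [iterate_succ_apply', P]
      refine (norm_add_le _ _).trans ?_
      rw [norm_pow]
      nlinarith [norm_nonneg ((P (1 / 4 - δ : ℂ))^[N] 0)]

theorem quarter_add_notMem_Mandelbrot {δ : ℝ} (h0 : 0 < δ) : (1 / 4 + δ : ℂ) ∉ Mandelbrot := fun h => by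
  obtain ⟨B, hB⟩ := (show Bornology.IsBounded (Set.range fun n : ℕ => (P (1 / 4 + δ : ℂ))^[n] 0) from h).exists_norm_le
  have h1 : ∀ N : ℕ, N * δ ≤ ((P (1 / 4 + δ : ℂ))^[N] 0).re ∧ ((P (1 / 4 + δ : ℂ))^[N] 0).im = 0 := fun N => by
    induction N with
    | zero => simp
    | succ N ih =>
      rw [iterate_succ_apply', P]
      simp only [pow_two, add_re, mul_re, add_im, mul_im, ih.2, ofReal_re,
        ofReal_im, show ((1 / 4 : ℂ)).re = 1 / 4 by norm_num, show ((1 / 4 : ℂ)).im = 0 by norm_num]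
      push_cast
      exact ⟨by nlinarith [sq_nonneg (((P (1 / 4 + δ : ℂ))^[N] 0).re - 1 / 2)], by ring⟩
  obtain ⟨N, hN⟩ := exists_nat_gt (B / δ)
  rw [div_lt_iff₀ h0] at hN
  linarith [(h1 N).1, re_le_norm ((P (1 / 4 + δ : ℂ))^[N] 0), hB _ (mem_range_self N)]

theorem exists_frontier_sphere {δ : ℝ} (h0 : 0 < δ) (h1 : δ ≤ 1 / 2) : ∃ y ∈ frontier Mandelbrot, dist y (1 / 4) = δ := by
  by_contra! hcon
  have hS := (isConnected_sphere (Complex.rank_real_complex ▸ Nat.one_lt_ofNat) (1 / 4 : ℂ) h0.le).isPreconnected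
  have hp : (1 / 4 + δ : ℂ) ∈ sphere (1 / 4 : ℂ) δ := by simp [h0.le]
  have hm : (1 / 4 - δ : ℂ) ∈ sphere (1 / 4 : ℂ) δ := by simp [h0.le]
  have hint : ∀ y ∈ sphere (1 / 4 : ℂ) δ, y ∈ Mandelbrot → y ∈ interior Mandelbrot := fun y hy hyM => by
    by_contra hi
    exact hcon y ⟨subset_closure hyM, hi⟩ hy
  obtain ⟨y, -, hy, hy'⟩ := hS (interior Mandelbrot) Mandelbrotᶜ isOpen_interior isClosed_Mandelbrot.isOpen_compl
    (fun y hy => or_iff_not_imp_right.2 fun h => hint y hy (not_not.1 h))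
    ⟨_, hm, hint _ hm (quarter_sub_mem_Mandelbrot h0.le h1)⟩ ⟨_, hp, quarter_add_notMem_Mandelbrot h0⟩
  exact hy' (interior_subset hy)

end QuadDyn

/-- There is a subset `Υ` of the Mandelbrot set, dense on the boundary of the Mandelbrot set,
consisting only of infinitely renormalizable parameters, at every point of which the
Mandelbrot set is locally connected. -/
theorem exists_dense_subset_infinitely_renormalizable_locally_connected :
    ∃ Υ : Set ℂ, Υ ⊆ Mandelbrot ∧ frontier Mandelbrot ⊆ closure Υ ∧
      ∀ c ∈ Υ, InfinitelyRenormalizable c ∧ LocallyConnectedAt Mandelbrot c := by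
  refine ⟨{c | c ∈ Mandelbrot ∧ InfinitelyRenormalizable c ∧ LocallyConnectedAt Mandelbrot c}, fun c hc => hc.1,
    fun x hx => Metric.mem_closure_iff.2 fun ε hε => ?_, fun c hc => hc.2⟩
  rcases eq_or_ne x (1 / 4) with rfl | hx4
  · have hδ : 0 < min (ε / 2) (1 / 2) := by positivity
    obtain ⟨y, hy, hyd⟩ := QuadDyn.exists_frontier_sphere hδ inf_le_right
    obtain ⟨c, hc, h⟩ := QuadDyn.exists_mem_ball hy (fun h => by rw [h, dist_self] at hyd; exact hδ.ne hyd) (half_pos hε)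
    refine ⟨c, h, ?_⟩
    have h1 := dist_triangle_left (1 / 4) c y
    linarith [Metric.mem_ball'.1 hc, min_le_left (ε / 2) (1 / 2)]
  · obtain ⟨c, hc, h⟩ := QuadDyn.exists_mem_ball hx hx4 hε
    exact ⟨c, h, Metric.mem_ball'.1 hc⟩
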